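/- (Long variation estimate.) Let n ≥ 2 be an integer, let Γ ∈ 𝒰, and let K be a homogeneous Calderón–Zygmund kernel on ℝ^n. If p ∈ (1,∞) and r ∈ (2,∞), then there exists a constant C such that for every Schwartz function f on ℝ^n one has ‖ V_r(H^{(u)}f(x) : u ∈ {2^k : k ∈ ℤ}) ‖_{L^p(ℝ^n, dx)} ≤ C ‖f‖_{L^p(ℝ^n)}, i.e. the r-variation of the dyadic family (H^{(2^k)}f)_{k∈ℤ} is bounded on L^p. -/

import Mathlib

open MeasureTheory Filter Set
open scoped ENNReal NNReal FourierTransform Topology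

noncomputable section

/-- `ℝⁿ` as a Euclidean space. -/
abbrev Rn (n : ℕ) := EuclideanSpace ℝ (Fin n)

/-- The class `𝒰` of phase functions: `Γ` is continuous on `[0,∞)`, smooth on `(0,∞)`,
`Γ(0) = 0`, `Γ′ > 0` on `(0,∞)`, with the bounds `c_{1,j} ≤ |s^j Γ^{(j)}(s)/Γ(s)|` for
`j = 1, 2` and `|s^j Γ^{(j)}(s)/Γ(s)| ≤ c_{2,j}` for all `j ≥ 1`. -/
structure IsGammaU (Γ : ℝ → ℝ) : Prop where
  continuousOn : ContinuousOn Γ (Set.Ici 0)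
  smooth : ContDiffOn ℝ (⊤ : ℕ∞) Γ (Set.Ioi 0)
  map_zero : Γ 0 = 0
  deriv_pos : ∀ s > (0 : ℝ), 0 < deriv Γ s
  lower : ∀ j ∈ ({1, 2} : Set ℕ), ∃ c > (0 : ℝ), ∀ s > (0 : ℝ),
    c ≤ |s ^ j * iteratedDeriv j Γ s / Γ s|
  upper : ∀ j : ℕ, 1 ≤ j → ∃ c > (0 : ℝ), ∀ s > (0 : ℝ),
    |s ^ j * iteratedDeriv j Γ s / Γ s| ≤ c

/-- `K` is a homogeneous Calderón–Zygmund kernel on `ℝⁿ`: `K(t) = Ω(t)/‖t‖ⁿ` with `Ω` smooth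
away from the origin, homogeneous of degree `0`, and of mean value zero on the unit sphere. -/
def IsHomCZKernel (n : ℕ) (K : Rn n → ℝ) : Prop :=
  ∃ Ω : Rn n → ℝ,
    ContDiffOn ℝ (⊤ : ℕ∞) Ω {x : Rn n | x ≠ 0} ∧
    (∀ c : ℝ, 0 < c → ∀ t : Rn n, Ω (c • t) = Ω t) ∧
    (∫ θ : Metric.sphere (0 : Rn n) 1, Ω θ ∂((volume : Measure (Rn n)).toSphere) = 0) ∧
    (∀ t : Rn n, t ≠ 0 → K t = Ω t / ‖t‖ ^ n)

/-- The `r`-variation of a family `(a_u)_{u ∈ 𝒦}`. -/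
def variation {ι : Type*} [LinearOrder ι] (r : ℝ) (𝒦 : Set ι) (a : ι → ℂ) : ℝ≥0∞ :=
  ⨆ (J : ℕ) (u : Fin (J + 1) → ι) (_ : StrictMono u) (_ : ∀ i, u i ∈ 𝒦),
    (∑ i : Fin J, (‖a (u i.succ) - a (u i.castSucc)‖₊ : ℝ≥0∞) ^ r) ^ (1 / r)

/-- The `λ`-jump counting function of a family `(a_u)_{u ∈ 𝒦}`. -/
def jumpCount {ι : Type*} [LinearOrder ι] (lam : ℝ) (𝒦 : Set ι) (a : ι → ℂ) : ℝ≥0∞ :=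
  ⨆ (J : ℕ) (s : Fin J → ι) (t : Fin J → ι) (_ : ∀ i, s i ∈ 𝒦) (_ : ∀ i, t i ∈ 𝒦)
    (_ : ∀ i, s i < t i) (_ : ∀ i j : Fin J, i < j → t i < s j)
    (_ : ∀ i, lam < ‖a (t i) - a (s i)‖), (J : ℝ≥0∞)

/-- The `L^p` norm of an `ℝ≥0∞`-valued function. -/
def lpNormENN {α : Type*} [MeasurableSpace α] (p : ℝ) (g : α → ℝ≥0∞) (μ : Measure α) : ℝ≥0∞ :=
  (∫⁻ x, g x ^ p ∂μ) ^ (1 / p)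

/-- The modulated singular integral `H^{(u)} f (x)`, defined as a principal value. -/
def pvH {n : ℕ} (Γ : ℝ → ℝ) (K : Rn n → ℝ) (u : ℝ) (f : Rn n → ℂ) (x : Rn n) : ℂ :=
  limUnder (𝓝[>] (0 : ℝ)) fun ε =>
    ∫ t in {t : Rn n | ε < ‖t‖ ∧ ‖t‖ < ε⁻¹},
      f (x - t) * Complex.exp (Complex.I * Complex.ofReal (u * Γ ‖t‖)) * Complex.ofReal (K t)

set_option linter.unusedSectionVars false

section Dyadic

variable {n : ℕ} {E : Type*} [NormedAddCommGroup E] [NormedSpace ℝ E]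

/-- The index of the dyadic cube of side `2⁻ʲ` containing `x`. -/
def dcell (j : ℤ) (x : Rn n) : Fin n → ℤ := fun i => ⌊(2 : ℝ) ^ j * x i⌋

/-- The dyadic cube of side `2⁻ʲ` containing `x`. -/
def dcube (j : ℤ) (x : Rn n) : Set (Rn n) := {y | dcell j y = dcell j x}

/-- Averages over the dyadic cubes of side `2⁻ʲ`. -/
def dyadicAvg (j : ℤ) (f : Rn n → E) (x : Rn n) : E :=
  (((2 : ℝ) ^ j) ^ n) • ∫ y in dcube j x, f y

lemma mem_dcube_self (j : ℤ) (x : Rn n) : x ∈ dcube j x := rfl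

lemma mem_dcube {j : ℤ} {x y : Rn n} : y ∈ dcube j x ↔ dcell j y = dcell j x := Iff.rfl

lemma measurable_dcell (j : ℤ) : Measurable (dcell j : Rn n → Fin n → ℤ) := by
  refine measurable_pi_lambda _ fun i => Int.measurable_floor.comp ?_
  fun_prop

lemma measurableSet_dcube (j : ℤ) (x : Rn n) : MeasurableSet (dcube j x) :=
  measurable_dcell j (measurableSet_singleton _)

lemma dcube_eq {j : ℤ} {x y : Rn n} (h : dcell j y = dcell j x) : dcube j y = dcube j x := by
  ext z; simp [dcube, h]

lemma dcell_mono {j k : ℤ} (hjk : j ≤ k) {x y : Rn n} (h : dcell k y = dcell k x) :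
    dcell j y = dcell j x := by
  obtain ⟨m, rfl⟩ := Int.le.dest hjk
  have key : ∀ z : Rn n, ∀ i, dcell j z i = dcell (j + m) z i / (2 ^ m : ℕ) := by
    intro z i
    simp only [dcell]
    rw [← Int.floor_div_natCast]
    congr 1
    rw [zpow_add₀ (by norm_num)]
    push_cast
    rw [zpow_natCast]
    field_simp
  funext i
  rw [key, key, h]

lemma dcube_subset {j k : ℤ} (hjk : j ≤ k) {x y : Rn n} (h : y ∈ dcube j x) :
    dcube k y ⊆ dcube j x := fun _ hz => (dcell_mono hjk hz).trans h

lemma dcube_eq_preimage (j : ℤ) (x : Rn n) :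
    dcube j x = (MeasurableEquiv.toLp 2 (Fin n → ℝ)).symm ⁻¹'
      (Set.pi univ fun i => Ico ((dcell j x i : ℝ) / 2 ^ j) (((dcell j x i : ℝ) + 1) / 2 ^ j)) := by
  ext y
  have h2 : (0 : ℝ) < 2 ^ j := by positivity
  simp only [mem_dcube, funext_iff, Set.mem_preimage, Set.mem_pi, mem_univ, true_imp_iff]
  refine forall_congr' fun i => ?_
  rw [show dcell j y i = ⌊(2 : ℝ) ^ j * y i⌋ from rfl, Int.floor_eq_iff, mem_Ico,
    div_le_iff₀ h2, lt_div_iff₀ h2]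
  simp [mul_comm]

lemma volume_dcube (j : ℤ) (x : Rn n) :
    volume (dcube j x) = ENNReal.ofReal ((((2 : ℝ) ^ j) ^ n)⁻¹) := by
  have h2 : (0 : ℝ) < 2 ^ j := by positivity
  rw [dcube_eq_preimage,
    (EuclideanSpace.volume_preserving_symm_measurableEquiv_toLp (Fin n)).measure_preimage_equiv,
    Real.volume_pi_Ico]
  rw [← ENNReal.ofReal_prod_of_nonneg]
  · congr 1
    rw [Finset.prod_congr rfl (g := fun _ => ((2 : ℝ) ^ j)⁻¹)]
    · simp
    · intro i _
      rw [← sub_div]; simp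
  · intro i _
    rw [← sub_div]; simp [h2.le]

lemma volume_dcube_lt_top (j : ℤ) (x : Rn n) : volume (dcube j x) < ⊤ := by
  rw [volume_dcube]; exact ENNReal.ofReal_lt_top

lemma measureReal_dcube (j : ℤ) (x : Rn n) :
    volume.real (dcube j x) = (((2 : ℝ) ^ j) ^ n)⁻¹ := by
  rw [measureReal_def, volume_dcube, ENNReal.toReal_ofReal (by positivity)]

lemma norm_sub_le_of_dcell {j : ℤ} {x y : Rn n} (h : dcell j y = dcell j x) :
    ‖y - x‖ ≤ √n * ((2 : ℝ) ^ j)⁻¹ := by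
  have h2 : (0 : ℝ) < 2 ^ j := by positivity
  have hi : ∀ i, ‖(y - x) i‖ ≤ ((2 : ℝ) ^ j)⁻¹ := by
    intro i
    have := Int.abs_sub_lt_one_of_floor_eq_floor (congrFun h i)
    rw [← mul_sub, abs_mul, abs_of_pos h2] at this
    rw [Real.norm_eq_abs, PiLp.sub_apply]
    rw [← one_div, le_div_iff₀ h2, mul_comm]
    exact this.le
  rw [EuclideanSpace.norm_eq]
  calc √(∑ i, ‖(y - x) i‖ ^ 2) ≤ √(∑ _i : Fin n, (((2 : ℝ) ^ j)⁻¹) ^ 2) := by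
        gcongr with i; exact hi i
    _ = _ := by
        rw [Finset.sum_const, Finset.card_univ, Fintype.card_fin, nsmul_eq_mul,
          Real.sqrt_mul (by positivity), Real.sqrt_sq (by positivity)]

/-- A function with vanishing integral over each dyadic cube of a given generation has vanishing
integral. -/
lemma integral_eq_zero_of_dcube {h : Rn n → E} (hh : Integrable h) (j : ℤ)
    (h0 : ∀ x, ∫ y in dcube j x, h y = 0) : ∫ y, h y = 0 := by
  have hU : (⋃ m : Fin n → ℤ, dcell j ⁻¹' {m}) = (univ : Set (Rn n)) := by
    ext x; simp
  rw [← setIntegral_univ, ← hU, integral_iUnion]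
  · rw [tsum_congr (g := fun _ => 0)]
    · simp
    intro m
    rcases (dcell j ⁻¹' {m} : Set (Rn n)).eq_empty_or_nonempty with he | ⟨x, hx⟩
    · simp [he]
    · have : dcell j ⁻¹' {m} = dcube j x := by
        ext y; simp only [mem_preimage, mem_singleton_iff] at hx ⊢; rw [mem_dcube, hx]
      rw [this, h0]
  · exact fun m => measurable_dcell j (measurableSet_singleton _)
  · intro a b hab
    exact Disjoint.preimage _ (by simpa using hab)
  · exact hh.integrableOn

lemma dyadicAvg_congr {j : ℤ} {x y : Rn n} (h : dcell j y = dcell j x) (f : Rn n → E) :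
    dyadicAvg j f y = dyadicAvg j f x := by
  simp only [dyadicAvg, dcube_eq h]

/-- Functions constant on dyadic cubes are strongly measurable. -/
lemma stronglyMeasurable_of_dcell {F : Type*} [TopologicalSpace F]
    [TopologicalSpace.PseudoMetrizableSpace F] {j : ℤ} {h : Rn n → F}
    (hh : ∀ x y, dcell j y = dcell j x → h y = h x) : StronglyMeasurable h := by
  classical
  rcases isEmpty_or_nonempty F with hF | ⟨⟨c⟩⟩
  · exact (hF.false (h 0)).elim
  let G : (Fin n → ℤ) → F := fun m => if hm : ∃ x, dcell j x = m then h hm.choose else c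
  have : h = G ∘ dcell j := by
    funext x
    have hm : ∃ z : Rn n, dcell j z = dcell j x := ⟨x, rfl⟩
    simp only [G, Function.comp, dif_pos hm]
    exact (hh _ _ hm.choose_spec).symm
  rw [this]
  borelize F
  have hG : StronglyMeasurable G := stronglyMeasurable_iff_measurable_separable.2
    ⟨measurable_of_countable G, (countable_range G).isSeparable⟩
  exact hG.comp_measurable (measurable_dcell j)

lemma stronglyMeasurable_dyadicAvg (j : ℤ) (f : Rn n → E) :
    StronglyMeasurable (dyadicAvg j f) :=
  stronglyMeasurable_of_dcell fun _ _ h => dyadicAvg_congr h f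

lemma lintegral_mono_of_dcube {g h : Rn n → ℝ≥0∞} (j : ℤ)
    (H : ∀ x, ∫⁻ y in dcube j x, g y ≤ ∫⁻ y in dcube j x, h y) :
    ∫⁻ y, g y ≤ ∫⁻ y, h y := by
  have hU : (⋃ m : Fin n → ℤ, dcell j ⁻¹' {m}) = (univ : Set (Rn n)) := by
    ext x; simp
  have hm : ∀ m : Fin n → ℤ, MeasurableSet (dcell j ⁻¹' {m} : Set (Rn n)) :=
    fun m => measurable_dcell j (measurableSet_singleton _)
  have hd : Pairwise (Function.onFun Disjoint fun m : Fin n → ℤ =>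
      (dcell j ⁻¹' {m} : Set (Rn n))) := by
    intro a b hab
    exact Disjoint.preimage _ (by simpa using hab)
  rw [← setLIntegral_univ g, ← setLIntegral_univ h, ← hU, lintegral_iUnion hm hd,
    lintegral_iUnion hm hd]
  refine ENNReal.tsum_le_tsum fun m => ?_
  rcases (dcell j ⁻¹' {m} : Set (Rn n)).eq_empty_or_nonempty with he | ⟨x, hx⟩
  · simp [he]
  · have : dcell j ⁻¹' {m} = dcube j x := by
      ext y; simp only [mem_preimage, mem_singleton_iff] at hx ⊢; rw [mem_dcube, hx]
    rw [this]; exact H x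

lemma setIntegral_dcube_dyadicAvg_self {j : ℤ} [CompleteSpace E] (f : Rn n → E)
    (x : Rn n) : ∫ y in dcube j x, dyadicAvg j f y = ∫ y in dcube j x, f y := by
  have h2 : (0 : ℝ) < 2 ^ j := by positivity
  rw [setIntegral_congr_fun (g := fun _ => dyadicAvg j f x) (measurableSet_dcube j x)
    (fun y hy => dyadicAvg_congr hy f), setIntegral_const, measureReal_dcube, dyadicAvg, smul_smul,
    inv_mul_cancel₀ (by positivity), one_smul]

lemma enorm_dyadicAvg_le (j : ℤ) (f : Rn n → E) (x : Rn n) :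
    ‖dyadicAvg j f x‖ₑ ≤ ENNReal.ofReal (((2 : ℝ) ^ j) ^ n) * ∫⁻ y in dcube j x, ‖f y‖ₑ := by
  rw [dyadicAvg, enorm_smul, Real.enorm_of_nonneg (by positivity)]
  gcongr
  exact enorm_integral_le_lintegral_enorm _

lemma norm_dyadicAvg_le (j : ℤ) (f : Rn n → E) (x : Rn n) :
    ‖dyadicAvg j f x‖ ≤ dyadicAvg j (fun y => ‖f y‖) x := by
  rw [dyadicAvg, dyadicAvg, norm_smul, Real.norm_of_nonneg (by positivity), smul_eq_mul]
  gcongr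
  exact norm_integral_le_integral_norm _

lemma lintegral_enorm_dyadicAvg_le (j : ℤ) (f : Rn n → E) :
    ∫⁻ x, ‖dyadicAvg j f x‖ₑ ≤ ∫⁻ x, ‖f x‖ₑ := by
  refine lintegral_mono_of_dcube j fun x => ?_
  rw [setLIntegral_congr_fun (g := fun _ => ‖dyadicAvg j f x‖ₑ) (measurableSet_dcube j x)
    (fun y hy => by simp only [dyadicAvg_congr hy f]), setLIntegral_const, volume_dcube]
  refine (mul_le_mul_left (enorm_dyadicAvg_le j f x) _).trans ?_
  rw [mul_right_comm, ← ENNReal.ofReal_mul (by positivity), mul_inv_cancel₀ (by positivity)]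
  simp

lemma MeasureTheory.Integrable.dyadicAvg {f : Rn n → E} (hf : Integrable f) (j : ℤ) :
    Integrable (dyadicAvg j f) :=
  ⟨(stronglyMeasurable_dyadicAvg j f).aestronglyMeasurable,
    (lintegral_enorm_dyadicAvg_le j f).trans_lt hf.2⟩

lemma norm_dyadicAvg_le_of_bound {f : Rn n → E} {C : ℝ} (hC : ∀ x, ‖f x‖ ≤ C) (j : ℤ)
    (x : Rn n) : ‖dyadicAvg j f x‖ ≤ C := by
  rw [dyadicAvg, norm_smul, Real.norm_of_nonneg (by positivity)]
  have := norm_setIntegral_le_of_norm_le_const (μ := volume) (volume_dcube_lt_top j x)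
    (f := f) (C := C) (fun y _ => hC y)
  rw [measureReal_dcube] at this
  calc _ ≤ ((2 : ℝ) ^ j) ^ n * (C * (((2 : ℝ) ^ j) ^ n)⁻¹) := by gcongr
    _ = C := by field_simp

/-- Functions constant on the cubes of generation `j` can be paired with `f` or with its dyadic
average. -/
lemma integral_apply_dyadicAvg [CompleteSpace E] {F : Type*} [NormedAddCommGroup F]
    [NormedSpace ℝ F] [CompleteSpace F]
    {j : ℤ} {f : Rn n → E} (hf : Integrable f) {φ : Rn n → E →L[ℝ] F}
    (hφ : ∀ x y, dcell j y = dcell j x → φ y = φ x) {C : ℝ} (hC : ∀ x, ‖φ x‖ ≤ C) :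
    ∫ y, φ y (dyadicAvg j f y) = ∫ y, φ y (f y) := by
  have hm := (stronglyMeasurable_of_dcell hφ).aestronglyMeasurable (μ := volume)
  have hint : ∀ g : Rn n → E, Integrable g → Integrable fun y => φ y (g y) := by
    intro g hg
    refine Integrable.mono' (hg.norm.const_mul C)
      ((ContinuousLinearMap.id ℝ (E →L[ℝ] F)).aestronglyMeasurable_comp₂ hm hg.1) ?_
    refine .of_forall fun y => ((φ y).le_opNorm _).trans ?_
    gcongr; exact hC y
  have h1 := hint _ hf
  have h2 := hint _ (hf.dyadicAvg j)
  rw [← sub_eq_zero, ← integral_sub h2 h1]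
  refine integral_eq_zero_of_dcube (h2.sub h1) j fun x => ?_
  rw [integral_sub h2.integrableOn h1.integrableOn, sub_eq_zero]
  have : ∀ g : Rn n → E, Integrable g →
      ∫ y in dcube j x, φ y (g y) = φ x (∫ y in dcube j x, g y) := by
    intro g hg
    rw [← ContinuousLinearMap.integral_comp_comm _ hg.integrableOn]
    exact setIntegral_congr_fun (measurableSet_dcube j x) fun y hy => by
      simp only [hφ x y hy]
  rw [this _ hf, this _ (hf.dyadicAvg j), setIntegral_dcube_dyadicAvg_self]

lemma setIntegral_dyadicAvg [CompleteSpace E] {j : ℤ} {f : Rn n → E} (hf : Integrable f)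
    {A : Set (Rn n)} (hA : ∀ x y, dcell j y = dcell j x → (y ∈ A ↔ x ∈ A)) :
    ∫ y in A, dyadicAvg j f y = ∫ y in A, f y := by
  classical
  have hAm : MeasurableSet A := by
    have := (stronglyMeasurable_of_dcell (F := ℝ) (j := j) (h := A.indicator fun _ => 1) (n := n)
      fun x y h => by simp only [indicator, hA x y h]).measurable
    exact (measurable_indicator_const_iff (1 : ℝ)).1 this
  have := integral_apply_dyadicAvg hf (φ := A.indicator fun _ => ContinuousLinearMap.id ℝ E)
    (j := j) (C := 1) (fun x y h => by simp only [indicator, hA x y h]) (fun x => by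
      by_cases hx : x ∈ A <;> simp [hx, ContinuousLinearMap.norm_id_le])
  rw [← integral_indicator hAm, ← integral_indicator hAm]
  have h1 : ∀ g : Rn n → E,
      (fun y => (A.indicator fun _ => ContinuousLinearMap.id ℝ E) y (g y)) = A.indicator g := by
    intro g; funext y
    by_cases hy : y ∈ A <;> simp [hy]
  rwa [h1, h1] at this

lemma setIntegral_dcube_dyadicAvg [CompleteSpace E] {j k : ℤ} (hjk : j ≤ k) {f : Rn n → E}
    (hf : Integrable f) (x : Rn n) :
    ∫ y in dcube j x, dyadicAvg k f y = ∫ y in dcube j x, f y :=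
  setIntegral_dyadicAvg hf fun a b h => by
    have := dcell_mono hjk h
    simp [mem_dcube, this]

lemma dyadicAvg_dyadicAvg [CompleteSpace E] {j k : ℤ} (hjk : j ≤ k) {f : Rn n → E}
    (hf : Integrable f) : dyadicAvg j (dyadicAvg k f) = dyadicAvg j f := by
  funext x
  rw [dyadicAvg, setIntegral_dcube_dyadicAvg hjk hf, dyadicAvg]

lemma dyadicAvg_add {j : ℤ} {f g : Rn n → E} (hf : Integrable f) (hg : Integrable g) :
    dyadicAvg j (f + g) = dyadicAvg j f + dyadicAvg j g := by
  funext x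
  simp only [dyadicAvg, Pi.add_apply]
  rw [integral_add hf.integrableOn hg.integrableOn, smul_add]

/-- Lebesgue differentiation along dyadic cubes. -/
lemma ae_le_of_dyadicAvg_le {f : Rn n → E} (hf : Integrable f) {c : ℝ} :
    ∀ᵐ x, (∀ j : ℤ, dyadicAvg j (fun y => ‖f y‖) x ≤ c) → ‖f x‖ ≤ c := by
  have key := IsUnifLocDoublingMeasure.ae_tendsto_average_norm_sub.{_, _, 0}
    (μ := (volume : Measure (Rn n))) hf.locallyIntegrable 1
  filter_upwards [key] with x hx h
  set R : ℝ := √n + 1 with hR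
  have hRpos : 0 < R := by positivity
  have hlim : Tendsto (fun m : ℕ => R * ((2 : ℝ) ^ (m : ℤ))⁻¹) atTop (𝓝[>] 0) := by
    refine tendsto_nhdsWithin_iff.2 ⟨?_, .of_forall fun m => by
      simp only [mem_Ioi]; positivity⟩
    have := (tendsto_inv_atTop_zero.comp
      (tendsto_pow_atTop_atTop_of_one_lt (one_lt_two (α := ℝ)))).const_mul R
    simpa using this
  have hxm := hx (fun _ => x) (fun m : ℕ => R * ((2 : ℝ) ^ (m : ℤ))⁻¹) hlim
    (.of_forall fun m => by
      simp only [one_mul]; exact Metric.mem_closedBall_self (by positivity))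
  set v : ℝ := volume.real (Metric.closedBall (0 : Rn n) 1) with hv
  have hle : ∀ m : ℕ, ‖f x‖ - c ≤ (R ^ n * v) *
      ⨍ y in Metric.closedBall x (R * ((2 : ℝ) ^ (m : ℤ))⁻¹), ‖f y - f x‖ := by
    intro m
    have hj := h (m : ℤ)
    generalize (m : ℤ) = j at hj ⊢
    have h2 : (0 : ℝ) < 2 ^ j := by positivity
    set B := Metric.closedBall x (R * ((2 : ℝ) ^ j)⁻¹) with hB
    have hBv : volume.real B = (R * ((2 : ℝ) ^ j)⁻¹) ^ n * v := by
      rw [hB, measureReal_def, Measure.addHaar_closedBall' _ _ (by positivity), ENNReal.toReal_mul,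
        ENNReal.toReal_ofReal (by positivity), finrank_euclideanSpace, Fintype.card_fin, hv,
        measureReal_def]
    have hBpos : 0 < volume.real B := by
      rw [measureReal_def]
      exact ENNReal.toReal_pos (Metric.measure_closedBall_pos _ _ (by positivity)).ne'
        measure_closedBall_lt_top.ne
    have hfi : ∀ s : Set (Rn n), volume s ≠ ⊤ → IntegrableOn (fun y => ‖f y - f x‖) s := by
      intro s hs
      exact (hf.integrableOn.sub (integrableOn_const hs)).norm
    have hsub : dcube j x ⊆ B := by
      intro y hy
      rw [hB, Metric.mem_closedBall, dist_eq_norm]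
      refine (norm_sub_le_of_dcell hy).trans ?_
      gcongr; simp [hR]
    have h3 : ‖f x‖ ≤ dyadicAvg j (fun y => ‖f y‖) x + dyadicAvg j (fun y => ‖f y - f x‖) x := by
      rw [← Pi.add_apply (dyadicAvg j _) (dyadicAvg j _)]
      simp only [dyadicAvg, Pi.add_apply]
      rw [← smul_add, ← integral_add hf.norm.integrableOn (hfi _ (volume_dcube_lt_top j x).ne),
        smul_eq_mul]
      calc ‖f x‖ = ((2 : ℝ) ^ j) ^ n * ∫ y in dcube j x, ‖f x‖ := by
            rw [setIntegral_const, measureReal_dcube, smul_eq_mul]; field_simp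
        _ ≤ _ := by
            gcongr ?_ * ?_
            refine integral_mono (integrableOn_const (volume_dcube_lt_top j x).ne)
              (hf.norm.integrableOn.add (hfi _ (volume_dcube_lt_top j x).ne)) fun y => ?_
            have := norm_sub_norm_le (f x) (f y)
            rw [norm_sub_rev] at this
            simp only; linarith
    have h4 : dyadicAvg j (fun y => ‖f y - f x‖) x ≤ (R ^ n * v) * ⨍ y in B, ‖f y - f x‖ := by
      rw [dyadicAvg, setAverage_eq, smul_eq_mul, smul_eq_mul]
      have h5 : ∫ y in dcube j x, ‖f y - f x‖ ≤ ∫ y in B, ‖f y - f x‖ :=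
        setIntegral_mono_set (hfi _ measure_closedBall_lt_top.ne)
          (.of_forall fun y => norm_nonneg _) hsub.eventuallyLE
      calc _ ≤ ((2 : ℝ) ^ j) ^ n * ∫ y in B, ‖f y - f x‖ := by gcongr
        _ = _ := by
          have : R ^ n * v = ((2 : ℝ) ^ j) ^ n * volume.real B := by
            rw [hBv, mul_pow, inv_pow]; field_simp
          rw [this]; field_simp
    linarith
  have := ge_of_tendsto' (hxm.const_mul (R ^ n * v)) hle
  rw [mul_zero] at this
  linarith

end Dyadic

section Stopping

variable {n : ℕ} {E : Type*} [NormedAddCommGroup E] [NormedSpace ℝ E]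

/-- `τ`, restricted to `Ω`, is a stopping level for the dyadic filtration. -/
def IsStopping (Ω : Set (Rn n)) (τ : Rn n → ℤ) : Prop :=
  ∀ x ∈ Ω, ∀ y, dcell (τ x) y = dcell (τ x) x → y ∈ Ω ∧ τ y = τ x

/-- The points stopped at level `j`. -/
def stopSet (Ω : Set (Rn n)) (τ : Rn n → ℤ) (j : ℤ) : Set (Rn n) := {x | x ∈ Ω ∧ τ x = j}

variable {Ω : Set (Rn n)} {τ : Rn n → ℤ}

lemma iUnion_stopSet (Ω : Set (Rn n)) (τ : Rn n → ℤ) : ⋃ j, stopSet Ω τ j = Ω := by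
  ext x; simp [stopSet]

lemma pairwise_disjoint_stopSet (Ω : Set (Rn n)) (τ : Rn n → ℤ) :
    Pairwise (Function.onFun Disjoint (stopSet Ω τ)) := by
  intro i j hij
  exact Set.disjoint_left.2 fun x hi hj => hij (hi.2.symm.trans hj.2)

lemma IsStopping.mem_stopSet_iff (h : IsStopping Ω τ) {j : ℤ} {x y : Rn n}
    (hxy : dcell j y = dcell j x) : y ∈ stopSet Ω τ j ↔ x ∈ stopSet Ω τ j := by
  constructor
  · rintro ⟨h1, rfl⟩
    exact ⟨(h y h1 x hxy.symm).1, (h y h1 x hxy.symm).2⟩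
  · rintro ⟨h1, rfl⟩
    exact ⟨(h x h1 y hxy).1, (h x h1 y hxy).2⟩

lemma measurableSet_of_dcell {j : ℤ} {A : Set (Rn n)}
    (hA : ∀ x y, dcell j y = dcell j x → (y ∈ A ↔ x ∈ A)) : MeasurableSet A := by
  classical
  have := (stronglyMeasurable_of_dcell (F := ℝ) (j := j) (h := A.indicator fun _ => 1) (n := n)
    fun x y h => by simp only [indicator, hA x y h]).measurable
  have h2 := this (measurableSet_singleton 1)
  convert h2 using 1
  ext x; simp [indicator]

lemma IsStopping.measurableSet_stopSet (h : IsStopping Ω τ) (j : ℤ) :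
    MeasurableSet (stopSet Ω τ j) :=
  measurableSet_of_dcell fun _ _ hxy => h.mem_stopSet_iff hxy

lemma IsStopping.measurableSet (h : IsStopping Ω τ) : MeasurableSet Ω := by
  rw [← iUnion_stopSet Ω τ]
  exact .iUnion h.measurableSet_stopSet

lemma IsStopping.lintegral_eq_tsum (h : IsStopping Ω τ) (g : Rn n → ℝ≥0∞) :
    ∫⁻ x in Ω, g x = ∑' j, ∫⁻ x in stopSet Ω τ j, g x := by
  conv_lhs => rw [← iUnion_stopSet Ω τ]
  exact lintegral_iUnion h.measurableSet_stopSet (pairwise_disjoint_stopSet Ω τ) _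

/-- Gluing countably many strongly measurable functions. -/
lemma stronglyMeasurable_glue {X ι F : Type*} [MeasurableSpace X] [Countable ι]
    [NormedAddCommGroup F] {σ : X → ι} (hσ : ∀ i, MeasurableSet (σ ⁻¹' {i})) {G : ι → X → F}
    (hG : ∀ i, StronglyMeasurable (G i)) : StronglyMeasurable fun x => G (σ x) x := by
  classical
  obtain ⟨e, he⟩ := Countable.exists_injective_nat ι
  refine stronglyMeasurable_of_tendsto (u := atTop)
    (f := fun (N : ℕ) x => if e (σ x) < N then G (σ x) x else 0) ?_ ?_
  · intro N
    induction N with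
    | zero => simpa using (stronglyMeasurable_const : StronglyMeasurable fun _ : X => (0 : F))
    | succ N ih =>
      by_cases hN : ∃ i, e i = N
      · obtain ⟨i, rfl⟩ := hN
        have h1 := ((hG i).indicator (hσ i)).add ih
        convert h1 using 1
        funext x
        by_cases hx : σ x = i
        · simp [hx]
        · have : e (σ x) ≠ e i := fun h => hx (he h)
          have h3 : e (σ x) < e i + 1 ↔ e (σ x) < e i := by omega
          simp [hx, h3]
      · convert ih using 3 with x
        have : e (σ x) ≠ N := fun h => hN ⟨_, h⟩
        omega
  · rw [tendsto_pi_nhds]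
    intro x
    refine tendsto_const_nhds.congr' ?_
    filter_upwards [eventually_gt_atTop (e (σ x))] with N hN
    simp [hN]

lemma dyadicAvg_indicator {j : ℤ} {A : Set (Rn n)}
    (hA : ∀ x y, dcell j y = dcell j x → (y ∈ A ↔ x ∈ A)) (f : Rn n → E) :
    dyadicAvg j (A.indicator f) = A.indicator (dyadicAvg j f) := by
  funext x
  by_cases hx : x ∈ A
  · rw [indicator_of_mem hx, dyadicAvg, dyadicAvg]
    congr 1
    refine setIntegral_congr_fun (measurableSet_dcube j x) fun y hy => ?_
    exact indicator_of_mem ((hA x y hy).2 hx) f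
  · rw [indicator_of_notMem hx, dyadicAvg, setIntegral_congr_fun (g := fun _ => 0)
      (measurableSet_dcube j x)]
    · simp
    · exact fun y hy => indicator_of_notMem (fun h => hx ((hA x y hy).1 h)) f

lemma IsStopping.lintegral_enorm_dyadicAvg_le (h : IsStopping Ω τ) (f : Rn n → E) :
    ∫⁻ x in Ω, ‖dyadicAvg (τ x) f x‖ₑ ≤ ∫⁻ x in Ω, ‖f x‖ₑ := by
  rw [h.lintegral_eq_tsum, h.lintegral_eq_tsum]
  refine ENNReal.tsum_le_tsum fun j => ?_
  have hm := h.measurableSet_stopSet j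
  have h1 := _root_.lintegral_enorm_dyadicAvg_le j ((stopSet Ω τ j).indicator f)
  rw [dyadicAvg_indicator fun _ _ hxy => h.mem_stopSet_iff hxy] at h1
  simp only [enorm_indicator_eq_indicator_enorm] at h1
  rw [lintegral_indicator hm, lintegral_indicator hm] at h1
  refine le_trans (le_of_eq ?_) h1
  exact setLIntegral_congr_fun hm fun x hx => by simp only [hx.2]

lemma IsStopping.setIntegral_apply_sub [CompleteSpace E] {F : Type*} [NormedAddCommGroup F]
    [NormedSpace ℝ F] [CompleteSpace F] (h : IsStopping Ω τ) {f : Rn n → E} (hf : Integrable f)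
    {φ : Rn n → E →L[ℝ] F} (hφ : ∀ x ∈ Ω, ∀ y, dcell (τ x) y = dcell (τ x) x → φ y = φ x)
    {C : ℝ} (hC : ∀ x, ‖φ x‖ ≤ C)
    (hint : IntegrableOn (fun y => φ y (f y - dyadicAvg (τ y) f y)) Ω) :
    ∫ y in Ω, φ y (f y - dyadicAvg (τ y) f y) = 0 := by
  have hU := iUnion_stopSet Ω τ
  rw [← hU] at hint ⊢
  rw [integral_iUnion h.measurableSet_stopSet (pairwise_disjoint_stopSet Ω τ) hint]
  refine (tsum_congr fun j => ?_).trans tsum_zero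
  have hm := h.measurableSet_stopSet j
  set ψ : Rn n → E →L[ℝ] F := (stopSet Ω τ j).indicator φ
  have hψ : ∀ x y, dcell j y = dcell j x → ψ y = ψ x := by
    intro x y hxy
    by_cases hx : x ∈ stopSet Ω τ j
    · have hy := (h.mem_stopSet_iff hxy).2 hx
      simp only [ψ, indicator_of_mem hx, indicator_of_mem hy]
      obtain ⟨hx1, rfl⟩ := hx
      exact hφ x hx1 y hxy
    · have hy : y ∉ stopSet Ω τ j := fun hy => hx ((h.mem_stopSet_iff hxy).1 hy)
      simp only [ψ, indicator_of_notMem hx, indicator_of_notMem hy]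
  have hψC : ∀ x, ‖ψ x‖ ≤ C := fun x =>
    (norm_indicator_le_norm_self φ x).trans (hC x)
  have key := integral_apply_dyadicAvg hf hψ hψC
  have hψm := (stronglyMeasurable_of_dcell hψ).aestronglyMeasurable (μ := volume)
  have hi : ∀ g : Rn n → E, Integrable g → Integrable fun y => ψ y (g y) := by
    intro g hg
    refine Integrable.mono' (hg.norm.const_mul C)
      ((ContinuousLinearMap.id ℝ (E →L[ℝ] F)).aestronglyMeasurable_comp₂ hψm hg.1) (.of_forall fun y => ?_)
    exact (ContinuousLinearMap.le_opNorm _ _).trans (by gcongr; exact hψC y)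
  have h2 : ∫ y, ψ y (f y - dyadicAvg j f y) = 0 := by
    simp only [map_sub]
    rw [integral_sub (hi _ hf) (hi _ (hf.dyadicAvg j)), key, sub_self]
  rw [← h2, ← integral_indicator hm]
  refine integral_congr_ae (.of_forall fun y => ?_)
  by_cases hy : y ∈ stopSet Ω τ j
  · simp [ψ, hy, hy.2]
  · simp [ψ, hy]

end Stopping

section OpConv

variable {n : ℕ} {E F : Type*} [NormedAddCommGroup E] [NormedSpace ℝ E]
  [NormedAddCommGroup F] [NormedSpace ℝ F]

/-- Bounded integrable functions. -/
structure Nice (f : Rn n → E) : Prop where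
  meas : StronglyMeasurable f
  int : Integrable f
  bdd : ∃ C, ∀ x, ‖f x‖ ≤ C

/-- Convolution with an operator valued kernel. -/
def opConv (κ : Rn n → E →L[ℝ] F) (f : Rn n → E) (x : Rn n) : F := ∫ y, κ (x - y) (f y)

lemma exists_bound_of_cc {G : Type*} [NormedAddCommGroup G] {κ : Rn n → G} (hκ : Continuous κ)
    (hc : HasCompactSupport κ) : ∃ C, 0 ≤ C ∧ ∀ x, ‖κ x‖ ≤ C := by
  obtain ⟨C, hC⟩ := hκ.bounded_above_of_compact_support hc
  exact ⟨C, (norm_nonneg _).trans (hC 0), hC⟩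

lemma integrable_opConv_integrand {κ : Rn n → E →L[ℝ] F} (hκ : Continuous κ)
    (hc : HasCompactSupport κ) {f : Rn n → E} (hf : Integrable f) (x : Rn n) :
    Integrable fun y => κ (x - y) (f y) := by
  obtain ⟨C, hC0, hC⟩ := exists_bound_of_cc hκ hc
  have hm : AEStronglyMeasurable (fun y => κ (x - y)) volume :=
    Continuous.aestronglyMeasurable (by fun_prop)
  refine Integrable.mono' (hf.norm.const_mul C)
    ((ContinuousLinearMap.id ℝ (E →L[ℝ] F)).aestronglyMeasurable_comp₂ hm hf.1)
    (.of_forall fun y => ?_)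
  exact (ContinuousLinearMap.le_opNorm _ _).trans (by gcongr; exact hC _)

lemma opConv_eq_convolution (κ : Rn n → E →L[ℝ] F) (f : Rn n → E) :
    opConv κ f = convolution f κ (ContinuousLinearMap.apply ℝ F) volume := by
  funext x; simp [opConv, convolution]

lemma continuous_opConv {κ : Rn n → E →L[ℝ] F} (hκ : Continuous κ)
    (hc : HasCompactSupport κ) {f : Rn n → E} (hf : Integrable f) : Continuous (opConv κ f) := by
  rw [opConv_eq_convolution]
  exact hc.continuous_convolution_right _ hf.locallyIntegrable hκ

lemma norm_opConv_le {κ : Rn n → E →L[ℝ] F} {C : ℝ} (hC : ∀ x, ‖κ x‖ ≤ C) {f : Rn n → E}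
    (hf : Integrable f) (x : Rn n) : ‖opConv κ f x‖ ≤ C * ∫ y, ‖f y‖ := by
  rw [opConv, ← integral_const_mul]
  refine norm_integral_le_of_norm_le (hf.norm.const_mul C) (.of_forall fun y => ?_)
  exact (ContinuousLinearMap.le_opNorm _ _).trans (by gcongr; exact hC _)

lemma Nice.opConv [CompleteSpace F] {κ : Rn n → E →L[ℝ] F} (hκ : Continuous κ)
    (hc : HasCompactSupport κ) {f : Rn n → E} (hf : Nice f) : Nice (opConv κ f) := by
  refine ⟨(continuous_opConv hκ hc hf.int).stronglyMeasurable, ?_, ?_⟩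
  · rw [opConv_eq_convolution]
    exact hf.int.integrable_convolution _ (hκ.integrable_of_hasCompactSupport hc)
  · obtain ⟨C, hC0, hC⟩ := exists_bound_of_cc hκ hc
    exact ⟨_, norm_opConv_le hC hf.int⟩

lemma Nice.sub {f g : Rn n → E} (hf : Nice f) (hg : Nice g) : Nice (f - g) := by
  obtain ⟨C, hC⟩ := hf.bdd
  obtain ⟨D, hD⟩ := hg.bdd
  exact ⟨hf.meas.sub hg.meas, hf.int.sub hg.int,
    C + D, fun x => (norm_sub_le _ _).trans (add_le_add (hC x) (hD x))⟩

lemma Nice.indicator {f : Rn n → E} (hf : Nice f) {A : Set (Rn n)} (hA : MeasurableSet A) :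
    Nice (A.indicator f) := by
  obtain ⟨C, hC⟩ := hf.bdd
  exact ⟨hf.meas.indicator hA, hf.int.indicator hA, C,
    fun x => (norm_indicator_le_norm_self f x).trans (hC x)⟩

lemma Nice.dyadicAvg {f : Rn n → E} (hf : Nice f) (j : ℤ) : Nice (dyadicAvg j f) := by
  obtain ⟨C, hC⟩ := hf.bdd
  exact ⟨stronglyMeasurable_dyadicAvg j f, hf.int.dyadicAvg j, C,
    norm_dyadicAvg_le_of_bound hC j⟩

lemma Nice.norm {f : Rn n → E} (hf : Nice f) : Nice fun x => ‖f x‖ := by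
  obtain ⟨C, hC⟩ := hf.bdd
  exact ⟨hf.meas.norm, hf.int.norm, C, by simpa using hC⟩

lemma opConv_add {κ : Rn n → E →L[ℝ] F} (hκ : Continuous κ)
    (hc : HasCompactSupport κ) {f g : Rn n → E} (hf : Integrable f) (hg : Integrable g) :
    opConv κ (f + g) = opConv κ f + opConv κ g := by
  funext x
  simp only [opConv, Pi.add_apply, map_add]
  exact integral_add (integrable_opConv_integrand hκ hc hf x)
    (integrable_opConv_integrand hκ hc hg x)

lemma opConv_sub {κ : Rn n → E →L[ℝ] F} (hκ : Continuous κ)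
    (hc : HasCompactSupport κ) {f g : Rn n → E} (hf : Integrable f) (hg : Integrable g) :
    opConv κ (f - g) = opConv κ f - opConv κ g := by
  funext x
  simp only [opConv, Pi.sub_apply, map_sub]
  exact integral_sub (integrable_opConv_integrand hκ hc hf x)
    (integrable_opConv_integrand hκ hc hg x)

end OpConv

section CalderonZygmund

variable {n : ℕ} {E : Type*} [NormedAddCommGroup E] [NormedSpace ℝ E]

lemma dyadicAvg_norm_le_pred {f : Rn n → E} (hf : Integrable f) (j : ℤ) (x : Rn n) :
    dyadicAvg j (fun y => ‖f y‖) x ≤ 2 ^ n * dyadicAvg (j - 1) (fun y => ‖f y‖) x := by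
  have h2 : (0 : ℝ) < 2 ^ j := by positivity
  rw [dyadicAvg, dyadicAvg, smul_eq_mul, smul_eq_mul, ← mul_assoc, ← mul_pow,
    show (2 : ℝ) * 2 ^ (j - 1) = 2 ^ j by
      rw [← zpow_one_add₀ (by norm_num : (2 : ℝ) ≠ 0)]; congr 1; ring]
  exact mul_le_mul_of_nonneg_left (setIntegral_mono_set hf.norm.integrableOn
    (.of_forall fun y => norm_nonneg _)
    (dcube_subset (show j - 1 ≤ j by omega) (mem_dcube_self _ x)).eventuallyLE) (by positivity)

/-- The Calderón–Zygmund stopping time at height `α`. -/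
lemma exists_stopping (hn : 0 < n) {f : Rn n → E} (hf : Integrable f) {α : ℝ} (hα : 0 < α) :
    ∃ (Ω : Set (Rn n)) (τ : Rn n → ℤ), IsStopping Ω τ ∧
      (∀ x ∈ Ω, α < dyadicAvg (τ x) (fun y => ‖f y‖) x ∧
        dyadicAvg (τ x) (fun y => ‖f y‖) x ≤ 2 ^ n * α) ∧
      ∀ᵐ x, x ∉ Ω → ‖f x‖ ≤ α := by
  classical
  set A : ℤ → Rn n → ℝ := fun j x => dyadicAvg j (fun y => ‖f y‖) x with hA
  set Ω : Set (Rn n) := {x | ∃ j, α < A j x} with hΩ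
  have hbdd : ∃ b : ℤ, ∀ x j, α < A j x → b ≤ j := by
    set I := ∫ y, ‖f y‖
    have hI : 0 ≤ I := integral_nonneg fun y => norm_nonneg _
    obtain ⟨m, hm⟩ := exists_nat_gt (I / α)
    refine ⟨-m, fun x j hj => ?_⟩
    by_contra! hlt
    have h1 : A j x ≤ ((2 : ℝ) ^ j) ^ n * I := by
      simp only [hA, dyadicAvg, smul_eq_mul]
      gcongr
      exact setIntegral_le_integral hf.norm (.of_forall fun y => norm_nonneg _)
    have h3 : (2 : ℝ) ^ j ≤ ((2 : ℝ) ^ m)⁻¹ := by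
      rw [← zpow_natCast, ← zpow_neg]; exact zpow_le_zpow_right₀ (by norm_num) hlt.le
    have h5 : (1 : ℝ) ≤ 2 ^ m := one_le_pow₀ (by norm_num)
    have h4 : ((2 : ℝ) ^ j) ^ n ≤ ((2 : ℝ) ^ m)⁻¹ := by
      refine (pow_le_of_le_one (by positivity) (h3.trans (inv_le_one_of_one_le₀ h5)) hn.ne').trans h3
    have h6 : (m : ℝ) < 2 ^ m := by exact_mod_cast m.lt_two_pow_self
    have h7 : I < α * 2 ^ m := by
      rw [div_lt_iff₀ hα] at hm; nlinarith
    have h8 : A j x ≤ ((2 : ℝ) ^ m)⁻¹ * I := h1.trans (by gcongr)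
    have h9 : ((2 : ℝ) ^ m)⁻¹ * I < α := by
      rw [inv_mul_lt_iff₀ (by positivity)]; linarith
    linarith
  obtain ⟨b, hb⟩ := hbdd
  have hleast : ∀ x, ∃ j, x ∈ Ω → α < A j x ∧ ∀ i, α < A i x → j ≤ i := by
    intro x
    by_cases hx : x ∈ Ω
    · obtain ⟨j, hj, hj'⟩ := Int.exists_least_of_bdd (P := fun j => α < A j x)
        ⟨b, fun j hj => hb x j hj⟩ hx
      exact ⟨j, fun _ => ⟨hj, hj'⟩⟩
    · exact ⟨0, fun h => (hx h).elim⟩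
  choose τ hτ using hleast
  refine ⟨Ω, τ, ?_, ?_, ?_⟩
  · intro x hx y hxy
    have hAeq : ∀ j ≤ τ x, A j y = A j x := fun j hj =>
      dyadicAvg_congr (dcell_mono hj hxy) _
    obtain ⟨h1, h2⟩ := hτ x hx
    have hy : α < A (τ x) y := by rw [hAeq _ le_rfl]; exact h1
    have hyΩ : y ∈ Ω := ⟨_, hy⟩
    refine ⟨hyΩ, ?_⟩
    obtain ⟨h3, h4⟩ := hτ y hyΩ
    have h5 := h4 _ hy
    refine le_antisymm h5 (h2 _ ?_)
    rwa [← hAeq _ h5]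
  · intro x hx
    obtain ⟨h1, h2⟩ := hτ x hx
    refine ⟨h1, (dyadicAvg_norm_le_pred hf _ x).trans ?_⟩
    gcongr
    by_contra! h
    have := h2 _ h
    omega
  · filter_upwards [ae_le_of_dyadicAvg_le hf (c := α)] with x hx hxΩ
    refine hx fun j => ?_
    by_contra! h
    exact hxΩ ⟨j, h⟩

/-- The good function: `f` averaged at the stopping level. -/
def goodPart (Ω : Set (Rn n)) (τ : Rn n → ℤ) (f : Rn n → E) (x : Rn n) : E :=
  open Classical in if x ∈ Ω then dyadicAvg (τ x) f x else f x

lemma goodPart_of_mem {Ω : Set (Rn n)} {τ : Rn n → ℤ} {f : Rn n → E} {x : Rn n} (hx : x ∈ Ω) :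
    goodPart Ω τ f x = dyadicAvg (τ x) f x := if_pos hx

lemma goodPart_of_notMem {Ω : Set (Rn n)} {τ : Rn n → ℤ} {f : Rn n → E} {x : Rn n}
    (hx : x ∉ Ω) : goodPart Ω τ f x = f x := if_neg hx

variable {Ω : Set (Rn n)} {τ : Rn n → ℤ}

lemma IsStopping.lintegral_goodPart_le (h : IsStopping Ω τ) (f : Rn n → E) :
    ∫⁻ x, ‖goodPart Ω τ f x‖ₑ ≤ ∫⁻ x, ‖f x‖ₑ := by
  rw [← lintegral_add_compl _ h.measurableSet, ← lintegral_add_compl (fun x => ‖f x‖ₑ)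
    h.measurableSet]
  refine add_le_add ?_ ?_
  · refine le_trans (le_of_eq ?_) (h.lintegral_enorm_dyadicAvg_le f)
    exact setLIntegral_congr_fun h.measurableSet fun x hx => by
      simp only [goodPart_of_mem hx]
  · refine le_of_eq (setLIntegral_congr_fun h.measurableSet.compl fun x hx => ?_)
    simp only [goodPart_of_notMem hx]

lemma IsStopping.nice_goodPart (h : IsStopping Ω τ) {f : Rn n → E} (hf : Nice f) :
    Nice (goodPart Ω τ f) := by
  classical
  have hm : StronglyMeasurable (goodPart Ω τ f) := by
    have := stronglyMeasurable_glue (X := Rn n) (F := E)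
      (σ := fun x => if x ∈ Ω then some (τ x) else none)
      (G := fun o => match o with
        | none => f
        | some j => _root_.dyadicAvg j f) ?_ ?_
    · convert this using 1
      funext x
      by_cases hx : x ∈ Ω
      · simp [goodPart_of_mem hx, hx]
      · simp [goodPart_of_notMem hx, hx]
    · rintro (_ | j)
      · convert h.measurableSet.compl using 1
        ext x; simp
      · convert h.measurableSet_stopSet j using 1
        ext x; simp [stopSet]
    · rintro (_ | j)
      · exact hf.meas
      · exact stronglyMeasurable_dyadicAvg j f
  refine ⟨hm, ⟨hm.aestronglyMeasurable, (h.lintegral_goodPart_le f).trans_lt hf.int.2⟩, ?_⟩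
  obtain ⟨C, hC⟩ := hf.bdd
  refine ⟨C, fun x => ?_⟩
  by_cases hx : x ∈ Ω
  · rw [goodPart_of_mem hx]; exact norm_dyadicAvg_le_of_bound hC _ x
  · rw [goodPart_of_notMem hx]; exact hC x

lemma IsStopping.measure_le (h : IsStopping Ω τ) {f : Rn n → E} {α : ℝ}
    (hα : ∀ x ∈ Ω, α < dyadicAvg (τ x) (fun y => ‖f y‖) x) :
    ENNReal.ofReal α * volume Ω ≤ ∫⁻ x, ‖f x‖ₑ := by
  calc ENNReal.ofReal α * volume Ω = ∫⁻ x in Ω, ENNReal.ofReal α := by simp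
    _ ≤ ∫⁻ x in Ω, ‖dyadicAvg (τ x) (fun y => ‖f y‖) x‖ₑ := by
        refine setLIntegral_mono' h.measurableSet fun x hx => ?_
        rw [← ofReal_norm]
        exact ENNReal.ofReal_le_ofReal ((hα x hx).le.trans (le_abs_self _))
    _ ≤ ∫⁻ x in Ω, ‖(‖f x‖)‖ₑ := h.lintegral_enorm_dyadicAvg_le _
    _ ≤ ∫⁻ x, ‖f x‖ₑ := by
        simp only [enorm_norm]
        exact setLIntegral_le_lintegral _ _

/-- A corner of the stopping cube containing `y`. -/
def stopCorner (τ : Rn n → ℤ) (y : Rn n) : Rn n :=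
  WithLp.toLp 2 fun i => (dcell (τ y) y i : ℝ) / 2 ^ τ y

lemma dcell_stopCorner (τ : Rn n → ℤ) (y : Rn n) :
    dcell (τ y) (stopCorner τ y) = dcell (τ y) y := by
  funext i
  have h2 : (0 : ℝ) < 2 ^ τ y := by positivity
  simp only [stopCorner]
  rw [dcell, PiLp.toLp_apply, mul_div_cancel₀ _ h2.ne', Int.floor_intCast]

lemma stopCorner_congr {x y : Rn n} (hτ : τ y = τ x) (h : dcell (τ x) y = dcell (τ x) x) :
    stopCorner τ y = stopCorner τ x := by
  simp only [stopCorner, hτ, h]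

end CalderonZygmund

section WeakType

variable {n : ℕ} {E : Type*} [NormedAddCommGroup E] [NormedSpace ℝ E]
  {Ω : Set (Rn n)} {τ : Rn n → ℤ}

/-- The dilated bad set. -/
def dilatedSet (Ω : Set (Rn n)) (τ : Rn n → ℤ) : Set (Rn n) :=
  {x | ∃ y ∈ Ω, ‖x - stopCorner τ y‖ < 2 * (√n * ((2 : ℝ) ^ τ y)⁻¹)}

lemma isOpen_dilatedSet (Ω : Set (Rn n)) (τ : Rn n → ℤ) : IsOpen (dilatedSet Ω τ) := by
  have : dilatedSet Ω τ = ⋃ y ∈ Ω, {x | ‖x - stopCorner τ y‖ < 2 * (√n * ((2 : ℝ) ^ τ y)⁻¹)} := by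
    ext x; simp [dilatedSet]
  rw [this]
  exact isOpen_biUnion fun y _ => isOpen_lt (by fun_prop) (by fun_prop)

/-- The constant by which the bad set is enlarged. -/
def dilConst (n : ℕ) : ℝ := (2 * √n) ^ n * volume.real (Metric.ball (0 : Rn n) 1)

lemma dilConst_nonneg (n : ℕ) : 0 ≤ dilConst n := by unfold dilConst; positivity

lemma IsStopping.measurable_indicator_level (h : IsStopping Ω τ) :
    Measurable (fun x => open Classical in if x ∈ Ω then τ x else 0) := by
  classical
  refine measurable_to_countable' fun j => ?_
  by_cases hj : j = 0
  · subst hj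
    have : (fun x => if x ∈ Ω then τ x else 0) ⁻¹' {0} = stopSet Ω τ 0 ∪ Ωᶜ := by
      ext x; by_cases hx : x ∈ Ω <;> simp [stopSet, hx]
    rw [this]
    exact (h.measurableSet_stopSet 0).union h.measurableSet.compl
  · have : (fun x => if x ∈ Ω then τ x else 0) ⁻¹' {j} = stopSet Ω τ j := by
      ext x
      by_cases hx : x ∈ Ω
      · simp [stopSet, hx]
      · simp [stopSet, hx, Ne.symm hj]
    rw [this]
    exact h.measurableSet_stopSet j

lemma measurable_stopCorner {σ : Rn n → ℤ} (h : Measurable σ) :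
    Measurable (stopCorner σ) := by
  have h0 : stopCorner σ = MeasurableEquiv.toLp 2 (Fin n → ℝ) ∘
      fun y i => (dcell (σ y) y i : ℝ) / 2 ^ σ y := rfl
  rw [h0]
  refine (MeasurableEquiv.toLp 2 (Fin n → ℝ)).measurable.comp
    (measurable_pi_iff.2 fun i => ?_)
  have h1 : Measurable fun p : ℤ × Rn n => (dcell p.1 p.2 i : ℝ) / (2 : ℝ) ^ p.1 := by
    refine measurable_from_prod_countable_right fun j => ?_
    have h2 : Measurable fun y : Rn n => (dcell j y i : ℝ) :=
      (measurable_from_top (f := fun m : ℤ => (m : ℝ))).comp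
        ((measurable_pi_apply i).comp (measurable_dcell j))
    exact h2.div_const ((2 : ℝ) ^ j)
  have h3 : Measurable fun y => (σ y, y) := h.prodMk measurable_id
  have h4 := h1.comp h3
  simp only [Function.comp_def] at h4
  exact h4

lemma IsStopping.volume_dilatedSet_le (hn : 0 < n) (h : IsStopping Ω τ) :
    volume (dilatedSet Ω τ) ≤ ENNReal.ofReal (dilConst n) * volume Ω := by
  classical
  set σ : Rn n → ℤ := fun x => if x ∈ Ω then τ x else 0 with hσ
  have hσm : Measurable σ := h.measurable_indicator_level
  have hσΩ : ∀ x ∈ Ω, σ x = τ x := fun x hx => if_pos hx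
  have hcΩ : ∀ x ∈ Ω, stopCorner σ x = stopCorner τ x := fun x hx => by
    simp only [stopCorner, hσΩ x hx]
  set R : Rn n → ℝ := fun y => 2 * (√n * ((2 : ℝ) ^ σ y)⁻¹) with hR
  have h2m : Measurable fun y => (2 : ℝ) ^ σ y :=
    (measurable_from_top (f := fun m : ℤ => (2 : ℝ) ^ m)).comp hσm
  have hRm : Measurable R := by fun_prop
  have hn' : (0 : ℝ) < n := by exact_mod_cast hn
  set N : Rn n → Rn n → ℝ≥0∞ := fun x y =>
    ENNReal.ofReal (((2 : ℝ) ^ σ y) ^ n) *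
      {p : Rn n × Rn n | ‖p.1 - stopCorner σ p.2‖ < R p.2}.indicator (fun _ => 1) (x, y) with hN
  have hset : MeasurableSet {p : Rn n × Rn n | ‖p.1 - stopCorner σ p.2‖ < R p.2} := by
    refine measurableSet_lt ?_ (hRm.comp measurable_snd)
    exact (measurable_fst.sub ((measurable_stopCorner hσm).comp measurable_snd)).norm
  have hNm : Measurable (Function.uncurry N) := by
    refine Measurable.mul ?_ (measurable_const.indicator hset)
    exact ((h2m.comp measurable_snd).pow_const n).ennreal_ofReal
  have hlow : ∀ x ∈ dilatedSet Ω τ, 1 ≤ ∫⁻ y in Ω, N x y := by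
    rintro x ⟨y, hy, hxy⟩
    have hsub : dcube (τ y) y ⊆ Ω := fun z hz => (h y hy z hz).1
    calc (1 : ℝ≥0∞) = ∫⁻ z in dcube (τ y) y, ENNReal.ofReal (((2 : ℝ) ^ τ y) ^ n) := by
          rw [setLIntegral_const, volume_dcube, ← ENNReal.ofReal_mul (by positivity),
            mul_inv_cancel₀ (by positivity), ENNReal.ofReal_one]
      _ ≤ ∫⁻ z in dcube (τ y) y, N x z := by
          refine setLIntegral_mono' (measurableSet_dcube _ _) fun z hz => ?_
          have hzτ : τ z = τ y := (h y hy z hz).2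
          have hzσ : σ z = τ y := by rw [hσΩ z (hsub hz), hzτ]
          have hzc : stopCorner σ z = stopCorner τ y := by
            rw [hcΩ z (hsub hz)]; exact stopCorner_congr hzτ hz
          simp only [hN]
          rw [indicator_of_mem, hzσ, mul_one]
          simp only [mem_ofPred_eq, hzc, hR, hzσ]
          exact hxy
      _ ≤ _ := lintegral_mono_set hsub
  calc volume (dilatedSet Ω τ) = ∫⁻ x in dilatedSet Ω τ, 1 := by simp
    _ ≤ ∫⁻ x in dilatedSet Ω τ, ∫⁻ y in Ω, N x y :=
        setLIntegral_mono' (isOpen_dilatedSet Ω τ).measurableSet hlow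
    _ ≤ ∫⁻ x, ∫⁻ y in Ω, N x y := setLIntegral_le_lintegral _ _
    _ = ∫⁻ y in Ω, ∫⁻ x, N x y := lintegral_lintegral_swap hNm.aemeasurable
    _ ≤ ∫⁻ y in Ω, ENNReal.ofReal (dilConst n) := by
        refine lintegral_mono fun y => ?_
        simp only [hN]
        rw [lintegral_const_mul']
        · have : (fun x => {p : Rn n × Rn n | ‖p.1 - stopCorner σ p.2‖ < R p.2}.indicator
              (fun _ => (1 : ℝ≥0∞)) (x, y)) =
              (Metric.ball (stopCorner σ y) (R y)).indicator fun _ => 1 := by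
            funext x
            simp [indicator, dist_eq_norm]
          rw [this, lintegral_indicator Metric.isOpen_ball.measurableSet, setLIntegral_one,
            Measure.addHaar_ball_of_pos _ _ (by positivity : 0 < R y), finrank_euclideanSpace,
            Fintype.card_fin, ← ENNReal.ofReal_toReal (measure_ball_lt_top).ne,
            ← ENNReal.ofReal_mul (by positivity), ← ENNReal.ofReal_mul (by positivity)]
          refine ENNReal.ofReal_le_ofReal (le_of_eq ?_)
          rw [dilConst, measureReal_def, ← mul_assoc, ← mul_pow]
          congr 2
          simp only [hR]
          have : (2 : ℝ) ^ σ y ≠ 0 := by positivity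
          field_simp
        · exact ENNReal.ofReal_ne_top
    _ = _ := by simp

end WeakType

section WeakType

variable {n : ℕ} {E F : Type*} [NormedAddCommGroup E] [NormedSpace ℝ E] [CompleteSpace E]
  [NormedAddCommGroup F] [NormedSpace ℝ F] [CompleteSpace F]

/-- `L²` boundedness of convolution with `κ`, on bounded integrable functions. -/
def L2Bound (κ : Rn n → E →L[ℝ] F) (A : ℝ) : Prop :=
  ∀ f : Rn n → E, Nice f →
    ∫⁻ x, ‖opConv κ f x‖ₑ ^ (2 : ℝ) ≤ ENNReal.ofReal (A ^ 2) * ∫⁻ x, ‖f x‖ₑ ^ (2 : ℝ)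

/-- Hörmander's condition. -/
def HormanderBound (κ : Rn n → E →L[ℝ] F) (B : ℝ) : Prop :=
  ∀ y : Rn n, ∫⁻ x in {x | 2 * ‖y‖ ≤ ‖x‖}, ‖κ (x - y) - κ x‖ₑ ≤ ENNReal.ofReal B

lemma markov_rpow {X : Type*} [MeasurableSpace X] {μ : Measure X} {g : X → F}
    (hg : Measurable fun x => ‖g x‖ₑ) {q lam : ℝ} (hq : 0 < q) (hlam : 0 < lam) :
    μ {x | lam ≤ ‖g x‖} ≤ ENNReal.ofReal ((lam ^ q)⁻¹) * ∫⁻ x, ‖g x‖ₑ ^ q ∂μ := by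
  have h := mul_meas_ge_le_lintegral (μ := μ) (hg.pow_const q) (ENNReal.ofReal (lam ^ q))
  have hset : {x | ENNReal.ofReal (lam ^ q) ≤ ‖g x‖ₑ ^ q} = {x | lam ≤ ‖g x‖} := by
    ext x
    simp only [mem_ofPred_eq]
    rw [← ENNReal.ofReal_rpow_of_pos hlam, ENNReal.rpow_le_rpow_iff hq, ← ofReal_norm,
      ENNReal.ofReal_le_ofReal_iff (norm_nonneg _)]
  rw [hset] at h
  rw [ENNReal.ofReal_inv_of_pos (by positivity), ← ENNReal.div_eq_inv_mul,
    ENNReal.le_div_iff_mul_le (.inl (by simp; positivity)) (.inl ENNReal.ofReal_ne_top), mul_comm]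
  exact h

variable {Ω : Set (Rn n)} {τ : Rn n → ℤ}

lemma IsStopping.lintegral_opConv_bad (h : IsStopping Ω τ) {κ : Rn n → E →L[ℝ] F}
    (hκ : Continuous κ) (hc : HasCompactSupport κ) {B : ℝ}
    (hH : HormanderBound κ B) {f : Rn n → E} (hf : Nice f) :
    ∫⁻ x in (dilatedSet Ω τ)ᶜ, ‖opConv κ (f - goodPart Ω τ f) x‖ₑ ≤
      ENNReal.ofReal (2 * B) * ∫⁻ x, ‖f x‖ₑ := by
  classical
  set b := f - goodPart Ω τ f with hb
  have hgn := h.nice_goodPart hf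
  have hbn : Nice b := hf.sub hgn
  set σ : Rn n → ℤ := fun x => if x ∈ Ω then τ x else 0 with hσ
  have hσm : Measurable σ := h.measurable_indicator_level
  have hσΩ : ∀ x ∈ Ω, σ x = τ x := fun x hx => if_pos hx
  have hcm := measurable_stopCorner hσm
  have hcΩ : ∀ x ∈ Ω, stopCorner σ x = stopCorner τ x := fun x hx => by
    simp only [stopCorner, hσΩ x hx]
  obtain ⟨C, hC0, hC⟩ := exists_bound_of_cc hκ hc
  set N : Rn n → Rn n → ℝ≥0∞ := fun x y =>
    ‖κ (x - y) - κ (x - stopCorner σ y)‖ₑ * ‖b y‖ₑ with hN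
  have hNm : Measurable (Function.uncurry N) := by
    refine Measurable.mul ?_ (hbn.meas.enorm.comp measurable_snd)
    have hcont : Continuous fun p : Rn n × Rn n × Rn n => ‖κ (p.1 - p.2.1) - κ (p.1 - p.2.2)‖ₑ := by
      fun_prop
    have hm2 : Measurable fun p : Rn n × Rn n => (p.1, p.2, stopCorner σ p.2) :=
      measurable_fst.prodMk (measurable_snd.prodMk (hcm.comp measurable_snd))
    have := hcont.measurable.comp hm2
    simp only [Function.comp_def] at this
    exact this
  have hΩm := h.measurableSet
  have hpt : ∀ x, ‖opConv κ b x‖ₑ ≤ ∫⁻ y in Ω, N x y := by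
    intro x
    have hi := integrable_opConv_integrand hκ hc hbn.int x
    have hb0 : ∀ y ∉ Ω, b y = 0 := fun y hy => by
      simp [hb, goodPart_of_notMem hy]
    have h1 : opConv κ b x = ∫ y in Ω, κ (x - y) (b y) := by
      rw [opConv, setIntegral_eq_integral_of_forall_compl_eq_zero]
      intro y hy; rw [hb0 y hy, map_zero]
    have hbΩ : ∀ y ∈ Ω, b y = f y - dyadicAvg (τ y) f y := fun y hy => by
      simp [hb, goodPart_of_mem hy]
    have hφm : StronglyMeasurable fun y => κ (x - stopCorner σ y) := by
      have hκ' : Continuous fun z => κ (x - z) := by fun_prop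
      exact hκ'.stronglyMeasurable.comp_measurable hcm
    have hi2 : Integrable fun y => κ (x - stopCorner σ y) (b y) := by
      refine Integrable.mono' (hbn.int.norm.const_mul C)
        ((ContinuousLinearMap.id ℝ (E →L[ℝ] F)).aestronglyMeasurable_comp₂
          hφm.aestronglyMeasurable hbn.int.1) (.of_forall fun y => ?_)
      exact (ContinuousLinearMap.le_opNorm _ _).trans (by gcongr; exact hC _)
    have h2 : ∫ y in Ω, κ (x - stopCorner σ y) (b y) = 0 := by
      have := h.setIntegral_apply_sub hf.int (φ := fun y => κ (x - stopCorner σ y)) ?_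
        (fun y => hC _) ?_
      · rw [← this]
        exact setIntegral_congr_fun hΩm fun y hy => by simp only [hbΩ y hy]
      · intro y hy z hz
        have hzy := h y hy z hz
        rw [hcΩ z hzy.1, hcΩ y hy, stopCorner_congr hzy.2 hz]
      · exact hi2.integrableOn.congr_fun (fun y hy => by simp only [hbΩ y hy]) hΩm
    rw [h1, ← sub_zero (∫ y in Ω, κ (x - y) (b y)), ← h2,
      ← integral_sub hi.integrableOn hi2.integrableOn]
    refine (enorm_integral_le_lintegral_enorm _).trans (lintegral_mono fun y => ?_)
    simp only [hN]
    rw [← sub_apply]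
    exact ContinuousLinearMap.le_opENorm _ _
  have hDm : MeasurableSet (dilatedSet Ω τ)ᶜ := (isOpen_dilatedSet Ω τ).measurableSet.compl
  have hinner : ∀ y ∈ Ω, ∫⁻ x in (dilatedSet Ω τ)ᶜ, N x y ≤ ENNReal.ofReal B * ‖b y‖ₑ := by
    intro y hy
    simp only [hN]
    rw [lintegral_mul_const' _ _ enorm_ne_top]
    gcongr
    rw [hcΩ y hy]
    set c := stopCorner τ y
    have hsub : (dilatedSet Ω τ)ᶜ ⊆ (fun x => x - c) ⁻¹' {x | 2 * ‖y - c‖ ≤ ‖x‖} := by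
      intro x hx
      simp only [dilatedSet, mem_compl_iff, mem_ofPred_eq, not_exists, not_and, not_lt] at hx
      have h1 := hx y hy
      have h2 : ‖y - c‖ ≤ √n * ((2 : ℝ) ^ τ y)⁻¹ := norm_sub_le_of_dcell (dcell_stopCorner τ y).symm
      simp only [mem_preimage, mem_ofPred_eq]
      linarith
    refine (lintegral_mono_set hsub).trans ?_
    refine le_trans (le_of_eq ?_) (hH (y - c))
    have hmp := measurePreserving_sub_right (volume : Measure (Rn n)) c
    rw [← hmp.setLIntegral_comp_preimage_emb (MeasurableEquiv.subRight c).measurableEmbedding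
      (fun x => ‖κ (x - (y - c)) - κ x‖ₑ)]
    simp only [sub_sub_sub_cancel_right]
  calc ∫⁻ x in (dilatedSet Ω τ)ᶜ, ‖opConv κ b x‖ₑ
      ≤ ∫⁻ x in (dilatedSet Ω τ)ᶜ, ∫⁻ y in Ω, N x y := lintegral_mono hpt
    _ = ∫⁻ y in Ω, ∫⁻ x in (dilatedSet Ω τ)ᶜ, N x y := lintegral_lintegral_swap hNm.aemeasurable
    _ ≤ ∫⁻ y in Ω, ENNReal.ofReal B * ‖b y‖ₑ := setLIntegral_mono' hΩm hinner
    _ ≤ ∫⁻ y, ENNReal.ofReal B * ‖b y‖ₑ := setLIntegral_le_lintegral _ _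
    _ = ENNReal.ofReal B * ∫⁻ y, ‖b y‖ₑ := lintegral_const_mul' _ _ ENNReal.ofReal_ne_top
    _ ≤ ENNReal.ofReal B * ((∫⁻ y, ‖f y‖ₑ) + ∫⁻ y, ‖f y‖ₑ) := by
        refine mul_le_mul_right ?_ _
        calc ∫⁻ y, ‖b y‖ₑ ≤ ∫⁻ y, (‖f y‖ₑ + ‖goodPart Ω τ f y‖ₑ) :=
              lintegral_mono fun y => enorm_sub_le
          _ = _ := lintegral_add_left hf.meas.enorm _
          _ ≤ _ := add_le_add le_rfl (h.lintegral_goodPart_le f)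
    _ = _ := by
        rw [← two_mul, ENNReal.ofReal_mul (by norm_num), ENNReal.ofReal_ofNat]; ring

/-- The Calderón–Zygmund weak type `(1,1)` inequality. -/
theorem weak_type_one (hn : 0 < n) {κ : Rn n → E →L[ℝ] F}
    (hκ : Continuous κ) (hc : HasCompactSupport κ) {A B : ℝ} (hA : 0 ≤ A) (hAB : A ≤ B) (hB : 0 < B)
    (h2 : L2Bound κ A) (hH : HormanderBound κ B) {f : Rn n → E} (hf : Nice f) {lam : ℝ}
    (hlam : 0 < lam) :
    volume {x | lam < ‖opConv κ f x‖} ≤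
      ENNReal.ofReal ((4 * 2 ^ n + dilConst n + 4) * B / lam) * ∫⁻ x, ‖f x‖ₑ := by
  have hα : 0 < lam / B := by positivity
  obtain ⟨Ω, τ, h, hΩ, hoff⟩ := exists_stopping hn hf.int hα
  set I := ∫⁻ x, ‖f x‖ₑ with hI
  set g := goodPart Ω τ f with hg
  have hgn : Nice g := h.nice_goodPart hf
  have hbn : Nice (f - g) := hf.sub hgn
  have hΩv : volume Ω ≤ ENNReal.ofReal (B / lam) * I := by
    have := h.measure_le fun x hx => (hΩ x hx).1
    rw [show B / lam = (lam / B)⁻¹ by simp, ENNReal.ofReal_inv_of_pos hα, ← ENNReal.div_eq_inv_mul,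
      ENNReal.le_div_iff_mul_le (.inl (by simpa using hα)) (.inl ENNReal.ofReal_ne_top), mul_comm]
    exact this
  have hD : volume (dilatedSet Ω τ) ≤ ENNReal.ofReal (dilConst n * B / lam) * I := by
    refine (h.volume_dilatedSet_le hn).trans ?_
    rw [mul_div_assoc, ENNReal.ofReal_mul (dilConst_nonneg n), mul_assoc]
    gcongr
  have hgb : ∀ᵐ x, ‖g x‖ ≤ 2 ^ n * (lam / B) := by
    filter_upwards [hoff] with x hx
    by_cases hxΩ : x ∈ Ω
    · rw [hg, goodPart_of_mem hxΩ]
      exact (norm_dyadicAvg_le _ _ _).trans (hΩ x hxΩ).2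
    · rw [hg, goodPart_of_notMem hxΩ]
      refine (hx hxΩ).trans (le_mul_of_one_le_left hα.le (one_le_pow₀ (by norm_num)))
  have hg2 : ∫⁻ x, ‖g x‖ₑ ^ (2 : ℝ) ≤ ENNReal.ofReal (2 ^ n * (lam / B)) * I := by
    calc ∫⁻ x, ‖g x‖ₑ ^ (2 : ℝ) ≤ ∫⁻ x, ENNReal.ofReal (2 ^ n * (lam / B)) * ‖g x‖ₑ := by
          refine lintegral_mono_ae ?_
          filter_upwards [hgb] with x hx
          rw [ENNReal.rpow_two, sq]
          gcongr
          rw [← ofReal_norm]; exact ENNReal.ofReal_le_ofReal hx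
      _ = ENNReal.ofReal (2 ^ n * (lam / B)) * ∫⁻ x, ‖g x‖ₑ :=
          lintegral_const_mul' _ _ ENNReal.ofReal_ne_top
      _ ≤ _ := by gcongr; exact h.lintegral_goodPart_le f
  have hTg : volume {x | lam / 2 ≤ ‖opConv κ g x‖} ≤ ENNReal.ofReal (4 * 2 ^ n * B / lam) * I := by
    refine (markov_rpow (continuous_opConv hκ hc hgn.int).enorm.measurable two_pos
      (half_pos hlam)).trans ?_
    refine (mul_le_mul_right ((h2 g hgn).trans (mul_le_mul_right hg2 _)) _).trans ?_
    rw [← mul_assoc, ← mul_assoc, ← ENNReal.ofReal_mul (by positivity),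
      ← ENNReal.ofReal_mul (by positivity)]
    gcongr
    rw [Real.rpow_two]
    have : A ^ 2 ≤ B ^ 2 := by gcongr
    calc ((lam / 2) ^ 2)⁻¹ * A ^ 2 * (2 ^ n * (lam / B))
        ≤ ((lam / 2) ^ 2)⁻¹ * B ^ 2 * (2 ^ n * (lam / B)) := by gcongr
      _ = _ := by field_simp; ring
  have hTb : volume.restrict (dilatedSet Ω τ)ᶜ {x | lam / 2 ≤ ‖opConv κ (f - g) x‖} ≤
      ENNReal.ofReal (4 * B / lam) * I := by
    refine (markov_rpow (continuous_opConv hκ hc hbn.int).enorm.measurable one_pos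
      (half_pos hlam)).trans ?_
    simp only [ENNReal.rpow_one, Real.rpow_one]
    refine (mul_le_mul_right (h.lintegral_opConv_bad hκ hc hH hf) _).trans ?_
    rw [← mul_assoc, ← ENNReal.ofReal_mul (by positivity)]
    gcongr
    refine le_of_eq ?_
    field_simp; ring
  have hsub : {x | lam < ‖opConv κ f x‖} ⊆ {x | lam / 2 ≤ ‖opConv κ g x‖} ∪
      (dilatedSet Ω τ ∪ ({x | lam / 2 ≤ ‖opConv κ (f - g) x‖} ∩ (dilatedSet Ω τ)ᶜ)) := by
    intro x hx
    by_contra hcon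
    simp only [mem_union, mem_inter_iff, mem_compl_iff, mem_ofPred_eq, not_or, not_and, not_not,
      not_le] at hcon hx
    obtain ⟨h1, h3, h4⟩ := hcon
    have h5 : ‖opConv κ (f - g) x‖ < lam / 2 := by
      by_contra! h6; exact h3 (h4 h6)
    have h7 : opConv κ f x = opConv κ g x + opConv κ (f - g) x := by
      rw [opConv_sub hκ hc hf.int hgn.int]; simp
    rw [h7] at hx
    linarith [norm_add_le (opConv κ g x) (opConv κ (f - g) x)]
  refine (measure_mono hsub).trans ((measure_union_le _ _).trans ?_)
  rw [show (4 * 2 ^ n + dilConst n + 4) * B / lam =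
    4 * 2 ^ n * B / lam + (dilConst n * B / lam + 4 * B / lam) by ring]
  have := dilConst_nonneg n
  rw [ENNReal.ofReal_add (by positivity) (by positivity),
    ENNReal.ofReal_add (by positivity) (by positivity), add_mul, add_mul]
  refine add_le_add hTg ((measure_union_le _ _).trans (add_le_add hD ?_))
  rwa [Measure.restrict_apply' (isOpen_dilatedSet Ω τ).measurableSet.compl] at hTb

end WeakType

section Marcinkiewicz

lemma lintegral_rpow_Ioo {a q : ℝ} (ha : 0 ≤ a) (hq : 0 < q) :
    ∫⁻ t in Ioo 0 a, ENNReal.ofReal (t ^ (q - 1)) = ENNReal.ofReal (a ^ q / q) := by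
  have hi : IntegrableOn (fun t : ℝ => t ^ (q - 1)) (Ioc 0 a) := by
    have := intervalIntegral.intervalIntegrable_rpow' (a := 0) (b := a) (r := q - 1) (by linarith)
    rwa [intervalIntegrable_iff_integrableOn_Ioc_of_le ha] at this
  rw [← setLIntegral_congr Ioo_ae_eq_Ioc.symm, ← ofReal_integral_eq_lintegral_ofReal hi,
    ← intervalIntegral.integral_of_le ha, integral_rpow (.inl (by linarith))]
  · congr 1
    rw [sub_add_cancel, Real.zero_rpow hq.ne', sub_zero]
  · filter_upwards [ae_restrict_mem measurableSet_Ioc] with t ht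
    exact Real.rpow_nonneg ht.1.le _

lemma lintegral_rpow_Ici {a q : ℝ} (ha : 0 < a) (hq : 0 < q) :
    ∫⁻ t in Ici a, ENNReal.ofReal (t ^ (-q - 1)) = ENNReal.ofReal (a ^ (-q) / q) := by
  have hi := integrableOn_Ioi_rpow_of_lt (a := -q - 1) (by linarith) ha
  rw [setLIntegral_congr Ioi_ae_eq_Ici.symm, ← ofReal_integral_eq_lintegral_ofReal hi,
    integral_Ioi_rpow_of_lt (by linarith) ha]
  · congr 1
    rw [sub_add_cancel, div_neg, neg_div, neg_neg]
  · filter_upwards [ae_restrict_mem measurableSet_Ioi] with t ht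
    exact Real.rpow_nonneg (ha.le.trans (mem_Ioi.1 ht).le) _

variable {n : ℕ} {E F : Type*} [NormedAddCommGroup E] [NormedSpace ℝ E]
  [NormedAddCommGroup F] [NormedSpace ℝ F] [CompleteSpace F]

/-- The constant in the Marcinkiewicz interpolation theorem. -/
def marcConst (p W A : ℝ) : ℝ := p * (2 / (p - 1) + 4 / (2 - p)) * (W ^ (2 - p) * A ^ (2 * (p - 1)))

theorem marcinkiewicz {κ : Rn n → E →L[ℝ] F} (hκ : Continuous κ) (hc : HasCompactSupport κ)
    {A W : ℝ} (hA : 0 < A) (hW : 0 < W) (h2 : L2Bound κ A)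
    (h1 : ∀ f : Rn n → E, Nice f → ∀ lam : ℝ, 0 < lam →
      volume {x | lam < ‖opConv κ f x‖} ≤ ENNReal.ofReal (W / lam) * ∫⁻ x, ‖f x‖ₑ)
    {p : ℝ} (hp1 : 1 < p) (hp2 : p < 2) {f : Rn n → E} (hf : Nice f) :
    ∫⁻ x, ‖opConv κ f x‖ₑ ^ p ≤ ENNReal.ofReal (marcConst p W A) * ∫⁻ x, ‖f x‖ₑ ^ p := by
  have hp0 : 0 < p := by linarith
  have hp1' : 0 < p - 1 := by linarith
  have hp2' : 0 < 2 - p := by linarith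
  set c : ℝ := W / A ^ 2 with hcdef
  have hc0 : 0 < c := by positivity
  have hfm : Measurable fun x => ‖f x‖ := hf.meas.norm.measurable
  have hpw : ∀ t : ℝ, 0 < t → volume {x | t < ‖opConv κ f x‖} ≤
      ENNReal.ofReal (2 * W / t) * (∫⁻ x, {x | c * t < ‖f x‖}.indicator (fun x => ‖f x‖ₑ) x) +
      ENNReal.ofReal (4 * A ^ 2 / t ^ 2) *
        ∫⁻ x, {x | ‖f x‖ ≤ c * t}.indicator (fun x => ‖f x‖ₑ ^ (2 : ℝ)) x := by
    intro t ht
    have hm1 : MeasurableSet {x | c * t < ‖f x‖} := measurableSet_lt measurable_const hfm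
    have hm2 : MeasurableSet {x | ‖f x‖ ≤ c * t} := measurableSet_le hfm measurable_const
    set hi := {x | c * t < ‖f x‖}.indicator f with hhi
    set lo := {x | ‖f x‖ ≤ c * t}.indicator f with hlo
    have hin : Nice hi := hf.indicator hm1
    have hlon : Nice lo := hf.indicator hm2
    have hsum : f = hi + lo := by
      funext x
      by_cases hx : c * t < ‖f x‖
      · simp [hhi, hlo, hx, not_le.2 hx]
      · simp [hhi, hlo, hx, not_lt.1 hx]
    have hsub : {x | t < ‖opConv κ f x‖} ⊆ {x | t / 2 < ‖opConv κ hi x‖} ∪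
        {x | t / 2 ≤ ‖opConv κ lo x‖} := by
      intro x hx
      by_contra hcon
      simp only [mem_union, mem_ofPred_eq, not_or, not_lt, not_le] at hcon hx
      rw [hsum, opConv_add hκ hc hin.int hlon.int, Pi.add_apply] at hx
      linarith [norm_add_le (opConv κ hi x) (opConv κ lo x)]
    refine (measure_mono hsub).trans ((measure_union_le _ _).trans (add_le_add ?_ ?_))
    · refine (h1 hi hin _ (half_pos ht)).trans (le_of_eq ?_)
      congr 1
      · congr 1; field_simp
      · refine lintegral_congr fun x => ?_
        simp only [hhi, enorm_indicator_eq_indicator_enorm]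
    · refine (markov_rpow (continuous_opConv hκ hc hlon.int).enorm.measurable two_pos
        (half_pos ht)).trans ?_
      refine (mul_le_mul_right (h2 lo hlon) _).trans (le_of_eq ?_)
      rw [← mul_assoc, ← ENNReal.ofReal_mul (by positivity)]
      congr 1
      · congr 1; rw [Real.rpow_two]; field_simp; norm_num
      · refine lintegral_congr fun x => ?_
        simp only [hlo, enorm_indicator_eq_indicator_enorm]
        by_cases hx : ‖f x‖ ≤ c * t <;> simp [hx]
  have hcont := continuous_opConv hκ hc hf.int
  have hlayer := lintegral_rpow_eq_lintegral_meas_lt_mul (volume : Measure (Rn n))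
    (f := fun x => ‖opConv κ f x‖) (.of_forall fun x => norm_nonneg _)
    hcont.norm.measurable.aemeasurable hp0
  have e1 : ∀ x, ENNReal.ofReal (‖opConv κ f x‖ ^ p) = ‖opConv κ f x‖ₑ ^ p := fun x => by
    rw [← ofReal_norm, ENNReal.ofReal_rpow_of_nonneg (norm_nonneg _) hp0.le]
  simp only [e1] at hlayer
  rw [hlayer]
  set N1 : ℝ → Rn n → ℝ≥0∞ := fun t x =>
    ENNReal.ofReal (2 * W) * ({q : ℝ × Rn n | c * q.1 < ‖f q.2‖}.indicator
      (fun q => ENNReal.ofReal (q.1 ^ (p - 1 - 1)) * ‖f q.2‖ₑ) (t, x)) with hN1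
  set N2 : ℝ → Rn n → ℝ≥0∞ := fun t x =>
    ENNReal.ofReal (4 * A ^ 2) * ({q : ℝ × Rn n | ‖f q.2‖ ≤ c * q.1}.indicator
      (fun q => ENNReal.ofReal (q.1 ^ (-(2 - p) - 1)) * ‖f q.2‖ₑ ^ (2 : ℝ)) (t, x)) with hN2
  have hfm2 : Measurable fun q : ℝ × Rn n => ‖f q.2‖ := hfm.comp measurable_snd
  have hfm3 : Measurable fun q : ℝ × Rn n => ‖f q.2‖ₑ := hf.meas.enorm.comp measurable_snd
  have hcm : Measurable fun q : ℝ × Rn n => c * q.1 := measurable_fst.const_mul c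
  have hN1m : Measurable (Function.uncurry N1) :=
    ((((measurable_fst.pow_const _).ennreal_ofReal).mul hfm3).indicator
      (measurableSet_lt hcm hfm2)).const_mul _
  have hN2m : Measurable (Function.uncurry N2) :=
    ((((measurable_fst.pow_const _).ennreal_ofReal).mul (hfm3.pow_const _)).indicator
      (measurableSet_le hfm2 hcm)).const_mul _
  have step : ∫⁻ t in Ioi (0 : ℝ), volume {x | t < ‖opConv κ f x‖} * ENNReal.ofReal (t ^ (p - 1)) ≤
      ∫⁻ t in Ioi (0 : ℝ), ((∫⁻ x, N1 t x) + ∫⁻ x, N2 t x) := by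
    refine setLIntegral_mono' measurableSet_Ioi fun t ht => ?_
    have ht0 : (0 : ℝ) < t := ht
    refine (mul_le_mul_left (hpw t ht) _).trans (le_of_eq ?_)
    rw [add_mul]
    congr 1
    · simp only [hN1]
      rw [lintegral_const_mul' _ _ ENNReal.ofReal_ne_top, mul_right_comm,
        ← ENNReal.ofReal_mul (by positivity),
        show 2 * W / t * t ^ (p - 1) = 2 * W * t ^ (p - 1 - 1) by
          rw [Real.rpow_sub_one ht0.ne' (p - 1)]; field_simp,
        ENNReal.ofReal_mul (by positivity), mul_assoc, ← lintegral_const_mul' _ _ ENNReal.ofReal_ne_top]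
      congr 1
      refine lintegral_congr fun x => ?_
      by_cases hx : c * t < ‖f x‖ <;> simp [hx]
    · simp only [hN2]
      rw [lintegral_const_mul' _ _ ENNReal.ofReal_ne_top, mul_right_comm,
        ← ENNReal.ofReal_mul (by positivity),
        show 4 * A ^ 2 / t ^ 2 * t ^ (p - 1) = 4 * A ^ 2 * t ^ (-(2 - p) - 1) by
          rw [show -(2 - p) - 1 = p - 1 - 2 by ring, Real.rpow_sub ht0 (p - 1) 2, Real.rpow_two]
          ring,
        ENNReal.ofReal_mul (by positivity), mul_assoc, ← lintegral_const_mul' _ _ ENNReal.ofReal_ne_top]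
      congr 1
      refine lintegral_congr fun x => ?_
      by_cases hx : ‖f x‖ ≤ c * t <;> simp [hx]
  have hN1x : ∀ x, ∫⁻ t in Ioi (0 : ℝ), N1 t x =
      ENNReal.ofReal (2 * W * (c ^ (1 - p) / (p - 1))) * ‖f x‖ₑ ^ p := by
    intro x
    have : ∀ t ∈ Ioi (0 : ℝ), N1 t x = ENNReal.ofReal (2 * W) * ‖f x‖ₑ *
        (Ioo 0 (‖f x‖ / c)).indicator (fun t => ENNReal.ofReal (t ^ (p - 1 - 1))) t := by
      intro t ht
      have ht0 : (0 : ℝ) < t := ht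
      simp only [hN1]
      by_cases hx : c * t < ‖f x‖
      · have h' : t < ‖f x‖ / c := by rw [lt_div_iff₀ hc0, mul_comm]; exact hx
        simp only [indicator, mem_ofPred_eq, hx, mem_Ioo, ht0, h', if_true, and_self]
        ring
      · have h' : ¬ t < ‖f x‖ / c := by rw [lt_div_iff₀ hc0, mul_comm]; exact hx
        simp only [indicator, mem_ofPred_eq, hx, mem_Ioo, ht0, h', if_false, and_false, mul_zero]
    rw [setLIntegral_congr_fun measurableSet_Ioi this, lintegral_const_mul' _ _
      (ENNReal.mul_ne_top ENNReal.ofReal_ne_top enorm_ne_top),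
      lintegral_indicator measurableSet_Ioo, Measure.restrict_restrict measurableSet_Ioo,
      inter_eq_left.2 Ioo_subset_Ioi_self, lintegral_rpow_Ioo (by positivity) hp1']
    rw [← ofReal_norm, ← ENNReal.ofReal_mul (by positivity), ← ENNReal.ofReal_mul (by positivity),
      ENNReal.ofReal_rpow_of_nonneg (norm_nonneg _) hp0.le, ← ENNReal.ofReal_mul (by positivity)]
    congr 1
    rw [Real.div_rpow (norm_nonneg _) hc0.le, show 1 - p = -(p - 1) by ring, Real.rpow_neg hc0.le]
    rcases (norm_nonneg (f x)).eq_or_lt with h0 | h0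
    · rw [← h0, Real.zero_rpow hp0.ne']; ring
    · rw [Real.rpow_sub_one h0.ne']
      have := (Real.rpow_pos_of_pos hc0 (p - 1)).ne'
      field_simp
  have hN2x : ∀ x, ∫⁻ t in Ioi (0 : ℝ), N2 t x ≤
      ENNReal.ofReal (4 * A ^ 2 * (c ^ (2 - p) / (2 - p))) * ‖f x‖ₑ ^ p := by
    intro x
    rcases (norm_nonneg (f x)).eq_or_lt with h0 | h0
    · have h0' : ‖f x‖ₑ = 0 := by rw [← ofReal_norm, ← h0, ENNReal.ofReal_zero]
      have : ∀ t, N2 t x = 0 := fun t => by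
        simp [hN2, indicator, h0']
      simp [this]
    have hpos : 0 < ‖f x‖ / c := by positivity
    have : ∀ t ∈ Ioi (0 : ℝ), N2 t x = ENNReal.ofReal (4 * A ^ 2) * ‖f x‖ₑ ^ (2 : ℝ) *
        (Ici (‖f x‖ / c)).indicator (fun t => ENNReal.ofReal (t ^ (-(2 - p) - 1))) t := by
      intro t ht
      simp only [hN2]
      by_cases hx : ‖f x‖ ≤ c * t
      · have h' : ‖f x‖ / c ≤ t := by rw [div_le_iff₀ hc0, mul_comm]; exact hx
        simp only [indicator, mem_ofPred_eq, hx, mem_Ici, h', if_true]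
        ring
      · have h' : ¬ ‖f x‖ / c ≤ t := by rw [div_le_iff₀ hc0, mul_comm]; exact hx
        simp only [indicator, mem_ofPred_eq, hx, mem_Ici, h', if_false, mul_zero]
    rw [setLIntegral_congr_fun measurableSet_Ioi this, lintegral_const_mul' _ _
      (ENNReal.mul_ne_top ENNReal.ofReal_ne_top (by simp)),
      lintegral_indicator measurableSet_Ici, Measure.restrict_restrict measurableSet_Ici,
      inter_eq_left.2 (Ici_subset_Ioi.2 hpos), lintegral_rpow_Ici hpos hp2']
    rw [← ofReal_norm, ENNReal.ofReal_rpow_of_nonneg (norm_nonneg _) two_pos.le,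
      ← ENNReal.ofReal_mul (by positivity), ← ENNReal.ofReal_mul (by positivity),
      ENNReal.ofReal_rpow_of_nonneg (norm_nonneg _) hp0.le, ← ENNReal.ofReal_mul (by positivity)]
    refine le_of_eq (congrArg _ ?_)
    rw [Real.div_rpow (norm_nonneg _) hc0.le, Real.rpow_neg hc0.le, Real.rpow_neg (norm_nonneg _),
      Real.rpow_sub h0]
    have := (Real.rpow_pos_of_pos hc0 (2 - p)).ne'
    have := (Real.rpow_pos_of_pos h0 2).ne'
    have := (Real.rpow_pos_of_pos h0 p).ne'
    field_simp
  calc ENNReal.ofReal p * ∫⁻ t in Ioi (0 : ℝ), volume {x | t < ‖opConv κ f x‖} *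
        ENNReal.ofReal (t ^ (p - 1))
      ≤ ENNReal.ofReal p * ∫⁻ t in Ioi (0 : ℝ), ((∫⁻ x, N1 t x) + ∫⁻ x, N2 t x) := by gcongr
    _ = ENNReal.ofReal p * ((∫⁻ x, ∫⁻ t in Ioi (0 : ℝ), N1 t x) +
          ∫⁻ x, ∫⁻ t in Ioi (0 : ℝ), N2 t x) := by
        have hN1m' : Measurable fun t => ∫⁻ x, N1 t x := hN1m.lintegral_prod_right'
        rw [lintegral_add_left hN1m', lintegral_lintegral_swap hN1m.aemeasurable,
          lintegral_lintegral_swap hN2m.aemeasurable]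
    _ ≤ ENNReal.ofReal p * (ENNReal.ofReal (2 * W * (c ^ (1 - p) / (p - 1))) * (∫⁻ x, ‖f x‖ₑ ^ p) +
          ENNReal.ofReal (4 * A ^ 2 * (c ^ (2 - p) / (2 - p))) * ∫⁻ x, ‖f x‖ₑ ^ p) := by
        rw [← lintegral_const_mul' _ _ ENNReal.ofReal_ne_top,
          ← lintegral_const_mul' _ _ ENNReal.ofReal_ne_top]
        refine mul_le_mul_right (add_le_add (lintegral_mono fun x => (hN1x x).le)
          (lintegral_mono hN2x)) _
    _ = _ := by
        rw [← add_mul, ← mul_assoc, ← ENNReal.ofReal_add (by positivity) (by positivity),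
          ← ENNReal.ofReal_mul hp0.le]
        congr 2
        rw [marcConst, mul_assoc p]
        congr 1
        have hA2 : c ^ (1 - p) = W ^ (1 - p) * A ^ (2 * (p - 1)) := by
          rw [hcdef, Real.div_rpow hW.le (by positivity), ← Real.rpow_two, ← Real.rpow_mul hA.le,
            show 2 * (1 - p) = -(2 * (p - 1)) by ring, Real.rpow_neg hA.le, div_inv_eq_mul]
        have hB2 : A ^ 2 * c ^ (2 - p) = W ^ (2 - p) * A ^ (2 * (p - 1)) := by
          rw [hcdef, Real.div_rpow hW.le (by positivity), ← Real.rpow_two, ← Real.rpow_mul hA.le,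
            show 2 * (p - 1) = 2 - 2 * (2 - p) by ring, Real.rpow_sub hA]
          ring
        have hW2 : W ^ (2 - p) = W * W ^ (1 - p) := by
          rw [show 2 - p = 1 + (1 - p) by ring, Real.rpow_add hW, Real.rpow_one]
        calc 2 * W * (c ^ (1 - p) / (p - 1)) + 4 * A ^ 2 * (c ^ (2 - p) / (2 - p))
            = 2 / (p - 1) * (W * c ^ (1 - p)) + 4 / (2 - p) * (A ^ 2 * c ^ (2 - p)) := by ring
          _ = _ := by rw [hB2, hA2, ← mul_assoc W, ← hW2]; ring

end Marcinkiewicz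

section Duality

variable {n : ℕ} {E F : Type*} [NormedAddCommGroup E] [InnerProductSpace ℝ E] [CompleteSpace E]
  [NormedAddCommGroup F] [NormedSpace ℝ F] [CompleteSpace F]

/-- The transposed kernel. -/
def adjKer (κ : Rn n → E →L[ℝ] F) (t : Rn n) : (F →L[ℝ] ℝ) →L[ℝ] (E →L[ℝ] ℝ) :=
  (ContinuousLinearMap.compL ℝ E F ℝ).flip (κ (-t))

lemma adjKer_apply (κ : Rn n → E →L[ℝ] F) (t : Rn n) (φ : F →L[ℝ] ℝ) (v : E) :
    adjKer κ t φ v = φ (κ (-t) v) := rfl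

lemma norm_adjKer_sub_le (κ : Rn n → E →L[ℝ] F) (s t : Rn n) :
    ‖adjKer κ s - adjKer κ t‖ ≤ ‖κ (-s) - κ (-t)‖ := by
  refine ContinuousLinearMap.opNorm_le_bound _ (norm_nonneg _) fun φ => ?_
  have : (adjKer κ s - adjKer κ t) φ = φ.comp (κ (-s) - κ (-t)) := by
    ext v; simp [adjKer_apply]
  rw [this, mul_comm]
  exact ContinuousLinearMap.opNorm_comp_le _ _

lemma continuous_adjKer {κ : Rn n → E →L[ℝ] F} (hκ : Continuous κ) : Continuous (adjKer κ) := by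
  unfold adjKer; fun_prop

lemma hasCompactSupport_adjKer {κ : Rn n → E →L[ℝ] F} (hc : HasCompactSupport κ) :
    HasCompactSupport (adjKer κ) := by
  have h1 : HasCompactSupport fun t => κ (-t) := hc.comp_homeomorph (Homeomorph.neg (Rn n))
  exact h1.comp_left (g := (ContinuousLinearMap.compL ℝ E F ℝ).flip) (map_zero _)

lemma HormanderBound.adjKer {κ : Rn n → E →L[ℝ] F} {B : ℝ} (h : HormanderBound κ B) :
    HormanderBound (adjKer κ) B := by
  intro y
  refine le_trans ?_ (h (-y))
  rw [norm_neg]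
  calc ∫⁻ x in {x : Rn n | 2 * ‖y‖ ≤ ‖x‖}, ‖_root_.adjKer κ (x - y) - _root_.adjKer κ x‖ₑ
      ≤ ∫⁻ x in {x : Rn n | 2 * ‖y‖ ≤ ‖x‖}, ‖κ (-x - -y) - κ (-x)‖ₑ := by
        refine lintegral_mono fun x => ?_
        simp only
        rw [← ofReal_norm, ← ofReal_norm, show -x - -y = -(x - y) by abel]
        exact ENNReal.ofReal_le_ofReal (norm_adjKer_sub_le κ _ _)
    _ = _ := by
        have hmp := Measure.measurePreserving_neg (volume : Measure (Rn n))
        have := hmp.setLIntegral_comp_preimage_emb (MeasurableEquiv.neg (Rn n)).measurableEmbedding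
          (fun x => ‖κ (x - -y) - κ x‖ₑ) {x : Rn n | 2 * ‖y‖ ≤ ‖x‖}
        rw [← this]
        congr 2
        ext x; simp

lemma integrable_pairing {κ : Rn n → E →L[ℝ] F} (hκ : Continuous κ) (hc : HasCompactSupport κ)
    {f : Rn n → E} (hf : Nice f) {ψ : Rn n → F →L[ℝ] ℝ} (hψ : Nice ψ) :
    Integrable (fun q : Rn n × Rn n => ψ q.1 (κ (q.1 - q.2) (f q.2))) := by
  obtain ⟨C, hC0, hC⟩ := exists_bound_of_cc hκ hc
  have hi : Integrable fun q : Rn n × Rn n => ‖ψ q.1‖ * ‖f q.2‖ := hψ.int.norm.mul_prod hf.int.norm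
  refine Integrable.mono' (hi.const_mul C) ?_ (.of_forall fun q => ?_)
  · have h1 : AEStronglyMeasurable (fun q : Rn n × Rn n => κ (q.1 - q.2) (f q.2))
        (volume.prod volume) :=
      (ContinuousLinearMap.id ℝ (E →L[ℝ] F)).aestronglyMeasurable_comp₂
        (Continuous.aestronglyMeasurable (by fun_prop))
        (hf.meas.comp_measurable measurable_snd).aestronglyMeasurable
    exact (ContinuousLinearMap.id ℝ (F →L[ℝ] ℝ)).aestronglyMeasurable_comp₂
      (hψ.meas.comp_measurable measurable_fst).aestronglyMeasurable h1
  · calc ‖ψ q.1 (κ (q.1 - q.2) (f q.2))‖ ≤ ‖ψ q.1‖ * (‖κ (q.1 - q.2)‖ * ‖f q.2‖) :=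
          (ContinuousLinearMap.le_opNorm _ _).trans
            (by gcongr; exact ContinuousLinearMap.le_opNorm _ _)
      _ ≤ ‖ψ q.1‖ * (C * ‖f q.2‖) := by gcongr; exact hC _
      _ = _ := by ring

lemma integral_pairing {κ : Rn n → E →L[ℝ] F} (hκ : Continuous κ) (hc : HasCompactSupport κ)
    {f : Rn n → E} (hf : Nice f) {ψ : Rn n → F →L[ℝ] ℝ} (hψ : Nice ψ) :
    ∫ x, ψ x (opConv κ f x) = ∫ y, opConv (adjKer κ) ψ y (f y) := by
  have h1 : ∀ x, ψ x (opConv κ f x) = ∫ y, ψ x (κ (x - y) (f y)) := fun x =>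
    (ContinuousLinearMap.integral_comp_comm _ (integrable_opConv_integrand hκ hc hf.int x)).symm
  have h2 : ∀ y, opConv (adjKer κ) ψ y (f y) = ∫ x, ψ x (κ (x - y) (f y)) := fun y => by
    rw [opConv, ContinuousLinearMap.integral_apply (integrable_opConv_integrand
      (continuous_adjKer hκ) (hasCompactSupport_adjKer hc) hψ.int y)]
    simp only [adjKer_apply, neg_sub]
  simp only [h1, h2]
  exact integral_integral_swap (integrable_pairing hκ hc hf hψ)

lemma enorm_integral_pairing_le {X : Type*} [MeasurableSpace X] {μ : Measure X} {p q : ℝ}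
    (hpq : p.HolderConjugate q)
    {ψ : X → F →L[ℝ] ℝ} {g : X → F} (hψ : AEMeasurable (fun x => ‖ψ x‖ₑ) μ)
    (hg : AEMeasurable (fun x => ‖g x‖ₑ) μ) :
    ‖∫ x, ψ x (g x) ∂μ‖ₑ ≤
      (∫⁻ x, ‖ψ x‖ₑ ^ p ∂μ) ^ (1 / p) * (∫⁻ x, ‖g x‖ₑ ^ q ∂μ) ^ (1 / q) := by
  refine (enorm_integral_le_lintegral_enorm _).trans (le_trans ?_
    (ENNReal.lintegral_mul_le_Lp_mul_Lq μ hpq hψ hg))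
  exact lintegral_mono fun x => ContinuousLinearMap.le_opENorm _ _

lemma Nice.lintegral_rpow_lt_top {f : Rn n → F} (hf : Nice f) {p : ℝ} (hp : 1 ≤ p) :
    ∫⁻ x, ‖f x‖ₑ ^ p < ⊤ := by
  obtain ⟨C, hC⟩ := hf.bdd
  have hC0 : 0 ≤ C := (norm_nonneg _).trans (hC 0)
  calc ∫⁻ x, ‖f x‖ₑ ^ p ≤ ∫⁻ x, ENNReal.ofReal (C ^ (p - 1)) * ‖f x‖ₑ := by
        refine lintegral_mono fun x => ?_
        simp only
        rw [← ofReal_norm, ENNReal.ofReal_rpow_of_nonneg (norm_nonneg _) (by linarith),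
          ← ENNReal.ofReal_mul (by positivity)]
        refine ENNReal.ofReal_le_ofReal ?_
        rcases (norm_nonneg (f x)).eq_or_lt with h0 | h0
        · rw [← h0, Real.zero_rpow (by linarith), mul_zero]
        · calc ‖f x‖ ^ p = ‖f x‖ ^ (p - 1) * ‖f x‖ := by
                rw [Real.rpow_sub_one h0.ne', div_mul_cancel₀ _ h0.ne']
            _ ≤ _ := by
                gcongr
                exact hC x
    _ = ENNReal.ofReal (C ^ (p - 1)) * ∫⁻ x, ‖f x‖ₑ :=
        lintegral_const_mul' _ _ ENNReal.ofReal_ne_top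
    _ < ⊤ := ENNReal.mul_lt_top ENNReal.ofReal_lt_top hf.int.2

lemma L2Bound.adjKer {κ : Rn n → E →L[ℝ] F} (hκ : Continuous κ) (hc : HasCompactSupport κ)
    {A : ℝ} (h : L2Bound κ A) : L2Bound (adjKer κ) A := by
  intro ψ hψ
  set g := opConv (_root_.adjKer κ) ψ with hg
  have hgn : Nice g := hψ.opConv (continuous_adjKer hκ) (hasCompactSupport_adjKer hc)
  set f : Rn n → E := fun y => (InnerProductSpace.toDual ℝ E).symm (g y) with hf
  have hfnorm : ∀ y, ‖f y‖ = ‖g y‖ := fun y => LinearIsometryEquiv.norm_map _ _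
  have hfn : Nice f := by
    obtain ⟨C, hC⟩ := hgn.bdd
    have hcont : Continuous (InnerProductSpace.toDual ℝ E).symm :=
      LinearIsometryEquiv.continuous _
    have hm : StronglyMeasurable f := hcont.comp_stronglyMeasurable hgn.meas
    exact ⟨hm, hgn.int.mono hm.aestronglyMeasurable (.of_forall fun y => (hfnorm y).le), C,
      fun x => (hfnorm x).trans_le (hC x)⟩
  have hgf : ∀ y, g y (f y) = ‖g y‖ ^ 2 := fun y => by
    have : g y = InnerProductSpace.toDual ℝ E (f y) := by simp [hf]
    conv_lhs => rw [this]
    rw [InnerProductSpace.toDual_apply_apply, real_inner_self_eq_norm_sq, hfnorm]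
  have hfe : ∀ y, ‖f y‖ₑ = ‖g y‖ₑ := fun y => by rw [← ofReal_norm, hfnorm, ofReal_norm]
  set G := ∫⁻ y, ‖g y‖ₑ ^ (2 : ℝ) with hG
  have hGtop : G < ⊤ := hgn.lintegral_rpow_lt_top (by norm_num)
  have hpair : G = ‖∫ x, ψ x (opConv κ f x)‖ₑ := by
    rw [integral_pairing hκ hc hfn hψ]
    simp only [← hg, hgf]
    rw [Real.enorm_of_nonneg (integral_nonneg fun y => by positivity),
      integral_eq_lintegral_of_nonneg_ae (.of_forall fun y => by positivity)
        (by exact (hgn.meas.norm.pow 2).aestronglyMeasurable)]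
    have : ∀ y, ENNReal.ofReal (‖g y‖ ^ 2) = ‖g y‖ₑ ^ (2 : ℝ) := fun y => by
      rw [ENNReal.ofReal_pow (norm_nonneg _), ofReal_norm, ENNReal.rpow_two]
    simp only [this]
    rw [ENNReal.ofReal_toReal hGtop.ne]
  have hle : G ≤ (∫⁻ x, ‖ψ x‖ₑ ^ (2 : ℝ)) ^ (1 / 2 : ℝ) * (ENNReal.ofReal (A ^ 2) * G) ^ (1 / 2 : ℝ) := by
    conv_lhs => rw [hpair]
    refine (enorm_integral_pairing_le Real.HolderConjugate.two_two
      hψ.meas.enorm.aemeasurable (continuous_opConv hκ hc hfn.int).enorm.measurable.aemeasurable).trans ?_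
    gcongr
    refine (h f hfn).trans (le_of_eq ?_)
    simp only [hfe, hG]
  have hsq := ENNReal.rpow_le_rpow hle (by norm_num : (0 : ℝ) ≤ 2)
  rw [ENNReal.mul_rpow_of_nonneg _ _ (by norm_num : (0 : ℝ) ≤ 2), ← ENNReal.rpow_mul,
    ← ENNReal.rpow_mul, show (1 / 2 : ℝ) * 2 = 1 by norm_num, ENNReal.rpow_one, ENNReal.rpow_one,
    ENNReal.rpow_two, sq, ← mul_assoc] at hsq
  rcases eq_or_ne G 0 with h0 | h0
  · rw [h0]; exact zero_le
  · rw [mul_comm (ENNReal.ofReal (A ^ 2))]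
    exact (ENNReal.mul_le_mul_iff_left h0 hGtop.ne).1 hsq

end Duality

section Norming

variable {F : Type*} [NormedAddCommGroup F] [NormedSpace ℝ F]

lemma exists_norming [TopologicalSpace.SeparableSpace F] :
    ∃ φ : ℕ → F →L[ℝ] ℝ, (∀ j, ‖φ j‖ ≤ 1) ∧ ∀ v : F, ∀ ε > 0, ∃ j, ‖v‖ - ε < φ j v := by
  obtain ⟨d, hd⟩ := TopologicalSpace.exists_dense_seq F
  choose φ h1 h2 using fun j => exists_dual_vector'' ℝ (d j)
  refine ⟨φ, h1, fun v ε hε => ?_⟩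
  obtain ⟨j, hj⟩ := hd.exists_dist_lt v (half_pos hε)
  refine ⟨j, ?_⟩
  rw [dist_eq_norm] at hj
  have h3 : ‖v‖ ≤ ‖v - d j‖ + ‖d j‖ := by simpa using norm_add_le (v - d j) (d j)
  have h4 : |φ j (v - d j)| ≤ 1 * ‖v - d j‖ :=
    ((φ j).le_opNorm _).trans (by gcongr; exact h1 j)
  have h5 : φ j v = φ j (v - d j) + ‖d j‖ := by
    have := h2 j
    simp only [RCLike.ofReal_real_eq_id, id] at this
    rw [map_sub, this]; ring
  have := (abs_le.1 h4).1
  linarith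

/-- Running maximum of a sequence of functionals. -/
def normMax (φ : ℕ → F →L[ℝ] ℝ) : ℕ → F → ℝ
  | 0, _ => 0
  | N + 1, v => max (normMax φ N v) (φ N v)

open Classical in
/-- A functional realizing the running maximum. -/
def normSel (φ : ℕ → F →L[ℝ] ℝ) : ℕ → F → F →L[ℝ] ℝ
  | 0, _ => 0
  | N + 1, v => if normMax φ N v < φ N v then φ N else normSel φ N v

variable {φ : ℕ → F →L[ℝ] ℝ}

lemma continuous_normMax (N : ℕ) : Continuous (normMax φ N) := by
  induction N with
  | zero => exact continuous_const
  | succ N ih => exact ih.max (φ N).continuous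

lemma normSel_apply (N : ℕ) (v : F) : normSel φ N v v = normMax φ N v := by
  induction N with
  | zero => rfl
  | succ N ih =>
    simp only [normSel, normMax]
    split_ifs with h
    · rw [max_eq_right h.le]
    · rw [max_eq_left (not_lt.1 h), ih]

lemma norm_normSel_le (hφ : ∀ j, ‖φ j‖ ≤ 1) (N : ℕ) (v : F) : ‖normSel φ N v‖ ≤ 1 := by
  induction N with
  | zero => simp [normSel]
  | succ N ih =>
    simp only [normSel]
    split_ifs
    exacts [hφ N, ih]

lemma normMax_mono (v : F) : Monotone fun N => normMax φ N v :=
  monotone_nat_of_le_succ fun _ => le_max_left _ _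

lemma normMax_nonneg (N : ℕ) (v : F) : 0 ≤ normMax φ N v := normMax_mono v (Nat.zero_le N)

lemma normMax_le (hφ : ∀ j, ‖φ j‖ ≤ 1) (N : ℕ) (v : F) : normMax φ N v ≤ ‖v‖ := by
  rw [← normSel_apply]
  refine (le_abs_self _).trans (((normSel φ N v).le_opNorm v).trans ?_)
  nlinarith [norm_normSel_le hφ N v, norm_nonneg v]

lemma tendsto_normMax (hφ : ∀ j, ‖φ j‖ ≤ 1) (h : ∀ v : F, ∀ ε > 0, ∃ j, ‖v‖ - ε < φ j v) (v : F) :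
    Tendsto (fun N => normMax φ N v) atTop (𝓝 ‖v‖) := by
  refine tendsto_atTop_isLUB (normMax_mono v) ⟨?_, ?_⟩
  · rintro _ ⟨N, rfl⟩; exact normMax_le hφ N v
  · intro b hb
    refine le_of_forall_pos_sub_le fun ε hε => ?_
    obtain ⟨j, hj⟩ := h v ε hε
    exact hj.le.trans ((le_max_right _ _).trans (hb ⟨j + 1, rfl⟩))

lemma stronglyMeasurable_normSel {X : Type*} [TopologicalSpace X] [MeasurableSpace X]
    [OpensMeasurableSpace X] {h : X → F} (hh : Continuous h) (N : ℕ) :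
    StronglyMeasurable fun x => normSel φ N (h x) := by
  induction N with
  | zero => exact stronglyMeasurable_const
  | succ N ih =>
    refine StronglyMeasurable.ite ?_ stronglyMeasurable_const ih
    exact (isOpen_lt ((continuous_normMax N).comp hh) ((φ N).continuous.comp hh)).measurableSet

end Norming

section DualBound

variable {n : ℕ} {E F : Type*} [NormedAddCommGroup E] [InnerProductSpace ℝ E] [CompleteSpace E]
  [NormedAddCommGroup F] [NormedSpace ℝ F] [CompleteSpace F]

lemma ennreal_self_bound {X Y D : ℝ≥0∞} {p q : ℝ} (hpq : p.HolderConjugate q) (hX : X ≠ ⊤)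
    (h : X ≤ (D * X) ^ (1 / q) * Y ^ (1 / p)) : X ≤ D ^ (p / q) * Y := by
  have hp := hpq.pos
  have hq := hpq.symm.pos
  rcases eq_or_ne X 0 with h0 | h0
  · rw [h0]; exact zero_le
  have e1 : X = X ^ (1 / q) * X ^ (1 / p) := by
    rw [← ENNReal.rpow_add _ _ h0 hX]
    have := hpq.inv_add_inv_eq_one
    rw [one_div, one_div, add_comm, this, ENNReal.rpow_one]
  have h1 : X ^ (1 / p) ≤ D ^ (1 / q) * Y ^ (1 / p) := by
    rw [ENNReal.mul_rpow_of_nonneg _ _ (by positivity)] at h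
    have h2 : X ^ (1 / q) * X ^ (1 / p) ≤ X ^ (1 / q) * (D ^ (1 / q) * Y ^ (1 / p)) := by
      rw [← e1]; refine h.trans (le_of_eq (by ring))
    refine (ENNReal.mul_le_mul_iff_right ?_ ?_).1 h2
    · exact (ENNReal.rpow_pos (pos_iff_ne_zero.2 h0) hX).ne'
    · exact ENNReal.rpow_ne_top_of_nonneg (by positivity) hX
  have h3 := ENNReal.rpow_le_rpow h1 hp.le
  rwa [ENNReal.mul_rpow_of_nonneg _ _ hp.le, ← ENNReal.rpow_mul, ← ENNReal.rpow_mul,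
    ← ENNReal.rpow_mul, one_div_mul_cancel hp.ne', ENNReal.rpow_one, ENNReal.rpow_one,
    one_div_mul_eq_div] at h3

theorem lintegral_opConv_le_of_adjKer [TopologicalSpace.SeparableSpace F] {κ : Rn n → E →L[ℝ] F}
    (hκ : Continuous κ) (hc : HasCompactSupport κ) {p q : ℝ} (hpq : p.HolderConjugate q)
    (hp2 : 2 ≤ p) {D : ℝ≥0∞}
    (hD : ∀ ψ : Rn n → F →L[ℝ] ℝ, Nice ψ →
      ∫⁻ x, ‖opConv (adjKer κ) ψ x‖ₑ ^ q ≤ D * ∫⁻ x, ‖ψ x‖ₑ ^ q)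
    {f : Rn n → E} (hf : Nice f) :
    ∫⁻ x, ‖opConv κ f x‖ₑ ^ p ≤ D ^ (p / q) * ∫⁻ x, ‖f x‖ₑ ^ p := by
  obtain ⟨φ, hφ1, hφ2⟩ := exists_norming (F := F)
  have hp0 := hpq.pos
  have hq0 := hpq.symm.pos
  set h := opConv κ f with hh
  have hhc : Continuous h := continuous_opConv hκ hc hf.int
  have hhn : Nice h := hf.opConv hκ hc
  have key : ∀ N, ∫⁻ x, ENNReal.ofReal (normMax φ N (h x)) ^ p ≤
      D ^ (p / q) * ∫⁻ x, ‖f x‖ₑ ^ p := by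
    intro N
    set W : Rn n → ℝ := fun x => normMax φ N (h x) with hW
    have hW0 : ∀ x, 0 ≤ W x := fun x => normMax_nonneg N _
    have hWle : ∀ x, W x ≤ ‖h x‖ := fun x => normMax_le hφ1 N _
    have hWc : Continuous W := (continuous_normMax N).comp hhc
    set ψ : Rn n → F →L[ℝ] ℝ := fun x => (W x ^ (p - 1)) • normSel φ N (h x) with hψ
    have hψle : ∀ x, ‖ψ x‖ ≤ W x ^ (p - 1) := fun x => by
      rw [hψ]
      simp only
      rw [norm_smul, Real.norm_of_nonneg (Real.rpow_nonneg (hW0 x) _)]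
      exact mul_le_of_le_one_right (Real.rpow_nonneg (hW0 x) _) (norm_normSel_le hφ1 N _)
    obtain ⟨C, hC⟩ := hhn.bdd
    have hC0 : 0 ≤ C := (norm_nonneg _).trans (hC 0)
    have hWC : ∀ x, W x ^ (p - 1) ≤ C ^ (p - 2) * ‖h x‖ := fun x => by
      rcases (hW0 x).eq_or_lt with h0 | h0
      · rw [← h0, Real.zero_rpow (by linarith)]; positivity
      · rw [show p - 1 = (p - 2) + 1 by ring, Real.rpow_add h0, Real.rpow_one]
        gcongr
        · exact (hWle x).trans (hC x)
        · exact hWle x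
    have hψm : StronglyMeasurable ψ :=
      StronglyMeasurable.smul (hWc.rpow_const fun x => Or.inr (by linarith)).stronglyMeasurable
        (stronglyMeasurable_normSel hhc N)
    have hψn : Nice ψ := by
      refine ⟨hψm, ?_, C ^ (p - 2) * C, fun x => ?_⟩
      · exact Integrable.mono' (hhn.int.norm.const_mul (C ^ (p - 2))) hψm.aestronglyMeasurable
          (.of_forall fun x => (hψle x).trans (hWC x))
      · exact (hψle x).trans ((hWC x).trans (by gcongr; exact hC x))
    set X := ∫⁻ x, ENNReal.ofReal (W x) ^ p with hX
    have hXtop : X ≠ ⊤ := by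
      refine ((lintegral_mono fun x => ?_).trans_lt
        (hhn.lintegral_rpow_lt_top (by linarith : 1 ≤ p))).ne
      simp only
      rw [← ofReal_norm]
      exact ENNReal.rpow_le_rpow (ENNReal.ofReal_le_ofReal (hWle x)) hp0.le
    have hpair : X = ‖∫ x, ψ x (h x)‖ₑ := by
      have e : ∀ x, ψ x (h x) = W x ^ p := fun x => by
        rw [hψ]
        simp only [smul_apply, normSel_apply, smul_eq_mul]
        rcases (hW0 x).eq_or_lt with h0 | h0
        · have : normMax φ N (h x) = 0 := h0.symm
          rw [← h0, this, Real.zero_rpow hp0.ne', mul_zero]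
        · rw [Real.rpow_sub_one h0.ne']
          exact div_mul_cancel₀ _ h0.ne'
      simp only [e]
      rw [Real.enorm_of_nonneg (integral_nonneg fun y => Real.rpow_nonneg (hW0 y) _),
        integral_eq_lintegral_of_nonneg_ae (.of_forall fun y => Real.rpow_nonneg (hW0 y) _)
          (hWc.rpow_const fun x => Or.inr hp0.le).aestronglyMeasurable]
      have e2 : ∀ y, ENNReal.ofReal (W y ^ p) = ENNReal.ofReal (W y) ^ p := fun y =>
        (ENNReal.ofReal_rpow_of_nonneg (hW0 y) hp0.le).symm
      simp only [e2]
      rw [ENNReal.ofReal_toReal hXtop]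
    refine ennreal_self_bound hpq hXtop ?_
    conv_lhs => rw [hpair]
    rw [hh, integral_pairing hκ hc hf hψn]
    refine (enorm_integral_pairing_le hpq.symm
      (continuous_opConv (continuous_adjKer hκ) (hasCompactSupport_adjKer hc)
        hψn.int).enorm.measurable.aemeasurable hf.meas.enorm.aemeasurable).trans ?_
    gcongr
    refine (hD ψ hψn).trans (mul_le_mul_right (lintegral_mono fun x => ?_) _)
    simp only
    rw [← ofReal_norm, ENNReal.ofReal_rpow_of_nonneg (norm_nonneg _) hq0.le,
      ENNReal.ofReal_rpow_of_nonneg (hW0 x) hp0.le]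
    refine ENNReal.ofReal_le_ofReal ((Real.rpow_le_rpow (norm_nonneg _) (hψle x) hq0.le).trans ?_)
    rw [← Real.rpow_mul (hW0 x), hpq.sub_one_mul_conj]
  have hlim : Tendsto (fun N => ∫⁻ x, ENNReal.ofReal (normMax φ N (h x)) ^ p) atTop
      (𝓝 (∫⁻ x, ‖h x‖ₑ ^ p)) := by
    refine lintegral_tendsto_of_tendsto_of_monotone (fun N => ?_) (.of_forall fun x => ?_)
      (.of_forall fun x => ?_)
    · exact ((((continuous_normMax N).comp hhc).measurable.ennreal_ofReal).pow_const p).aemeasurable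
    · intro a b hab
      exact ENNReal.rpow_le_rpow (ENNReal.ofReal_le_ofReal (normMax_mono _ hab)) hp0.le
    · rw [← ofReal_norm]
      exact ((ENNReal.continuous_rpow_const.tendsto _).comp
        ((ENNReal.continuous_ofReal.tendsto _).comp (tendsto_normMax hφ1 hφ2 (h x))))
  exact le_of_tendsto' hlim key

end DualBound

section LpBound

variable {n : ℕ}

lemma marcConst_eq {p c A B : ℝ} (hp1 : 1 < p) (hc : 0 < c) (hA : 0 < A) (hB : 0 < B) :
    marcConst p (c * B) A = marcConst p c 1 *
      (A ^ (2 * (p - 1) / p) * B ^ (1 - 2 * (p - 1) / p)) ^ p := by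
  have hp : p ≠ 0 := by linarith
  unfold marcConst
  rw [Real.mul_rpow hc.le hB.le, Real.mul_rpow (by positivity) (by positivity),
    ← Real.rpow_mul hA.le, ← Real.rpow_mul hB.le, div_mul_cancel₀ _ hp, sub_mul,
    div_mul_cancel₀ _ hp, Real.one_rpow, show 1 * p - 2 * (p - 1) = 2 - p by ring]
  ring

lemma marcConst_pos {p c A : ℝ} (hp1 : 1 < p) (hp2 : p < 2) (hc : 0 < c) (hA : 0 < A) :
    0 < marcConst p c A := by
  have : 0 < p - 1 := by linarith
  have : 0 < 2 - p := by linarith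
  unfold marcConst; positivity

/-- The constant in the weak type estimate. -/
def weakConst (n : ℕ) : ℝ := 4 * 2 ^ n + dilConst n + 4

lemma weakConst_pos (n : ℕ) : 0 < weakConst n := by
  have := dilConst_nonneg n
  unfold weakConst; positivity

lemma lp_bound_lt_two (hn : 0 < n) {p : ℝ} (hp1 : 1 < p) (hp2 : p < 2)
    {E F : Type*} [NormedAddCommGroup E] [NormedSpace ℝ E] [CompleteSpace E]
    [NormedAddCommGroup F] [NormedSpace ℝ F] [CompleteSpace F]
    {κ : Rn n → E →L[ℝ] F} (hκ : Continuous κ) (hc : HasCompactSupport κ)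
    {A B : ℝ} (hA : 0 < A) (hAB : A ≤ B) (h2 : L2Bound κ A) (hH : HormanderBound κ B)
    {f : Rn n → E} (hf : Nice f) :
    ∫⁻ x, ‖opConv κ f x‖ₑ ^ p ≤ ENNReal.ofReal (marcConst p (weakConst n) 1 *
      (A ^ (2 * (p - 1) / p) * B ^ (1 - 2 * (p - 1) / p)) ^ p) * ∫⁻ x, ‖f x‖ₑ ^ p := by
  have hB : 0 < B := hA.trans_le hAB
  rw [← marcConst_eq hp1 (weakConst_pos n) hA hB]
  exact marcinkiewicz hκ hc hA (mul_pos (weakConst_pos n) hB) h2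
    (fun g hg lam hlam => weak_type_one hn hκ hc hA.le hAB hB h2 hH hg hlam) hp1 hp2 hf

theorem lp_bound (hn : 0 < n) {p : ℝ} (hp : 1 < p) :
    ∃ C > (0 : ℝ), ∃ a > (0 : ℝ), a ≤ 1 ∧ ∀ (F : Type) [NormedAddCommGroup F] [NormedSpace ℝ F]
      [CompleteSpace F] [TopologicalSpace.SeparableSpace F] (κ : Rn n → ℂ →L[ℝ] F),
      Continuous κ → HasCompactSupport κ → ∀ A B : ℝ, 0 < A → A ≤ B → L2Bound κ A →
      HormanderBound κ B → ∀ f : Rn n → ℂ, Nice f →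
      ∫⁻ x, ‖opConv κ f x‖ₑ ^ p ≤
        ENNReal.ofReal (C * (A ^ a * B ^ (1 - a)) ^ p) * ∫⁻ x, ‖f x‖ₑ ^ p := by
  rcases lt_trichotomy p 2 with hp2 | hp2 | hp2
  · refine ⟨_, marcConst_pos hp hp2 (weakConst_pos n) one_pos, 2 * (p - 1) / p, ?_, ?_, ?_⟩
    · have : 0 < p - 1 := by linarith
      positivity
    · rw [div_le_one (by linarith)]; linarith
    · intro F _ _ _ _ κ hκ hc A B hA hAB h2 hH f hf
      exact lp_bound_lt_two hn hp hp2 hκ hc hA hAB h2 hH hf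
  · subst hp2
    refine ⟨1, one_pos, 1, one_pos, le_rfl, ?_⟩
    intro F _ _ _ _ κ hκ hc A B hA hAB h2 hH f hf
    rw [one_mul, Real.rpow_one, sub_self, Real.rpow_zero, mul_one, Real.rpow_two]
    exact h2 f hf
  · have hpq : p.HolderConjugate (p.conjExponent) := Real.HolderConjugate.conjExponent hp
    set q := p.conjExponent with hq
    have hq1 : 1 < q := hpq.symm.lt
    have hq2 : q < 2 := by
      rw [hq, Real.conjExponent, div_lt_iff₀ (by linarith)]; linarith
    have hq0 : 0 < q := by linarith
    set M := marcConst q (weakConst n) 1 with hM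
    have hM0 : 0 < M := marcConst_pos hq1 hq2 (weakConst_pos n) one_pos
    refine ⟨M ^ (p / q), by positivity, 2 * (q - 1) / q, ?_, ?_, ?_⟩
    · have : 0 < q - 1 := by linarith
      positivity
    · rw [div_le_one (by linarith)]; linarith
    · intro F _ _ _ _ κ hκ hc A B hA hAB h2 hH f hf
      have hB : 0 < B := hA.trans_le hAB
      have := lintegral_opConv_le_of_adjKer hκ hc hpq hp2.le
        (fun ψ hψ => lp_bound_lt_two hn hq1 hq2 (continuous_adjKer hκ) (hasCompactSupport_adjKer hc)
          hA hAB (h2.adjKer hκ hc) hH.adjKer hψ) hf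
      refine this.trans (mul_le_mul_left (le_of_eq ?_) _)
      rw [← hM, ENNReal.ofReal_rpow_of_nonneg (by positivity) (by positivity),
        Real.mul_rpow hM0.le (by positivity), ← Real.rpow_mul (by positivity),
        mul_div_cancel₀ _ hq0.ne']

end LpBound

section Pathwise

/-- The running maximum of a sequence. -/
def runMax (a : ℕ → ℂ) : ℕ → ℝ
  | 0 => ‖a 0‖
  | t + 1 => max (runMax a t) ‖a (t + 1)‖

/-- The sequence of anchors: updated when the sequence moves by a proportion `θ` of the running
maximum. -/
def anchor (θ : ℝ) (a : ℕ → ℂ) : ℕ → ℂ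
  | 0 => a 0
  | t + 1 => if θ * runMax a (t + 1) ≤ ‖a (t + 1) - anchor θ a t‖ then a (t + 1) else anchor θ a t

/-- The quadratic variation of the anchors. -/
def anchorSq (θ : ℝ) (a : ℕ → ℂ) (t : ℕ) : ℝ :=
  ∑ u ∈ Finset.range t, ‖anchor θ a (u + 1) - anchor θ a u‖ ^ 2

variable {a b : ℕ → ℂ} {θ : ℝ}

lemma runMax_congr {t : ℕ} (h : ∀ s ≤ t, a s = b s) : runMax a t = runMax b t := by
  induction t with
  | zero => simp [runMax, h 0 le_rfl]
  | succ t ih => rw [runMax, runMax, ih fun s hs => h s (by omega), h (t + 1) le_rfl]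

lemma anchor_congr {t : ℕ} (h : ∀ s ≤ t, a s = b s) : anchor θ a t = anchor θ b t := by
  induction t with
  | zero => simp [anchor, h 0 le_rfl]
  | succ t ih =>
    rw [anchor, anchor, ih fun s hs => h s (by omega), h (t + 1) le_rfl, runMax_congr h]

lemma runMax_mono : Monotone (runMax a) := monotone_nat_of_le_succ fun _ => le_max_left _ _

lemma norm_le_runMax (t : ℕ) : ‖a t‖ ≤ runMax a t := by
  cases t with
  | zero => exact le_rfl
  | succ t => exact le_max_right _ _

lemma runMax_nonneg (t : ℕ) : 0 ≤ runMax a t := (norm_nonneg _).trans (norm_le_runMax t)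

lemma runMax_le {C : ℝ} {t : ℕ} (h : ∀ s ≤ t, ‖a s‖ ≤ C) : runMax a t ≤ C := by
  induction t with
  | zero => exact h 0 le_rfl
  | succ t ih => exact max_le (ih fun s hs => h s (by omega)) (h _ le_rfl)

lemma anchorSq_mono : Monotone (anchorSq θ a) := by
  refine monotone_nat_of_le_succ fun t => ?_
  rw [anchorSq, anchorSq, Finset.sum_range_succ]
  exact le_add_of_nonneg_right (by positivity)

lemma anchorSq_nonneg (t : ℕ) : 0 ≤ anchorSq θ a t :=
  Finset.sum_nonneg fun _ _ => by positivity

lemma norm_sub_anchor_le (hθ : 0 ≤ θ) (t : ℕ) : ‖a t - anchor θ a t‖ ≤ θ * runMax a t := by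
  cases t with
  | zero => simpa [anchor] using mul_nonneg hθ (runMax_nonneg (a := a) 0)
  | succ t =>
    rw [anchor]
    split_ifs with h
    · simpa using mul_nonneg hθ (runMax_nonneg (a := a) (t + 1))
    · exact (not_le.1 h).le

lemma norm_anchor_le (t : ℕ) : ‖anchor θ a t‖ ≤ runMax a t := by
  induction t with
  | zero => exact le_rfl
  | succ t ih =>
    rw [anchor]
    split_ifs with h
    · exact norm_le_runMax _
    · exact ih.trans (runMax_mono (Nat.le_succ t))

lemma anchor_sq_add (t : ℕ) :
    ‖a (t + 1) - anchor θ a (t + 1)‖ ^ 2 + ‖anchor θ a (t + 1) - anchor θ a t‖ ^ 2 =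
      ‖a (t + 1) - anchor θ a t‖ ^ 2 := by
  rw [anchor]
  split_ifs with h <;> simp

/-- A jump larger than twice the threshold forces an update of the anchor. -/
lemma exists_update (hθ : 0 ≤ θ) {s t : ℕ} (hst : s ≤ t)
    (h : 2 * θ * runMax a t < ‖a t - a s‖) :
    ∃ u, s ≤ u ∧ u < t ∧ θ * runMax a s ≤ ‖anchor θ a (u + 1) - anchor θ a u‖ := by
  by_contra! hcon
  have hconst : ∀ v, s ≤ v → v ≤ t → anchor θ a v = anchor θ a s := by
    intro v hsv
    induction v, hsv using Nat.le_induction with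
    | base => exact fun _ => rfl
    | succ v hsv ih =>
      intro hvt
      have h1 := ih (by omega)
      have h2 := hcon v hsv (by omega)
      rw [← h1]
      rw [anchor] at h2 ⊢
      split_ifs at h2 ⊢ with h3
      · have : θ * runMax a s ≤ θ * runMax a (v + 1) :=
          mul_le_mul_of_nonneg_left (runMax_mono (by omega)) hθ
        linarith
      · rfl
  have h1 := norm_sub_anchor_le (a := a) hθ t
  have h2 := norm_sub_anchor_le (a := a) hθ s
  rw [hconst t hst le_rfl] at h1
  have h3 : θ * runMax a s ≤ θ * runMax a t := mul_le_mul_of_nonneg_left (runMax_mono hst) hθ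
  have h4 : ‖a t - a s‖ ≤ ‖a t - anchor θ a s‖ + ‖a s - anchor θ a s‖ := by
    rw [show a t - a s = (a t - anchor θ a s) - (a s - anchor θ a s) by ring]
    exact norm_sub_le _ _
  linarith

lemma anchorSq_add_le {s t u : ℕ} (hsu : s ≤ u) (hut : u < t) :
    anchorSq θ a s + ‖anchor θ a (u + 1) - anchor θ a u‖ ^ 2 ≤ anchorSq θ a t := by
  refine le_trans ?_ (anchorSq_mono (θ := θ) (a := a) (Nat.succ_le_of_lt hut))
  conv_rhs => rw [anchorSq, Nat.succ_eq_add_one, Finset.sum_range_succ]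
  exact add_le_add_left (anchorSq_mono hsu) _

/-- One jump is controlled by the growth of the running maximum or by an anchor update. -/
lemma jump_le {r : ℝ} (hr : 2 < r) {s t : ℕ} (hst : s ≤ t) :
    ‖a t - a s‖ ^ r + 4 ^ r * runMax a s ^ r ≤ 4 ^ r * runMax a t ^ r ∨
    ∃ m : ℕ, ‖a t - a s‖ ^ r + 4 ^ (r + 1) * runMax a t ^ (r - 2) *
        ((2 : ℝ) ^ (-(r - 2))) ^ m * anchorSq ((1 / 2) ^ m) a s ≤
      4 ^ (r + 1) * runMax a t ^ (r - 2) *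
        ((2 : ℝ) ^ (-(r - 2))) ^ m * anchorSq ((1 / 2) ^ m) a t := by
  set δ := ‖a t - a s‖ with hδ
  have hM0 := runMax_nonneg (a := a) t
  have hMs := runMax_nonneg (a := a) s
  have hMst := runMax_mono (a := a) hst
  have hδM : δ ≤ 2 * runMax a t := by
    refine (norm_sub_le _ _).trans ?_
    linarith [norm_le_runMax (a := a) t, norm_le_runMax (a := a) s]
  rcases (norm_nonneg (a t - a s)).eq_or_lt with h0 | hpos
  · left
    rw [hδ, ← h0, Real.zero_rpow (by linarith), zero_add]
    gcongr
  change 0 < δ at hpos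
  have hMt : 0 < runMax a t := by linarith
  rcases lt_or_ge (2 * runMax a s) (runMax a t) with hc | hc
  · left
    have h1 : runMax a s ^ r ≤ (runMax a t / 2) ^ r := by gcongr; linarith
    have h2 : δ ^ r ≤ (2 * runMax a t) ^ r := by gcongr
    rw [Real.div_rpow hM0 (by norm_num)] at h1
    rw [Real.mul_rpow (by norm_num) hM0] at h2
    have h4 : (4 : ℝ) ^ r = 2 ^ r * 2 ^ r := by
      rw [← Real.mul_rpow (by norm_num) (by norm_num)]; norm_num
    have h5 : (4 : ℝ) ≤ 2 ^ r := by
      calc (4 : ℝ) = 2 ^ (2 : ℝ) := by norm_num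
        _ ≤ 2 ^ r := Real.rpow_le_rpow_of_exponent_le (by norm_num) hr.le
    have h6 : 0 ≤ runMax a t ^ r := Real.rpow_nonneg hM0 _
    have h7 : (4 : ℝ) ^ r * runMax a s ^ r ≤ 2 ^ r * runMax a t ^ r := by
      calc (4 : ℝ) ^ r * runMax a s ^ r ≤ 4 ^ r * (runMax a t ^ r / 2 ^ r) := by gcongr
        _ = 2 ^ r * runMax a t ^ r := by rw [h4]; field_simp
    rw [h4] at h7 ⊢
    have : (2 : ℝ) ^ r * runMax a t ^ r * 4 ≤ 2 ^ r * runMax a t ^ r * 2 ^ r := by gcongr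
    nlinarith [mul_nonneg (by positivity : (0:ℝ) ≤ 2 ^ r) h6]
  · right
    obtain ⟨k, hk1, hk2⟩ := exists_nat_pow_near_of_lt_one (x := δ / (2 * runMax a t))
      (y := (1 / 2 : ℝ)) (by positivity) (by rw [div_le_one (by positivity)]; exact hδM)
      (by norm_num) (by norm_num)
    refine ⟨k + 1, ?_⟩
    set θ : ℝ := (1 / 2) ^ (k + 1) with hθ
    have hθ0 : 0 < θ := by positivity
    rw [lt_div_iff₀ (by positivity)] at hk1
    rw [div_le_iff₀ (by positivity)] at hk2
    have hk3 : δ ≤ 4 * θ * runMax a t := by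
      rw [hθ, pow_succ]; linarith
    obtain ⟨u, hsu, hut, hu⟩ := exists_update hθ0.le hst (a := a) (by linarith)
    have h1 := anchorSq_add_le (θ := θ) (a := a) hsu hut
    have h2 : δ / 8 ≤ ‖anchor θ a (u + 1) - anchor θ a u‖ := by
      refine le_trans ?_ hu
      nlinarith
    have h3 : δ ^ 2 / 64 ≤ ‖anchor θ a (u + 1) - anchor θ a u‖ ^ 2 := by
      calc δ ^ 2 / 64 = (δ / 8) ^ 2 := by ring
        _ ≤ _ := by gcongr
    have hw : ((2 : ℝ) ^ (-(r - 2))) ^ (k + 1) = θ ^ (r - 2) := by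
      rw [hθ, ← Real.rpow_natCast, ← Real.rpow_natCast, ← Real.rpow_mul (by norm_num),
        ← Real.rpow_mul (by norm_num), one_div, Real.inv_rpow (by norm_num),
        ← Real.rpow_neg (by norm_num)]
      ring_nf
    have h4 : δ ^ r ≤ (4 * θ * runMax a t) ^ (r - 2) * δ ^ 2 := by
      calc δ ^ r = δ ^ (r - 2) * δ ^ 2 := by
            rw [← Real.rpow_two, ← Real.rpow_add hpos]; ring_nf
        _ ≤ _ := by gcongr
    rw [Real.mul_rpow (by positivity) hM0, Real.mul_rpow (by norm_num) hθ0.le] at h4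
    rw [hw]
    have h5 : (4 : ℝ) ^ (r + 1) = 4 ^ (r - 2) * 64 := by
      rw [show r + 1 = (r - 2) + 3 by ring, Real.rpow_add (by norm_num)]; norm_num
    rw [h5]
    set P := 4 ^ (r - 2) * θ ^ (r - 2) * runMax a t ^ (r - 2) with hP
    have hP0 : 0 ≤ P := by positivity
    have h6 : δ ^ r + P * 64 * anchorSq θ a s ≤ P * 64 * anchorSq θ a t := by
      have : P * 64 * (anchorSq θ a s + δ ^ 2 / 64) ≤ P * 64 * anchorSq θ a t := by
        gcongr; linarith
      nlinarith
    calc _ = δ ^ r + P * 64 * anchorSq θ a s := by rw [hP]; ring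
      _ ≤ _ := h6
      _ = _ := by rw [hP]; ring

/-- The quantity controlling the `r`-variation of a sequence up to time `t`. -/
def varCtl (r : ℝ) (a : ℕ → ℂ) (t : ℕ) : ℝ≥0∞ :=
  ENNReal.ofReal (runMax a t ^ 2) + ∑' m : ℕ, ENNReal.ofReal (((2 : ℝ) ^ (-(r - 2))) ^ m) *
    ENNReal.ofReal (anchorSq ((1 / 2) ^ m) a t)

theorem sum_jump_le {r : ℝ} (hr : 2 < r) {N J : ℕ} (u : Fin (J + 1) → ℕ) (hu : Monotone u)
    (hN : ∀ i, u i ≤ N) :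
    ∑ i : Fin J, ENNReal.ofReal (‖a (u i.succ) - a (u i.castSucc)‖ ^ r) ≤
      ENNReal.ofReal (2 * 4 ^ (r + 1)) * varCtl r a N ^ (r / 2) := by
  set w : ℝ := (2 : ℝ) ^ (-(r - 2)) with hw
  have hw0 : 0 < w := by positivity
  set c : ℝ := 4 ^ (r + 1) * runMax a N ^ (r - 2) with hcdef
  have hMN := runMax_nonneg (a := a) N
  have hc0 : 0 ≤ c := by positivity
  set Φ : ℕ → ℝ≥0∞ := fun t => ENNReal.ofReal (4 ^ r * runMax a t ^ r) +
    ∑' m : ℕ, ENNReal.ofReal (c * w ^ m * anchorSq ((1 / 2) ^ m) a t) with hΦ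
  have hstep : ∀ s t : ℕ, s ≤ t → t ≤ N → ENNReal.ofReal (‖a t - a s‖ ^ r) + Φ s ≤ Φ t := by
    intro s t hst htN
    have hmono : ∀ m : ℕ, ENNReal.ofReal (c * w ^ m * anchorSq ((1 / 2) ^ m) a s) ≤
        ENNReal.ofReal (c * w ^ m * anchorSq ((1 / 2) ^ m) a t) := fun m =>
      ENNReal.ofReal_le_ofReal (mul_le_mul_of_nonneg_left (anchorSq_mono hst) (by positivity))
    have hMs := runMax_nonneg (a := a) s
    have hMt := runMax_nonneg (a := a) t
    have hMst := runMax_mono (a := a) hst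
    rcases jump_le (a := a) hr hst with h | ⟨m, h⟩
    · rw [hΦ]
      simp only
      rw [← add_assoc, ← ENNReal.ofReal_add (by positivity) (by positivity)]
      exact add_le_add (ENNReal.ofReal_le_ofReal h) (ENNReal.tsum_le_tsum hmono)
    · have h' : ‖a t - a s‖ ^ r + c * w ^ m * anchorSq ((1 / 2) ^ m) a s ≤
          c * w ^ m * anchorSq ((1 / 2) ^ m) a t := by
        have hd : 0 ≤ anchorSq ((1 / 2) ^ m) a t - anchorSq ((1 / 2) ^ m) a s :=
          sub_nonneg.2 (anchorSq_mono hst)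
        have hcle : 4 ^ (r + 1) * runMax a t ^ (r - 2) ≤ c := by
          rw [hcdef]; gcongr; exact runMax_mono htN
        have := mul_le_mul_of_nonneg_right (mul_le_mul_of_nonneg_right hcle
          (by positivity : 0 ≤ w ^ m)) hd
        linarith
      rw [hΦ]
      simp only
      have h2 : ∑' i : ℕ, (Pi.single m (ENNReal.ofReal (‖a t - a s‖ ^ r)) : ℕ → ℝ≥0∞) i =
          ENNReal.ofReal (‖a t - a s‖ ^ r) := tsum_pi_single m _
      rw [add_left_comm]
      conv_lhs => rw [← h2]
      rw [← ENNReal.tsum_add]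
      refine add_le_add (ENNReal.ofReal_le_ofReal (by gcongr)) (ENNReal.tsum_le_tsum fun i => ?_)
      rcases eq_or_ne i m with rfl | hi
      · rw [Pi.single_eq_same, ← ENNReal.ofReal_add (by positivity)
          (mul_nonneg (by positivity) (anchorSq_nonneg _))]
        exact ENNReal.ofReal_le_ofReal h'
      · rw [Pi.single_eq_of_ne hi, zero_add]; exact hmono i
  have hsum : ∀ (J : ℕ) (u : Fin (J + 1) → ℕ), Monotone u → (∀ i, u i ≤ N) →
      ∑ i : Fin J, ENNReal.ofReal (‖a (u i.succ) - a (u i.castSucc)‖ ^ r) ≤ Φ (u (Fin.last J)) := by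
    intro J
    induction J with
    | zero => intro u _ _; simp
    | succ J ih =>
      intro u hu hN
      rw [Fin.sum_univ_castSucc]
      have h1 := ih (fun i => u i.castSucc) (fun i k hik => hu (by simpa using hik))
        fun i => hN _
      refine le_trans ?_ (hstep (u (Fin.last J).castSucc) (u (Fin.last (J + 1)))
        (hu (Fin.le_last _)) (hN _))
      rw [add_comm]
      refine add_le_add le_rfl (le_trans (le_of_eq ?_) h1)
      rfl
  refine (hsum J u hu hN).trans (((le_refl _).trans ?_ : Φ (u (Fin.last J)) ≤ Φ N).trans ?_)
  · exact le_add_self.trans (hstep _ _ (hN _) le_rfl)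
  · set Q := ∑' m : ℕ, ENNReal.ofReal (w ^ m) * ENNReal.ofReal (anchorSq ((1 / 2) ^ m) a N) with hQ
    have hV : varCtl r a N = ENNReal.ofReal (runMax a N ^ 2) + Q := rfl
    have hM : ENNReal.ofReal (runMax a N ^ r) ≤ varCtl r a N ^ (r / 2) := by
      calc ENNReal.ofReal (runMax a N ^ r) = ENNReal.ofReal (runMax a N ^ 2) ^ (r / 2) := by
            rw [ENNReal.ofReal_rpow_of_nonneg (by positivity) (by linarith), ← Real.rpow_two,
              ← Real.rpow_mul hMN]
            congr 2; ring
        _ ≤ _ := ENNReal.rpow_le_rpow (hV ▸ le_self_add) (by linarith)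
    have h2 : ∑' m : ℕ, ENNReal.ofReal (c * w ^ m * anchorSq ((1 / 2) ^ m) a N) ≤
        ENNReal.ofReal (4 ^ (r + 1)) * varCtl r a N ^ (r / 2) := by
      have e : ∀ m : ℕ, ENNReal.ofReal (c * w ^ m * anchorSq ((1 / 2) ^ m) a N) =
          ENNReal.ofReal c * (ENNReal.ofReal (w ^ m) * ENNReal.ofReal (anchorSq ((1 / 2) ^ m) a N)) :=
        fun m => by
          rw [mul_assoc, ENNReal.ofReal_mul hc0, ENNReal.ofReal_mul (pow_nonneg hw0.le m)]
      simp only [e]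
      rw [ENNReal.tsum_mul_left, ← hQ, hcdef, ENNReal.ofReal_mul (by positivity), mul_assoc]
      refine mul_le_mul_right ?_ _
      have h3 : ENNReal.ofReal (runMax a N ^ (r - 2)) ≤ varCtl r a N ^ ((r - 2) / 2) := by
        calc ENNReal.ofReal (runMax a N ^ (r - 2))
            = ENNReal.ofReal (runMax a N ^ 2) ^ ((r - 2) / 2) := by
              rw [ENNReal.ofReal_rpow_of_nonneg (by positivity) (by linarith), ← Real.rpow_two,
                ← Real.rpow_mul hMN]
              congr 2; ring
          _ ≤ _ := ENNReal.rpow_le_rpow (hV ▸ le_self_add) (by linarith)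
      calc ENNReal.ofReal (runMax a N ^ (r - 2)) * Q
          ≤ varCtl r a N ^ ((r - 2) / 2) * varCtl r a N ^ (1 : ℝ) := by
            rw [ENNReal.rpow_one]
            exact mul_le_mul' h3 (hV ▸ le_add_self)
        _ = _ := by
            rw [← ENNReal.rpow_add_of_nonneg _ _ (by linarith) (by norm_num)]; ring_nf
    calc Φ N ≤ ENNReal.ofReal (4 ^ r) * varCtl r a N ^ (r / 2) +
          ENNReal.ofReal (4 ^ (r + 1)) * varCtl r a N ^ (r / 2) := by
          refine add_le_add ?_ h2
          rw [ENNReal.ofReal_mul (by positivity)]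
          exact mul_le_mul_right hM _
      _ ≤ _ := by
          rw [← add_mul, ← ENNReal.ofReal_add (by positivity) (by positivity)]
          refine mul_le_mul_left (ENNReal.ofReal_le_ofReal ?_) _
          have : (4 : ℝ) ^ r ≤ 4 ^ (r + 1) :=
            Real.rpow_le_rpow_of_exponent_le (by norm_num) (by linarith)
          linarith

end Pathwise

section SqInt

variable {n : ℕ} {E : Type*} [NormedAddCommGroup E]

lemma integrable_norm_sq [NormedSpace ℝ E] {f : Rn n → E} (hf : Nice f) :
    Integrable fun x => ‖f x‖ ^ 2 := by
  obtain ⟨C, hC⟩ := hf.bdd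
  refine Integrable.mono' (hf.int.norm.const_mul C) (hf.meas.norm.pow 2).aestronglyMeasurable
    (.of_forall fun x => ?_)
  rw [Real.norm_of_nonneg (by positivity), sq]
  gcongr; exact hC x

lemma lintegral_sq_eq [NormedSpace ℝ E] {f : Rn n → E} (hf : Nice f) :
    ∫⁻ x, ‖f x‖ₑ ^ (2 : ℝ) = ENNReal.ofReal (∫ x, ‖f x‖ ^ 2) := by
  rw [ofReal_integral_eq_lintegral_ofReal (integrable_norm_sq hf)
    (.of_forall fun x => by positivity)]
  refine lintegral_congr fun x => ?_
  rw [ENNReal.ofReal_pow (norm_nonneg _), ofReal_norm, ENNReal.rpow_two]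

variable [InnerProductSpace ℝ E]

lemma integrable_inner_nice {f g : Rn n → E} (hf : Nice f) (hg : Nice g) :
    Integrable fun x => inner ℝ (f x) (g x) := by
  obtain ⟨C, hC⟩ := hf.bdd
  refine Integrable.mono' (hg.int.norm.const_mul C)
    (hf.meas.inner hg.meas).aestronglyMeasurable (.of_forall fun x => ?_)
  refine (norm_inner_le_norm _ _).trans ?_
  gcongr; exact hC x

lemma integral_norm_add_sq {f g : Rn n → E} (hf : Nice f) (hg : Nice g) :
    ∫ x, ‖f x + g x‖ ^ 2 = (∫ x, ‖f x‖ ^ 2) + 2 * (∫ x, inner ℝ (f x) (g x)) + ∫ x, ‖g x‖ ^ 2 := by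
  simp only [norm_add_sq_real]
  have i : Integrable fun x => ‖f x‖ ^ 2 + 2 * inner ℝ (f x) (g x) :=
    (integrable_norm_sq hf).add ((integrable_inner_nice hf hg).const_mul 2)
  rw [integral_add i (integrable_norm_sq hg),
    integral_add (integrable_norm_sq hf) ((integrable_inner_nice hf hg).const_mul 2),
    integral_const_mul]

lemma integral_inner_dyadicAvg [CompleteSpace E] {j : ℤ} {d f : Rn n → E} (hd : Nice d)
    (hdc : ∀ x y, dcell j y = dcell j x → d y = d x) (hf : Nice f) :
    ∫ x, inner ℝ (d x) (dyadicAvg j f x) = ∫ x, inner ℝ (d x) (f x) := by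
  obtain ⟨C, hC⟩ := hd.bdd
  exact integral_apply_dyadicAvg hf.int (φ := fun x => innerSL ℝ (d x))
    (fun x y h => by simp only [hdc x y h]) (C := C) fun x => by
      rw [innerSL_apply_norm]; exact hC x

lemma integral_norm_sub_dyadicAvg_add_sq [CompleteSpace E] {j : ℤ} {d f : Rn n → E} (hd : Nice d)
    (hdc : ∀ x y, dcell j y = dcell j x → d y = d x) (hf : Nice f) :
    ∫ x, ‖f x - dyadicAvg j f x + d x‖ ^ 2 =
      (∫ x, ‖f x - dyadicAvg j f x‖ ^ 2) + ∫ x, ‖d x‖ ^ 2 := by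
  have h := integral_norm_add_sq (hf.sub (hf.dyadicAvg j)) hd
  simp only [Pi.sub_apply] at h
  rw [h]
  have h2 : ∀ x, inner ℝ (f x - dyadicAvg j f x) (d x) =
      inner ℝ (d x) (f x) - inner ℝ (d x) (dyadicAvg j f x) := fun x => by
    rw [real_inner_comm, inner_sub_right]
  simp only [h2]
  rw [integral_sub (integrable_inner_nice hd hf) (integrable_inner_nice hd (hf.dyadicAvg j)),
    integral_inner_dyadicAvg hd hdc hf]
  ring

lemma integral_norm_sq_dyadicAvg_add [CompleteSpace E] (j : ℤ) {f : Rn n → E} (hf : Nice f) :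
    ∫ x, ‖f x‖ ^ 2 = (∫ x, ‖f x - dyadicAvg j f x‖ ^ 2) + ∫ x, ‖dyadicAvg j f x‖ ^ 2 := by
  rw [← integral_norm_sub_dyadicAvg_add_sq (hf.dyadicAvg j) (fun x y h => dyadicAvg_congr h f) hf]
  simp

end SqInt

section Lepingle

variable {n : ℕ} {g : Rn n → ℂ} {j : ℕ → ℤ}

/-- The martingale of a function along a sequence of dyadic levels. -/
def mart (j : ℕ → ℤ) (g : Rn n → ℂ) (x : Rn n) (t : ℕ) : ℂ := dyadicAvg (j t) g x

lemma mart_congr (hj : Monotone j) {t : ℕ} {x y : Rn n} (h : dcell (j t) y = dcell (j t) x) :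
    ∀ s ≤ t, mart j g y s = mart j g x s :=
  fun _ hs => dyadicAvg_congr (dcell_mono (hj hs) h) g

lemma dyadicAvg_mart (hj : Monotone j) (hg : Nice g) (t : ℕ) :
    dyadicAvg (j t) (fun x => mart j g x (t + 1)) = fun x => mart j g x t :=
  dyadicAvg_dyadicAvg (hj (Nat.le_succ t)) hg.int

lemma nice_mart (hg : Nice g) (t : ℕ) : Nice fun x => mart j g x t := hg.dyadicAvg _

lemma runMax_mart_congr (hj : Monotone j) {t : ℕ} {x y : Rn n}
    (h : dcell (j t) y = dcell (j t) x) : runMax (mart j g y) t = runMax (mart j g x) t :=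
  runMax_congr (mart_congr hj h)

lemma nice_runMax (hj : Monotone j) (hg : Nice g) (t : ℕ) :
    Nice fun x => runMax (mart j g x) t := by
  obtain ⟨C, hC⟩ := hg.bdd
  have hm : ∀ t, StronglyMeasurable fun x => runMax (mart j g x) t := fun t =>
    stronglyMeasurable_of_dcell fun x y h => runMax_mart_congr hj h
  refine ⟨hm t, ?_, C, fun x => ?_⟩
  · induction t with
    | zero => exact (nice_mart hg 0).int.norm
    | succ t ih =>
      refine (ih.norm.add (nice_mart (j := j) hg (t + 1)).int.norm).mono' (hm _).aestronglyMeasurable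
        (.of_forall fun x => ?_)
      rw [Real.norm_of_nonneg (runMax_nonneg _)]
      simp only [Pi.add_apply]
      rw [Real.norm_of_nonneg (runMax_nonneg _)]
      exact max_le (le_add_of_nonneg_right (norm_nonneg _))
        (le_add_of_nonneg_left (runMax_nonneg _))
  · rw [Real.norm_of_nonneg (runMax_nonneg _)]
    exact runMax_le fun s _ => norm_dyadicAvg_le_of_bound hC _ x

lemma nice_anchor (hj : Monotone j) (hg : Nice g) (θ : ℝ) (t : ℕ) :
    Nice fun x => anchor θ (mart j g x) t := by
  have hM := nice_runMax hj hg t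
  obtain ⟨C, hC⟩ := hM.bdd
  have hm : StronglyMeasurable fun x => anchor θ (mart j g x) t :=
    stronglyMeasurable_of_dcell fun x y h => anchor_congr (mart_congr hj h)
  have hle : ∀ x, ‖anchor θ (mart j g x) t‖ ≤ ‖runMax (mart j g x) t‖ := fun x => by
    rw [Real.norm_of_nonneg (runMax_nonneg _)]; exact norm_anchor_le t
  exact ⟨hm, hM.int.mono hm.aestronglyMeasurable (.of_forall hle), C,
    fun x => (hle x).trans (hC x)⟩

lemma integral_anchorSq_le (hj : Monotone j) (hg : Nice g) (θ : ℝ) (t : ℕ) :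
    (∫ x, anchorSq θ (mart j g x) t) +
      ∫ x, ‖mart j g x t - anchor θ (mart j g x) t‖ ^ 2 ≤ ∫ x, ‖mart j g x t‖ ^ 2 := by
  induction t with
  | zero =>
    simp only [anchorSq, Finset.range_zero, Finset.sum_empty, integral_zero, anchor, sub_self,
      norm_zero]
    norm_num
    exact integral_nonneg fun x => by positivity
  | succ t ih =>
    have hA := nice_anchor (g := g) hj hg θ t
    have hA' := nice_anchor (g := g) hj hg θ (t + 1)
    have hf := nice_mart (j := j) hg t
    have hf' := nice_mart (j := j) hg (t + 1)
    have hS : Integrable fun x => anchorSq θ (mart j g x) t :=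
      integrable_finsetSum _ fun u _ => integrable_norm_sq
        ((nice_anchor hj hg θ (u + 1)).sub (nice_anchor hj hg θ u))
    have e1 : ∫ x, anchorSq θ (mart j g x) (t + 1) = (∫ x, anchorSq θ (mart j g x) t) +
        ∫ x, ‖anchor θ (mart j g x) (t + 1) - anchor θ (mart j g x) t‖ ^ 2 := by
      rw [← integral_add hS (by simpa using integrable_norm_sq (hA'.sub hA))]
      refine integral_congr_ae (.of_forall fun x => ?_)
      simp only [anchorSq, Finset.sum_range_succ]
    have e2 : (∫ x, ‖anchor θ (mart j g x) (t + 1) - anchor θ (mart j g x) t‖ ^ 2) +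
        ∫ x, ‖mart j g x (t + 1) - anchor θ (mart j g x) (t + 1)‖ ^ 2 =
        ∫ x, ‖mart j g x (t + 1) - anchor θ (mart j g x) t‖ ^ 2 := by
      have i1 := integrable_norm_sq (hA'.sub hA)
      have i2 := integrable_norm_sq (hf'.sub hA')
      simp only [Pi.sub_apply] at i1 i2
      rw [← integral_add i1 i2]
      refine integral_congr_ae (.of_forall fun x => ?_)
      simp only
      rw [add_comm, anchor_sq_add]
    have e3 : ∫ x, ‖mart j g x (t + 1) - anchor θ (mart j g x) t‖ ^ 2 =
        (∫ x, ‖mart j g x (t + 1) - mart j g x t‖ ^ 2) +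
        ∫ x, ‖mart j g x t - anchor θ (mart j g x) t‖ ^ 2 := by
      have := integral_norm_sub_dyadicAvg_add_sq (j := j t) (hf.sub hA) (fun x y h => by
        simp only [Pi.sub_apply]
        rw [mart_congr hj h t le_rfl, anchor_congr (mart_congr hj h)]) hf'
      rw [dyadicAvg_mart hj hg] at this
      simpa using this
    have e4 := integral_norm_sq_dyadicAvg_add (j t) hf'
    rw [dyadicAvg_mart hj hg] at e4
    rw [e1, e4]
    linarith

lemma integral_runMax_mul_le (hj : Monotone j) (hg : Nice g) (t : ℕ) :
    ∫ x, runMax (mart j g x) t * ‖mart j g x t‖ ≤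
      ∫ x, runMax (mart j g x) t * ‖mart j g x (t + 1)‖ := by
  have hM := nice_runMax hj hg t
  have hf := nice_mart (j := j) hg t
  have hf' := nice_mart (j := j) hg (t + 1)
  have h := integral_inner_dyadicAvg (j := j t) hM
    (fun x y h => runMax_mart_congr hj h) hf'.norm
  have e : ∀ a b : ℝ, inner ℝ a b = a * b := fun a b => by simp [mul_comm]
  have i1 := integrable_inner_nice hM hf.norm
  have i2 := integrable_inner_nice hM (hf'.norm.dyadicAvg (j t))
  simp only [e] at h i1 i2
  rw [← h]
  refine integral_mono i1 i2 fun x => ?_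
  refine mul_le_mul_of_nonneg_left ?_ (runMax_nonneg t)
  have := norm_dyadicAvg_le (j t) (fun x => mart j g x (t + 1)) x
  rwa [dyadicAvg_mart hj hg] at this

/-- Doob's maximal inequality. -/
lemma integral_runMax_sq_le (hj : Monotone j) (hg : Nice g) (t : ℕ) :
    ∫ x, runMax (mart j g x) t ^ 2 ≤ 4 * ∫ x, ‖mart j g x t‖ ^ 2 := by
  have e : ∀ a b : ℝ, inner ℝ a b = a * b := fun a b => by simp [mul_comm]
  have iMX : ∀ s t, Integrable fun x => runMax (mart j g x) s * ‖mart j g x t‖ := fun s t => by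
    have := integrable_inner_nice (nice_runMax hj hg s) (nice_mart (j := j) hg t).norm
    simpa only [e] using this
  have iM : ∀ t, Integrable fun x => runMax (mart j g x) t ^ 2 := fun t => by
    simpa using integrable_norm_sq (nice_runMax hj hg t)
  have key : ∀ t, ∫ x, runMax (mart j g x) t ^ 2 ≤
      2 * ∫ x, runMax (mart j g x) t * ‖mart j g x t‖ := by
    intro t
    induction t with
    | zero =>
      rw [← integral_const_mul]
      refine integral_mono (iM 0) ((iMX 0 0).const_mul 2) fun x => ?_
      simp only [runMax]
      nlinarith [norm_nonneg (mart j g x 0)]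
    | succ t ih =>
      have h1 := integral_runMax_mul_le hj hg t
      have h2 : ∫ x, (runMax (mart j g x) (t + 1) ^ 2 +
          2 * (runMax (mart j g x) t * ‖mart j g x (t + 1)‖)) ≤
          ∫ x, (runMax (mart j g x) t ^ 2 +
          2 * (runMax (mart j g x) (t + 1) * ‖mart j g x (t + 1)‖)) := by
        refine integral_mono ((iM _).add ((iMX _ _).const_mul 2))
          ((iM _).add ((iMX _ _).const_mul 2)) fun x => ?_
        simp only [runMax]
        rcases le_total (runMax (mart j g x) t) ‖mart j g x (t + 1)‖ with h | h
        · rw [max_eq_right h]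
          nlinarith
        · rw [max_eq_left h]
      rw [integral_add (iM _) ((iMX _ _).const_mul 2), integral_add (iM _) ((iMX _ _).const_mul 2),
        integral_const_mul, integral_const_mul] at h2
      linarith
  have h3 : 2 * ∫ x, runMax (mart j g x) t * ‖mart j g x t‖ ≤
      (1 / 2) * (∫ x, runMax (mart j g x) t ^ 2) + 2 * ∫ x, ‖mart j g x t‖ ^ 2 := by
    rw [← integral_const_mul, ← integral_const_mul, ← integral_const_mul,
      ← integral_add ((iM t).const_mul _) ((integrable_norm_sq (nice_mart hg t)).const_mul _)]
    refine integral_mono ((iMX t t).const_mul 2)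
      (((iM t).const_mul _).add ((integrable_norm_sq (nice_mart hg t)).const_mul _)) fun x => ?_
    simp only
    nlinarith [sq_nonneg (runMax (mart j g x) t - 2 * ‖mart j g x t‖)]
  linarith [key t]

/-- The `L²` bound for the quantity controlling the variation of a dyadic martingale. -/
theorem lintegral_varCtl_le {r : ℝ} (hr : 2 < r) (hj : Monotone j) (hg : Nice g) (t : ℕ) :
    ∫⁻ x, varCtl r (mart j g x) t ≤
      ENNReal.ofReal (4 + (1 - (2 : ℝ) ^ (-(r - 2)))⁻¹) * ∫⁻ x, ‖g x‖ₑ ^ (2 : ℝ) := by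
  set w : ℝ := (2 : ℝ) ^ (-(r - 2)) with hw
  have hw0 : 0 ≤ w := by positivity
  have hw1 : w < 1 := Real.rpow_lt_one_of_one_lt_of_neg (by norm_num) (by linarith)
  have hGt : ∫ x, ‖mart j g x t‖ ^ 2 ≤ ∫ x, ‖g x‖ ^ 2 := by
    rw [integral_norm_sq_dyadicAvg_add (j t) hg]
    exact le_add_of_nonneg_left (integral_nonneg fun x => by positivity)
  set G := ∫ x, ‖g x‖ ^ 2 with hG
  have hG0 : 0 ≤ G := integral_nonneg fun x => by positivity
  have hS : ∀ m : ℕ, Integrable fun x => anchorSq ((1 / 2) ^ m) (mart j g x) t := fun m =>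
      integrable_finsetSum _ fun u _ => integrable_norm_sq
        ((nice_anchor hj hg _ (u + 1)).sub (nice_anchor hj hg _ u))
  have hSle : ∀ m : ℕ, ∫⁻ x, ENNReal.ofReal (anchorSq ((1 / 2) ^ m) (mart j g x) t) ≤
      ENNReal.ofReal G := fun m => by
    rw [← ofReal_integral_eq_lintegral_ofReal (hS m) (.of_forall fun x => anchorSq_nonneg t)]
    refine ENNReal.ofReal_le_ofReal ?_
    have := integral_anchorSq_le hj hg ((1 / 2) ^ m) t
    have h0 : 0 ≤ ∫ x, ‖mart j g x t - anchor ((1 / 2) ^ m) (mart j g x) t‖ ^ 2 :=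
      integral_nonneg fun x => by positivity
    linarith
  have iM : Integrable fun x => runMax (mart j g x) t ^ 2 := by
    simpa using integrable_norm_sq (nice_runMax hj hg t)
  have hSm : ∀ m : ℕ, AEMeasurable
      (fun x => ENNReal.ofReal (anchorSq ((1 / 2) ^ m) (mart j g x) t)) volume :=
    fun m => (hS m).1.aemeasurable.ennreal_ofReal
  unfold varCtl
  rw [lintegral_add_left' iM.1.aemeasurable.ennreal_ofReal,
    lintegral_tsum fun m => (hSm m).const_mul _, lintegral_sq_eq hg,
    ← ofReal_integral_eq_lintegral_ofReal iM (.of_forall fun x => by positivity),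
    ENNReal.ofReal_add (by norm_num) (inv_nonneg.2 (by linarith)), add_mul]
  refine add_le_add ?_ ?_
  · rw [← ENNReal.ofReal_mul (by norm_num)]
    refine ENNReal.ofReal_le_ofReal ((integral_runMax_sq_le hj hg t).trans (by linarith))
  · calc ∑' m : ℕ, ∫⁻ x, ENNReal.ofReal (w ^ m) *
          ENNReal.ofReal (anchorSq ((1 / 2) ^ m) (mart j g x) t)
        ≤ ∑' m : ℕ, ENNReal.ofReal w ^ m * ENNReal.ofReal G := by
          refine ENNReal.tsum_le_tsum fun m => ?_
          rw [lintegral_const_mul' _ _ ENNReal.ofReal_ne_top, ENNReal.ofReal_pow hw0]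
          exact mul_le_mul_right (hSle m) _
      _ = _ := by
          rw [ENNReal.tsum_mul_right, ENNReal.tsum_geometric, ENNReal.ofReal_inv_of_pos (by linarith),
            ENNReal.ofReal_sub _ hw0, ENNReal.ofReal_one]

end Lepingle

section Plancherel

variable {n : ℕ}

lemma Nice.memLp_two {f : Rn n → ℂ} (hf : Nice f) : MemLp f 2 := by
  rw [memLp_two_iff_integrable_sq_norm hf.meas.aestronglyMeasurable]
  exact integrable_norm_sq hf

/-- The Fourier transform on `L²` is given by the Fourier integral on `L¹ ∩ L²`. -/
lemma coeFn_fourier_toLp {f : Rn n → ℂ} (hf : Integrable f) (hf2 : MemLp f 2) :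
    (𝓕 (hf2.toLp f) : Lp ℂ 2 (volume : Measure (Rn n))) =ᵐ[volume] 𝓕 f := by
  have hc : Continuous (𝓕 f) :=
    VectorFourier.fourierIntegral_continuous Real.continuous_fourierChar continuous_inner hf
  refine ae_eq_of_integral_contDiff_smul_eq
    ((Lp.memLp _).locallyIntegrable (by norm_num)) hc.locallyIntegrable fun g hg hgc => ?_
  have hgc' : HasCompactSupport fun x => (g x : ℂ) :=
    hgc.comp_left (g := fun r : ℝ => (r : ℂ)) Complex.ofReal_zero
  set φ : SchwartzMap (Rn n) ℂ := hgc'.toSchwartzMap (Complex.ofRealCLM.contDiff.comp hg) with hφ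
  have hφx : ∀ x, φ x = (g x : ℂ) := fun x => rfl
  have h1 : ∀ h : Rn n → ℂ, ∫ x, g x • h x = ∫ x, φ x • h x := fun h => by
    simp only [hφx, Complex.real_smul, smul_eq_mul]
  rw [h1, h1]
  have h2 := DFunLike.congr_fun (Lp.fourier_toTemperedDistribution_eq (hf2.toLp f)) φ
  rw [TemperedDistribution.fourier_apply, Lp.toTemperedDistribution_apply,
    Lp.toTemperedDistribution_apply] at h2
  rw [← h2]
  have h3 := VectorFourier.integral_fourierIntegral_smul_eq_flip (μ := volume) (ν := volume)
    (L := innerₗ (Rn n)) (f := φ) (g := f)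
    Real.continuous_fourierChar continuous_inner φ.integrable hf
  have h4 : (innerₗ (Rn n)).flip = innerₗ (Rn n) := by
    ext x y; simp
  rw [h4] at h3
  calc _ = ∫ x, (𝓕 φ) x • f x := by
        refine integral_congr_ae ?_
        filter_upwards [hf2.coeFn_toLp] with x hx
        rw [hx]
    _ = _ := h3

lemma lintegral_fourier_sq {f : Rn n → ℂ} (hf : Nice f) :
    ∫⁻ ξ, ‖𝓕 f ξ‖ₑ ^ (2 : ℝ) = ∫⁻ x, ‖f x‖ₑ ^ (2 : ℝ) := by
  have hf2 := hf.memLp_two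
  have h := Lp.norm_fourier_eq (hf2.toLp f)
  rw [Lp.norm_def, Lp.norm_def, ENNReal.toReal_eq_toReal_iff' (Lp.eLpNorm_ne_top _)
    (Lp.eLpNorm_ne_top _), eLpNorm_congr_ae (coeFn_fourier_toLp hf.int hf2),
    eLpNorm_congr_ae hf2.coeFn_toLp, eLpNorm_eq_lintegral_rpow_enorm_toReal (by norm_num) (by norm_num),
    eLpNorm_eq_lintegral_rpow_enorm_toReal (by norm_num) (by norm_num)] at h
  simp only [ENNReal.toReal_ofNat] at h
  have h2 := congrArg (fun t => t ^ (2 : ℝ)) h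
  simp only [← ENNReal.rpow_mul] at h2
  norm_num at h2
  exact_mod_cast h2

/-- The operator of multiplication by the values of a scalar kernel. -/
def mulK (κ : Rn n → ℂ) (t : Rn n) : ℂ →L[ℝ] ℂ := ContinuousLinearMap.mul ℝ ℂ (κ t)

lemma mulK_apply (κ : Rn n → ℂ) (t : Rn n) (z : ℂ) : mulK κ t z = κ t * z := rfl

lemma continuous_mulK {κ : Rn n → ℂ} (hκ : Continuous κ) : Continuous (mulK κ) :=
  (ContinuousLinearMap.mul ℝ ℂ).continuous.comp hκ

lemma hasCompactSupport_mulK {κ : Rn n → ℂ} (hκ : HasCompactSupport κ) :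
    HasCompactSupport (mulK κ) :=
  hκ.comp_left (g := ContinuousLinearMap.mul ℝ ℂ) (map_zero _)

lemma opConv_mulK (κ f : Rn n → ℂ) (x : Rn n) :
    opConv (mulK κ) f x = ∫ y, κ (x - y) * f y := rfl

lemma fourier_opConv_mulK {κ f : Rn n → ℂ} (hκ : Integrable κ) (hf : Integrable f) (ξ : Rn n) :
    𝓕 (opConv (mulK κ) f) ξ = 𝓕 κ ξ * 𝓕 f ξ := by
  rw [← Real.fourier_mul_convolution_eq hκ hf]
  have h : opConv (mulK κ) f = convolution κ f (ContinuousLinearMap.mul ℂ ℂ) volume := by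
    funext x
    rw [opConv_mulK, convolution_eq_swap]
    rfl
  rw [h]

lemma sum_lintegral_sq_le_of_fourier {ι : Type*} (s : Finset ι) {g m : ι → Rn n → ℂ}
    {f : Rn n → ℂ} (hg : ∀ k, Nice (g k)) (hf : Nice f)
    (hgm : ∀ k ξ, 𝓕 (g k) ξ = m k ξ * 𝓕 f ξ) {M : ℝ} (hM : ∀ ξ, ∑ k ∈ s, ‖m k ξ‖ ^ 2 ≤ M) :
    ∑ k ∈ s, ∫⁻ x, ‖g k x‖ₑ ^ (2 : ℝ) ≤ ENNReal.ofReal M * ∫⁻ x, ‖f x‖ₑ ^ (2 : ℝ) := by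
  have hcont : ∀ {g : Rn n → ℂ}, Integrable g → Continuous (𝓕 g) := fun hg =>
    VectorFourier.fourierIntegral_continuous Real.continuous_fourierChar continuous_inner hg
  simp only [← lintegral_fourier_sq (hg _), ← lintegral_fourier_sq hf]
  have hms : ∀ k ∈ s, Measurable fun ξ => ‖𝓕 (g k) ξ‖ₑ ^ (2 : ℝ) := fun k _ =>
    (hcont (hg k).int).measurable.enorm.pow_const _
  rw [← lintegral_finsetSum s hms,
    ← lintegral_const_mul _ ((hcont hf.int).measurable.enorm.pow_const _)]
  refine lintegral_mono fun ξ => ?_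
  simp only [hgm, enorm_mul, ENNReal.mul_rpow_of_nonneg _ _ zero_le_two, ← Finset.sum_mul]
  refine mul_le_mul_left ?_ _
  refine le_trans (le_of_eq ?_) (ENNReal.ofReal_le_ofReal (hM ξ))
  rw [ENNReal.ofReal_sum_of_nonneg fun _ _ => by positivity]
  refine Finset.sum_congr rfl fun k _ => ?_
  rw [ENNReal.ofReal_pow (norm_nonneg _), ofReal_norm, ENNReal.rpow_two]

lemma sum_lintegral_opConv_sq_le {ι : Type*} (s : Finset ι) {κ : ι → Rn n → ℂ}
    (hκ : ∀ k, Continuous (κ k)) (hc : ∀ k, HasCompactSupport (κ k)) {M : ℝ}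
    (hM : ∀ ξ, ∑ k ∈ s, ‖𝓕 (κ k) ξ‖ ^ 2 ≤ M) {f : Rn n → ℂ} (hf : Nice f) :
    ∑ k ∈ s, ∫⁻ x, ‖opConv (mulK (κ k)) f x‖ₑ ^ (2 : ℝ) ≤
      ENNReal.ofReal M * ∫⁻ x, ‖f x‖ₑ ^ (2 : ℝ) :=
  sum_lintegral_sq_le_of_fourier s
    (fun k => hf.opConv (continuous_mulK (hκ k)) (hasCompactSupport_mulK (hc k))) hf
    (fun k => fourier_opConv_mulK ((hκ k).integrable_of_hasCompactSupport (hc k)) hf.int) hM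

lemma fourier_finsetSum {ι : Type*} (s : Finset ι) {q : ι → Rn n → ℂ}
    (hq : ∀ i ∈ s, Integrable (q i)) (ξ : Rn n) :
    𝓕 (fun t => ∑ i ∈ s, q i t) ξ = ∑ i ∈ s, 𝓕 (q i) ξ := by
  simp only [Real.fourier_eq, Finset.smul_sum]
  exact integral_finsetSum _ fun i hi => (Real.fourierIntegral_convergent_iff ξ).2 (hq i hi)

lemma fourier_sub {f g : Rn n → ℂ} (hf : Integrable f) (hg : Integrable g) (ξ : Rn n) :
    𝓕 (f - g) ξ = 𝓕 f ξ - 𝓕 g ξ := by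
  simp only [Real.fourier_eq, Pi.sub_apply, smul_sub]
  exact integral_sub ((Real.fourierIntegral_convergent_iff ξ).2 hf)
    ((Real.fourierIntegral_convergent_iff ξ).2 hg)

end Plancherel

section ScaleKer

variable {n : ℕ} {R σ A B : ℝ} {κ : Rn n → ℂ}

/-- Kernels living at scale `σ`: supported in a ball of radius `R σ`, bounded by `A σ⁻ⁿ`, and
Lipschitz with constant `B σ⁻ⁿ⁻¹`. -/
structure ScaleKer (R σ A B : ℝ) (κ : Rn n → ℂ) : Prop where
  supp : ∀ t, R * σ < ‖t‖ → κ t = 0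
  bd : ∀ t, ‖κ t‖ ≤ A * (σ ^ n)⁻¹
  lip : ∀ s t, ‖κ s - κ t‖ ≤ B * (σ ^ (n + 1))⁻¹ * ‖s - t‖

/-- The volume of the unit ball. -/
def unitVol (n : ℕ) : ℝ := (volume : Measure (Rn n)).real (Metric.ball 0 1)

lemma unitVol_pos (n : ℕ) : 0 < unitVol n :=
  ENNReal.toReal_pos (Metric.measure_ball_pos _ _ one_pos).ne' measure_ball_lt_top.ne

lemma norm_integral_le_of_supp {g : Rn n → ℂ} {c ρ : ℝ} (hρ : 0 ≤ ρ) (hg : ∀ t, ‖g t‖ ≤ c)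
    (h0 : ∀ t, ρ < ‖t‖ → g t = 0) : ‖∫ t, g t‖ ≤ c * ρ ^ n * unitVol n := by
  have h : ∫ t in Metric.closedBall 0 ρ, g t = ∫ t, g t :=
    setIntegral_eq_integral_of_forall_compl_eq_zero fun t ht => h0 t (by simpa using ht)
  rw [← h]
  refine (norm_setIntegral_le_of_norm_le_const measure_closedBall_lt_top
    fun t _ => hg t).trans (le_of_eq ?_)
  rw [Measure.addHaar_real_closedBall _ _ hρ, finrank_euclideanSpace_fin, unitVol, mul_assoc]

namespace ScaleKer

lemma continuous (hκ : ScaleKer R σ A B κ) : Continuous κ := by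
  refine (LipschitzWith.of_dist_le_mul (K := (B * (σ ^ (n + 1))⁻¹).toNNReal) fun s t => ?_).continuous
  rw [dist_eq_norm, dist_eq_norm]
  exact (hκ.lip s t).trans (mul_le_mul_of_nonneg_right (Real.le_coe_toNNReal _) (norm_nonneg _))

lemma hasCompactSupport (hκ : ScaleKer R σ A B κ) : HasCompactSupport κ :=
  HasCompactSupport.intro (isCompact_closedBall 0 (R * σ)) fun t ht => hκ.supp t (by simpa using ht)

lemma integrable (hκ : ScaleKer R σ A B κ) : Integrable κ :=
  hκ.continuous.integrable_of_hasCompactSupport hκ.hasCompactSupport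

lemma nonneg_bd (hσ : 0 < σ) (hκ : ScaleKer R σ A B κ) : 0 ≤ A := by
  have := (norm_nonneg _).trans (hκ.bd 0)
  have h2 : 0 < (σ ^ n)⁻¹ := by positivity
  exact nonneg_of_mul_nonneg_left this h2

end ScaleKer

/-- The constant in the Fourier decay estimates. -/
def fourierConst (n : ℕ) (R : ℝ) : ℝ := 2 * Real.pi * (R + 1) ^ (n + 1) * unitVol n

lemma fourierConst_pos (n : ℕ) (hR : 0 ≤ R) : 0 < fourierConst n R := by
  have := unitVol_pos n
  have := Real.pi_pos
  unfold fourierConst; positivity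

lemma pow_mul_unitVol_le (hR : 0 ≤ R) : (R + 1) ^ n * unitVol n ≤ fourierConst n R := by
  have h := unitVol_pos n
  have h2 : (R + 1) ^ n ≤ 2 * Real.pi * (R + 1) ^ (n + 1) := by
    rw [pow_succ]
    have : 1 ≤ 2 * Real.pi * (R + 1) := by nlinarith [Real.pi_gt_three]
    have h3 : 0 ≤ (R + 1) ^ n := by positivity
    nlinarith
  unfold fourierConst
  gcongr

namespace ScaleKer

lemma norm_fourier_le (hκ : ScaleKer R σ A B κ) (hσ : 0 < σ) (hR : 0 ≤ R) (ξ : Rn n) :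
    ‖𝓕 κ ξ‖ ≤ fourierConst n R * A := by
  have hA := hκ.nonneg_bd hσ
  rw [Real.fourier_eq]
  refine (norm_integral_le_of_supp (c := A * (σ ^ n)⁻¹) (ρ := (R + 1) * σ) (by positivity)
    (fun t => by rw [Circle.norm_smul]; exact hκ.bd t)
    (fun t ht => by rw [hκ.supp t (by nlinarith), smul_zero])).trans ?_
  refine le_trans (le_of_eq ?_) (mul_le_mul_of_nonneg_right (pow_mul_unitVol_le (n := n) hR) hA)
  rw [mul_pow]; field_simp

lemma norm_fourier_sub_integral_le (hκ : ScaleKer R σ A B κ) (hσ : 0 < σ) (hR : 0 ≤ R)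
    (ξ : Rn n) : ‖𝓕 κ ξ - ∫ t, κ t‖ ≤ fourierConst n R * A * (σ * ‖ξ‖) := by
  have hA := hκ.nonneg_bd hσ
  have hi : Integrable fun t => Real.fourierChar (-inner ℝ t ξ) • κ t :=
    (Real.fourierIntegral_convergent_iff ξ).2 hκ.integrable
  rw [Real.fourier_eq, ← integral_sub hi hκ.integrable]
  refine (norm_integral_le_of_supp (c := A * (σ ^ n)⁻¹ * (2 * Real.pi * ((R + 1) * σ * ‖ξ‖)))
    (ρ := (R + 1) * σ) (by positivity) (fun t => ?_)
    (fun t ht => by rw [hκ.supp t (by nlinarith), smul_zero, sub_zero])).trans ?_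
  · by_cases ht : R * σ < ‖t‖
    · rw [hκ.supp t ht, smul_zero, sub_zero, norm_zero]; positivity
    have h1 : Real.fourierChar (-inner ℝ t ξ) • κ t - κ t =
        κ t * (Complex.exp (Complex.I * ((2 * Real.pi * -inner ℝ t ξ : ℝ) : ℂ)) - 1) := by
      rw [Circle.smul_def, Real.fourierChar_apply, smul_eq_mul, mul_comm Complex.I]; ring
    rw [h1, norm_mul]
    refine mul_le_mul (hκ.bd t) (Real.norm_exp_I_mul_ofReal_sub_one_le.trans ?_) (norm_nonneg _)
      (by positivity)
    rw [norm_mul, norm_neg, Real.norm_of_nonneg (by positivity : 0 ≤ 2 * Real.pi)]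
    gcongr
    refine (norm_inner_le_norm _ _).trans ?_
    gcongr
    nlinarith
  · refine le_of_eq ?_
    rw [fourierConst, mul_pow, pow_succ]
    field_simp

lemma norm_fourier_le_div (hκ : ScaleKer R σ A B κ) (hσ : 0 < σ) (hR : 0 ≤ R)
    {ξ : Rn n} (hξ : 1 ≤ σ * ‖ξ‖) : ‖𝓕 κ ξ‖ ≤ fourierConst n R * B / (σ * ‖ξ‖) := by
  have hξ0 : 0 < ‖ξ‖ := by
    by_contra h
    nlinarith [norm_nonneg ξ]
  have hB : 0 ≤ B * (σ ^ (n + 1))⁻¹ := by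
    have h := (norm_nonneg _).trans (hκ.lip ξ 0)
    rw [sub_zero] at h
    exact nonneg_of_mul_nonneg_left h hξ0
  have hB' : 0 ≤ B := nonneg_of_mul_nonneg_left hB (by positivity)
  rw [Real.fourier_eq, fourierIntegral_eq_half_sub_half_period_translate (norm_pos_iff.1 hξ0)
    hκ.integrable, norm_smul]
  have hn : ‖(1 / (2 * ‖ξ‖ ^ 2) : ℝ) • ξ‖ = 1 / (2 * ‖ξ‖) := by
    rw [norm_smul, Real.norm_of_nonneg (by positivity)]; field_simp
  have hle : 1 / (2 * ‖ξ‖) ≤ σ := by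
    rw [div_le_iff₀ (by positivity)]; nlinarith
  have hmain := norm_integral_le_of_supp
    (g := fun v => Real.fourierChar (-inner ℝ v ξ) •
      (κ v - κ (v + (1 / (2 * ‖ξ‖ ^ 2) : ℝ) • ξ)))
    (c := B * (σ ^ (n + 1))⁻¹ * (1 / (2 * ‖ξ‖)))
    (ρ := (R + 1) * σ) (by positivity) (fun t => by
      rw [Circle.norm_smul]
      refine (hκ.lip _ _).trans (le_of_eq ?_)
      rw [sub_add_cancel_left, norm_neg, hn]) (fun t ht => by
      have h2 : ‖t‖ ≤ ‖t + (1 / (2 * ‖ξ‖ ^ 2) : ℝ) • ξ‖ + 1 / (2 * ‖ξ‖) := by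
        rw [← hn]; exact norm_le_add_norm_add _ _
      rw [hκ.supp t (by nlinarith), hκ.supp _ (by nlinarith), sub_zero, smul_zero])
  have h3 : B * (σ ^ (n + 1))⁻¹ * (1 / (2 * ‖ξ‖)) * ((R + 1) * σ) ^ n * unitVol n =
      2⁻¹ * ((R + 1) ^ n * unitVol n * B / (σ * ‖ξ‖)) := by
    rw [mul_pow, pow_succ]; field_simp
  rw [h3] at hmain
  have h4 : (R + 1) ^ n * unitVol n * B / (σ * ‖ξ‖) ≤ fourierConst n R * B / (σ * ‖ξ‖) := by
    gcongr; exact pow_mul_unitVol_le hR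
  have h5 : 0 ≤ (R + 1) ^ n * unitVol n * B / (σ * ‖ξ‖) := by
    have := unitVol_pos n
    positivity
  have h6 : ‖(1 / 2 : ℂ)‖ = 2⁻¹ := by norm_num
  rw [h6]
  nlinarith [norm_nonneg (∫ v, Real.fourierChar (-inner ℝ v ξ) •
      (κ v - κ (v + (1 / (2 * ‖ξ‖ ^ 2) : ℝ) • ξ)))]

end ScaleKer

end ScaleKer

section CauchySchwarz

variable {α : Type*} [MeasurableSpace α] {μ : Measure α}

lemma sq_lintegral_mul_le {w u : α → ℝ≥0∞} (hw : AEMeasurable w μ) (hu : AEMeasurable u μ) :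
    (∫⁻ a, w a * u a ∂μ) ^ (2 : ℝ) ≤ (∫⁻ a, w a ∂μ) * ∫⁻ a, w a * u a ^ (2 : ℝ) ∂μ := by
  have h := ENNReal.lintegral_mul_le_Lp_mul_Lq μ Real.HolderConjugate.two_two
    (hw.pow_const (1 / 2 : ℝ)) ((hw.pow_const (1 / 2 : ℝ)).mul hu)
  have h1 : ∀ a, w a ^ (1 / 2 : ℝ) * (w a ^ (1 / 2 : ℝ) * u a) = w a * u a := fun a => by
    rw [← mul_assoc, ← ENNReal.rpow_add_of_nonneg _ _ (by norm_num) (by norm_num)]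
    norm_num
  have h2 : ∀ a, (w a ^ (1 / 2 : ℝ)) ^ (2 : ℝ) = w a := fun a => by
    rw [← ENNReal.rpow_mul]; norm_num
  simp only [Pi.mul_apply, h1, ENNReal.mul_rpow_of_nonneg _ _ zero_le_two, h2] at h
  refine (ENNReal.rpow_le_rpow h zero_le_two).trans (le_of_eq ?_)
  rw [ENNReal.mul_rpow_of_nonneg _ _ zero_le_two, ← ENNReal.rpow_mul, ← ENNReal.rpow_mul]
  norm_num

end CauchySchwarz

section Young

variable {n : ℕ}

lemma lintegral_conv_sq_le {w u : Rn n → ℝ≥0∞} (hw : Measurable w) (hu : Measurable u) :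
    ∫⁻ x, (∫⁻ y, w (x - y) * u y) ^ (2 : ℝ) ≤
      (∫⁻ x, w x) ^ (2 : ℝ) * ∫⁻ x, u x ^ (2 : ℝ) := by
  have hwx : ∀ x, ∫⁻ y, w (x - y) = ∫⁻ y, w y := fun x => lintegral_sub_left_eq_self w x
  have hm : Measurable fun q : Rn n × Rn n => w (q.1 - q.2) * u q.2 ^ (2 : ℝ) :=
    (hw.comp (measurable_fst.sub measurable_snd)).mul
      ((hu.comp measurable_snd).pow_const _)
  calc ∫⁻ x, (∫⁻ y, w (x - y) * u y) ^ (2 : ℝ)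
      ≤ ∫⁻ x, (∫⁻ y, w y) * ∫⁻ y, w (x - y) * u y ^ (2 : ℝ) := lintegral_mono fun x => by
        have h := sq_lintegral_mul_le (w := fun y => w (x - y)) (u := u) (μ := volume)
          (hw.comp (measurable_const.sub measurable_id)).aemeasurable hu.aemeasurable
        rwa [hwx] at h
    _ = (∫⁻ y, w y) * ∫⁻ x, ∫⁻ y, w (x - y) * u y ^ (2 : ℝ) := by
        rw [lintegral_const_mul _ hm.lintegral_prod_right']
    _ = (∫⁻ y, w y) * ∫⁻ y, ∫⁻ x, w (x - y) * u y ^ (2 : ℝ) := by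
        rw [lintegral_lintegral_swap hm.aemeasurable]
    _ = (∫⁻ y, w y) * ∫⁻ y, (∫⁻ x, w x) * u y ^ (2 : ℝ) := by
        congr 1
        refine lintegral_congr fun y => ?_
        have hm2 : Measurable fun x => w (x - y) :=
          hw.comp (measurable_id.sub measurable_const)
        rw [lintegral_mul_const _ hm2, lintegral_sub_right_eq_self w y]
    _ = _ := by
        rw [lintegral_const_mul _ (hu.pow_const _), ← mul_assoc, ENNReal.rpow_two, sq]

end Young

section Slab

variable {n : ℕ}

lemma volume_box (a b : Fin n → ℝ) :
    volume {y : Rn n | ∀ k, a k ≤ y k ∧ y k < b k} = ∏ k, ENNReal.ofReal (b k - a k) := by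
  have h : {y : Rn n | ∀ k, a k ≤ y k ∧ y k < b k} =
      (MeasurableEquiv.toLp 2 (Fin n → ℝ)).symm ⁻¹' (Set.univ.pi fun k => Set.Ico (a k) (b k)) := by
    ext y; simp [Set.mem_pi]
  rw [h, (EuclideanSpace.volume_preserving_symm_measurableEquiv_toLp (Fin n)).measure_preimage_equiv,
    Real.volume_pi_Ico]

lemma volume_slab_le (j : ℤ) (x t : Rn n) (i : Fin n) :
    volume {y | y ∈ dcube j x ∧ dcell j (y - t) i ≠ dcell j y i} ≤
      ENNReal.ofReal (|t i| * 2 ^ j) * volume (dcube j x) := by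
  have h2 : (0 : ℝ) < 2 ^ j := by positivity
  set l : ℝ := (2 ^ j)⁻¹ with hl
  have hl2 : 2 ^ j * l = 1 := mul_inv_cancel₀ h2.ne'
  have hl0 : 0 < l := by positivity
  have hd1 : ∀ c z : ℝ, c ≤ 2 ^ j * z ↔ c * l ≤ z := fun c z => by
    rw [hl, mul_inv_le_iff₀ h2, mul_comm]
  have hd2 : ∀ c z : ℝ, 2 ^ j * z < c ↔ z < c * l := fun c z => by
    rw [hl, lt_mul_inv_iff₀ h2, mul_comm]
  set m : Fin n → ℝ := fun k => (dcell j x k : ℝ) * l with hm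
  set a : Fin n → ℝ := fun k => if k = i then (if 0 ≤ t i then m k else m k + l - |t i|) else m k
    with ha
  set b : Fin n → ℝ := fun k => if k = i then a i + |t i| else m k + l with hb
  have hsub : {y | y ∈ dcube j x ∧ dcell j (y - t) i ≠ dcell j y i} ⊆
      {y : Rn n | ∀ k, a k ≤ y k ∧ y k < b k} := by
    rintro y ⟨hy, hne⟩ k
    have hyk : ∀ k, m k ≤ y k ∧ y k < m k + l := fun k => by
      have h := congrFun (mem_dcube.1 hy) k
      simp only [dcell] at h
      rw [Int.floor_eq_iff, hd1, hd2, add_mul, one_mul] at h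
      exact h
    by_cases hk : k = i
    · subst hk
      simp only [ha, hb, if_true]
      have h := congrFun (mem_dcube.1 hy) k
      rw [h] at hne
      have hyk := hyk k
      have hne2 : ¬ ((dcell j x k : ℝ) ≤ 2 ^ j * (y k - t k) ∧
          2 ^ j * (y k - t k) < dcell j x k + 1) := by
        rw [← Int.floor_eq_iff]; exact hne
      rw [hd1, hd2, add_mul, one_mul] at hne2
      change ¬ (m k ≤ y k - t k ∧ y k - t k < m k + l) at hne2
      by_cases h0 : 0 ≤ t k
      · rw [if_pos h0, abs_of_nonneg h0]
        refine ⟨hyk.1, ?_⟩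
        by_contra hcon
        exact hne2 ⟨by linarith, by linarith⟩
      · push Not at h0
        rw [if_neg h0.not_ge, abs_of_neg h0]
        refine ⟨?_, by linarith⟩
        by_contra hcon
        exact hne2 ⟨by linarith, by linarith⟩
    · simp only [ha, hb, if_neg hk]
      exact hyk k
  refine (measure_mono hsub).trans (le_of_eq ?_)
  rw [volume_box, volume_dcube]
  have h3 : ∀ k, ENNReal.ofReal (b k - a k) =
      (if k = i then ENNReal.ofReal (|t i| * 2 ^ j) else 1) * ENNReal.ofReal l := fun k => by
    by_cases hk : k = i
    · subst hk
      rw [if_pos rfl, ← ENNReal.ofReal_mul (by positivity)]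
      simp only [hb, if_true, add_sub_cancel_left, mul_assoc, hl2, mul_one]
    · simp only [ha, hb, if_neg hk, add_sub_cancel_left, one_mul]
  rw [Finset.prod_congr rfl fun k _ => h3 k, Finset.prod_mul_distrib, Finset.prod_ite_eq']
  simp only [Finset.mem_univ, if_true, Finset.prod_const, Finset.card_univ, Fintype.card_fin]
  rw [← ENNReal.ofReal_pow hl0.le, hl, inv_pow]

/-- A translation by `t` moves only a small portion of a dyadic cube to other cubes. -/
lemma volume_dcube_shift_le (j : ℤ) (x t : Rn n) :
    volume (dcube j x ∩ {y | dcell j (y - t) ≠ dcell j y}) ≤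
      ENNReal.ofReal (n * (‖t‖ * 2 ^ j)) * volume (dcube j x) := by
  have hsub : dcube j x ∩ {y | dcell j (y - t) ≠ dcell j y} ⊆
      ⋃ i : Fin n, {y | y ∈ dcube j x ∧ dcell j (y - t) i ≠ dcell j y i} := by
    rintro y ⟨hy, hne⟩
    obtain ⟨i, hi⟩ := Function.ne_iff.1 hne
    exact mem_iUnion.2 ⟨i, hy, hi⟩
  refine (measure_mono hsub).trans ((measure_iUnion_fintype_le _ _).trans ?_)
  refine (Finset.sum_le_sum fun i _ => volume_slab_le j x t i).trans ?_
  rw [← Finset.sum_mul]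
  refine mul_le_mul_left ?_ _
  calc ∑ i : Fin n, ENNReal.ofReal (|t i| * 2 ^ j)
      ≤ ∑ _i : Fin n, ENNReal.ofReal (‖t‖ * 2 ^ j) := Finset.sum_le_sum fun i _ => by
        refine ENNReal.ofReal_le_ofReal ?_
        gcongr
        exact PiLp.norm_apply_le t i
    _ = _ := by
        rw [Finset.sum_const, Finset.card_univ, Fintype.card_fin, nsmul_eq_mul,
          ENNReal.ofReal_mul (Nat.cast_nonneg n), ENNReal.ofReal_natCast]

end Slab

section DyadicSmooth

variable {n : ℕ} {R σ A B : ℝ} {κ : Rn n → ℂ}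

/-- A representative of the cell of `y`, depending only on the cell. -/
lemma exists_rep (n : ℕ) (j : ℤ) : ∃ rep : Rn n → Rn n, (∀ y, dcell j (rep y) = dcell j y) ∧
    ∀ x y, dcell j y = dcell j x → rep y = rep x := by
  classical
  refine ⟨fun y => Function.invFun (dcell j) (dcell j y), fun y => ?_, fun x y h => by simp only [h]⟩
  exact Function.invFun_eq (f := dcell j) ⟨y, rfl⟩

lemma lintegral_indicator_closedBall_const (n : ℕ) {c ρ : ℝ} (hc : 0 ≤ c) (hρ : 0 ≤ ρ) :
    ∫⁻ t : Rn n, (Metric.closedBall 0 ρ).indicator (fun _ => ENNReal.ofReal c) t =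
      ENNReal.ofReal (c * ρ ^ n * unitVol n) := by
  rw [lintegral_indicator measurableSet_closedBall, lintegral_const, Measure.restrict_apply_univ,
    ← ofReal_measureReal measure_closedBall_lt_top.ne, Measure.addHaar_real_closedBall _ _ hρ,
    finrank_euclideanSpace_fin, ← ENNReal.ofReal_mul hc, unitVol, mul_assoc]

lemma lintegral_enorm_le_of_supp {g : Rn n → ℂ} {c ρ : ℝ} (hρ : 0 ≤ ρ) (hg : ∀ t, ‖g t‖ ≤ c)
    (h0 : ∀ t, ρ < ‖t‖ → g t = 0) : ∫⁻ t, ‖g t‖ₑ ≤ ENNReal.ofReal (c * ρ ^ n * unitVol n) := by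
  rw [← lintegral_indicator_closedBall_const n ((norm_nonneg _).trans (hg 0)) hρ]
  refine lintegral_mono fun t => ?_
  by_cases ht : ρ < ‖t‖
  · simp [h0 t ht]
  · rw [indicator_of_mem (by simpa using ht), ← ofReal_norm]
    exact ENNReal.ofReal_le_ofReal (hg t)

lemma lintegral_opConv_sq_le_of_dyadicAvg_eq_zero (hκ : ScaleKer R σ A B κ) (hσ : 0 < σ)
    (hR : 0 ≤ R) (hB : 0 ≤ B) {h : Rn n → ℂ} (hh : Nice h) {j : ℤ}
    (h0 : ∀ x, dyadicAvg j h x = 0) :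
    ∫⁻ x, ‖opConv (mulK κ) h x‖ₑ ^ (2 : ℝ) ≤
      ENNReal.ofReal ((B * (σ ^ (n + 1))⁻¹ * (√n * (2 ^ j)⁻¹) * (R * σ + √n * (2 ^ j)⁻¹) ^ n *
        unitVol n) ^ 2) * ∫⁻ x, ‖h x‖ₑ ^ (2 : ℝ) := by
  obtain ⟨rep, hr1, hr2⟩ := exists_rep n j
  set δ : ℝ := √n * (2 ^ j)⁻¹ with hδ
  have hδ0 : 0 ≤ δ := by positivity
  set c : ℝ := B * (σ ^ (n + 1))⁻¹ * δ with hc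
  have hc0 : 0 ≤ c := by positivity
  set w : Rn n → ℝ≥0∞ :=
    (Metric.closedBall 0 (R * σ + δ)).indicator fun _ => ENNReal.ofReal c with hw
  have hrep : ∀ y, ‖rep y - y‖ ≤ δ := fun y => norm_sub_le_of_dcell (hr1 y)
  obtain ⟨C, -, hC⟩ := exists_bound_of_cc (continuous_mulK hκ.continuous)
    (hasCompactSupport_mulK hκ.hasCompactSupport)
  have hpt : ∀ x y, ‖κ (x - y) - κ (x - rep y)‖ₑ ≤ w (x - y) := fun x y => by
    by_cases hxy : R * σ + δ < ‖x - y‖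
    · have h2 : R * σ < ‖x - rep y‖ := by
        have := norm_sub_le_norm_sub_add_norm_sub x (rep y) y
        linarith [hrep y]
      rw [hκ.supp _ h2, hκ.supp _ (by linarith)]
      simp
    · rw [hw, indicator_of_mem (by simpa using hxy), ← ofReal_norm]
      refine ENNReal.ofReal_le_ofReal ((hκ.lip _ _).trans ?_)
      rw [hc, sub_sub_sub_cancel_left]
      gcongr
      exact hrep y
  have hle : ∀ x, ‖opConv (mulK κ) h x‖ₑ ≤ ∫⁻ y, w (x - y) * ‖h y‖ₑ := fun x => by
    have hz : ∫ y, mulK κ (x - rep y) (h y) = 0 := by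
      rw [← integral_apply_dyadicAvg hh.int (j := j) (φ := fun y => mulK κ (x - rep y))
        (fun x y hxy => by simp only [hr2 _ _ hxy]) fun y => hC _]
      simp [h0]
    have hm : StronglyMeasurable fun y => mulK κ (x - rep y) :=
      stronglyMeasurable_of_dcell (j := j) fun x y hxy => by simp only [hr2 _ _ hxy]
    have hi : Integrable fun y => mulK κ (x - rep y) (h y) := by
      refine Integrable.mono' (hh.int.norm.const_mul C) ?_ (.of_forall fun y =>
        (ContinuousLinearMap.le_opNorm _ _).trans (by gcongr; exact hC _))
      exact (ContinuousLinearMap.apply ℝ ℂ).flip.aestronglyMeasurable_comp₂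
        hm.aestronglyMeasurable hh.meas.aestronglyMeasurable
    have he : opConv (mulK κ) h x = ∫ y, (κ (x - y) - κ (x - rep y)) * h y := by
      rw [opConv, ← sub_zero (∫ y, _), ← hz, ← integral_sub (integrable_opConv_integrand
        (continuous_mulK hκ.continuous) (hasCompactSupport_mulK hκ.hasCompactSupport) hh.int x) hi]
      simp only [mulK_apply, sub_mul]
    rw [he]
    refine (enorm_integral_le_lintegral_enorm _).trans (lintegral_mono fun y => ?_)
    rw [enorm_mul]
    exact mul_le_mul_left (hpt x y) _
  calc ∫⁻ x, ‖opConv (mulK κ) h x‖ₑ ^ (2 : ℝ)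
      ≤ ∫⁻ x, (∫⁻ y, w (x - y) * ‖h y‖ₑ) ^ (2 : ℝ) :=
        lintegral_mono fun x => ENNReal.rpow_le_rpow (hle x) zero_le_two
    _ ≤ (∫⁻ x, w x) ^ (2 : ℝ) * ∫⁻ x, ‖h x‖ₑ ^ (2 : ℝ) :=
        lintegral_conv_sq_le (measurable_const.indicator measurableSet_closedBall) hh.meas.enorm
    _ = _ := by
        rw [hw, lintegral_indicator_closedBall_const n hc0 (by positivity), ENNReal.rpow_two,
          ENNReal.ofReal_pow]
        have := unitVol_pos n
        positivity

lemma lintegral_indicator_shift_le {h : Rn n → ℂ} {j : ℤ}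
    (hj : ∀ x y, dcell j y = dcell j x → h y = h x) (t : Rn n) :
    ∫⁻ x, {y | dcell j (y - t) ≠ dcell j y}.indicator (fun y => ‖h y‖ₑ ^ (2 : ℝ)) x ≤
      ENNReal.ofReal (n * (‖t‖ * 2 ^ j)) * ∫⁻ x, ‖h x‖ₑ ^ (2 : ℝ) := by
  have hms : MeasurableSet {y : Rn n | dcell j (y - t) ≠ dcell j y} :=
    (measurableSet_eq_fun ((measurable_dcell j).comp (measurable_id.sub measurable_const))
      (measurable_dcell j)).compl
  rw [← lintegral_const_mul _ ((stronglyMeasurable_of_dcell hj).enorm.pow_const _)]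
  refine lintegral_mono_of_dcube j fun x => ?_
  have h1 : ∀ y ∈ dcube j x,
      {y | dcell j (y - t) ≠ dcell j y}.indicator (fun y => ‖h y‖ₑ ^ (2 : ℝ)) y =
        {y | dcell j (y - t) ≠ dcell j y}.indicator (fun _ => ‖h x‖ₑ ^ (2 : ℝ)) y := fun y hy => by
    simp only [indicator, hj x y hy]
  have h2 : ∀ y ∈ dcube j x, ENNReal.ofReal (n * (‖t‖ * 2 ^ j)) * ‖h y‖ₑ ^ (2 : ℝ) =
      ENNReal.ofReal (n * (‖t‖ * 2 ^ j)) * ‖h x‖ₑ ^ (2 : ℝ) := fun y hy => by rw [hj x y hy]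
  rw [setLIntegral_congr_fun (measurableSet_dcube j x) h1,
    setLIntegral_congr_fun (measurableSet_dcube j x) h2, lintegral_indicator hms,
    Measure.restrict_restrict hms, setLIntegral_const, setLIntegral_const, inter_comm,
    mul_comm _ (‖h x‖ₑ ^ (2 : ℝ)), mul_assoc]
  exact mul_le_mul_right (volume_dcube_shift_le j x t) _

lemma lintegral_sub_shift_sq_le {h : Rn n → ℂ} {j : ℤ}
    (hj : ∀ x y, dcell j y = dcell j x → h y = h x) (t : Rn n) :
    ∫⁻ x, ‖h x - h (x - t)‖ₑ ^ (2 : ℝ) ≤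
      ENNReal.ofReal (4 * (n * (‖t‖ * 2 ^ j))) * ∫⁻ x, ‖h x‖ₑ ^ (2 : ℝ) := by
  set N : Rn n → Set (Rn n) := fun t => {y | dcell j (y - t) ≠ dcell j y} with hN
  set u : Rn n → ℝ≥0∞ := fun y => ‖h y‖ₑ ^ (2 : ℝ) with hu
  have hmu : Measurable u := (stronglyMeasurable_of_dcell hj).enorm.pow_const _
  have hms : ∀ t, MeasurableSet (N t) := fun t =>
    (measurableSet_eq_fun ((measurable_dcell j).comp (measurable_id.sub measurable_const))
      (measurable_dcell j)).compl
  have hpt : ∀ x, ‖h x - h (x - t)‖ₑ ^ (2 : ℝ) ≤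
      2 * ((N t).indicator u x + (N (-t)).indicator u (x - t)) := fun x => by
    by_cases hx : dcell j (x - t) = dcell j x
    · rw [hj _ _ hx]; simp
    · rw [indicator_of_mem (show x ∈ N t from hx), indicator_of_mem
        (show x - t ∈ N (-t) by simp only [hN, Set.mem_ofPred_eq, sub_neg_eq_add, sub_add_cancel];
                                exact Ne.symm hx)]
      refine (ENNReal.rpow_le_rpow enorm_sub_le zero_le_two).trans ?_
      refine (ENNReal.rpow_add_le_mul_rpow_add_rpow _ _ one_le_two).trans (le_of_eq ?_)
      norm_num [hu]
  refine (lintegral_mono hpt).trans ?_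
  have hm1 : Measurable fun x => (N t).indicator u x := hmu.indicator (hms t)
  have hm2 : Measurable fun x => (N (-t)).indicator u (x - t) :=
    (hmu.indicator (hms (-t))).comp (measurable_id.sub measurable_const)
  have hm12 : Measurable fun x => (N t).indicator u x + (N (-t)).indicator u (x - t) :=
    hm1.add hm2
  rw [lintegral_const_mul _ hm12, lintegral_add_left hm1,
    lintegral_sub_right_eq_self (fun x => (N (-t)).indicator u x) t]
  have h1 := lintegral_indicator_shift_le hj t
  have h2 := lintegral_indicator_shift_le hj (-t)
  rw [norm_neg] at h2
  refine (mul_le_mul_right (add_le_add h1 h2) _).trans (le_of_eq ?_)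
  rw [← two_mul, ← mul_assoc, ← mul_assoc, ENNReal.ofReal_mul (p := 4) (by norm_num)]
  norm_num [hu]

lemma lintegral_sub_opConv_sq_le (hκ : ScaleKer R σ A B κ) (hσ : 0 < σ) (hR : 0 ≤ R)
    (h1 : ∫ t, κ t = 1) {h : Rn n → ℂ} (hh : Nice h) {j : ℤ}
    (hj : ∀ x y, dcell j y = dcell j x → h y = h x) :
    ∫⁻ x, ‖h x - opConv (mulK κ) h x‖ₑ ^ (2 : ℝ) ≤
      ENNReal.ofReal ((A * R ^ n * unitVol n) ^ 2 * (4 * (n * (R * σ * 2 ^ j)))) *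
        ∫⁻ x, ‖h x‖ₑ ^ (2 : ℝ) := by
  have hA := hκ.nonneg_bd hσ
  have hvol := unitVol_pos n
  have hmκ : Measurable fun t => ‖κ t‖ₑ := hκ.continuous.measurable.enorm
  have hκ1 : ∫⁻ t, ‖κ t‖ₑ ≤ ENNReal.ofReal (A * R ^ n * unitVol n) := by
    refine (lintegral_enorm_le_of_supp (by positivity) hκ.bd hκ.supp).trans (le_of_eq ?_)
    rw [mul_pow]; field_simp
  have hmh : Measurable fun q : Rn n × Rn n => ‖h q.1 - h (q.1 - q.2)‖ₑ ^ (2 : ℝ) := by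
    have h1 : StronglyMeasurable fun q : Rn n × Rn n => h q.1 := hh.meas.comp_measurable measurable_fst
    have h2 : StronglyMeasurable fun q : Rn n × Rn n => h (q.1 - q.2) :=
      hh.meas.comp_measurable (measurable_fst.sub measurable_snd)
    exact (h1.sub h2).enorm.pow_const _
  have hle : ∀ x, ‖h x - opConv (mulK κ) h x‖ₑ ≤ ∫⁻ t, ‖κ t‖ₑ * ‖h x - h (x - t)‖ₑ := fun x => by
    have hi1 : Integrable fun y => κ (x - y) * h x := by
      have : Integrable fun y => κ (x - y) := hκ.integrable.comp_sub_left x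
      exact this.mul_const _
    have he : h x - opConv (mulK κ) h x = ∫ y, κ (x - y) * (h x - h y) := by
      have h3 : ∫ y, κ (x - y) * h x = h x := by
        rw [integral_mul_const, integral_sub_left_eq_self κ volume x, h1, one_mul]
      conv_lhs => rw [← h3]
      rw [opConv, ← integral_sub hi1 (integrable_opConv_integrand
        (continuous_mulK hκ.continuous) (hasCompactSupport_mulK hκ.hasCompactSupport) hh.int x)]
      simp only [mulK_apply, mul_sub]
    rw [he]
    refine (enorm_integral_le_lintegral_enorm _).trans (le_of_eq ?_)
    rw [← lintegral_sub_left_eq_self (fun t => ‖κ t‖ₑ * ‖h x - h (x - t)‖ₑ) x]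
    simp only [enorm_mul, sub_sub_cancel]
  have hsq : ∀ x, ‖h x - opConv (mulK κ) h x‖ₑ ^ (2 : ℝ) ≤
      (∫⁻ t, ‖κ t‖ₑ) * ∫⁻ t, ‖κ t‖ₑ * ‖h x - h (x - t)‖ₑ ^ (2 : ℝ) := fun x =>
    (ENNReal.rpow_le_rpow (hle x) zero_le_two).trans (sq_lintegral_mul_le hmκ.aemeasurable
      (((stronglyMeasurable_const.sub (hh.meas.comp_measurable
        (measurable_const.sub measurable_id))).enorm).aemeasurable))
  have hm3 : Measurable fun q : Rn n × Rn n => ‖κ q.2‖ₑ * ‖h q.1 - h (q.1 - q.2)‖ₑ ^ (2 : ℝ) :=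
    (hmκ.comp measurable_snd).mul hmh
  refine (lintegral_mono hsq).trans ?_
  rw [lintegral_const_mul _ hm3.lintegral_prod_right',
    lintegral_lintegral_swap hm3.aemeasurable]
  set X := ∫⁻ x, ‖h x‖ₑ ^ (2 : ℝ) with hX
  have hin : ∀ t, ∫⁻ x, ‖κ t‖ₑ * ‖h x - h (x - t)‖ₑ ^ (2 : ℝ) ≤
      ‖κ t‖ₑ * (ENNReal.ofReal (4 * (n * (R * σ * 2 ^ j))) * X) := fun t => by
    have hm4 : Measurable fun x => ‖h x - h (x - t)‖ₑ ^ (2 : ℝ) :=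
      hmh.comp (measurable_id.prodMk measurable_const)
    rw [lintegral_const_mul _ hm4]
    by_cases ht : R * σ < ‖t‖
    · simp [hκ.supp t ht]
    · refine mul_le_mul_right ((lintegral_sub_shift_sq_le hj t).trans (mul_le_mul_left
        (ENNReal.ofReal_le_ofReal ?_) _)) _
      gcongr
      exact not_lt.1 ht
  refine (mul_le_mul_right (lintegral_mono hin) _).trans ?_
  rw [lintegral_mul_const _ hmκ, ← mul_assoc, ← mul_assoc]
  refine mul_le_mul_left ((mul_le_mul_left (mul_le_mul' hκ1 hκ1) _).trans (le_of_eq ?_)) _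
  rw [← ENNReal.ofReal_mul (by positivity), ← ENNReal.ofReal_mul (by positivity), sq]

end DyadicSmooth

section MartingaleEstimates

variable {n : ℕ}

lemma sum_pow_dist_le {θ : ℝ} (h0 : 0 < θ) (h1 : θ < 1) (M k : ℕ) :
    ∑ m ∈ Finset.range M, θ ^ ((k - m) + (m - k)) ≤ 2 * (1 - θ)⁻¹ := by
  have hg : ∀ L : ℕ, ∑ i ∈ Finset.range L, θ ^ i ≤ (1 - θ)⁻¹ := fun L => by
    rw [← tsum_geometric_of_lt_one h0.le h1]
    exact (summable_geometric_of_lt_one h0.le h1).sum_le_tsum _ fun i _ => by positivity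
  calc ∑ m ∈ Finset.range M, θ ^ ((k - m) + (m - k))
      ≤ ∑ m ∈ Finset.range (k + 1 + M), θ ^ ((k - m) + (m - k)) :=
        Finset.sum_le_sum_of_subset_of_nonneg (by simp) fun i _ _ => by positivity
    _ = (∑ m ∈ Finset.range (k + 1), θ ^ ((k - m) + (m - k))) +
          ∑ i ∈ Finset.range M, θ ^ ((k - (k + 1 + i)) + (k + 1 + i - k)) :=
        Finset.sum_range_add _ _ _
    _ ≤ (1 - θ)⁻¹ + (1 - θ)⁻¹ := by
        refine add_le_add ?_ ?_
        · rw [← Finset.sum_range_reflect]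
          refine (Finset.sum_le_sum fun i hi => ?_).trans (hg (k + 1))
          rw [Finset.mem_range] at hi
          refine le_of_eq (congrArg _ ?_)
          omega
        · refine (Finset.sum_le_sum fun i hi => ?_).trans (hg M)
          exact pow_le_pow_of_le_one h0.le h1.le (by omega)
    _ = _ := by ring

lemma sum_lintegral_sum_sq_le {θ C : ℝ} (h0 : 0 < θ) (h1 : θ < 1) (hC : 0 ≤ C)
    {M N : ℕ} {h : ℕ → ℕ → Rn n → ℂ} {X : ℕ → ℝ≥0∞}
    (hm : ∀ k m, Measurable (h k m))
    (hb : ∀ k < N, ∀ m < M, ∫⁻ x, ‖h k m x‖ₑ ^ (2 : ℝ) ≤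
      ENNReal.ofReal (C * (θ ^ ((k - m) + (m - k))) ^ 2) * X m) :
    ∑ k ∈ Finset.range N, ∫⁻ x, ‖∑ m ∈ Finset.range M, h k m x‖ₑ ^ (2 : ℝ) ≤
      ENNReal.ofReal (C * (2 * (1 - θ)⁻¹) ^ 2) * ∑ m ∈ Finset.range M, X m := by
  set W : ℝ := 2 * (1 - θ)⁻¹ with hW
  have hW0 : 0 ≤ W := by have : 0 < 1 - θ := by linarith
                         positivity
  have hpt : ∀ k x, ‖∑ m ∈ Finset.range M, h k m x‖ₑ ^ (2 : ℝ) ≤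
      ∑ m ∈ Finset.range M, ENNReal.ofReal (W * (θ ^ ((k - m) + (m - k)))⁻¹) *
        ‖h k m x‖ₑ ^ (2 : ℝ) := fun k x => by
    have hr : ‖∑ m ∈ Finset.range M, h k m x‖ ^ 2 ≤
        ∑ m ∈ Finset.range M, W * (θ ^ ((k - m) + (m - k)))⁻¹ * ‖h k m x‖ ^ 2 := by
      have h2 := Finset.sum_sq_le_sum_mul_sum_of_sq_le_mul (Finset.range M)
        (r := fun m => ‖h k m x‖) (f := fun m => θ ^ ((k - m) + (m - k)))
        (g := fun m => (θ ^ ((k - m) + (m - k)))⁻¹ * ‖h k m x‖ ^ 2)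
        (fun m _ => by positivity) (fun m _ => by positivity)
        (fun m _ => by
          have : θ ^ ((k - m) + (m - k)) ≠ 0 := by positivity
          exact le_of_eq (by field_simp))
      calc ‖∑ m ∈ Finset.range M, h k m x‖ ^ 2 ≤ (∑ m ∈ Finset.range M, ‖h k m x‖) ^ 2 := by
            gcongr; exact norm_sum_le _ _
        _ ≤ _ := h2
        _ ≤ W * ∑ m ∈ Finset.range M, (θ ^ ((k - m) + (m - k)))⁻¹ * ‖h k m x‖ ^ 2 :=
            mul_le_mul_of_nonneg_right (sum_pow_dist_le h0 h1 M k)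
              (Finset.sum_nonneg fun m _ => by positivity)
        _ = _ := by rw [Finset.mul_sum]; exact Finset.sum_congr rfl fun m _ => by ring
    have hof : ∀ z : ℂ, ‖z‖ₑ ^ (2 : ℝ) = ENNReal.ofReal (‖z‖ ^ 2) := fun z => by
      rw [ENNReal.rpow_two, ENNReal.ofReal_pow (norm_nonneg _), ofReal_norm]
    simp only [hof]
    refine (ENNReal.ofReal_le_ofReal hr).trans (le_of_eq ?_)
    rw [ENNReal.ofReal_sum_of_nonneg fun m _ => by positivity]
    exact Finset.sum_congr rfl fun m _ => ENNReal.ofReal_mul (by positivity)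
  have hk : ∀ k ∈ Finset.range N, ∫⁻ x, ‖∑ m ∈ Finset.range M, h k m x‖ₑ ^ (2 : ℝ) ≤
      ∑ m ∈ Finset.range M, ENNReal.ofReal (W * C) *
        (ENNReal.ofReal (θ ^ ((k - m) + (m - k))) * X m) := fun k hk => by
    refine (lintegral_mono (hpt k)).trans ?_
    rw [lintegral_finsetSum _ fun m _ => ((hm k m).enorm.pow_const _).const_mul _]
    refine Finset.sum_le_sum fun m hm' => ?_
    rw [lintegral_const_mul _ ((hm k m).enorm.pow_const _)]
    refine (mul_le_mul_right (hb k (Finset.mem_range.1 hk) m (Finset.mem_range.1 hm')) _).trans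
      (le_of_eq ?_)
    rw [← mul_assoc, ← mul_assoc, ← ENNReal.ofReal_mul (by positivity),
      ← ENNReal.ofReal_mul (by positivity)]
    congr 2
    field_simp
  refine (Finset.sum_le_sum hk).trans ?_
  rw [Finset.sum_comm, Finset.mul_sum]
  refine Finset.sum_le_sum fun m _ => ?_
  rw [← Finset.mul_sum, ← Finset.sum_mul, ← mul_assoc,
    ← ENNReal.ofReal_sum_of_nonneg fun m _ => by positivity,
    ← ENNReal.ofReal_mul (by positivity)]
  refine mul_le_mul_left (ENNReal.ofReal_le_ofReal ?_) _
  have := sum_pow_dist_le h0 h1 N m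
  simp only [add_comm (m - _)] at this
  calc W * C * _ ≤ W * C * W := by gcongr
    _ = _ := by ring

end MartingaleEstimates

section MartingaleDifferences

variable {n : ℕ}

/-- The martingale of `g` up to time `N`, completed by `g` itself. -/
def fullMart (j : ℕ → ℤ) (N : ℕ) (g : Rn n → ℂ) (m : ℕ) : Rn n → ℂ :=
  if m ≤ N then dyadicAvg (j m) g else g

/-- Differences of `fullMart`. -/
def martDiff (j : ℕ → ℤ) (N : ℕ) (g : Rn n → ℂ) : ℕ → Rn n → ℂ
  | 0 => fullMart j N g 0
  | m + 1 => fullMart j N g (m + 1) - fullMart j N g m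

section

variable {j : ℕ → ℤ} {N : ℕ} {g : Rn n → ℂ}

lemma nice_fullMart (hg : Nice g) (m : ℕ) : Nice (fullMart j N g m) := by
  unfold fullMart
  split_ifs
  exacts [hg.dyadicAvg _, hg]

lemma nice_martDiff (hg : Nice g) (m : ℕ) : Nice (martDiff j N g m) := by
  cases m with
  | zero => exact nice_fullMart hg 0
  | succ m => exact (nice_fullMart hg _).sub (nice_fullMart hg _)

lemma sum_martDiff (m : ℕ) (x : Rn n) :
    ∑ i ∈ Finset.range (m + 1), martDiff j N g i x = fullMart j N g m x := by
  induction m with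
  | zero => simp [martDiff]
  | succ m ih => rw [Finset.sum_range_succ, ih, martDiff]; simp

lemma dyadicAvg_fullMart (hj : Monotone j) (hg : Nice g) {m : ℕ} (hm : m ≤ N) :
    dyadicAvg (j m) (fullMart j N g (m + 1)) = fullMart j N g m := by
  have h2 : fullMart j N g m = dyadicAvg (j m) g := if_pos hm
  rw [h2, fullMart]
  split_ifs
  · exact dyadicAvg_dyadicAvg (hj m.le_succ) hg.int
  · rfl

lemma dyadicAvg_martDiff (hj : Monotone j) (hg : Nice g) {m : ℕ} (hm : m ≤ N) :
    dyadicAvg (j m) (martDiff j N g (m + 1)) = 0 := by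
  have h2 : fullMart j N g m = dyadicAvg (j m) g := if_pos hm
  have h3 : dyadicAvg (j m) (martDiff j N g (m + 1)) + dyadicAvg (j m) (fullMart j N g m) =
      dyadicAvg (j m) (fullMart j N g (m + 1)) := by
    rw [← dyadicAvg_add (nice_martDiff hg _).int (nice_fullMart hg _).int, martDiff,
      sub_add_cancel]
  rwa [dyadicAvg_fullMart hj hg hm, h2, dyadicAvg_dyadicAvg le_rfl hg.int, add_eq_right] at h3

lemma martDiff_congr (hj : Monotone j) {m : ℕ} (hm : m ≤ N) {x y : Rn n}
    (h : dcell (j m) y = dcell (j m) x) : martDiff j N g m y = martDiff j N g m x := by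
  cases m with
  | zero =>
    simp only [martDiff, fullMart, if_pos hm]
    exact dyadicAvg_congr h g
  | succ m =>
    simp only [martDiff, fullMart, if_pos hm, if_pos (m.le_succ.trans hm), Pi.sub_apply]
    rw [dyadicAvg_congr h g, dyadicAvg_congr (dcell_mono (hj m.le_succ) h) g]

lemma sum_integral_martDiff_sq (hj : Monotone j) (hg : Nice g) {m : ℕ} (hm : m ≤ N + 1) :
    ∑ i ∈ Finset.range (m + 1), ∫ x, ‖martDiff j N g i x‖ ^ 2 =
      ∫ x, ‖fullMart j N g m x‖ ^ 2 := by
  induction m with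
  | zero => simp [martDiff]
  | succ m ih =>
    rw [Finset.sum_range_succ, ih (by omega),
      integral_norm_sq_dyadicAvg_add (j m) (nice_fullMart hg (m + 1)),
      dyadicAvg_fullMart hj hg (by omega), add_comm]
    rfl

lemma sum_lintegral_martDiff_sq (hj : Monotone j) (hg : Nice g) :
    ∑ i ∈ Finset.range (N + 2), ∫⁻ x, ‖martDiff j N g i x‖ₑ ^ (2 : ℝ) =
      ∫⁻ x, ‖g x‖ₑ ^ (2 : ℝ) := by
  simp only [lintegral_sq_eq (nice_martDiff hg _), lintegral_sq_eq hg]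
  rw [← ENNReal.ofReal_sum_of_nonneg fun i _ => integral_nonneg fun x => by positivity,
    sum_integral_martDiff_sq hj hg le_rfl]
  simp [fullMart]

lemma sum_opConv_martDiff {κ : Rn n → ℂ →L[ℝ] ℂ} (hκ : Continuous κ) (hc : HasCompactSupport κ)
    (hg : Nice g) (m : ℕ) (x : Rn n) :
    ∑ i ∈ Finset.range (m + 1), opConv κ (martDiff j N g i) x = opConv κ (fullMart j N g m) x := by
  induction m with
  | zero => simp [martDiff]
  | succ m ih =>
    rw [Finset.sum_range_succ, ih, martDiff, opConv_sub hκ hc (nice_fullMart hg _).int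
      (nice_fullMart hg _).int]
    simp

end

/-- Dyadic averages are comparable in square function sense to smooth averages at lacunary
scales. -/
theorem exists_sum_lintegral_dyadicAvg_sub_le (n : ℕ) {R A ρ : ℝ} (hR : 0 ≤ R) (hA : 0 ≤ A)
    (hρ0 : 0 < ρ) (hρ1 : ρ < 1) :
    ∃ C : ℝ, 0 ≤ C ∧ ∀ (j : ℕ → ℤ) (σ : ℕ → ℝ) (φ : ℕ → Rn n → ℂ), Monotone j →
      (∀ k, 0 < σ k) → (∀ k, ((2 : ℝ) ^ j k)⁻¹ ≤ σ k) → (∀ k, σ k ≤ 2 * ((2 : ℝ) ^ j k)⁻¹) →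
      (∀ k, σ (k + 1) ≤ ρ * σ k) → (∀ k, ScaleKer R (σ k) A A (φ k)) → (∀ k, ∫ t, φ k t = 1) →
      ∀ N : ℕ, ∀ g : Rn n → ℂ, Nice g →
      ∑ k ∈ Finset.range (N + 1), ∫⁻ x, ‖dyadicAvg (j k) g x - opConv (mulK (φ k)) g x‖ₑ ^ (2 : ℝ) ≤
        ENNReal.ofReal C * ∫⁻ x, ‖g x‖ₑ ^ (2 : ℝ) := by
  set θ : ℝ := √ρ with hθ
  have hθ0 : 0 < θ := Real.sqrt_pos.2 hρ0
  have hθ1 : θ < 1 := by rw [hθ, Real.sqrt_lt' one_pos]; simpa using hρ1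
  have hθρ : ∀ d : ℕ, (θ ^ d) ^ 2 = ρ ^ d := fun d => by
    rw [← pow_mul, mul_comm, pow_mul, Real.sq_sqrt hρ0.le]
  have hv := unitVol_pos n
  set C1 : ℝ := (A * R ^ n * unitVol n) ^ 2 * (4 * (n * (R * 2))) with hC1
  set C2 : ℝ := (A * √n * (R + √n) ^ n * unitVol n) ^ 2 * ρ⁻¹ with hC2
  have hC10 : 0 ≤ C1 := by positivity
  have hC20 : 0 ≤ C2 := by positivity
  refine ⟨(C1 + C2) * (2 * (1 - θ)⁻¹) ^ 2, by positivity, ?_⟩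
  intro j σ φ hj hσ hδ1 hδ2 hlac hφ hφ1 N g hg
  have hlac' : ∀ k d : ℕ, σ (k + d) ≤ ρ ^ d * σ k := fun k d => by
    induction d with
    | zero => simp
    | succ d ih =>
      calc σ (k + (d + 1)) ≤ ρ * σ (k + d) := hlac _
        _ ≤ ρ * (ρ ^ d * σ k) := by gcongr
        _ = _ := by ring
  have hc := fun k => continuous_mulK (hφ k).continuous
  have hcc := fun k => hasCompactSupport_mulK (hφ k).hasCompactSupport
  set h : ℕ → ℕ → Rn n → ℂ := fun k m x =>
    (if m ≤ k then martDiff j N g m x else 0) - opConv (mulK (φ k)) (martDiff j N g m) x with hh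
  have hsum : ∀ k ∈ Finset.range (N + 1), ∀ x, dyadicAvg (j k) g x - opConv (mulK (φ k)) g x =
      ∑ m ∈ Finset.range (N + 2), h k m x := fun k hk x => by
    rw [Finset.mem_range] at hk
    simp only [hh]
    rw [Finset.sum_sub_distrib, sum_opConv_martDiff (hc k) (hcc k) hg, ← Finset.sum_filter]
    have h1 : (Finset.range (N + 2)).filter (· ≤ k) = Finset.range (k + 1) := by
      ext m; simp only [Finset.mem_filter, Finset.mem_range]; omega
    rw [h1, sum_martDiff]
    simp [fullMart, Nat.lt_succ_iff.1 hk]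
  rw [Finset.sum_congr rfl fun k hk => lintegral_congr fun x => by rw [hsum k hk x]]
  rw [← sum_lintegral_martDiff_sq (N := N) hj hg]
  refine sum_lintegral_sum_sq_le hθ0 hθ1 (by positivity) (fun k m => ?_) fun k hk m hm => ?_
  · have h1 := (nice_martDiff (j := j) (N := N) hg m).meas.measurable
    have h2 := (continuous_opConv (hc k) (hcc k) (nice_martDiff (j := j) (N := N) hg m).int).measurable
    simp only [hh]
    split_ifs
    exacts [h1.sub h2, measurable_const.sub h2]
  · rw [hθρ]
    by_cases hmk : m ≤ k
    · simp only [hh, if_pos hmk]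
      refine (lintegral_sub_opConv_sq_le (hφ k) (hσ k) hR (hφ1 k) (nice_martDiff hg m)
        fun x y => martDiff_congr hj (by omega)).trans (mul_le_mul_left (ENNReal.ofReal_le_ofReal ?_) _)
      have h1 : σ k * 2 ^ j m ≤ 2 * ρ ^ ((k - m) + (m - k)) := by
        have h2 := hlac' m (k - m)
        rw [Nat.add_sub_cancel' hmk] at h2
        rw [Nat.sub_eq_zero_of_le hmk, add_zero]
        have h3 : (0 : ℝ) < 2 ^ j m := by positivity
        calc σ k * 2 ^ j m ≤ ρ ^ (k - m) * (2 * ((2 : ℝ) ^ j m)⁻¹) * 2 ^ j m := by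
              gcongr; exact h2.trans (by gcongr; exact hδ2 m)
          _ = _ := by field_simp
      calc (A * R ^ n * unitVol n) ^ 2 * (4 * (n * (R * σ k * 2 ^ j m)))
          = (A * R ^ n * unitVol n) ^ 2 * (4 * (n * (R * (σ k * 2 ^ j m)))) := by ring
        _ ≤ (A * R ^ n * unitVol n) ^ 2 * (4 * (n * (R * (2 * ρ ^ ((k - m) + (m - k)))))) := by
            gcongr
        _ = C1 * ρ ^ ((k - m) + (m - k)) := by rw [hC1]; ring
        _ ≤ _ := by gcongr; linarith
    · obtain ⟨d, rfl⟩ : ∃ d, m = k + d + 1 := ⟨m - k - 1, by omega⟩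
      simp only [hh, if_neg hmk, zero_sub, enorm_neg]
      refine (lintegral_opConv_sq_le_of_dyadicAvg_eq_zero (hφ k) (hσ k) hR hA (nice_martDiff hg _)
        (j := j (k + d)) fun x => ?_).trans (mul_le_mul_left (ENNReal.ofReal_le_ofReal ?_) _)
      · rw [dyadicAvg_martDiff hj hg (by omega)]; rfl
      · have hd : (k - (k + d + 1)) + (k + d + 1 - k) = d + 1 := by omega
        rw [hd]
        have h2 : ((2 : ℝ) ^ j (k + d))⁻¹ ≤ ρ ^ d * σ k := (hδ1 _).trans (hlac' k d)
        have h3 : ((2 : ℝ) ^ j (k + d))⁻¹ ≤ σ k :=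
          h2.trans (mul_le_of_le_one_left (hσ k).le (pow_le_one₀ hρ0.le hρ1.le))
        have hsk := hσ k
        calc (A * (σ k ^ (n + 1))⁻¹ * (√n * (2 ^ j (k + d))⁻¹) *
              (R * σ k + √n * (2 ^ j (k + d))⁻¹) ^ n * unitVol n) ^ 2
            ≤ (A * (σ k ^ (n + 1))⁻¹ * (√n * (ρ ^ d * σ k)) *
              (R * σ k + √n * σ k) ^ n * unitVol n) ^ 2 := by gcongr
          _ = (A * √n * (R + √n) ^ n * unitVol n) ^ 2 * (ρ ^ d) ^ 2 := by
              rw [← add_mul, mul_pow _ (σ k)]; field_simp; ring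
          _ ≤ (A * √n * (R + √n) ^ n * unitVol n) ^ 2 * ρ ^ d := by
              gcongr
              rw [pow_two]
              exact mul_le_of_le_one_left (by positivity) (pow_le_one₀ hρ0.le hρ1.le)
          _ = C2 * ρ ^ (d + 1) := by rw [hC2]; field_simp; ring
          _ ≤ _ := by gcongr; linarith

end MartingaleDifferences

/-- Finite sequences of indices. -/
abbrev Chain := Σ J : ℕ, (Fin (J + 1) → ℕ)

/-- The target space of the jump operators along finitely many chains. -/
abbrev JumpSpace (r : ℝ) (s : Finset Chain) :=
  ∀ c : s, PiLp (ENNReal.ofReal r) (fun _ : Fin c.1.1 => ℂ)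

/-- The jumps of a sequence along finitely many chains. -/
def jumpVec (r : ℝ) (s : Finset Chain) (α : ℕ → ℂ) : JumpSpace r s :=
  fun c => WithLp.toLp _ fun i => α (c.1.2 i.succ) - α (c.1.2 i.castSucc)

/-- The chains of `s` are increasing and bounded by `N`. -/
def ChainsLe (s : Finset Chain) (N : ℕ) : Prop := ∀ c ∈ s, StrictMono c.2 ∧ ∀ i, c.2 i ≤ N

section JumpVec

variable {r : ℝ} {s : Finset Chain} {α : ℕ → ℂ} {N : ℕ}

lemma jumpVec_sub (α β : ℕ → ℂ) : jumpVec r s (fun k => α k - β k) =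
    jumpVec r s α - jumpVec r s β := by
  funext c
  ext i
  simp only [jumpVec, Pi.sub_apply, PiLp.sub_apply]
  ring

lemma jumpVec_add (α β : ℕ → ℂ) : jumpVec r s (fun k => α k + β k) =
    jumpVec r s α + jumpVec r s β := by
  funext c
  ext i
  simp only [jumpVec, Pi.add_apply, PiLp.add_apply]
  ring

variable [hq : Fact (1 ≤ ENNReal.ofReal r)]

lemma one_le_of_fact (r : ℝ) [hq : Fact (1 ≤ ENNReal.ofReal r)] : 1 ≤ r := by
  have := hq.out
  rwa [← ENNReal.ofReal_one, ENNReal.ofReal_le_ofReal_iff' , or_iff_left (by norm_num)] at this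

lemma norm_toLp_rpow {ι : Type} [Fintype ι] (v : ι → ℂ) :
    ‖(WithLp.toLp (ENNReal.ofReal r) v : PiLp (ENNReal.ofReal r) fun _ : ι => ℂ)‖ =
      (∑ i, ‖v i‖ ^ r) ^ (1 / r) := by
  have h1 := one_le_of_fact r
  rw [PiLp.norm_eq_sum (by rw [ENNReal.toReal_ofReal (by linarith)]; linarith)]
  rw [ENNReal.toReal_ofReal (by linarith)]

lemma norm_jumpVec_le {b : ℝ} (hb : 0 ≤ b)
    (h : ∀ c ∈ s, (∑ i, ‖α (c.2 (Fin.succ i)) - α (c.2 i.castSucc)‖ ^ r) ^ (1 / r) ≤ b) :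
    ‖jumpVec r s α‖ ≤ b := by
  rw [pi_norm_le_iff_of_nonneg hb]
  intro c
  rw [jumpVec, norm_toLp_rpow]
  exact h c.1 c.2

lemma le_norm_jumpVec {c : Chain} (hc : c ∈ s) :
    (∑ i, ‖α (c.2 (Fin.succ i)) - α (c.2 i.castSucc)‖ ^ r) ^ (1 / r) ≤ ‖jumpVec r s α‖ := by
  have h := norm_le_pi_norm (jumpVec r s α) ⟨c, hc⟩
  rwa [jumpVec, norm_toLp_rpow] at h

lemma rpow_sum_rpow_le {ι : Type*} [Fintype ι] {v : ι → ℝ} (hv : ∀ i, 0 ≤ v i) {p q b : ℝ}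
    (hp : 0 < p) (hpq : p ≤ q) (hb : 0 ≤ b) (h : ∑ i, v i ^ p ≤ b ^ p) :
    (∑ i, v i ^ q) ^ (1 / q) ≤ b := by
  have hvb : ∀ i, v i ≤ b := fun i => by
    refine (Real.rpow_le_rpow_iff (hv i) hb hp).1 (le_trans ?_ h)
    exact Finset.single_le_sum (f := fun i => v i ^ p)
      (fun i _ => Real.rpow_nonneg (hv i) _) (Finset.mem_univ i)
  have h1 : ∑ i, v i ^ q ≤ b ^ q := by
    have e : ∀ t : ℝ, 0 ≤ t → t ^ q = t ^ p * t ^ (q - p) := fun t ht => by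
      rw [← Real.rpow_add_of_nonneg ht hp.le (by linarith)]; congr 1; ring
    calc ∑ i, v i ^ q ≤ ∑ i, v i ^ p * b ^ (q - p) := by
          refine Finset.sum_le_sum fun i _ => ?_
          rw [e _ (hv i)]
          exact mul_le_mul_of_nonneg_left (Real.rpow_le_rpow (hv i) (hvb i) (by linarith))
            (Real.rpow_nonneg (hv i) _)
      _ = (∑ i, v i ^ p) * b ^ (q - p) := by rw [Finset.sum_mul]
      _ ≤ b ^ p * b ^ (q - p) := mul_le_mul_of_nonneg_right h (Real.rpow_nonneg hb _)
      _ = b ^ q := (e b hb).symm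
  have hs : 0 ≤ ∑ i, v i ^ q := Finset.sum_nonneg fun i _ => Real.rpow_nonneg (hv i) _
  calc (∑ i, v i ^ q) ^ (1 / q) ≤ (b ^ q) ^ (1 / q) :=
        Real.rpow_le_rpow hs h1 (one_div_nonneg.2 (by linarith))
    _ = b := by rw [← Real.rpow_mul hb, mul_one_div_cancel (by linarith), Real.rpow_one]

lemma sum_jump_le_sum {d : ℕ → ℝ} (hd0 : ∀ k, 0 ≤ d k) (hd : ∀ k, ‖α (k + 1) - α k‖ ≤ d k)
    (J : ℕ) (u : Fin (J + 1) → ℕ) (hu : Monotone u) :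
    ∑ i : Fin J, ‖α (u i.succ) - α (u i.castSucc)‖ ≤ ∑ k ∈ Finset.range (u (Fin.last J)), d k := by
  have hstep : ∀ a b : ℕ, a ≤ b → ‖α b - α a‖ + ∑ k ∈ Finset.range a, d k ≤
      ∑ k ∈ Finset.range b, d k := fun a b hab => by
    induction b, hab using Nat.le_induction with
    | base => simp
    | succ b hab ih =>
      rw [Finset.sum_range_succ]
      have := norm_sub_le_norm_sub_add_norm_sub (α (b + 1)) (α b) (α a)
      linarith [hd b]
  induction J with
  | zero => simpa using Finset.sum_nonneg fun k _ => hd0 k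
  | succ J ih =>
    rw [Fin.sum_univ_castSucc]
    have h1 := ih (u ∘ Fin.castSucc) (hu.comp Fin.strictMono_castSucc.monotone)
    have h2 := hstep (u (Fin.last J).castSucc) (u (Fin.last (J + 1))) (hu (Fin.le_last _))
    simp only [Function.comp_apply, ← Fin.succ_castSucc] at h1
    rw [Fin.succ_last]
    linarith

lemma norm_jumpVec_le_sum {d : ℕ → ℝ} (hs : ChainsLe s N) (hd0 : ∀ k, 0 ≤ d k)
    (hd : ∀ k, ‖α (k + 1) - α k‖ ≤ d k) :
    ‖jumpVec r s α‖ ≤ ∑ k ∈ Finset.range N, d k := by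
  refine norm_jumpVec_le (Finset.sum_nonneg fun k _ => hd0 k) fun c hc => ?_
  obtain ⟨h1, h2⟩ := hs c hc
  refine rpow_sum_rpow_le (fun i => norm_nonneg _) one_pos (one_le_of_fact r)
    (Finset.sum_nonneg fun k _ => hd0 k) ?_
  simp only [Real.rpow_one]
  refine (sum_jump_le_sum hd0 hd _ _ h1.monotone).trans ?_
  exact Finset.sum_le_sum_of_subset_of_nonneg (by simpa using h2 _) fun k _ _ => hd0 k

lemma norm_jumpVec_sq_le (hr : 2 ≤ r) (hs : ChainsLe s N) :
    ‖jumpVec r s α‖ ^ 2 ≤ 4 * ∑ k ∈ Finset.range (N + 1), ‖α k‖ ^ 2 := by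
  set S := ∑ k ∈ Finset.range (N + 1), ‖α k‖ ^ 2 with hS
  have hS0 : 0 ≤ S := Finset.sum_nonneg fun k _ => by positivity
  have hb : ‖jumpVec r s α‖ ≤ √(4 * S) := by
    refine norm_jumpVec_le (Real.sqrt_nonneg _) fun c hc => ?_
    obtain ⟨h1, h2⟩ := hs c hc
    refine rpow_sum_rpow_le (fun i => norm_nonneg _) two_pos hr (Real.sqrt_nonneg _) ?_
    rw [Real.rpow_two, Real.sq_sqrt (by positivity)]
    have hinj : ∀ g : Fin c.1 → ℕ, Function.Injective g → (∀ i, g i ≤ N) →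
        ∑ i, ‖α (g i)‖ ^ 2 ≤ S := fun g hg hgN => by
      rw [← Finset.sum_image (f := fun k => ‖α k‖ ^ 2) (g := g) hg.injOn]
      refine Finset.sum_le_sum_of_subset_of_nonneg ?_ fun k _ _ => by positivity
      intro k hk
      obtain ⟨i, -, rfl⟩ := Finset.mem_image.1 hk
      exact Finset.mem_range.2 (Nat.lt_succ_of_le (hgN i))
    have h3 := hinj (fun i => c.2 i.succ) (h1.injective.comp (Fin.succ_injective _)) fun i => h2 _
    have h4 := hinj (fun i => c.2 i.castSucc)
      (h1.injective.comp (Fin.castSucc_injective _)) fun i => h2 _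
    calc ∑ i, ‖α (c.2 (Fin.succ i)) - α (c.2 i.castSucc)‖ ^ (2 : ℝ)
        ≤ ∑ i, (2 * ‖α (c.2 (Fin.succ i))‖ ^ 2 + 2 * ‖α (c.2 i.castSucc)‖ ^ 2) := by
          refine Finset.sum_le_sum fun i _ => ?_
          rw [Real.rpow_two]
          have h5 := norm_sub_le (α (c.2 (Fin.succ i))) (α (c.2 i.castSucc))
          have h6 := norm_nonneg (α (c.2 (Fin.succ i)) - α (c.2 i.castSucc))
          nlinarith [sq_nonneg (‖α (c.2 (Fin.succ i))‖ - ‖α (c.2 i.castSucc)‖)]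
      _ = 2 * (∑ i, ‖α (c.2 (Fin.succ i))‖ ^ 2) + 2 * ∑ i, ‖α (c.2 (Fin.castSucc i))‖ ^ 2 := by
          rw [Finset.sum_add_distrib, Finset.mul_sum, Finset.mul_sum]
      _ ≤ 4 * S := by linarith
  calc ‖jumpVec r s α‖ ^ 2 ≤ √(4 * S) ^ 2 := by gcongr
    _ = _ := Real.sq_sqrt (by positivity)

lemma norm_jumpVec_le_two_sum (hr : 2 ≤ r) (hs : ChainsLe s N) :
    ‖jumpVec r s α‖ ≤ 2 * ∑ k ∈ Finset.range (N + 1), ‖α k‖ := by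
  refine abs_le_of_sq_le_sq' ?_ (by positivity) |>.2
  refine (norm_jumpVec_sq_le hr hs).trans ?_
  rw [mul_pow]
  have := Finset.sum_sq_le_sq_sum_of_nonneg (s := Finset.range (N + 1)) (f := fun k => ‖α k‖)
    fun k _ => norm_nonneg _
  nlinarith

lemma enorm_jumpVec_sq_le_varCtl (hr : 2 < r) (hs : ChainsLe s N) :
    ‖jumpVec r s α‖ₑ ^ (2 : ℝ) ≤ ENNReal.ofReal (2 * 4 ^ (r + 1)) ^ (2 / r) * varCtl r α N := by
  rcases s.eq_empty_or_nonempty with rfl | hne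
  · have : ‖jumpVec r ∅ α‖ ≤ 0 := norm_jumpVec_le le_rfl (by simp)
    have h0 : jumpVec r ∅ α = 0 := norm_le_zero_iff.1 this
    simp [h0]
  have : ∃ c ∈ s, ‖jumpVec r s α‖ ≤ (∑ i, ‖α (c.2 (Fin.succ i)) - α (c.2 i.castSucc)‖ ^ r) ^ (1 / r) := by
    obtain ⟨c, hc, hmax⟩ := s.exists_max_image
      (fun c => (∑ i, ‖α (c.2 (Fin.succ i)) - α (c.2 i.castSucc)‖ ^ r) ^ (1 / r)) hne
    exact ⟨c, hc, norm_jumpVec_le (by positivity) hmax⟩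
  obtain ⟨c, hc, hle⟩ := this
  obtain ⟨h1, h2⟩ := hs c hc
  have hr0 : 0 < r := by linarith
  have hJ := sum_jump_le (a := α) hr c.2 h1.monotone h2
  rw [← ENNReal.ofReal_sum_of_nonneg fun i _ => by positivity] at hJ
  set X := ∑ i, ‖α (c.2 (Fin.succ i)) - α (c.2 i.castSucc)‖ ^ r with hX
  have hX0 : 0 ≤ X := Finset.sum_nonneg fun i _ => by positivity
  calc ‖jumpVec r s α‖ₑ ^ (2 : ℝ) ≤ ENNReal.ofReal (X ^ (1 / r)) ^ (2 : ℝ) := by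
        rw [← ofReal_norm]
        exact ENNReal.rpow_le_rpow (ENNReal.ofReal_le_ofReal hle) zero_le_two
    _ = ENNReal.ofReal X ^ (2 / r) := by
        rw [← ENNReal.ofReal_rpow_of_nonneg hX0 (by positivity), ← ENNReal.rpow_mul]
        congr 1; ring
    _ ≤ (ENNReal.ofReal (2 * 4 ^ (r + 1)) * varCtl r α N ^ (r / 2)) ^ (2 / r) :=
        ENNReal.rpow_le_rpow hJ (by positivity)
    _ = _ := by
        rw [ENNReal.mul_rpow_of_nonneg _ _ (by positivity), ← ENNReal.rpow_mul]
        have : r / 2 * (2 / r) = 1 := by field_simp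
        rw [this, ENNReal.rpow_one]

variable {n : ℕ}

/-- The convolution kernel of the jumps of a family of scalar kernels. -/
def jumpKer (r : ℝ) [Fact (1 ≤ ENNReal.ofReal r)] (s : Finset Chain) (K : ℕ → Rn n → ℂ) (t : Rn n) :
    ℂ →L[ℝ] JumpSpace r s :=
  (ContinuousLinearMap.lsmul ℝ ℂ).flip (jumpVec r s fun k => K k t)

lemma jumpKer_apply (K : ℕ → Rn n → ℂ) (t : Rn n) (z : ℂ) :
    jumpKer r s K t z = jumpVec r s fun k => mulK (K k) t z := by
  rw [jumpKer, ContinuousLinearMap.flip_apply, ContinuousLinearMap.lsmul_apply]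
  funext c
  ext i
  simp only [jumpVec, Pi.smul_apply, PiLp.smul_apply, mulK_apply, smul_eq_mul]
  ring

lemma norm_jumpKer_sub_le (K : ℕ → Rn n → ℂ) (t t' : Rn n) :
    ‖jumpKer r s K t - jumpKer r s K t'‖ ≤ ‖jumpVec r s fun k => K k t - K k t'‖ := by
  rw [jumpKer, jumpKer, ← map_sub, ← jumpVec_sub]
  refine ContinuousLinearMap.opNorm_le_bound _ (norm_nonneg _) fun z => ?_
  rw [ContinuousLinearMap.flip_apply, ContinuousLinearMap.lsmul_apply, norm_smul, mul_comm]

lemma continuous_jumpKer {K : ℕ → Rn n → ℂ} (hK : ∀ k, Continuous (K k)) :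
    Continuous (jumpKer r s K) := by
  refine (ContinuousLinearMap.continuous _).comp (continuous_pi fun c => ?_)
  refine (PiLp.continuous_toLp _ _).comp (continuous_pi fun i => ?_)
  exact (hK _).sub (hK _)

lemma hasCompactSupport_jumpKer {K : ℕ → Rn n → ℂ} (hc : ∀ k, HasCompactSupport (K k)) :
    HasCompactSupport (jumpKer r s K) := by
  have hcs : IsCompact (⋃ c ∈ s, ⋃ i, tsupport (K (c.2 i))) :=
    s.isCompact_biUnion fun c _ => isCompact_iUnion fun i => hc _
  refine HasCompactSupport.intro hcs fun t ht => ?_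
  simp only [mem_iUnion, not_exists] at ht
  have h0 : jumpVec r s (fun k => K k t) = 0 := by
    funext c
    ext i
    simp only [jumpVec, image_eq_zero_of_notMem_tsupport (ht c.1 c.2 _), sub_zero]
    rfl
  rw [jumpKer, h0, map_zero]

lemma opConv_jumpKer {K : ℕ → Rn n → ℂ} (hK : ∀ k, Continuous (K k))
    (hc : ∀ k, HasCompactSupport (K k)) {f : Rn n → ℂ} (hf : Integrable f) (x : Rn n) :
    opConv (jumpKer r s K) f x = jumpVec r s fun k => opConv (mulK (K k)) f x := by
  have hi := integrable_opConv_integrand (continuous_jumpKer (r := r) (s := s) hK)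
    (hasCompactSupport_jumpKer hc) hf x
  funext c
  ext i
  have h1 := ((PiLp.proj (𝕜 := ℝ) (ENNReal.ofReal r) (fun _ : Fin c.1.1 => ℂ) i).comp
    (ContinuousLinearMap.proj (R := ℝ)
      (φ := fun c : s => PiLp (ENNReal.ofReal r) (fun _ : Fin c.1.1 => ℂ)) c)).integral_comp_comm hi
  simp only [ContinuousLinearMap.comp_apply, ContinuousLinearMap.proj_apply, PiLp.proj_apply,
    jumpKer_apply] at h1
  simp only [jumpKer_apply, opConv, jumpVec] at h1 ⊢
  rw [← h1]
  exact integral_sub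
    (integrable_opConv_integrand (continuous_mulK (hK _)) (hasCompactSupport_mulK (hc _)) hf x)
    (integrable_opConv_integrand (continuous_mulK (hK _)) (hasCompactSupport_mulK (hc _)) hf x)

end JumpVec

section Lacunary

variable {x : ℕ → ℝ} {ρ : ℝ}

lemma lacunary_le (hρ : 0 ≤ ρ) (hx : ∀ i, x (i + 1) ≤ ρ * x i) (k d : ℕ) :
    x (k + d) ≤ ρ ^ d * x k := by
  induction d with
  | zero => simp
  | succ d ih =>
    calc x (k + (d + 1)) ≤ ρ * x (k + d) := hx _
      _ ≤ ρ * (ρ ^ d * x k) := by gcongr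
      _ = _ := by ring

lemma sum_Ico_lacunary_le (hρ0 : 0 < ρ) (hρ : ρ < 1) (hx0 : ∀ i, 0 < x i)
    (hx : ∀ i, x (i + 1) ≤ ρ * x i) (k N : ℕ) :
    ∑ i ∈ Finset.Ico k N, x i ≤ (1 - ρ)⁻¹ * x k := by
  rw [Finset.sum_Ico_eq_sum_range]
  calc ∑ i ∈ Finset.range (N - k), x (k + i) ≤ ∑ i ∈ Finset.range (N - k), ρ ^ i * x k :=
        Finset.sum_le_sum fun i _ => lacunary_le hρ0.le hx k i
    _ = (∑ i ∈ Finset.range (N - k), ρ ^ i) * x k := by rw [Finset.sum_mul]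
    _ ≤ (1 - ρ)⁻¹ * x k := by
        have := (hx0 k).le
        gcongr
        rw [← tsum_geometric_of_lt_one hρ0.le hρ]
        exact (summable_geometric_of_lt_one hρ0.le hρ).sum_le_tsum _ fun i _ => by positivity

lemma sum_range_inv_lacunary_le (hρ0 : 0 < ρ) (hρ : ρ < 1) (hx0 : ∀ i, 0 < x i)
    (hx : ∀ i, x (i + 1) ≤ ρ * x i) (k : ℕ) :
    ∑ i ∈ Finset.range k, (x i)⁻¹ ≤ ρ * (1 - ρ)⁻¹ * (x k)⁻¹ := by
  have h1 : 0 < 1 - ρ := by linarith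
  have hstep : ∀ k, (x k)⁻¹ ≤ ρ * (x (k + 1))⁻¹ := fun k => by
    have h2 := hx0 k
    have h3 := hx0 (k + 1)
    rw [← div_eq_mul_inv, inv_le_comm₀ h2 (by positivity), inv_div, div_le_iff₀ hρ0]
    linarith [hx k]
  induction k with
  | zero => have := hx0 0; simp; positivity
  | succ k ih =>
    rw [Finset.sum_range_succ]
    calc ∑ i ∈ Finset.range k, (x i)⁻¹ + (x k)⁻¹
        ≤ ρ * (1 - ρ)⁻¹ * (x k)⁻¹ + (x k)⁻¹ := by gcongr
      _ = (1 - ρ)⁻¹ * (x k)⁻¹ := by field_simp; ring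
      _ ≤ (1 - ρ)⁻¹ * (ρ * (x (k + 1))⁻¹) := by gcongr; exact hstep k
      _ = _ := by ring

lemma sum_min_lacunary_le (hρ0 : 0 < ρ) (hρ : ρ < 1) (hx0 : ∀ i, 0 < x i)
    (hx : ∀ i, x (i + 1) ≤ ρ * x i) (N : ℕ) :
    ∑ i ∈ Finset.range N, min (x i) (x i)⁻¹ ≤ 2 * (1 - ρ)⁻¹ := by
  have h1 : 0 < 1 - ρ := by linarith
  obtain ⟨k, hkN, hk1, hk2⟩ : ∃ k ≤ N, (∀ i < k, 1 < x i) ∧ (k < N → x k ≤ 1) := by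
    classical
    have hex : ∃ k, N ≤ k ∨ x k ≤ 1 := ⟨N, .inl le_rfl⟩
    refine ⟨Nat.find hex, Nat.find_min' hex (.inl le_rfl), fun i hi => ?_, fun h => ?_⟩
    · have := Nat.find_min hex hi
      push Not at this
      exact this.2
    · exact (Nat.find_spec hex).resolve_left (by omega)
  rw [← Finset.sum_range_add_sum_Ico _ hkN, two_mul]
  refine add_le_add ?_ ?_
  · refine (Finset.sum_le_sum fun i _ => min_le_right _ _).trans ?_
    cases k with
    | zero => simp; exact hρ.le
    | succ k =>
      have h2 : (x k)⁻¹ ≤ 1 := inv_le_one_of_one_le₀ (hk1 k (by omega)).le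
      have h4 := hx0 k
      have h5 : ∑ i ∈ Finset.range (k + 1), (x i)⁻¹ ≤ (1 - ρ)⁻¹ * (x k)⁻¹ := by
        rw [Finset.sum_range_succ]
        calc ∑ i ∈ Finset.range k, (x i)⁻¹ + (x k)⁻¹
            ≤ ρ * (1 - ρ)⁻¹ * (x k)⁻¹ + (x k)⁻¹ := by
              gcongr; exact sum_range_inv_lacunary_le hρ0 hρ hx0 hx k
          _ = (1 - ρ)⁻¹ * (x k)⁻¹ := by field_simp; ring
      exact h5.trans (mul_le_of_le_one_right (by positivity) h2)
  · rcases hkN.eq_or_lt with rfl | hlt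
    · simp; exact hρ.le
    · refine (Finset.sum_le_sum fun i _ => min_le_left _ _).trans
        ((sum_Ico_lacunary_le hρ0 hρ hx0 hx k N).trans ?_)
      exact mul_le_of_le_one_right (by positivity) (hk2 hlt)

end Lacunary

section HighPart

variable {n : ℕ} {r : ℝ} [hq : Fact (1 ≤ ENNReal.ofReal r)] {s : Finset Chain} {N : ℕ}

lemma hormanderBound_jumpKer_of_sum (hr : 2 ≤ r) (hs : ChainsLe s N) {κ : ℕ → Rn n → ℂ} {B : ℝ}
    (hκ : ∀ k, Continuous (κ k))
    (hH : ∀ y, ∑ k ∈ Finset.range (N + 1),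
      ∫⁻ x in {x | 2 * ‖y‖ ≤ ‖x‖}, ‖κ k (x - y) - κ k x‖ₑ ≤ ENNReal.ofReal B) :
    HormanderBound (jumpKer r s κ) (2 * B) := fun y => by
  have hpt : ∀ x, ‖jumpKer r s κ (x - y) - jumpKer r s κ x‖ₑ ≤
      2 * ∑ k ∈ Finset.range (N + 1), ‖κ k (x - y) - κ k x‖ₑ := fun x => by
    rw [← ofReal_norm]
    refine (ENNReal.ofReal_le_ofReal ((norm_jumpKer_sub_le κ _ _).trans
      (norm_jumpVec_le_two_sum hr hs))).trans (le_of_eq ?_)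
    rw [ENNReal.ofReal_mul zero_le_two, ENNReal.ofReal_sum_of_nonneg fun _ _ => norm_nonneg _]
    simp [ofReal_norm]
  have hm : ∀ k, Measurable fun x => ‖κ k (x - y) - κ k x‖ₑ := fun k =>
    Continuous.measurable (by have := hκ k; fun_prop)
  refine (lintegral_mono hpt).trans ?_
  rw [lintegral_const_mul _ (Finset.measurable_sum _ fun k _ => hm k),
    lintegral_finsetSum _ fun k _ => hm k, ENNReal.ofReal_mul zero_le_two]
  simpa using mul_le_mul_right (hH y) 2

lemma l2Bound_jumpKer_of_sum (hr : 2 ≤ r) (hs : ChainsLe s N) {κ : ℕ → Rn n → ℂ} {A : ℝ}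
    (hκ : ∀ k, Continuous (κ k)) (hc : ∀ k, HasCompactSupport (κ k))
    (hA : ∀ ξ, ∑ k ∈ Finset.range (N + 1), ‖𝓕 (κ k) ξ‖ ^ 2 ≤ A ^ 2) :
    L2Bound (jumpKer r s κ) (2 * A) := fun f hf => by
  have hpt : ∀ x, ‖opConv (jumpKer r s κ) f x‖ₑ ^ (2 : ℝ) ≤
      4 * ∑ k ∈ Finset.range (N + 1), ‖opConv (mulK (κ k)) f x‖ₑ ^ (2 : ℝ) := fun x => by
    rw [opConv_jumpKer hκ hc hf.int, ENNReal.rpow_two, ← ofReal_norm,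
      ← ENNReal.ofReal_pow (norm_nonneg _)]
    refine (ENNReal.ofReal_le_ofReal (norm_jumpVec_sq_le hr hs)).trans (le_of_eq ?_)
    rw [ENNReal.ofReal_mul (by norm_num), ENNReal.ofReal_sum_of_nonneg fun _ _ => by positivity]
    simp [ENNReal.ofReal_pow, ofReal_norm]
  have hm : ∀ k, Measurable fun x => ‖opConv (mulK (κ k)) f x‖ₑ ^ (2 : ℝ) := fun k =>
    (continuous_opConv (continuous_mulK (hκ k)) (hasCompactSupport_mulK (hc k))
      hf.int).measurable.enorm.pow_const _
  refine (lintegral_mono hpt).trans ?_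
  rw [lintegral_const_mul _ (Finset.measurable_sum _ fun k _ => hm k),
    lintegral_finsetSum _ fun k _ => hm k]
  refine (mul_le_mul_right (sum_lintegral_opConv_sq_le _ hκ hc hA hf) 4).trans (le_of_eq ?_)
  rw [← mul_assoc, mul_pow, ENNReal.ofReal_mul (by norm_num)]
  norm_num

end HighPart

/-- `L^p` bounds for the jumps of a family of convolution operators with a square function
bound. -/
theorem lp_jump_bound {n : ℕ} (hn : 0 < n) {p r : ℝ} (hp : 1 < p) (hr : 2 ≤ r)
    [hq : Fact (1 ≤ ENNReal.ofReal r)] :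
    ∃ C > (0 : ℝ), ∃ a > (0 : ℝ), a ≤ 1 ∧ ∀ (s : Finset Chain) (N : ℕ), ChainsLe s N →
      ∀ κ : ℕ → Rn n → ℂ, (∀ k, Continuous (κ k)) → (∀ k, HasCompactSupport (κ k)) →
      ∀ A B : ℝ, 0 < A → A ≤ B →
      (∀ ξ, ∑ k ∈ Finset.range (N + 1), ‖𝓕 (κ k) ξ‖ ^ 2 ≤ A ^ 2) →
      (∀ y, ∑ k ∈ Finset.range (N + 1),
        ∫⁻ x in {x | 2 * ‖y‖ ≤ ‖x‖}, ‖κ k (x - y) - κ k x‖ₑ ≤ ENNReal.ofReal B) →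
      ∀ f : Rn n → ℂ, Nice f →
      ∫⁻ x, ‖jumpVec r s fun k => opConv (mulK (κ k)) f x‖ₑ ^ p ≤
        ENNReal.ofReal (C * (A ^ a * B ^ (1 - a)) ^ p) * ∫⁻ x, ‖f x‖ₑ ^ p := by
  obtain ⟨C, hC, a, ha0, ha1, h⟩ := lp_bound hn hp
  refine ⟨C * 2 ^ p, by positivity, a, ha0, ha1, ?_⟩
  intro s N hs κ hκ hc A B hA hAB h2 hH f hf
  have h1 := h (JumpSpace r s) (jumpKer r s κ) (continuous_jumpKer hκ)
    (hasCompactSupport_jumpKer hc) (2 * A) (2 * B) (by positivity) (by linarith)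
    (l2Bound_jumpKer_of_sum hr hs hκ hc h2) (hormanderBound_jumpKer_of_sum hr hs hκ hH) f hf
  simp only [opConv_jumpKer hκ hc hf.int] at h1
  have hB : 0 < B := by linarith
  have he : (2 * A) ^ a * (2 * B) ^ (1 - a) = 2 * (A ^ a * B ^ (1 - a)) := by
    rw [Real.mul_rpow zero_le_two hA.le, Real.mul_rpow zero_le_two hB.le]
    have : (2 : ℝ) ^ a * 2 ^ (1 - a) = 2 := by
      rw [← Real.rpow_add two_pos]; simp
    linear_combination (A ^ a * B ^ (1 - a)) * this
  rw [he, Real.mul_rpow zero_le_two (by positivity), ← mul_assoc] at h1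
  exact h1

section Hormander

variable {n : ℕ} {R A B : ℝ}

lemma ScaleKer.lintegral_sub_le {σ ε : ℝ} {κ : Rn n → ℂ} (hκ : ScaleKer R σ A B κ) (hσ : 0 < σ)
    (hR : 0 < R) (hA : 0 < A) (hB : 0 < B) (hε0 : 0 < ε) (hε1 : ε ≤ 1) {y : Rn n} (hy : y ≠ 0) :
    ∫⁻ x in {x | 2 * ‖y‖ ≤ ‖x‖}, ‖κ (x - y) - κ x‖ₑ ≤
      ENNReal.ofReal ((2 * R) ^ n * unitVol n * ((2 * A) ^ (1 - ε) * B ^ ε * R ^ ε) *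
        min ((R * σ / ‖y‖) ^ ε) ((R * σ / ‖y‖) ^ ε)⁻¹) := by
  have hy0 : 0 < ‖y‖ := norm_pos_iff.2 hy
  have hv := unitVol_pos n
  have hms : MeasurableSet {x : Rn n | 2 * ‖y‖ ≤ ‖x‖} :=
    measurableSet_le measurable_const measurable_norm
  have hhalf : ∀ x : Rn n, 2 * ‖y‖ ≤ ‖x‖ → ‖x‖ ≤ 2 * ‖x - y‖ := fun x hx => by
    have := norm_le_norm_sub_add x y
    linarith
  by_cases hyR : R * σ < ‖y‖
  · rw [setLIntegral_congr_fun (g := fun _ => 0) hms fun x hx => ?_]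
    · simp
    · have hx' : 2 * ‖y‖ ≤ ‖x‖ := hx
      have h2 := hhalf x hx'
      simp only
      rw [hκ.supp _ (by linarith), hκ.supp x (by linarith)]
      simp
  · push Not at hyR
    set w : ℝ := (R * σ / ‖y‖) ^ ε with hw
    have hw1 : 1 ≤ w := Real.one_le_rpow ((one_le_div hy0).2 hyR) hε0.le
    have hmin : min w w⁻¹ = w⁻¹ := min_eq_right ((inv_le_one_of_one_le₀ hw1).trans hw1)
    set c : ℝ := (2 * A) ^ (1 - ε) * B ^ ε * R ^ ε * w⁻¹ * (σ ^ n)⁻¹ with hc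
    have hc0 : 0 ≤ c := by positivity
    have hwi : R ^ ε * w⁻¹ = (‖y‖ / σ) ^ ε := by
      rw [hw, ← Real.inv_rpow (by positivity), ← Real.mul_rpow hR.le (by positivity)]
      congr 1; field_simp
    have hpt : ∀ x, ‖κ (x - y) - κ x‖ ≤ c := fun x => by
      have h1 : ‖κ (x - y) - κ x‖ ≤ 2 * A * (σ ^ n)⁻¹ := by
        have := norm_sub_le (κ (x - y)) (κ x)
        linarith [hκ.bd (x - y), hκ.bd x]
      have h2 : ‖κ (x - y) - κ x‖ ≤ B * (‖y‖ / σ) * (σ ^ n)⁻¹ := by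
        refine (hκ.lip _ _).trans (le_of_eq ?_)
        rw [sub_sub_cancel_left, norm_neg]
        field_simp
        ring
      have h3 : ∀ t a b : ℝ, 0 ≤ t → t ≤ a → t ≤ b → t ≤ a ^ (1 - ε) * b ^ ε :=
        fun t a b ht h1 h2 => by
          calc t = t ^ (1 - ε) * t ^ ε := by
                rw [← Real.rpow_add_of_nonneg ht (by linarith) hε0.le]; simp
            _ ≤ _ := mul_le_mul (Real.rpow_le_rpow ht h1 (by linarith))
                (Real.rpow_le_rpow ht h2 hε0.le) (Real.rpow_nonneg ht _)
                (Real.rpow_nonneg (ht.trans h1) _)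
      refine (h3 _ _ _ (norm_nonneg _) h1 h2).trans (le_of_eq ?_)
      rw [Real.mul_rpow (x := 2 * A) (y := (σ ^ n)⁻¹) (by positivity) (by positivity),
        Real.mul_rpow (x := B * (‖y‖ / σ)) (y := (σ ^ n)⁻¹) (by positivity) (by positivity),
        Real.mul_rpow (x := B) (y := ‖y‖ / σ) hB.le (by positivity), ← hwi, hc]
      have h4 : ((σ ^ n)⁻¹ : ℝ) ^ (1 - ε) * ((σ ^ n)⁻¹) ^ ε = (σ ^ n)⁻¹ := by
        rw [← Real.rpow_add (by positivity)]; simp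
      linear_combination ((2 * A) ^ (1 - ε) * B ^ ε * R ^ ε * w⁻¹) * h4
    calc ∫⁻ x in {x | 2 * ‖y‖ ≤ ‖x‖}, ‖κ (x - y) - κ x‖ₑ
        = ∫⁻ x, ‖{x | 2 * ‖y‖ ≤ ‖x‖}.indicator (fun x => κ (x - y) - κ x) x‖ₑ := by
          rw [← lintegral_indicator hms]
          simp only [enorm_indicator_eq_indicator_enorm]
      _ ≤ ENNReal.ofReal (c * (2 * R * σ) ^ n * unitVol n) := by
          refine (lintegral_enorm_le_of_supp (ρ := 2 * R * σ) (c := c)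
            (g := {x : Rn n | 2 * ‖y‖ ≤ ‖x‖}.indicator fun x => κ (x - y) - κ x) (by positivity)
            (fun x => (norm_indicator_le_norm_self (fun x => κ (x - y) - κ x) x).trans (hpt x)) fun x hx => ?_).trans
            (le_of_eq ?_)
          · by_cases hx2 : 2 * ‖y‖ ≤ ‖x‖
            · rw [indicator_of_mem (by exact hx2)]
              have h2 := hhalf x hx2
              rw [hκ.supp _ (by linarith), hκ.supp x (by nlinarith [mul_pos hR hσ]), sub_zero]
            · rw [indicator_of_notMem (by exact hx2)]
          · ring_nf
      _ = _ := by
          rw [hmin, hc]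
          congr 1
          rw [mul_pow _ σ]
          field_simp

/-- Hörmander's condition for a family of kernels at lacunary scales. -/
lemma sum_lintegral_sub_le {ε ρ : ℝ} (hR : 0 < R) (hA : 0 < A) (hB : 0 < B) (hε0 : 0 < ε)
    (hε1 : ε ≤ 1) (hρ0 : 0 < ρ) (hρ : ρ < 1) {σ : ℕ → ℝ} (hσ : ∀ k, 0 < σ k)
    (hlac : ∀ k, σ (k + 1) ≤ ρ * σ k) {κ : ℕ → Rn n → ℂ} (hκ : ∀ k, ScaleKer R (σ k) A B (κ k))
    (y : Rn n) (N : ℕ) :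
    ∑ k ∈ Finset.range N, ∫⁻ x in {x | 2 * ‖y‖ ≤ ‖x‖}, ‖κ k (x - y) - κ k x‖ₑ ≤
      ENNReal.ofReal ((2 * R) ^ n * unitVol n * ((2 * A) ^ (1 - ε) * B ^ ε * R ^ ε) *
        (2 * (1 - ρ ^ ε)⁻¹)) := by
  rcases eq_or_ne y 0 with rfl | hy
  · simp
  have hy0 : 0 < ‖y‖ := norm_pos_iff.2 hy
  have hv := unitVol_pos n
  refine (Finset.sum_le_sum fun k _ =>
    (hκ k).lintegral_sub_le (hσ k) hR hA hB hε0 hε1 hy).trans ?_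
  have hw0 : ∀ k, 0 < (R * σ k / ‖y‖) ^ ε := fun k => by have := hσ k; positivity
  rw [← ENNReal.ofReal_sum_of_nonneg fun k _ => by have := hw0 k; positivity, ← Finset.mul_sum]
  refine ENNReal.ofReal_le_ofReal (mul_le_mul_of_nonneg_left ?_ (by positivity))
  refine sum_min_lacunary_le (x := fun k => (R * σ k / ‖y‖) ^ ε) (by positivity)
    (Real.rpow_lt_one hρ0.le hρ hε0) hw0 (fun k => ?_) N
  have := hσ k
  have := hσ (k + 1)
  rw [← Real.mul_rpow hρ0.le (by positivity)]
  refine Real.rpow_le_rpow (by positivity) ?_ hε0.le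
  rw [← mul_div_assoc]
  exact div_le_div_of_nonneg_right (by nlinarith [hlac k]) hy0.le

end Hormander

section LowPart

lemma norm_low_symbol_le {c ρ : ℝ} (hc : 0 ≤ c) (hρ0 : 0 < ρ) (hρ : ρ < 1) {x : ℕ → ℝ}
    (hx0 : ∀ i, 0 < x i) (hx : ∀ i, x (i + 1) ≤ ρ * x i) {Q Φ : ℕ → ℂ}
    (hQ : ∀ i, ‖Q i‖ ≤ c * min (x i) (x i)⁻¹) (hΦ : ∀ i, ‖Φ i‖ ≤ c)
    (hΦ' : ∀ i, ‖Φ i‖ ≤ c * (x i)⁻¹) (hΦ1 : ∀ i, ‖1 - Φ i‖ ≤ c * x i) {k N : ℕ} (hk : k ≤ N) :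
    ‖∑ i ∈ Finset.range k, Q i - Φ k * ∑ i ∈ Finset.range N, Q i‖ ≤
      c * (1 + 3 * c) * (1 - ρ)⁻¹ * min (x k) (x k)⁻¹ := by
  have hD : 0 < (1 - ρ)⁻¹ := inv_pos.2 (by linarith)
  have hxk := hx0 k
  have e : ∑ i ∈ Finset.range k, Q i - Φ k * ∑ i ∈ Finset.range N, Q i =
      (1 - Φ k) * ∑ i ∈ Finset.range k, Q i - Φ k * ∑ i ∈ Finset.Ico k N, Q i := by
    rw [← Finset.sum_range_add_sum_Ico _ hk]; ring
  have hall : ∀ s : Finset ℕ, s ⊆ Finset.range N → ‖∑ i ∈ s, Q i‖ ≤ c * (2 * (1 - ρ)⁻¹) :=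
    fun s hs => by
    refine (norm_sum_le_of_le s fun i _ => hQ i).trans ?_
    rw [← Finset.mul_sum]
    refine mul_le_mul_of_nonneg_left ((Finset.sum_le_sum_of_subset_of_nonneg hs fun i _ _ => ?_).trans
      (sum_min_lacunary_le hρ0 hρ hx0 hx N)) hc
    have := hx0 i; positivity
  rw [e]
  refine (norm_sub_le _ _).trans ?_
  rw [norm_mul, norm_mul]
  rcases le_total (x k) 1 with h | h
  · rw [min_eq_left (h.trans ((one_le_inv₀ hxk).2 h))]
    have h1 : ‖∑ i ∈ Finset.Ico k N, Q i‖ ≤ c * ((1 - ρ)⁻¹ * x k) := by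
      refine (norm_sum_le_of_le _ fun i _ => (hQ i).trans
        (mul_le_mul_of_nonneg_left (min_le_left _ _) hc)).trans ?_
      rw [← Finset.mul_sum]
      exact mul_le_mul_of_nonneg_left (sum_Ico_lacunary_le hρ0 hρ hx0 hx k N) hc
    have h2 := mul_le_mul (hΦ1 k) (hall _ (Finset.range_subset_range.2 hk)) (norm_nonneg _)
      (by positivity)
    have h3 := mul_le_mul (hΦ k) h1 (norm_nonneg _) hc
    refine (add_le_add h2 h3).trans ?_
    have : 0 ≤ c * (1 - ρ)⁻¹ * x k := by positivity
    linarith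
  · rw [min_eq_right ((inv_le_one_of_one_le₀ h).trans h)]
    have h1 : ‖∑ i ∈ Finset.range k, Q i‖ ≤ c * ((1 - ρ)⁻¹ * (x k)⁻¹) := by
      refine (norm_sum_le_of_le _ fun i _ => (hQ i).trans
        (mul_le_mul_of_nonneg_left (min_le_right _ _) hc)).trans ?_
      rw [← Finset.mul_sum]
      refine mul_le_mul_of_nonneg_left
        ((sum_range_inv_lacunary_le hρ0 hρ hx0 hx k).trans ?_) hc
      gcongr
      exact mul_le_of_le_one_left hD.le hρ.le
    have h4 : ‖1 - Φ k‖ ≤ 1 + c := by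
      have := norm_sub_le 1 (Φ k)
      rw [norm_one] at this
      linarith [hΦ k]
    have h2 := mul_le_mul h4 h1 (norm_nonneg _) (by positivity)
    have h3 := mul_le_mul (hΦ' k) (hall (Finset.Ico k N) fun i hi => by
      simp only [Finset.mem_Ico, Finset.mem_range] at hi ⊢; exact hi.2) (norm_nonneg _)
      (by positivity)
    refine (add_le_add h2 h3).trans ?_
    have : 0 ≤ c * (1 - ρ)⁻¹ * (x k)⁻¹ := by positivity
    linarith

lemma sum_norm_low_symbol_sq_le {c ρ : ℝ} (hρ0 : 0 < ρ) (hρ : ρ < 1) {x : ℕ → ℝ}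
    (hx0 : ∀ i, 0 < x i) (hx : ∀ i, x (i + 1) ≤ ρ * x i) {m : ℕ → ℂ} {N : ℕ}
    (hm : ∀ k < N, ‖m k‖ ≤ c * min (x k) (x k)⁻¹) :
    ∑ k ∈ Finset.range N, ‖m k‖ ^ 2 ≤ c ^ 2 * (2 * (1 - ρ)⁻¹) := by
  calc ∑ k ∈ Finset.range N, ‖m k‖ ^ 2
      ≤ ∑ k ∈ Finset.range N, c ^ 2 * min (x k) (x k)⁻¹ := by
        refine Finset.sum_le_sum fun k hk => ?_
        have h0 : 0 ≤ min (x k) (x k)⁻¹ := by have := hx0 k; positivity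
        have h1 : min (x k) (x k)⁻¹ ≤ 1 := by
          rcases le_total (x k) 1 with h | h
          · exact (min_le_left _ _).trans h
          · exact (min_le_right _ _).trans (inv_le_one_of_one_le₀ h)
        refine (pow_le_pow_left₀ (norm_nonneg _) (hm k (Finset.mem_range.1 hk)) 2).trans ?_
        rw [mul_pow]
        gcongr
        nlinarith
    _ ≤ _ := by
        rw [← Finset.mul_sum]
        gcongr
        exact sum_min_lacunary_le hρ0 hρ hx0 hx N

variable {n : ℕ} {R A σ : ℝ}

lemma ScaleKer.norm_fourier_le_min {B : ℝ} {q : Rn n → ℂ} (hq : ScaleKer R σ A B q) (hσ : 0 < σ)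
    (hR : 0 < R) (hAB : A ≤ B) (h0 : ∫ t, q t = 0) {ξ : Rn n} (hξ : ξ ≠ 0) :
    ‖𝓕 q ξ‖ ≤ fourierConst n R * B * min (σ * ‖ξ‖) (σ * ‖ξ‖)⁻¹ := by
  have hx : 0 < σ * ‖ξ‖ := mul_pos hσ (norm_pos_iff.2 hξ)
  have hfc := fourierConst_pos n hR.le
  rcases le_total (σ * ‖ξ‖) 1 with h | h
  · rw [min_eq_left (h.trans ((one_le_inv₀ hx).2 h))]
    have := hq.norm_fourier_sub_integral_le hσ hR.le ξ
    rw [h0, sub_zero] at this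
    refine this.trans ?_
    gcongr
  · rw [min_eq_right ((inv_le_one_of_one_le₀ h).trans h), ← div_eq_mul_inv]
    exact hq.norm_fourier_le_div hσ hR.le h

lemma ScaleKer.norm_fourier_le_inv {q : Rn n → ℂ} (hq : ScaleKer R σ A A q) (hσ : 0 < σ)
    (hR : 0 < R) {ξ : Rn n} (hξ : ξ ≠ 0) :
    ‖𝓕 q ξ‖ ≤ fourierConst n R * A * (σ * ‖ξ‖)⁻¹ := by
  have hx : 0 < σ * ‖ξ‖ := mul_pos hσ (norm_pos_iff.2 hξ)
  have hfc := fourierConst_pos n hR.le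
  have hA := hq.nonneg_bd hσ
  rcases le_total (σ * ‖ξ‖) 1 with h | h
  · exact (hq.norm_fourier_le hσ hR.le ξ).trans
      (le_mul_of_one_le_right (by positivity) ((one_le_inv₀ hx).2 h))
  · rw [← div_eq_mul_inv]
    exact hq.norm_fourier_le_div hσ hR.le h

lemma hasCompactSupport_finsetSum {ι : Type*} (s : Finset ι) {q : ι → Rn n → ℂ}
    (hq : ∀ i, HasCompactSupport (q i)) : HasCompactSupport fun t => ∑ i ∈ s, q i t := by
  classical
  induction s using Finset.induction_on with
  | empty => exact HasCompactSupport.zero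
  | insert a s ha ih => simp only [Finset.sum_insert ha]; exact (hq a).add ih

lemma norm_sub_add_sq_le {E : Type*} [NormedAddCommGroup E] (a b c : E) :
    ‖a - b + c‖ₑ ^ (2 : ℝ) ≤ 3 * (‖a‖ₑ ^ (2 : ℝ) + ‖b‖ₑ ^ (2 : ℝ) + ‖c‖ₑ ^ (2 : ℝ)) := by
  simp only [ENNReal.rpow_two, ← ofReal_norm, ← ENNReal.ofReal_pow (norm_nonneg _)]
  rw [← ENNReal.ofReal_add (by positivity) (by positivity),
    ← ENNReal.ofReal_add (by positivity) (by positivity),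
    show (3 : ℝ≥0∞) = ENNReal.ofReal 3 by simp, ← ENNReal.ofReal_mul (by norm_num)]
  refine ENNReal.ofReal_le_ofReal ?_
  have h1 : ‖a - b + c‖ ≤ ‖a‖ + ‖b‖ + ‖c‖ :=
    (norm_add_le _ _).trans (by gcongr; exact norm_sub_le _ _)
  refine (pow_le_pow_left₀ (norm_nonneg _) h1 2).trans ?_
  nlinarith [sq_nonneg (‖a‖ - ‖b‖), sq_nonneg (‖a‖ - ‖c‖), sq_nonneg (‖b‖ - ‖c‖)]

end LowPart

section LowPart

variable {n : ℕ}

/-- The data of the low frequency part: dyadic levels, an approximation of the identity and mean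
zero kernels, at comparable lacunary scales. -/
structure LowData (R A ρ : ℝ) (j : ℕ → ℤ) (σ : ℕ → ℝ) (φ q : ℕ → Rn n → ℂ) : Prop where
  mono : Monotone j
  pos : ∀ k, 0 < σ k
  le_scale : ∀ k, ((2 : ℝ) ^ j k)⁻¹ ≤ σ k
  scale_le : ∀ k, σ k ≤ 2 * ((2 : ℝ) ^ j k)⁻¹
  lac : ∀ k, σ (k + 1) ≤ ρ * σ k
  ker : ∀ k, ScaleKer R (σ k) A A (φ k)
  ker_one : ∀ k, ∫ t, φ k t = 1
  ker_q : ∀ k, ScaleKer R (σ k) A A (q k)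
  ker_zero : ∀ k, ∫ t, q k t = 0

/-- The partial sums of a sequence of kernels. -/
def psum (q : ℕ → Rn n → ℂ) (k : ℕ) (t : Rn n) : ℂ := ∑ i ∈ Finset.range k, q i t

namespace LowData

variable {R A ρ : ℝ} {j : ℕ → ℤ} {σ : ℕ → ℝ} {φ q : ℕ → Rn n → ℂ}

lemma continuous_psum (h : LowData R A ρ j σ φ q) (k : ℕ) : Continuous (psum q k) :=
  continuous_finsetSum _ fun i _ => (h.ker_q i).continuous

lemma hasCompactSupport_psum (h : LowData R A ρ j σ φ q) (k : ℕ) : HasCompactSupport (psum q k) :=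
  hasCompactSupport_finsetSum _ fun i => (h.ker_q i).hasCompactSupport

lemma integrable_psum (h : LowData R A ρ j σ φ q) (k : ℕ) : Integrable (psum q k) :=
  (h.continuous_psum k).integrable_of_hasCompactSupport (h.hasCompactSupport_psum k)

lemma fourier_psum (h : LowData R A ρ j σ φ q) (k : ℕ) (ξ : Rn n) :
    𝓕 (psum q k) ξ = ∑ i ∈ Finset.range k, 𝓕 (q i) ξ :=
  fourier_finsetSum _ (fun i _ => (h.ker_q i).integrable) ξ

lemma norm_fourier_psum_le (hR : 0 < R) (hA : 0 < A) (hρ0 : 0 < ρ) (hρ : ρ < 1)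
    (h : LowData R A ρ j σ φ q) (k : ℕ) (ξ : Rn n) :
    ‖𝓕 (psum q k) ξ‖ ≤ fourierConst n R * A * (2 * (1 - ρ)⁻¹) := by
  have hfc := fourierConst_pos n hR.le
  rw [h.fourier_psum]
  rcases eq_or_ne ξ 0 with rfl | hξ
  · have hz : ∀ i, 𝓕 (q i) 0 = 0 := fun i => by
      have := (h.ker_q i).norm_fourier_sub_integral_le (h.pos i) hR.le 0
      rw [h.ker_zero] at this
      simpa using this
    simp only [hz, Finset.sum_const_zero, norm_zero]
    have : 0 < 1 - ρ := by linarith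
    positivity
  have hξ0 := norm_pos_iff.2 hξ
  refine (norm_sum_le_of_le _ fun i _ => (h.ker_q i).norm_fourier_le_min (h.pos i) hR le_rfl
    (h.ker_zero i) hξ).trans ?_
  rw [← Finset.mul_sum]
  refine mul_le_mul_of_nonneg_left (sum_min_lacunary_le hρ0 hρ
    (fun i => mul_pos (h.pos i) hξ0) (fun i => ?_) k) (by positivity)
  rw [← mul_assoc]
  exact mul_le_mul_of_nonneg_right (h.lac i) hξ0.le

lemma sum_symbol_sq_le (hR : 0 < R) (hA : 0 < A) (hρ0 : 0 < ρ) (hρ : ρ < 1)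
    (h : LowData R A ρ j σ φ q) (N : ℕ) (ξ : Rn n) :
    ∑ k ∈ Finset.range (N + 1), ‖𝓕 (psum q k) ξ - 𝓕 (φ k) ξ * 𝓕 (psum q N) ξ‖ ^ 2 ≤
      (fourierConst n R * A * (1 + 3 * (fourierConst n R * A)) * (1 - ρ)⁻¹) ^ 2 *
        (2 * (1 - ρ)⁻¹) := by
  have hfc := fourierConst_pos n hR.le
  have hρ' : 0 < 1 - ρ := by linarith
  simp only [h.fourier_psum]
  rcases eq_or_ne ξ 0 with rfl | hξ
  · have hz : ∀ i, 𝓕 (q i) 0 = 0 := fun i => by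
      have := (h.ker_q i).norm_fourier_sub_integral_le (h.pos i) hR.le 0
      rw [h.ker_zero] at this
      simpa using this
    simp only [hz, Finset.sum_const_zero, mul_zero, sub_zero, norm_zero]
    norm_num
    positivity
  have hξ0 := norm_pos_iff.2 hξ
  have hx0 : ∀ i, 0 < σ i * ‖ξ‖ := fun i => mul_pos (h.pos i) hξ0
  have hx : ∀ i, σ (i + 1) * ‖ξ‖ ≤ ρ * (σ i * ‖ξ‖) := fun i => by
    rw [← mul_assoc]
    exact mul_le_mul_of_nonneg_right (h.lac i) hξ0.le
  refine sum_norm_low_symbol_sq_le hρ0 hρ hx0 hx fun k hk => ?_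
  refine norm_low_symbol_le (by positivity) hρ0 hρ hx0 hx
    (fun i => (h.ker_q i).norm_fourier_le_min (h.pos i) hR le_rfl (h.ker_zero i) hξ)
    (fun i => (h.ker i).norm_fourier_le (h.pos i) hR.le ξ)
    (fun i => (h.ker i).norm_fourier_le_inv (h.pos i) hR hξ) (fun i => ?_) (by omega)
  rw [norm_sub_rev, ← h.ker_one i]
  exact (h.ker i).norm_fourier_sub_integral_le (h.pos i) hR.le ξ

end LowData

/-- The `L²` bound for the jumps of the partial sums. -/
lemma exists_l2Bound_jumpKer_psum {r R A ρ : ℝ} (hr : 2 < r) [hq : Fact (1 ≤ ENNReal.ofReal r)]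
    (hR : 0 < R) (hA : 0 < A) (hρ0 : 0 < ρ) (hρ : ρ < 1) :
    ∃ C > (0 : ℝ), ∀ (s : Finset Chain) (N : ℕ), ChainsLe s N →
      ∀ (j : ℕ → ℤ) (σ : ℕ → ℝ) (φ q : ℕ → Rn n → ℂ), LowData R A ρ j σ φ q →
        L2Bound (jumpKer r s fun k => psum q (min k N)) C := by
  obtain ⟨C₁, hC₁, hD⟩ := exists_sum_lintegral_dyadicAvg_sub_le n hR.le hA.le hρ0 hρ
  have hfc := fourierConst_pos n hR.le
  have hρ' : 0 < 1 - ρ := by linarith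
  set C₂ := (fourierConst n R * A * (1 + 3 * (fourierConst n R * A)) * (1 - ρ)⁻¹) ^ 2 *
    (2 * (1 - ρ)⁻¹) with hC₂
  set C₃ := (fourierConst n R * A * (2 * (1 - ρ)⁻¹)) ^ 2 with hC₃
  set L := (ENNReal.ofReal (2 * 4 ^ (r + 1)) ^ (2 / r) *
    ENNReal.ofReal (4 + (1 - (2 : ℝ) ^ (-(r - 2)))⁻¹)).toReal with hL
  have hLt : ENNReal.ofReal L = ENNReal.ofReal (2 * 4 ^ (r + 1)) ^ (2 / r) *
      ENNReal.ofReal (4 + (1 - (2 : ℝ) ^ (-(r - 2)))⁻¹) :=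
    ENNReal.ofReal_toReal (ENNReal.mul_ne_top
      (ENNReal.rpow_ne_top_of_nonneg (by positivity) ENNReal.ofReal_ne_top) ENNReal.ofReal_ne_top)
  have hL0 : 0 ≤ L := ENNReal.toReal_nonneg
  refine ⟨√(3 * ((L + 4 * C₁) * C₃ + 4 * C₂)), by positivity, ?_⟩
  intro s N hs j σ φ q h f hf
  rw [Real.sq_sqrt (by positivity)]
  have hcφ : ∀ k, Continuous (mulK (φ k)) := fun k =>
    continuous_mulK (h.ker k).continuous
  have hsφ : ∀ k, HasCompactSupport (mulK (φ k)) := fun k =>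
    hasCompactSupport_mulK (h.ker k).hasCompactSupport
  have hcW : ∀ k, Continuous (mulK (psum q k)) := fun k => continuous_mulK (h.continuous_psum k)
  have hsW : ∀ k, HasCompactSupport (mulK (psum q k)) := fun k =>
    hasCompactSupport_mulK (h.hasCompactSupport_psum k)
  set g := opConv (mulK (psum q N)) f with hg
  have hgN : Nice g := hf.opConv (hcW N) (hsW N)
  set b : ℕ → Rn n → ℂ := fun k x => dyadicAvg (j k) g x - opConv (mulK (φ k)) g x with hb
  set c : ℕ → Rn n → ℂ := fun k => opConv (mulK (psum q (min k N))) f - opConv (mulK (φ k)) g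
    with hcdef
  have hbN : ∀ k, Nice (b k) := fun k => (hgN.dyadicAvg (j k)).sub (hgN.opConv (hcφ k) (hsφ k))
  have hcN : ∀ k, Nice (c k) := fun k =>
    (hf.opConv (hcW _) (hsW _)).sub (hgN.opConv (hcφ k) (hsφ k))
  have hgf : ∫⁻ x, ‖g x‖ₑ ^ (2 : ℝ) ≤ ENNReal.ofReal C₃ * ∫⁻ x, ‖f x‖ₑ ^ (2 : ℝ) := by
    have := sum_lintegral_opConv_sq_le (Finset.range 1) (κ := fun _ => psum q N)
      (fun _ => h.continuous_psum N) (fun _ => h.hasCompactSupport_psum N) (M := C₃)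
      (fun ξ => by
        simpa using pow_le_pow_left₀ (norm_nonneg _)
          (h.norm_fourier_psum_le hR hA hρ0 hρ N ξ) 2) hf
    simpa using this
  have hm : ∀ {u : ℕ → Rn n → ℂ}, (∀ k, Nice (u k)) → ∀ k, Measurable fun x =>
      ‖u k x‖ₑ ^ (2 : ℝ) := fun hu k => (hu k).meas.measurable.enorm.pow_const _
  have hsum : ∀ {u : ℕ → Rn n → ℂ}, (∀ k, Nice (u k)) →
      ∫⁻ x, 4 * ∑ k ∈ Finset.range (N + 1), ‖u k x‖ₑ ^ (2 : ℝ) =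
        4 * ∑ k ∈ Finset.range (N + 1), ∫⁻ x, ‖u k x‖ₑ ^ (2 : ℝ) := fun hu => by
    rw [lintegral_const_mul _ (Finset.measurable_sum _ fun k _ => hm hu k),
      lintegral_finsetSum _ fun k _ => hm hu k]
  have hjv : ∀ u : ℕ → ℂ, ‖jumpVec r s u‖ₑ ^ (2 : ℝ) ≤
      4 * ∑ k ∈ Finset.range (N + 1), ‖u k‖ₑ ^ (2 : ℝ) := fun u => by
    rw [ENNReal.rpow_two, ← ofReal_norm, ← ENNReal.ofReal_pow (norm_nonneg _)]
    refine (ENNReal.ofReal_le_ofReal (norm_jumpVec_sq_le hr.le hs)).trans (le_of_eq ?_)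
    rw [ENNReal.ofReal_mul (by norm_num), ENNReal.ofReal_sum_of_nonneg fun _ _ => by positivity]
    simp [ENNReal.ofReal_pow, ofReal_norm]
  have hpt : ∀ x, ‖opConv (jumpKer r s fun k => psum q (min k N)) f x‖ₑ ^ (2 : ℝ) ≤
      3 * (ENNReal.ofReal (2 * 4 ^ (r + 1)) ^ (2 / r) * varCtl r (mart j g x) N +
        4 * ∑ k ∈ Finset.range (N + 1), ‖b k x‖ₑ ^ (2 : ℝ) +
        4 * ∑ k ∈ Finset.range (N + 1), ‖c k x‖ₑ ^ (2 : ℝ)) := fun x => by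
    rw [opConv_jumpKer (fun k => h.continuous_psum _) (fun k => h.hasCompactSupport_psum _) hf.int]
    have e : (jumpVec r s fun k => opConv (mulK (psum q (min k N))) f x) =
        jumpVec r s (mart j g x) - jumpVec r s (fun k => b k x) + jumpVec r s (fun k => c k x) := by
      rw [← jumpVec_sub, ← jumpVec_add]
      congr 1; funext k
      simp only [hb, hcdef, mart, Pi.sub_apply]
      ring
    rw [e]
    refine (norm_sub_add_sq_le _ _ _).trans (mul_le_mul_right ?_ 3)
    exact add_le_add (add_le_add (enorm_jumpVec_sq_le_varCtl hr hs) (hjv _)) (hjv _)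
  have hmb : Measurable fun x => 4 * ∑ k ∈ Finset.range (N + 1), ‖b k x‖ₑ ^ (2 : ℝ) :=
    (Finset.measurable_sum _ fun k _ => hm hbN k).const_mul _
  have hmc : Measurable fun x => 4 * ∑ k ∈ Finset.range (N + 1), ‖c k x‖ₑ ^ (2 : ℝ) :=
    (Finset.measurable_sum _ fun k _ => hm hcN k).const_mul _
  have hbs : ∑ k ∈ Finset.range (N + 1), ∫⁻ x, ‖b k x‖ₑ ^ (2 : ℝ) ≤
      ENNReal.ofReal C₁ * ∫⁻ x, ‖g x‖ₑ ^ (2 : ℝ) :=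
    hD j σ φ h.mono h.pos h.le_scale h.scale_le h.lac h.ker h.ker_one N g hgN
  have hcs : ∑ k ∈ Finset.range (N + 1), ∫⁻ x, ‖c k x‖ₑ ^ (2 : ℝ) ≤
      ENNReal.ofReal C₂ * ∫⁻ x, ‖f x‖ₑ ^ (2 : ℝ) := by
    refine sum_lintegral_sq_le_of_fourier _ hcN hf
      (m := fun k ξ => 𝓕 (psum q (min k N)) ξ - 𝓕 (φ k) ξ * 𝓕 (psum q N) ξ) (fun k ξ => ?_)
      fun ξ => ?_
    · rw [hcdef, fourier_sub (hf.opConv (hcW _) (hsW _)).int (hgN.opConv (hcφ k) (hsφ k)).int,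
        fourier_opConv_mulK (h.integrable_psum _) hf.int,
        fourier_opConv_mulK (h.ker k).integrable hgN.int, hg,
        fourier_opConv_mulK (h.integrable_psum _) hf.int]
      ring
    · refine le_trans (le_of_eq (Finset.sum_congr rfl fun k hk => ?_))
        (h.sum_symbol_sq_le hR hA hρ0 hρ N ξ)
      rw [min_eq_left (by have := Finset.mem_range.1 hk; omega)]
  set X := ∫⁻ x, ‖f x‖ₑ ^ (2 : ℝ) with hX
  refine (lintegral_mono hpt).trans ?_
  rw [lintegral_const_mul' _ _ (by simp), lintegral_add_right _ hmc, lintegral_add_right _ hmb,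
    hsum hbN, hsum hcN, lintegral_const_mul' _ _
      (ENNReal.rpow_ne_top_of_nonneg (by positivity) ENNReal.ofReal_ne_top)]
  have h1 : ENNReal.ofReal (2 * 4 ^ (r + 1)) ^ (2 / r) * ∫⁻ x, varCtl r (mart j g x) N ≤
      ENNReal.ofReal (L * C₃) * X := by
    rw [ENNReal.ofReal_mul hL0, hLt, mul_assoc, mul_assoc]
    exact mul_le_mul_right ((lintegral_varCtl_le hr h.mono hgN N).trans
      (mul_le_mul_right hgf _)) _
  have h2 : 4 * ∑ k ∈ Finset.range (N + 1), ∫⁻ x, ‖b k x‖ₑ ^ (2 : ℝ) ≤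
      ENNReal.ofReal (4 * C₁ * C₃) * X := by
    rw [ENNReal.ofReal_mul (by positivity), ENNReal.ofReal_mul (by norm_num), mul_assoc, mul_assoc]
    simpa using mul_le_mul_right (hbs.trans (mul_le_mul_right hgf _)) 4
  have h3 : 4 * ∑ k ∈ Finset.range (N + 1), ∫⁻ x, ‖c k x‖ₑ ^ (2 : ℝ) ≤
      ENNReal.ofReal (4 * C₂) * X := by
    rw [ENNReal.ofReal_mul (by norm_num), mul_assoc]
    simpa using mul_le_mul_right hcs 4
  refine (mul_le_mul_right (add_le_add (add_le_add h1 h2) h3) 3).trans (le_of_eq ?_)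
  rw [← add_mul, ← add_mul, ← mul_assoc, ← ENNReal.ofReal_add (by positivity) (by positivity),
    ← ENNReal.ofReal_add (by positivity) (by positivity),
    show (3 : ℝ≥0∞) = ENNReal.ofReal 3 by simp, ← ENNReal.ofReal_mul (by norm_num)]
  congr 2
  ring

/-- `L^p` bounds for the jumps of the partial sums. -/
theorem lp_low_bound (hn : 0 < n) {p r R A ρ : ℝ} (hp : 1 < p) (hr : 2 < r)
    [hq : Fact (1 ≤ ENNReal.ofReal r)]
    (hR : 0 < R) (hA : 0 < A) (hρ0 : 0 < ρ) (hρ : ρ < 1) :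
    ∃ C > (0 : ℝ), ∀ (s : Finset Chain) (N : ℕ), ChainsLe s N →
      ∀ (j : ℕ → ℤ) (σ : ℕ → ℝ) (φ q : ℕ → Rn n → ℂ), LowData R A ρ j σ φ q →
      ∀ f : Rn n → ℂ, Nice f →
      ∫⁻ x, ‖jumpVec r s fun k => opConv (mulK (psum q (min k N))) f x‖ₑ ^ p ≤
        ENNReal.ofReal C * ∫⁻ x, ‖f x‖ₑ ^ p := by
  obtain ⟨C₀, hC₀, h2⟩ := exists_l2Bound_jumpKer_psum (n := n) hr hR hA hρ0 hρ
  obtain ⟨C, hC, a, ha0, ha1, hlp⟩ := lp_bound hn hp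
  set B₀ := (2 * R) ^ n * unitVol n * ((2 * A) ^ ((1 : ℝ) - 1) * A ^ (1 : ℝ) * R ^ (1 : ℝ)) *
    (2 * (1 - ρ ^ (1 : ℝ))⁻¹) with hB₀
  refine ⟨C * (C₀ ^ a * (max C₀ B₀) ^ (1 - a)) ^ p, by positivity, ?_⟩
  intro s N hs j σ φ q h f hf
  have hcW : ∀ k, Continuous (psum q (min k N)) := fun k => h.continuous_psum _
  have hsW : ∀ k, HasCompactSupport (psum q (min k N)) := fun k => h.hasCompactSupport_psum _
  have := hlp (JumpSpace r s) (jumpKer r s fun k => psum q (min k N)) (continuous_jumpKer hcW)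
    (hasCompactSupport_jumpKer hsW) C₀ (max C₀ B₀) hC₀ (le_max_left _ _) (h2 s N hs j σ φ q h)
    (fun y => ?_) f hf
  · simpa only [opConv_jumpKer hcW hsW hf.int] using this
  have hc : ∀ k, Continuous (q k) := fun k => (h.ker_q k).continuous
  have hpt : ∀ x, ‖jumpKer r s (fun k => psum q (min k N)) (x - y) -
      jumpKer r s (fun k => psum q (min k N)) x‖ₑ ≤
      ∑ k ∈ Finset.range N, ‖q k (x - y) - q k x‖ₑ := fun x => by
    rw [← ofReal_norm]
    refine (ENNReal.ofReal_le_ofReal ((norm_jumpKer_sub_le _ _ _).trans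
      (norm_jumpVec_le_sum (d := fun k => ‖q k (x - y) - q k x‖) hs (fun _ => norm_nonneg _)
        fun k => ?_))).trans (le_of_eq ?_)
    · rcases le_or_gt N k with hk | hk
      · rw [min_eq_right hk, min_eq_right (by omega)]; simp
      · rw [min_eq_left hk.le, min_eq_left (by omega)]
        simp only [psum, Finset.sum_range_succ]
        refine le_of_eq (congrArg _ ?_)
        ring
    · rw [ENNReal.ofReal_sum_of_nonneg fun _ _ => norm_nonneg _]
      simp [ofReal_norm]
  have hm : ∀ k, Measurable fun x => ‖q k (x - y) - q k x‖ₑ := fun k =>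
    Continuous.measurable (by have := hc k; fun_prop)
  refine (lintegral_mono hpt).trans ?_
  rw [lintegral_finsetSum _ fun k _ => hm k]
  exact (sum_lintegral_sub_le hR hA hA one_pos le_rfl hρ0 hρ h.pos h.lac h.ker_q y N).trans
    (ENNReal.ofReal_le_ofReal (le_max_right _ _))

end LowPart

section HighPart

variable {n : ℕ}

lemma ScaleKer.fourier_zero {R σ A B : ℝ} {q : Rn n → ℂ} (hq : ScaleKer R σ A B q) (hσ : 0 < σ)
    (hR : 0 ≤ R) (h0 : ∫ t, q t = 0) : 𝓕 q 0 = 0 := by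
  have := hq.norm_fourier_sub_integral_le hσ hR 0
  rw [h0] at this
  simpa using this

lemma sum_fourier_sq_le {R A B ρ : ℝ} (hR : 0 < R) (hAB : A ≤ B) (hρ0 : 0 < ρ)
    (hρ : ρ < 1) {σ : ℕ → ℝ} (hσ : ∀ k, 0 < σ k) (hlac : ∀ k, σ (k + 1) ≤ ρ * σ k)
    {κ : ℕ → Rn n → ℂ} (hκ : ∀ k, ScaleKer R (σ k) A B (κ k)) (h0 : ∀ k, ∫ t, κ k t = 0)
    (N : ℕ) (ξ : Rn n) :
    ∑ k ∈ Finset.range N, ‖𝓕 (κ k) ξ‖ ^ 2 ≤ (fourierConst n R * B) ^ 2 * (2 * (1 - ρ)⁻¹) := by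
  have hfc := fourierConst_pos n hR.le
  have hρ' : 0 < 1 - ρ := by linarith
  rcases eq_or_ne ξ 0 with rfl | hξ
  · simp only [(hκ _).fourier_zero (hσ _) hR.le (h0 _)]
    norm_num
    positivity
  have hξ0 := norm_pos_iff.2 hξ
  refine sum_norm_low_symbol_sq_le hρ0 hρ (fun i => mul_pos (hσ i) hξ0) (fun i => ?_) fun k _ =>
    (hκ k).norm_fourier_le_min (hσ k) hR hAB (h0 k) hξ
  rw [← mul_assoc]
  exact mul_le_mul_of_nonneg_right (hlac i) hξ0.le

lemma sum_fourier_sq_le_of_decay {R A B H ρ : ℝ} (hR : 0 < R) (hB : 0 ≤ B) (hAB : A ≤ B)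
    (hH : 0 ≤ H) (hρ0 : 0 < ρ) (hρ : ρ < 1) {σ : ℕ → ℝ} (hσ : ∀ k, 0 < σ k)
    (hlac : ∀ k, σ (k + 1) ≤ ρ * σ k) {κ : ℕ → Rn n → ℂ}
    (hκ : ∀ k, ScaleKer R (σ k) A B (κ k)) (h0 : ∀ k, ∫ t, κ k t = 0)
    (hd : ∀ k ξ, ‖𝓕 (κ k) ξ‖ ≤ H) (N : ℕ) (ξ : Rn n) :
    ∑ k ∈ Finset.range N, ‖𝓕 (κ k) ξ‖ ^ 2 ≤
      H ^ (3 / 2 : ℝ) * (fourierConst n R * B) ^ (1 / 2 : ℝ) *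
        (2 * (1 - ρ ^ (1 / 2 : ℝ))⁻¹) := by
  have hfc := fourierConst_pos n hR.le
  have hρ1 : ρ ^ (1 / 2 : ℝ) < 1 := Real.rpow_lt_one hρ0.le hρ (by norm_num)
  have hρ' : 0 < 1 - ρ ^ (1 / 2 : ℝ) := by linarith
  rcases eq_or_ne ξ 0 with rfl | hξ
  · simp only [(hκ _).fourier_zero (hσ _) hR.le (h0 _)]
    norm_num
    norm_num at hρ'
    positivity
  have hξ0 := norm_pos_iff.2 hξ
  have hx0 : ∀ i, 0 < σ i * ‖ξ‖ := fun i => mul_pos (hσ i) hξ0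
  have key : ∀ k, ‖𝓕 (κ k) ξ‖ ^ 2 ≤ H ^ (3 / 2 : ℝ) * (fourierConst n R * B) ^ (1 / 2 : ℝ) *
      min ((σ k * ‖ξ‖) ^ (1 / 2 : ℝ)) ((σ k * ‖ξ‖) ^ (1 / 2 : ℝ))⁻¹ := fun k => by
    have h1 := (hκ k).norm_fourier_le_min (hσ k) hR hAB (h0 k) hξ
    have hx := hx0 k
    have hmin : min (σ k * ‖ξ‖) (σ k * ‖ξ‖)⁻¹ ^ (1 / 2 : ℝ) ≤
        min ((σ k * ‖ξ‖) ^ (1 / 2 : ℝ)) ((σ k * ‖ξ‖) ^ (1 / 2 : ℝ))⁻¹ := by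
      rw [← Real.inv_rpow hx.le]
      exact le_min (Real.rpow_le_rpow (by positivity) (min_le_left _ _) (by norm_num))
        (Real.rpow_le_rpow (by positivity) (min_le_right _ _) (by norm_num))
    calc ‖𝓕 (κ k) ξ‖ ^ 2 = ‖𝓕 (κ k) ξ‖ ^ (3 / 2 : ℝ) * ‖𝓕 (κ k) ξ‖ ^ (1 / 2 : ℝ) := by
          rw [← Real.rpow_add_of_nonneg (norm_nonneg _) (by norm_num) (by norm_num),
            ← Real.rpow_natCast]
          norm_num
      _ ≤ H ^ (3 / 2 : ℝ) *
          (fourierConst n R * B * min (σ k * ‖ξ‖) (σ k * ‖ξ‖)⁻¹) ^ (1 / 2 : ℝ) :=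
          mul_le_mul (Real.rpow_le_rpow (norm_nonneg _) (hd k ξ) (by norm_num))
            (Real.rpow_le_rpow (norm_nonneg _) h1 (by norm_num)) (by positivity) (by positivity)
      _ ≤ _ := by
          rw [Real.mul_rpow (by positivity) (by positivity), mul_assoc]
          gcongr
  refine (Finset.sum_le_sum fun k _ => key k).trans ?_
  rw [← Finset.mul_sum]
  refine mul_le_mul_of_nonneg_left (sum_min_lacunary_le (by positivity) hρ1
    (fun i => Real.rpow_pos_of_pos (hx0 i) _) (fun i => ?_) N) (by positivity)
  rw [← Real.mul_rpow hρ0.le (hx0 i).le]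
  refine Real.rpow_le_rpow (hx0 _).le ?_ (by norm_num)
  rw [← mul_assoc]
  exact mul_le_mul_of_nonneg_right (hlac i) hξ0.le

/-- Bounds for the jumps of mean zero kernels at lacunary scales with amplitude `L`. -/
theorem lp_small_bound (hn : 0 < n) {p r R M ρ : ℝ} (hp : 1 < p) (hr : 2 ≤ r)
    [hq : Fact (1 ≤ ENNReal.ofReal r)] (hR : 0 < R) (hM : 0 < M) (hρ0 : 0 < ρ) (hρ : ρ < 1) :
    ∃ C > (0 : ℝ), ∀ (s : Finset Chain) (N : ℕ), ChainsLe s N →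
      ∀ (L : ℝ) (σ : ℕ → ℝ) (κ : ℕ → Rn n → ℂ), 0 < L → (∀ k, 0 < σ k) →
      (∀ k, σ (k + 1) ≤ ρ * σ k) → (∀ k, ScaleKer R (σ k) (M * L) (M * L) (κ k)) →
      (∀ k, ∫ t, κ k t = 0) → ∀ f : Rn n → ℂ, Nice f →
      ∫⁻ x, ‖jumpVec r s fun k => opConv (mulK (κ k)) f x‖ₑ ^ p ≤
        ENNReal.ofReal (C * L ^ p) * ∫⁻ x, ‖f x‖ₑ ^ p := by
  obtain ⟨C, hC, a, ha0, ha1, hlp⟩ := lp_jump_bound hn hp hr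
  have hfc := fourierConst_pos n hR.le
  have hv := unitVol_pos n
  have hρ' : 0 < 1 - ρ := by linarith
  set A₀ := fourierConst n R * M * √(2 * (1 - ρ)⁻¹) with hA₀
  set B₀ := (2 * R) ^ n * unitVol n * (M * R) * (2 * (1 - ρ)⁻¹) with hB₀
  have hA0 : 0 < A₀ := by positivity
  have hB0 : 0 < max A₀ B₀ := lt_max_of_lt_left hA0
  refine ⟨C * (A₀ ^ a * (max A₀ B₀) ^ (1 - a)) ^ p, by positivity, ?_⟩
  intro s N hs L σ κ hL hσ hlac hκ h0 f hf
  have := hlp s N hs κ (fun k => (hκ k).continuous) (fun k => (hκ k).hasCompactSupport)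
    (A₀ * L) (max A₀ B₀ * L) (by positivity) (by gcongr; exact le_max_left _ _)
    (fun ξ => (sum_fourier_sq_le hR le_rfl hρ0 hρ hσ hlac hκ h0 _ ξ).trans
      (le_of_eq ?_))
    (fun y => (sum_lintegral_sub_le hR (by positivity) (by positivity) one_pos le_rfl hρ0 hρ hσ
      hlac hκ y _).trans (ENNReal.ofReal_le_ofReal ?_)) f hf
  · have e : (A₀ * L) ^ a * (max A₀ B₀ * L) ^ (1 - a) =
        (A₀ ^ a * (max A₀ B₀) ^ (1 - a)) * L := by
      rw [Real.mul_rpow hA0.le hL.le, Real.mul_rpow hB0.le hL.le]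
      have : L ^ a * L ^ (1 - a) = L := by
        rw [← Real.rpow_add hL]; simp
      linear_combination (A₀ ^ a * (max A₀ B₀) ^ (1 - a)) * this
    rwa [e, Real.mul_rpow (by positivity) hL.le, ← mul_assoc] at this
  · rw [hA₀, mul_pow, mul_pow, mul_pow, mul_pow, Real.sq_sqrt (by positivity)]
    ring
  · refine le_trans (le_of_eq ?_) (mul_le_mul_of_nonneg_right (le_max_right A₀ B₀) hL.le)
    simp only [sub_self, Real.rpow_zero, Real.rpow_one, hB₀]
    ring

/-- Bounds for the jumps of mean zero oscillating kernels at lacunary scales. -/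
theorem lp_high_bound (hn : 0 < n) {p r R M ρ : ℝ} (hp : 1 < p) (hr : 2 ≤ r)
    [hq : Fact (1 ≤ ENNReal.ofReal r)] (hR : 0 < R) (hM : 0 < M) (hρ0 : 0 < ρ) (hρ : ρ < 1) :
    ∃ C > (0 : ℝ), ∃ δ > (0 : ℝ), ∀ (s : Finset Chain) (N : ℕ), ChainsLe s N →
      ∀ (L : ℝ) (σ : ℕ → ℝ) (κ : ℕ → Rn n → ℂ), 1 ≤ L → (∀ k, 0 < σ k) →
      (∀ k, σ (k + 1) ≤ ρ * σ k) → (∀ k, ScaleKer R (σ k) M (M * L) (κ k)) →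
      (∀ k, ∫ t, κ k t = 0) → (∀ k ξ, ‖𝓕 (κ k) ξ‖ ≤ M * L ^ (-(1 / 2) : ℝ)) →
      ∀ f : Rn n → ℂ, Nice f →
      ∫⁻ x, ‖jumpVec r s fun k => opConv (mulK (κ k)) f x‖ₑ ^ p ≤
        ENNReal.ofReal (C * (L ^ (-δ)) ^ p) * ∫⁻ x, ‖f x‖ₑ ^ p := by
  obtain ⟨C, hC, a, ha0, ha1, hlp⟩ := lp_jump_bound hn hp hr
  have hfc := fourierConst_pos n hR.le
  have hv := unitVol_pos n
  have hρ1 : ρ ^ (1 / 2 : ℝ) < 1 := Real.rpow_lt_one hρ0.le hρ (by norm_num)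
  have hρ' : 0 < 1 - ρ ^ (1 / 2 : ℝ) := by linarith
  have hρ2 : 0 < 1 - ρ ^ (a / 16) := by
    have := Real.rpow_lt_one hρ0.le hρ (z := a / 16) (by positivity)
    linarith
  set A₁ := M ^ (3 / 2 : ℝ) * (fourierConst n R * M) ^ (1 / 2 : ℝ) *
    (2 * (1 - ρ ^ (1 / 2 : ℝ))⁻¹) with hA₁
  have hA1 : 0 < A₁ := by positivity
  set B₀ := (2 * R) ^ n * unitVol n * ((2 * M) ^ (1 - a / 16) * M ^ (a / 16) * R ^ (a / 16)) *
    (2 * (1 - ρ ^ (a / 16))⁻¹) with hB₀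
  have hA0 : 0 < √A₁ := by positivity
  have hB0 : 0 < max √A₁ B₀ := lt_max_of_lt_left hA0
  refine ⟨C * (√A₁ ^ a * (max √A₁ B₀) ^ (1 - a)) ^ p, by positivity, a / 16, by positivity, ?_⟩
  intro s N hs L σ κ hL1 hσ hlac hκ h0 hd f hf
  have hL : 0 < L := by linarith
  have := hlp s N hs κ (fun k => (hκ k).continuous) (fun k => (hκ k).hasCompactSupport)
    (√A₁ * L ^ (-(1 / 8) : ℝ)) (max √A₁ B₀ * L ^ (a / 16)) (by positivity) ?_
    (fun ξ => (sum_fourier_sq_le_of_decay hR (by positivity) (le_mul_of_one_le_right hM.le hL1)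
      (by positivity) hρ0 hρ hσ hlac hκ h0 hd _ ξ).trans (le_of_eq ?_))
    (fun y => (sum_lintegral_sub_le (ε := a / 16) hR (by positivity) (by positivity)
      (by positivity) (by linarith) hρ0 hρ hσ
      hlac hκ y _).trans (ENNReal.ofReal_le_ofReal ?_)) f hf
  · refine this.trans (mul_le_mul_left (ENNReal.ofReal_le_ofReal ?_) _)
    have e : (√A₁ * L ^ (-(1 / 8) : ℝ)) ^ a * (max √A₁ B₀ * L ^ (a / 16)) ^ (1 - a) ≤
        (√A₁ ^ a * (max √A₁ B₀) ^ (1 - a)) * L ^ (-(a / 16)) := by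
      rw [Real.mul_rpow hA0.le (by positivity), Real.mul_rpow hB0.le (by positivity),
        ← Real.rpow_mul hL.le, ← Real.rpow_mul hL.le, mul_mul_mul_comm, ← Real.rpow_add hL]
      gcongr 2
      nlinarith
    rw [mul_assoc, ← Real.mul_rpow (by positivity) (by positivity)]
    gcongr
  · refine mul_le_mul (le_max_left _ _) (Real.rpow_le_rpow_of_exponent_le hL1 ?_)
      (by positivity) hB0.le
    linarith
  · rw [mul_pow, Real.sq_sqrt hA1.le, hA₁, ← mul_assoc (fourierConst n R), Real.mul_rpow hM.le
      (by positivity), Real.mul_rpow (by positivity) hL.le, ← Real.rpow_mul hL.le,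
      ← Real.rpow_natCast, ← Real.rpow_mul hL.le]
    have : L ^ (-(1 / 2) * (3 / 2) : ℝ) * L ^ (1 / 2 : ℝ) = L ^ (-(1 / 8) * (2 : ℕ) : ℝ) := by
      rw [← Real.rpow_add hL]; norm_num
    rw [← this]
    ring
  · refine le_trans (le_of_eq ?_) (mul_le_mul_of_nonneg_right (le_max_right (√A₁) B₀)
      (Real.rpow_nonneg hL.le _))
    rw [Real.mul_rpow hM.le hL.le, hB₀]
    ring

end HighPart

section PhaseFunction

/-- Quantitative form of the hypotheses on the phase. -/
structure PhaseCtl (Γ : ℝ → ℝ) (c₁ c₂ : ℝ) : Prop where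
  c₁_pos : 0 < c₁
  c₂_pos : 0 < c₂
  cont : ContinuousOn Γ (Ici 0)
  zero : Γ 0 = 0
  smono : StrictMonoOn Γ (Ici 0)
  d1 : ∀ s > 0, HasDerivAt Γ (deriv Γ s) s
  d2 : ∀ s > 0, HasDerivAt (deriv Γ) (deriv (deriv Γ) s) s
  cont2 : ContinuousOn (deriv (deriv Γ)) (Ioi 0)
  lo : ∀ s > 0, c₁ * Γ s ≤ s * deriv Γ s
  hi : ∀ s > 0, s * deriv Γ s ≤ c₂ * Γ s
  lo2 : ∀ s > 0, c₁ * Γ s ≤ s ^ 2 * |deriv (deriv Γ) s|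

lemma IsGammaU.exists_phaseCtl {Γ : ℝ → ℝ} (h : IsGammaU Γ) : ∃ c₁ c₂, PhaseCtl Γ c₁ c₂ := by
  have hsm : StrictMonoOn Γ (Ici 0) :=
    strictMonoOn_of_deriv_pos (convex_Ici 0) h.continuousOn fun s hs => by
      rw [interior_Ici] at hs; exact h.deriv_pos s hs
  have hpos : ∀ s > 0, 0 < Γ s := fun s hs => by
    have := hsm (mem_Ici.2 le_rfl) (mem_Ici.2 hs.le) hs
    rwa [h.map_zero] at this
  have hsm1 : ContDiffOn ℝ 1 (deriv Γ) (Ioi 0) :=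
    (h.smooth.of_le (m := 2) (WithTop.coe_le_coe.2 (le_top : (2 : ℕ∞) ≤ ⊤))).deriv_of_isOpen
      isOpen_Ioi (by norm_num)
  have hd : ∀ s > 0, HasDerivAt Γ (deriv Γ s) s := fun s hs =>
    ((h.smooth.contDiffAt (Ioi_mem_nhds hs)).differentiableAt (by simp)).hasDerivAt
  have hd2 : ∀ s > 0, HasDerivAt (deriv Γ) (deriv (deriv Γ) s) s := fun s hs =>
    ((hsm1.contDiffAt (Ioi_mem_nhds hs)).differentiableAt (by simp)).hasDerivAt
  have hc2 : ContinuousOn (deriv (deriv Γ)) (Ioi 0) :=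
    hsm1.continuousOn_deriv_of_isOpen isOpen_Ioi le_rfl
  obtain ⟨a, ha, h1⟩ := h.lower 1 (by simp)
  obtain ⟨b, hb, h2⟩ := h.lower 2 (by simp)
  obtain ⟨c, hc, h3⟩ := h.upper 1 le_rfl
  have e1 : ∀ s > 0, |s ^ 1 * iteratedDeriv 1 Γ s / Γ s| = s * deriv Γ s / Γ s := fun s hs => by
    have := hpos s hs
    have := h.deriv_pos s hs
    rw [iteratedDeriv_one, pow_one, abs_of_pos (by positivity)]
  refine ⟨min a b, c, lt_min ha hb, hc, h.continuousOn, h.map_zero, hsm, hd, hd2, hc2,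
    fun s hs => ?_, fun s hs => ?_, fun s hs => ?_⟩
  · have := h1 s hs
    rw [e1 s hs, le_div_iff₀ (hpos s hs)] at this
    exact (mul_le_mul_of_nonneg_right (min_le_left _ _) (hpos s hs).le).trans this
  · have := h3 s hs
    rwa [e1 s hs, div_le_iff₀ (hpos s hs)] at this
  · have := h2 s hs
    rw [abs_div, abs_mul, abs_of_pos (hpos s hs), le_div_iff₀ (hpos s hs), iteratedDeriv_succ,
      iteratedDeriv_one, abs_of_pos (pow_pos hs 2)] at this
    exact (mul_le_mul_of_nonneg_right (min_le_right _ _) (hpos s hs).le).trans this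

/-- The scale at which the phase takes the value `2^{-m}`. -/
def phaseScale (Γ : ℝ → ℝ) (m : ℤ) : ℝ := Function.invFunOn Γ (Ioi 0) ((2 : ℝ) ^ (-m))

namespace PhaseCtl

variable {Γ : ℝ → ℝ} {c₁ c₂ : ℝ}

lemma pos (h : PhaseCtl Γ c₁ c₂) {s : ℝ} (hs : 0 < s) : 0 < Γ s := by
  have := h.smono (mem_Ici.2 le_rfl) (mem_Ici.2 hs.le) hs
  rwa [h.zero] at this

lemma nonneg (h : PhaseCtl Γ c₁ c₂) {s : ℝ} (hs : 0 ≤ s) : 0 ≤ Γ s := by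
  rcases hs.eq_or_lt with rfl | hs
  · exact h.zero.ge
  · exact (h.pos hs).le

lemma hasDerivAt_mul_rpow (h : PhaseCtl Γ c₁ c₂) (c : ℝ) {s : ℝ} (hs : 0 < s) :
    HasDerivAt (fun s => Γ s * s ^ (-c)) ((s * deriv Γ s - c * Γ s) * s ^ (-c - 1)) s := by
  refine ((h.d1 s hs).mul (Real.hasDerivAt_rpow_const (p := -c) (.inl hs.ne'))).congr_deriv ?_
  have : s ^ (-c) = s * s ^ (-c - 1) := by
    rw [Real.rpow_sub_one hs.ne']; field_simp
  rw [this]; ring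

lemma mul_rpow_le_mul_rpow (h : PhaseCtl Γ c₁ c₂) {s t : ℝ} (hs : 0 < s) (hst : s ≤ t) :
    Γ s * (t / s) ^ c₁ ≤ Γ t ∧ Γ t ≤ Γ s * (t / s) ^ c₂ := by
  have ht := hs.trans_le hst
  have hcont : ∀ c : ℝ, ContinuousOn (fun s => Γ s * s ^ (-c)) (Ioi 0) := fun c x hx =>
    (h.hasDerivAt_mul_rpow c hx).continuousAt.continuousWithinAt
  have e : ∀ c : ℝ, (t / s) ^ c = t ^ c * s ^ (-c) := fun c => by
    rw [Real.div_rpow ht.le hs.le, Real.rpow_neg hs.le]; rfl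
  have e2 : ∀ c : ℝ, t ^ (-c) * t ^ c = 1 := fun c => by
    rw [← Real.rpow_add ht]; simp
  constructor
  · have hm : MonotoneOn (fun s => Γ s * s ^ (-c₁)) (Ioi 0) :=
      monotoneOn_of_deriv_nonneg (convex_Ioi 0) (hcont c₁)
        (fun x hx => by
          rw [interior_Ioi] at hx
          exact (h.hasDerivAt_mul_rpow c₁ hx).differentiableAt.differentiableWithinAt)
        fun x hx => by
          rw [interior_Ioi] at hx
          rw [(h.hasDerivAt_mul_rpow c₁ hx).deriv]
          have := h.lo x hx
          have hx' : (0 : ℝ) < x := hx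
          exact mul_nonneg (by linarith) (by positivity)
    have := mul_le_mul_of_nonneg_right (hm hs ht hst) (Real.rpow_nonneg ht.le c₁)
    simp only [mul_assoc, e2, mul_one] at this
    rw [e, mul_comm (t ^ c₁)]
    exact this
  · have hm : AntitoneOn (fun s => Γ s * s ^ (-c₂)) (Ioi 0) :=
      antitoneOn_of_deriv_nonpos (convex_Ioi 0) (hcont c₂)
        (fun x hx => by
          rw [interior_Ioi] at hx
          exact (h.hasDerivAt_mul_rpow c₂ hx).differentiableAt.differentiableWithinAt)
        fun x hx => by
          rw [interior_Ioi] at hx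
          rw [(h.hasDerivAt_mul_rpow c₂ hx).deriv]
          have := h.hi x hx
          have hx' : (0 : ℝ) < x := hx
          exact mul_nonpos_of_nonpos_of_nonneg (by linarith) (by positivity)
    have := mul_le_mul_of_nonneg_right (hm hs ht hst) (Real.rpow_nonneg ht.le c₂)
    simp only [mul_assoc, e2, mul_one] at this
    rw [e, mul_comm (t ^ c₂)]
    exact this

lemma surjOn (h : PhaseCtl Γ c₁ c₂) : SurjOn Γ (Ioi 0) (Ioi 0) := fun v hv => by
  have hv0 : (0 : ℝ) < v := hv
  have h1 := h.pos one_pos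
  set T : ℝ := max 1 ((v / Γ 1) ^ (c₁⁻¹)) with hT
  have hT1 : 1 ≤ T := le_max_left _ _
  have hvT : v ≤ Γ T := by
    have := (h.mul_rpow_le_mul_rpow one_pos hT1).1
    rw [div_one] at this
    refine le_trans ?_ this
    have h2 : ((v / Γ 1) ^ (c₁⁻¹)) ^ c₁ ≤ T ^ c₁ :=
      Real.rpow_le_rpow (by positivity) (le_max_right _ _) h.c₁_pos.le
    rw [← Real.rpow_mul (by positivity), inv_mul_cancel₀ h.c₁_pos.ne', Real.rpow_one,
      div_le_iff₀ h1] at h2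
    linarith
  obtain ⟨s, hs, rfl⟩ := intermediate_value_Icc (by linarith : (0 : ℝ) ≤ T)
    (h.cont.mono Icc_subset_Ici_self) (⟨by rw [h.zero]; exact hv0.le, hvT⟩ : v ∈ Icc (Γ 0) (Γ T))
  refine ⟨s, ?_, rfl⟩
  rcases hs.1.eq_or_lt with h0 | h0
  · rw [← h0, h.zero] at hv0; exact absurd hv0 (lt_irrefl _)
  · exact h0

lemma scale_pos (h : PhaseCtl Γ c₁ c₂) (m : ℤ) : 0 < phaseScale Γ m :=
  Function.invFunOn_mem (h.surjOn (show (2 : ℝ) ^ (-m) ∈ Ioi 0 by simp; positivity))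

lemma map_scale (h : PhaseCtl Γ c₁ c₂) (m : ℤ) : Γ (phaseScale Γ m) = (2 : ℝ) ^ (-m) :=
  Function.invFunOn_eq (h.surjOn (show (2 : ℝ) ^ (-m) ∈ Ioi 0 by simp; positivity))

lemma le_iff (h : PhaseCtl Γ c₁ c₂)
    {s t : ℝ} (hs : 0 ≤ s) (ht : 0 ≤ t) : Γ s ≤ Γ t ↔ s ≤ t := h.smono.le_iff_le hs ht

lemma scale_succ_le (h : PhaseCtl Γ c₁ c₂) (m : ℤ) : phaseScale Γ (m + 1) ≤ phaseScale Γ m := by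
  rw [← h.le_iff (h.scale_pos _).le (h.scale_pos _).le, h.map_scale, h.map_scale]
  exact zpow_le_zpow_right₀ one_le_two (by omega)

lemma ratio (h : PhaseCtl Γ c₁ c₂) (m : ℤ) : (phaseScale Γ m / phaseScale Γ (m + 1)) ^ c₁ ≤ 2 ∧
    2 ≤ (phaseScale Γ m / phaseScale Γ (m + 1)) ^ c₂ := by
  have h1 := h.mul_rpow_le_mul_rpow (h.scale_pos (m + 1)) (h.scale_succ_le m)
  rw [h.map_scale, h.map_scale, neg_add, zpow_add₀ two_ne_zero, zpow_neg_one, mul_assoc,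
    mul_assoc] at h1
  have hp : (0 : ℝ) < 2 ^ (-m) := by positivity
  constructor
  · have := h1.1
    nlinarith
  · have := h1.2
    nlinarith

/-- Ratio of consecutive scales, lower bound. -/
lemma scale_succ_le_mul (h : PhaseCtl Γ c₁ c₂) (m : ℤ) :
    phaseScale Γ (m + 1) ≤ (2 : ℝ) ^ (-c₂⁻¹) * phaseScale Γ m := by
  have h0 := h.scale_pos m
  have h1 := h.scale_pos (m + 1)
  have h2 := Real.rpow_le_rpow zero_le_two (h.ratio m).2 (inv_nonneg.2 h.c₂_pos.le)
  rw [← Real.rpow_mul (by positivity), mul_inv_cancel₀ h.c₂_pos.ne', Real.rpow_one,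
    le_div_iff₀ h1] at h2
  rw [Real.rpow_neg zero_le_two, le_inv_mul_iff₀ (by positivity)]
  exact h2

lemma scale_le_mul_succ (h : PhaseCtl Γ c₁ c₂) (m : ℤ) :
    phaseScale Γ m ≤ (2 : ℝ) ^ (c₁⁻¹) * phaseScale Γ (m + 1) := by
  have h0 := h.scale_pos m
  have h1 := h.scale_pos (m + 1)
  have h2 := Real.rpow_le_rpow (by positivity) (h.ratio m).1 (inv_nonneg.2 h.c₁_pos.le)
  rwa [← Real.rpow_mul (by positivity), mul_inv_cancel₀ h.c₁_pos.ne', Real.rpow_one,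
    div_le_iff₀ h1] at h2

/-- The annulus where `2^m Γ` is of size one. -/
lemma mem_annulus (h : PhaseCtl Γ c₁ c₂)
    {m : ℤ} {s : ℝ} (hs : 0 ≤ s) (h1 : 1 / 2 ≤ (2 : ℝ) ^ m * Γ s)
    (h2 : (2 : ℝ) ^ m * Γ s ≤ 2) :
    phaseScale Γ (m + 1) ≤ s ∧ s ≤ phaseScale Γ (m - 1) := by
  have hp : (0 : ℝ) < 2 ^ m := by positivity
  rw [← h.le_iff (h.scale_pos _).le hs, ← h.le_iff hs (h.scale_pos _).le, h.map_scale, h.map_scale,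
    neg_add, neg_sub, sub_eq_add_neg, zpow_add₀ two_ne_zero, zpow_add₀ two_ne_zero, zpow_neg,
    zpow_neg_one, zpow_one, inv_mul_le_iff₀ hp, ← div_eq_mul_inv, le_div_iff₀' hp]
  constructor <;> linarith

lemma mul_map_le_of_mem (h : PhaseCtl Γ c₁ c₂)
    {m : ℤ} {s : ℝ} (hs : 0 ≤ s) (h1 : phaseScale Γ (m + 1) ≤ s)
    (h2 : s ≤ phaseScale Γ (m - 1)) : 1 / 2 ≤ (2 : ℝ) ^ m * Γ s ∧ (2 : ℝ) ^ m * Γ s ≤ 2 := by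
  have hp : (0 : ℝ) < 2 ^ m := by positivity
  rw [← h.le_iff (h.scale_pos _).le hs, h.map_scale, neg_add, zpow_add₀ two_ne_zero, zpow_neg,
    zpow_neg_one, inv_mul_le_iff₀ hp] at h1
  rw [← h.le_iff hs (h.scale_pos _).le, h.map_scale, neg_sub, sub_eq_add_neg, zpow_add₀ two_ne_zero,
    zpow_neg, zpow_one, ← div_eq_mul_inv, le_div_iff₀' hp] at h2
  constructor <;> linarith

/-- The second derivative of the phase has constant sign. -/
lemma second_deriv_sign (h : PhaseCtl Γ c₁ c₂) :
    (∀ s > 0, 0 < deriv (deriv Γ) s) ∨ ∀ s > 0, deriv (deriv Γ) s < 0 := by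
  have hne : ∀ s > 0, deriv (deriv Γ) s ≠ 0 := fun s hs h0 => by
    have := h.lo2 s hs
    rw [h0, abs_zero, mul_zero] at this
    exact absurd this (not_le.2 (mul_pos h.c₁_pos (h.pos hs)))
  by_contra hcon
  push Not at hcon
  obtain ⟨⟨s, hs, h1⟩, t, ht, h2⟩ := hcon
  obtain ⟨u, hu, hu0⟩ := isPreconnected_Ioi.intermediate_value (s := Ioi (0 : ℝ)) hs ht h.cont2
    (⟨h1, h2⟩ : (0 : ℝ) ∈ Icc _ _)
  exact hne u hu hu0

end PhaseCtl

end PhaseFunction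

section Polar

variable {n : ℕ}

/-- Integration in polar coordinates. -/
lemma integral_polar (hn : 0 < n) {g : Rn n → ℂ} (hg : Integrable g) :
    ∫ x, g x = ∫ θ : Metric.sphere (0 : Rn n) 1, (∫ ρ in Ioi (0 : ℝ),
      ((ρ ^ (n - 1) : ℝ) : ℂ) * g (ρ • (θ : Rn n))) ∂((volume : Measure (Rn n)).toSphere) := by
  have : Nonempty (Fin n) := ⟨⟨0, hn⟩⟩
  have hdim : Module.finrank ℝ (Rn n) = n := by simp
  set G : Metric.sphere (0 : Rn n) 1 × Ioi (0 : ℝ) → ℂ := fun z => g (z.2.1 • z.1.1) with hG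
  have hmp := (volume : Measure (Rn n)).measurePreserving_homeomorphUnitSphereProd
  have hemb := (homeomorphUnitSphereProd (Rn n)).measurableEmbedding
  have hcomp : ∀ x : ({(0)}ᶜ : Set (Rn n)), G (homeomorphUnitSphereProd (Rn n) x) = g x := fun x => by
    have := congrArg Subtype.val ((homeomorphUnitSphereProd (Rn n)).symm_apply_apply x)
    rw [homeomorphUnitSphereProd_symm_apply_coe] at this
    simp only [hG]
    rw [this]
  have h1 : ∫ x, g x = ∫ z, G z ∂((volume : Measure (Rn n)).toSphere.prod
      (Measure.volumeIoiPow (Module.finrank ℝ (Rn n) - 1))) := by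
    rw [← hmp.integral_comp hemb]
    simp only [hcomp]
    rw [integral_subtype_comap (measurableSet_singleton _).compl, restrict_compl_singleton]
  have h2 : Integrable G ((volume : Measure (Rn n)).toSphere.prod
      (Measure.volumeIoiPow (Module.finrank ℝ (Rn n) - 1))) := by
    rw [← hmp.integrable_comp_emb hemb]
    have : (G ∘ homeomorphUnitSphereProd (Rn n)) = g ∘ Subtype.val := funext hcomp
    rw [this, ← integrableOn_iff_comap_subtypeVal (measurableSet_singleton _).compl]
    exact hg.integrableOn
  rw [h1, integral_prod _ h2]
  refine integral_congr_ae (Eventually.of_forall fun θ => ?_)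
  simp only [hdim, hG]
  simp only [Measure.volumeIoiPow, ENNReal.ofReal]
  rw [integral_withDensity_eq_integral_smul (measurable_subtype_coe.pow_const _).real_toNNReal,
    integral_subtype_comap measurableSet_Ioi fun a : ℝ =>
      Real.toNNReal (a ^ (n - 1)) • g (a • (θ : Rn n))]
  refine setIntegral_congr_fun measurableSet_Ioi fun x hx => ?_
  simp only [NNReal.smul_def]
  rw [Real.coe_toNNReal _ (pow_nonneg (le_of_lt hx) _), Complex.real_smul]

end Polar

section VanDerCorput

/-- Van der Corput's lemma for phases with large second derivative. -/
lemma norm_integral_exp_le {α β μ S D : ℝ} (hαβ : α ≤ β) (hμ : 0 < μ) {Φ Φ' Φ'' a a' : ℝ → ℝ}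
    (h1 : ∀ x ∈ Icc α β, HasDerivAt Φ (Φ' x) x) (h2 : ∀ x ∈ Icc α β, HasDerivAt Φ' (Φ'' x) x)
    (hc2 : ContinuousOn Φ'' (Icc α β))
    (hsgn : (∀ x ∈ Icc α β, μ ≤ Φ'' x) ∨ ∀ x ∈ Icc α β, Φ'' x ≤ -μ)
    (h3 : ∀ x ∈ Icc α β, HasDerivAt a (a' x) x) (hc3 : ContinuousOn a' (Icc α β))
    (hα : a α = 0) (hβ : a β = 0) (hS : ∀ x ∈ Icc α β, |a x| ≤ S)
    (hD : ∀ x ∈ Icc α β, |a' x| ≤ D) :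
    ‖∫ x in α..β, Complex.exp (Complex.I * (Φ x : ℂ)) * (a x : ℂ)‖ ≤
      2 * Real.pi * S / √μ + D * (β - α) / √μ := by
  set δ := √μ with hδ
  have hδ0 : 0 < δ := Real.sqrt_pos.2 hμ
  have hδ2 : δ ^ 2 = μ := Real.sq_sqrt hμ.le
  have hS0 : 0 ≤ S := (abs_nonneg _).trans (hS α ⟨le_rfl, hαβ⟩)
  have hD0 : 0 ≤ D := (abs_nonneg _).trans (hD α ⟨le_rfl, hαβ⟩)
  have hcΦ : ContinuousOn Φ (Icc α β) := fun x hx => (h1 x hx).continuousAt.continuousWithinAt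
  have hcΦ' : ContinuousOn Φ' (Icc α β) := fun x hx => (h2 x hx).continuousAt.continuousWithinAt
  have hca : ContinuousOn a (Icc α β) := fun x hx => (h3 x hx).continuousAt.continuousWithinAt
  have hq : ∀ x, 0 < Φ' x ^ 2 + δ ^ 2 := fun x => by positivity
  set w : ℝ → ℝ := fun x => Φ' x / (Φ' x ^ 2 + δ ^ 2) with hw
  set w' : ℝ → ℝ := fun x => Φ'' x * (δ ^ 2 - Φ' x ^ 2) / (Φ' x ^ 2 + δ ^ 2) ^ 2 with hw'
  have hdw : ∀ x ∈ Icc α β, HasDerivAt w (w' x) x := fun x hx => by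
    refine ((h2 x hx).div (((h2 x hx).pow 2).add_const (δ ^ 2)) (hq x).ne').congr_deriv ?_
    rw [hw']
    simp only [Pi.pow_apply]
    congr 1
    ring
  set E : ℝ → ℂ := fun x => Complex.exp (Complex.I * (Φ x : ℂ)) with hE
  have hEn : ∀ x, ‖E x‖ = 1 := fun x => by
    simp only [hE]; rw [mul_comm]; exact Complex.norm_exp_ofReal_mul_I _
  have hdE : ∀ x ∈ Icc α β, HasDerivAt E (E x * (Complex.I * (Φ' x : ℂ))) x := fun x hx =>
    (((h1 x hx).ofReal_comp).const_mul Complex.I).cexp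
  set F' : ℝ → ℂ := fun x => E x * (Complex.I * (Φ' x : ℂ)) * ((w x * a x : ℝ) : ℂ) +
    E x * ((w' x * a x + w x * a' x : ℝ) : ℂ) with hF'
  have hdF : ∀ x ∈ Icc α β, HasDerivAt (fun x => E x * ((w x * a x : ℝ) : ℂ)) (F' x) x :=
    fun x hx => (hdE x hx).mul ((hdw x hx).mul (h3 x hx)).ofReal_comp
  have hcE : ContinuousOn E (Icc α β) := fun x hx => (hdE x hx).continuousAt.continuousWithinAt
  have hcw : ContinuousOn w (Icc α β) := fun x hx => (hdw x hx).continuousAt.continuousWithinAt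
  have hcw' : ContinuousOn w' (Icc α β) :=
    (hc2.mul (continuousOn_const.sub (hcΦ'.pow 2))).div
      (((hcΦ'.pow 2).add continuousOn_const).pow 2) fun x _ => (pow_pos (hq x) 2).ne'
  have hof : ∀ {u : ℝ → ℝ}, ContinuousOn u (Icc α β) →
      ContinuousOn (fun x => (u x : ℂ)) (Icc α β) := fun hu =>
    Complex.continuous_ofReal.comp_continuousOn hu
  have hcF' : ContinuousOn F' (Icc α β) :=
    ((hcE.mul (continuousOn_const.mul (hof hcΦ'))).mul (hof (hcw.mul hca))).add
      (hcE.mul (hof ((hcw'.mul hca).add (hcw.mul hc3))))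
  have hint : ∀ {u : ℝ → ℂ}, ContinuousOn u (Icc α β) → IntervalIntegrable u volume α β := fun hu =>
    ContinuousOn.intervalIntegrable (by rwa [uIcc_of_le hαβ])
  have hF0 : ∫ x in α..β, F' x = 0 := by
    rw [intervalIntegral.integral_eq_sub_of_hasDerivAt
      (fun x hx => hdF x (by rwa [uIcc_of_le hαβ] at hx)) (hint hcF')]
    simp [hα, hβ]
  set V : ℝ → ℝ := fun x => |Φ'' x| / (Φ' x ^ 2 + δ ^ 2) with hV
  have hcV : ContinuousOn V (Icc α β) :=
    hc2.abs.div ((hcΦ'.pow 2).add continuousOn_const) fun x _ => (hq x).ne'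
  have hVint : ∫ x in α..β, V x ≤ Real.pi / δ := by
    obtain ⟨e, he, heV⟩ : ∃ e : ℝ, |e| = 1 ∧ ∀ x ∈ Icc α β, |Φ'' x| = e * Φ'' x := by
      rcases hsgn with h | h
      · exact ⟨1, by simp, fun x hx => by rw [one_mul, abs_of_pos (hμ.trans_le (h x hx))]⟩
      · exact ⟨-1, by simp, fun x hx => by rw [abs_of_neg (by linarith [h x hx])]; ring⟩
    have hd : ∀ x ∈ Icc α β, HasDerivAt (fun x => e / δ * Real.arctan (Φ' x / δ)) (V x) x :=
      fun x hx => by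
      refine ((((h2 x hx).div_const δ).arctan).const_mul (e / δ)).congr_deriv ?_
      simp only [hV]
      rw [heV x hx]
      have := hq x
      field_simp
      ring
    rw [intervalIntegral.integral_eq_sub_of_hasDerivAt
      (fun x hx => hd x (by rwa [uIcc_of_le hαβ] at hx))
      (ContinuousOn.intervalIntegrable (by rwa [uIcc_of_le hαβ])), ← mul_sub]
    refine (le_abs_self _).trans ?_
    rw [abs_mul, abs_div, he, abs_of_pos hδ0, one_div, div_eq_inv_mul Real.pi δ]
    refine mul_le_mul_of_nonneg_left (abs_le.2 ⟨?_, ?_⟩) (inv_nonneg.2 hδ0.le)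
    · linarith [Real.arctan_lt_pi_div_two (Φ' α / δ), Real.neg_pi_div_two_lt_arctan (Φ' β / δ)]
    · linarith [Real.arctan_lt_pi_div_two (Φ' β / δ), Real.neg_pi_div_two_lt_arctan (Φ' α / δ)]
  have hkey : ∫ x in α..β, E x * (a x : ℂ) =
      ∫ x in α..β, (E x * (a x : ℂ) + Complex.I * F' x) := by
    rw [intervalIntegral.integral_add (f := fun x => E x * (a x : ℂ))
      (g := fun x => Complex.I * F' x) (hint (hcE.mul (hof hca)))
      (hint (continuousOn_const.mul hcF')), intervalIntegral.integral_const_mul, hF0]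
    simp
  have hpt : ∀ x ∈ Icc α β, ‖E x * (a x : ℂ) + Complex.I * F' x‖ ≤ 2 * S * V x + D / δ :=
    fun x hx => by
    have hqx := hq x
    have hμx : δ ^ 2 ≤ |Φ'' x| := by
      rw [hδ2]
      rcases hsgn with h | h
      · exact (h x hx).trans (le_abs_self _)
      · exact (by linarith [h x hx] : μ ≤ -Φ'' x).trans (neg_le_abs _)
    have e1 : E x * (a x : ℂ) + Complex.I * F' x =
        E x * ((a x * (1 - Φ' x * w x) : ℝ) : ℂ) +
          E x * (Complex.I * ((w' x * a x + w x * a' x : ℝ) : ℂ)) := by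
      simp only [hF']
      push_cast
      linear_combination (E x * Φ' x * w x * a x : ℂ) * Complex.I_sq
    rw [e1]
    refine (norm_add_le _ _).trans ?_
    rw [norm_mul, norm_mul, norm_mul, hEn, one_mul, one_mul, Complex.norm_I, one_mul,
      Complex.norm_real, Complex.norm_real, Real.norm_eq_abs, Real.norm_eq_abs]
    have b1 : |a x * (1 - Φ' x * w x)| ≤ S * V x := by
      have : 1 - Φ' x * w x = δ ^ 2 / (Φ' x ^ 2 + δ ^ 2) := by
        simp only [hw]; field_simp; ring
      rw [this, abs_mul, abs_of_nonneg (a := δ ^ 2 / (Φ' x ^ 2 + δ ^ 2)) (by positivity)]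
      exact mul_le_mul (hS x hx) (div_le_div_of_nonneg_right hμx hqx.le) (by positivity) hS0
    have b2 : |w' x| ≤ V x := by
      simp only [hw', hV]
      rw [abs_div, abs_mul, abs_of_pos (pow_pos hqx 2), div_le_div_iff₀ (by positivity) hqx]
      have : |δ ^ 2 - Φ' x ^ 2| ≤ Φ' x ^ 2 + δ ^ 2 :=
        abs_le.2 ⟨by nlinarith [sq_nonneg (Φ' x), sq_nonneg δ],
          by nlinarith [sq_nonneg (Φ' x), sq_nonneg δ]⟩
      calc |Φ'' x| * |δ ^ 2 - Φ' x ^ 2| * (Φ' x ^ 2 + δ ^ 2)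
          ≤ |Φ'' x| * (Φ' x ^ 2 + δ ^ 2) * (Φ' x ^ 2 + δ ^ 2) := by gcongr
        _ = _ := by ring
    have b3 : |w x| ≤ 1 / δ := by
      simp only [hw]
      rw [abs_div, abs_of_pos hqx, div_le_div_iff₀ hqx hδ0, ← sq_abs (Φ' x)]
      nlinarith [sq_nonneg (|Φ' x| - δ), abs_nonneg (Φ' x), sq_nonneg (|Φ' x|)]
    have b4 : |w' x * a x + w x * a' x| ≤ S * V x + D / δ := by
      refine (abs_add_le _ _).trans (add_le_add ?_ ?_)
      · rw [abs_mul, mul_comm]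
        exact mul_le_mul (hS x hx) b2 (abs_nonneg _) hS0
      · rw [abs_mul, mul_comm, div_eq_mul_one_div]
        exact mul_le_mul (hD x hx) b3 (abs_nonneg _) hD0
    linarith
  rw [hkey]
  have hVi : IntervalIntegrable V volume α β :=
    ContinuousOn.intervalIntegrable (by rwa [uIcc_of_le hαβ])
  refine (intervalIntegral.norm_integral_le_of_norm_le hαβ (g := fun x => 2 * S * V x + D / δ)
    (Eventually.of_forall fun x hx => hpt x (Ioc_subset_Icc_self hx))
    ((hVi.const_mul _).add intervalIntegrable_const)).trans ?_
  rw [intervalIntegral.integral_add (hVi.const_mul _) intervalIntegrable_const,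
    intervalIntegral.integral_const_mul, intervalIntegral.integral_const, smul_eq_mul]
  have := mul_le_mul_of_nonneg_left hVint (by positivity : 0 ≤ 2 * S)
  refine (add_le_add this le_rfl).trans (le_of_eq ?_)
  ring

end VanDerCorput

section CutKernel

variable {n : ℕ}

namespace IsHomCZKernel

variable {K : Rn n → ℝ}

lemma map_smul (hK : IsHomCZKernel n K) {c : ℝ} (hc : 0 < c) {t : Rn n} (ht : t ≠ 0) :
    K (c • t) = (c ^ n)⁻¹ * K t := by
  obtain ⟨Ω, -, h2, -, h4⟩ := hK
  rw [h4 t ht, h4 _ (smul_ne_zero hc.ne' ht), h2 c hc, norm_smul, Real.norm_of_nonneg hc.le, mul_pow]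
  have : ‖t‖ ^ n ≠ 0 := pow_ne_zero _ (norm_ne_zero_iff.2 ht)
  field_simp

lemma contDiffAt (hK : IsHomCZKernel n K) {t : Rn n} (ht : t ≠ 0) : ContDiffAt ℝ 1 K t := by
  obtain ⟨Ω, h1, -, -, h4⟩ := hK
  have hmem : {x : Rn n | x ≠ 0} ∈ 𝓝 t := isOpen_ne.mem_nhds ht
  have hΩ : ContDiffAt ℝ 1 Ω t :=
    (h1.contDiffAt hmem).of_le (WithTop.coe_le_coe.2 (le_top : (1 : ℕ∞) ≤ ⊤))
  refine (hΩ.div ((contDiffAt_norm ℝ ht).pow n)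
    (pow_ne_zero _ (norm_ne_zero_iff.2 ht))).congr_of_eventuallyEq ?_
  filter_upwards [hmem] with x hx using h4 x hx

lemma continuousOn (hK : IsHomCZKernel n K) : ContinuousOn K {0}ᶜ := fun _ ht =>
  (hK.contDiffAt ht).continuousAt.continuousWithinAt

lemma exists_norm_le (hK : IsHomCZKernel n K) :
    ∃ C > 0, ∀ t : Rn n, t ≠ 0 → |K t| ≤ C * (‖t‖ ^ n)⁻¹ := by
  obtain ⟨C, hC⟩ := (isCompact_sphere (0 : Rn n) 1).exists_bound_of_continuousOn
    (hK.continuousOn.mono fun t ht h0 => by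
      rw [mem_singleton_iff] at h0
      rw [h0] at ht
      simp at ht)
  refine ⟨max C 1, by positivity, fun t ht => ?_⟩
  have hn := norm_pos_iff.2 ht
  have h1 : ‖t‖⁻¹ • t ∈ Metric.sphere (0 : Rn n) 1 := by
    rw [mem_sphere_zero_iff_norm, norm_smul, norm_inv, norm_norm, inv_mul_cancel₀ hn.ne']
  have h2 : K t = (‖t‖ ^ n)⁻¹ * K (‖t‖⁻¹ • t) := by
    rw [hK.map_smul (inv_pos.2 hn) ht, inv_pow, inv_inv, inv_mul_cancel_left₀ (by positivity)]
  rw [h2, abs_mul, abs_of_nonneg (by positivity), mul_comm]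
  exact mul_le_mul_of_nonneg_right ((hC _ h1).trans (le_max_left _ _)) (by positivity)

/-- Radial multiples of the kernel have integral zero. -/
lemma integral_radial_mul (hn : 0 < n) (hK : IsHomCZKernel n K) {G : ℝ → ℂ}
    (hG : Integrable fun t : Rn n => G ‖t‖ * (K t : ℂ)) : ∫ t : Rn n, G ‖t‖ * (K t : ℂ) = 0 := by
  obtain ⟨Ω, -, h2, h3, h4⟩ := hK
  rw [integral_polar hn hG]
  have : ∀ θ : Metric.sphere (0 : Rn n) 1, (∫ ρ in Ioi (0 : ℝ), ((ρ ^ (n - 1) : ℝ) : ℂ) *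
      (G ‖ρ • (θ : Rn n)‖ * (K (ρ • (θ : Rn n)) : ℂ))) =
      ((Ω θ : ℝ) : ℂ) * ∫ ρ in Ioi (0 : ℝ), G ρ * ((ρ⁻¹ : ℝ) : ℂ) := fun θ => by
    rw [← integral_const_mul]
    refine setIntegral_congr_fun measurableSet_Ioi fun ρ hρ => ?_
    have hρ0 : (0 : ℝ) < ρ := hρ
    have hθ : ‖(θ : Rn n)‖ = 1 := mem_sphere_zero_iff_norm.1 θ.2
    have hne : ρ • (θ : Rn n) ≠ 0 := smul_ne_zero hρ0.ne' (norm_ne_zero_iff.1 (by rw [hθ]; simp))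
    have hnorm : ‖ρ • (θ : Rn n)‖ = ρ := by rw [norm_smul, hθ, mul_one, Real.norm_of_nonneg hρ0.le]
    have hpow : ρ ^ n = ρ ^ (n - 1) * ρ := by rw [← pow_succ, Nat.sub_add_cancel hn]
    have e : ρ ^ (n - 1) * K (ρ • (θ : Rn n)) = Ω θ * ρ⁻¹ := by
      rw [h4 _ hne, h2 ρ hρ0, hnorm, hpow]
      field_simp
    simp only [hnorm]
    rw [mul_left_comm, ← Complex.ofReal_mul, e]
    push_cast
    ring
  simp only [this]
  rw [integral_mul_const, integral_complex_ofReal, h3]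
  simp

end IsHomCZKernel

/-- A bounded Lipschitz profile supported in `[1/2, 2]`. -/
structure Profile (a b : ℝ) (h : ℝ → ℂ) : Prop where
  left : ∀ v ≤ 1 / 2, h v = 0
  right : ∀ v, 2 ≤ v → h v = 0
  bd : ∀ v, ‖h v‖ ≤ a
  lip : ∀ u v, ‖h u - h v‖ ≤ b * |u - v|

/-- The part of the kernel `K` where `2^m Γ(|t|)` is of size one, with a radial weight. -/
def cutKer (Γ : ℝ → ℝ) (K : Rn n → ℝ) (h : ℝ → ℂ) (m : ℤ) (t : Rn n) : ℂ :=
  h ((2 : ℝ) ^ m * Γ ‖t‖) * (K t : ℂ)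

variable {Γ : ℝ → ℝ} {c₁ c₂ : ℝ} {K : Rn n → ℝ} {h : ℝ → ℂ} {a b : ℝ}

lemma Profile.nonneg (hh : Profile a b h) : 0 ≤ a ∧ 0 ≤ b :=
  ⟨(norm_nonneg _).trans (hh.bd 0), by simpa using (norm_nonneg _).trans (hh.lip 0 1)⟩

/-- The scale ratio across an annulus. -/
def annRatio (c₁ : ℝ) : ℝ := (2 : ℝ) ^ (c₁⁻¹)

lemma annRatio_pos (c₁ : ℝ) : 0 < annRatio c₁ := Real.rpow_pos_of_pos two_pos _

lemma one_le_annRatio (hc : 0 < c₁) : 1 ≤ annRatio c₁ :=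
  Real.one_le_rpow one_le_two (inv_nonneg.2 hc.le)

/-- A truncation of the kernel to a fixed annulus is bounded and Lipschitz. -/
lemma exists_unit_kernel (hK : IsHomCZKernel n K) {R : ℝ} (hR : 0 < R) :
    ∃ (P : Rn n → ℝ) (C : ℝ), 0 < C ∧ (∀ t, |P t| ≤ C) ∧ (∀ s t, |P s - P t| ≤ C * ‖s - t‖) ∧
      ∀ t, R⁻¹ ≤ ‖t‖ → ‖t‖ ≤ R → P t = K t := by
  set w : Rn n → ℝ := fun t => Real.smoothTransition (2 * R ^ 2 * ‖t‖ ^ 2 - 1) *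
    Real.smoothTransition (2 - ‖t‖ ^ 2 / R ^ 2) with hw
  have hwd : ContDiff ℝ 1 w :=
    (Real.smoothTransition.contDiff.comp
      ((contDiff_const.mul (contDiff_norm_sq ℝ)).sub contDiff_const)).mul
    (Real.smoothTransition.contDiff.comp (contDiff_const.sub ((contDiff_norm_sq ℝ).div_const _)))
  have hPd : ContDiff ℝ 1 fun t => w t * K t := by
    rw [contDiff_iff_contDiffAt]
    intro t
    by_cases ht : t = 0
    · refine (contDiffAt_const (c := (0 : ℝ))).congr_of_eventuallyEq ?_
      have : {x : Rn n | 2 * R ^ 2 * ‖x‖ ^ 2 - 1 < 0} ∈ 𝓝 t :=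
        (isOpen_lt (by fun_prop) continuous_const).mem_nhds (by simp [ht])
      filter_upwards [this] with x hx
      simp only [hw]
      rw [Real.smoothTransition.zero_of_nonpos (le_of_lt hx), zero_mul, zero_mul]
    · exact hwd.contDiffAt.mul (hK.contDiffAt ht)
  have hsupp : HasCompactSupport fun t => w t * K t :=
    HasCompactSupport.intro (isCompact_closedBall 0 (2 * R)) fun t ht => by
      rw [mem_closedBall_zero_iff, not_le] at ht
      have : 2 - ‖t‖ ^ 2 / R ^ 2 ≤ 0 := by
        rw [sub_nonpos, le_div_iff₀ (by positivity)]
        nlinarith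
      simp only [hw]
      rw [Real.smoothTransition.zero_of_nonpos this, mul_zero, zero_mul]
  obtain ⟨C₁, hC₁⟩ := hPd.continuous.bounded_above_of_compact_support hsupp
  obtain ⟨C₂, hC₂⟩ := hPd.lipschitzWith_of_hasCompactSupport hsupp (by simp)
  refine ⟨fun t => w t * K t, max (max C₁ C₂) 1, by positivity, fun t =>
    (hC₁ t).trans ((le_max_left _ _).trans (le_max_left _ _)), fun s t => ?_, fun t h1 h2 => ?_⟩
  · have := hC₂.dist_le_mul s t
    rw [Real.dist_eq, dist_eq_norm] at this
    exact this.trans (mul_le_mul_of_nonneg_right ((le_max_right _ _).trans (le_max_left _ _))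
      (norm_nonneg _))
  · have e1 : 1 ≤ R * ‖t‖ := (inv_le_iff_one_le_mul₀' hR).1 h1
    have e2 : 1 ≤ 2 * R ^ 2 * ‖t‖ ^ 2 - 1 := by nlinarith
    have e3 : 1 ≤ 2 - ‖t‖ ^ 2 / R ^ 2 := by
      have : ‖t‖ ^ 2 / R ^ 2 ≤ 1 := by
        rw [div_le_one (by positivity)]
        exact pow_le_pow_left₀ (norm_nonneg _) h2 2
      linarith
    simp only [hw]
    rw [Real.smoothTransition.one_of_one_le e2, Real.smoothTransition.one_of_one_le e3, one_mul,
      one_mul]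

namespace PhaseCtl

lemma scale_annulus (hΓ : PhaseCtl Γ c₁ c₂)
    (m : ℤ) : phaseScale Γ m ≤ annRatio c₁ * phaseScale Γ (m + 1) ∧
    phaseScale Γ (m - 1) ≤ annRatio c₁ * phaseScale Γ m := by
  refine ⟨hΓ.scale_le_mul_succ m, ?_⟩
  have := hΓ.scale_le_mul_succ (m - 1)
  rwa [sub_add_cancel] at this

/-- The phase is Lipschitz on an annulus, at the correct scale. -/
lemma lipschitz_annulus (hΓ : PhaseCtl Γ c₁ c₂)
    (m : ℤ) {s t : ℝ} (hs : s ∈ Icc (phaseScale Γ (m + 1)) (phaseScale Γ (m - 1)))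
    (ht : t ∈ Icc (phaseScale Γ (m + 1)) (phaseScale Γ (m - 1))) :
    |(2 : ℝ) ^ m * Γ s - (2 : ℝ) ^ m * Γ t| ≤
      2 * c₂ * annRatio c₁ * (phaseScale Γ m)⁻¹ * |s - t| := by
  have h1 := hΓ.scale_pos (m + 1)
  have h0 := hΓ.scale_pos m
  refine (convex_Icc _ _).norm_image_sub_le_of_norm_hasDerivWithin_le
    (f := fun x => (2 : ℝ) ^ m * Γ x) (f' := fun x => (2 : ℝ) ^ m * deriv Γ x)
    (fun x hx => ((hΓ.d1 x (h1.trans_le hx.1)).const_mul _).hasDerivWithinAt) (fun x hx => ?_) ht hs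
  have hx0 : 0 < x := h1.trans_le hx.1
  have h2 := (hΓ.mul_map_le_of_mem hx0.le hx.1 hx.2).2
  have h3 := hΓ.hi x hx0
  have h4 := hΓ.lo x hx0
  have hp : (0 : ℝ) < 2 ^ m := by positivity
  have hd : 0 ≤ deriv Γ x := nonneg_of_mul_nonneg_right
    ((mul_pos hΓ.c₁_pos (hΓ.pos hx0)).le.trans h4) hx0
  rw [Real.norm_of_nonneg (by positivity), ← div_eq_mul_inv, le_div_iff₀ h0]
  have h5 := (hΓ.scale_annulus m).1
  have hr := annRatio_pos c₁
  calc (2 : ℝ) ^ m * deriv Γ x * phaseScale Γ m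
      ≤ (2 : ℝ) ^ m * deriv Γ x * (annRatio c₁ * x) :=
        mul_le_mul_of_nonneg_left (h5.trans (mul_le_mul_of_nonneg_left hx.1 hr.le)) (by positivity)
    _ = (2 : ℝ) ^ m * (x * deriv Γ x) * annRatio c₁ := by ring
    _ ≤ (2 : ℝ) ^ m * (c₂ * Γ x) * annRatio c₁ := by gcongr
    _ = c₂ * annRatio c₁ * ((2 : ℝ) ^ m * Γ x) := by ring
    _ ≤ c₂ * annRatio c₁ * 2 := by
        have := hΓ.c₂_pos
        gcongr
    _ = _ := by ring

/-- Composition of a profile with the phase. -/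
lemma profile_lip (hΓ : PhaseCtl Γ c₁ c₂)
    (hh : Profile a b h) (m : ℤ) {s t : ℝ} (hs : 0 ≤ s) (ht : 0 ≤ t) :
    ‖h ((2 : ℝ) ^ m * Γ s) - h ((2 : ℝ) ^ m * Γ t)‖ ≤
      b * (2 * c₂ * annRatio c₁ * (phaseScale Γ m)⁻¹ * |s - t|) := by
  have hle : phaseScale Γ (m + 1) ≤ phaseScale Γ (m - 1) := by
    refine (hΓ.scale_succ_le m).trans ?_
    have := hΓ.scale_succ_le (m - 1)
    rwa [sub_add_cancel] at this
  have hm : phaseScale Γ (m + 1) ∈ Icc (phaseScale Γ (m + 1)) (phaseScale Γ (m - 1)) := ⟨le_rfl, hle⟩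
  have hp : (0 : ℝ) < 2 ^ m := by positivity
  have key : ∀ x, 0 ≤ x → h ((2 : ℝ) ^ m * Γ x) = h ((2 : ℝ) ^ m * Γ (projIcc _ _ hle x)) :=
    fun x hx => by
    rcases le_total x (phaseScale Γ (m + 1)) with h1 | h1
    · rw [projIcc_of_le_left hle h1]
      have e : (2 : ℝ) ^ m * Γ (phaseScale Γ (m + 1)) = 1 / 2 := by
        rw [hΓ.map_scale, ← zpow_add₀ two_ne_zero]; norm_num
      have h2 := (hΓ.le_iff hx (hΓ.scale_pos _).le).2 h1
      rw [hh.left _ (e ▸ mul_le_mul_of_nonneg_left h2 hp.le), hh.left _ e.le]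
    rcases le_total x (phaseScale Γ (m - 1)) with h2 | h2
    · rw [projIcc_of_mem hle ⟨h1, h2⟩]
    · rw [projIcc_of_right_le hle h2]
      have e : (2 : ℝ) ^ m * Γ (phaseScale Γ (m - 1)) = 2 := by
        rw [hΓ.map_scale, ← zpow_add₀ two_ne_zero]; norm_num
      have h3 := (hΓ.le_iff (hΓ.scale_pos _).le hx).2 h2
      rw [hh.right _ (e.ge.trans (mul_le_mul_of_nonneg_left h3 hp.le)), hh.right _ e.ge]
  rw [key s hs, key t ht]
  refine (hh.lip _ _).trans (mul_le_mul_of_nonneg_left ?_ hh.nonneg.2)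
  refine (hΓ.lipschitz_annulus m (projIcc _ _ hle s).2 (projIcc _ _ hle t).2).trans ?_
  have h0 := hΓ.scale_pos m
  have := hΓ.c₂_pos
  have hr := annRatio_pos c₁
  have h5 : |(projIcc _ _ hle s : ℝ) - projIcc _ _ hle t| ≤ |s - t| := by
    simpa [Real.dist_eq, Subtype.dist_eq] using (LipschitzWith.projIcc hle).dist_le_mul s t
  exact mul_le_mul_of_nonneg_left h5 (by positivity)

/-- Pieces of the kernel are kernels at the scale where the phase has size `2^{-m}`. -/
lemma exists_scaleKer_cutKer (hΓ : PhaseCtl Γ c₁ c₂) (hK : IsHomCZKernel n K) :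
    ∃ C > 0, ∀ a b h, Profile a b h → ∀ m : ℤ,
      ScaleKer (annRatio c₁) (phaseScale Γ m) (C * a) (C * (a + b)) (cutKer Γ K h m) := by
  have hr := annRatio_pos c₁
  have hr1 := one_le_annRatio hΓ.c₁_pos
  have hc₂ := hΓ.c₂_pos
  obtain ⟨P, C, hC, hP1, hP2, hP3⟩ := exists_unit_kernel hK hr
  set C' : ℝ := C * (1 + 2 * c₂ * annRatio c₁) with hC'
  have hCC' : C ≤ C' := le_mul_of_one_le_right hC.le (by nlinarith [mul_pos hc₂ hr])
  refine ⟨C', by positivity, fun a b h hh m => ?_⟩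
  have ha := hh.nonneg.1
  have hb := hh.nonneg.2
  set σ := phaseScale Γ m with hσ
  have h0 : 0 < σ := hΓ.scale_pos m
  have e : ∀ t : Rn n, cutKer Γ K h m t =
      h ((2 : ℝ) ^ m * Γ ‖t‖) * (((σ ^ n)⁻¹ * P (σ⁻¹ • t) : ℝ) : ℂ) := fun t => by
    unfold cutKer
    by_cases hz : h ((2 : ℝ) ^ m * Γ ‖t‖) = 0
    · rw [hz, zero_mul, zero_mul]
    congr 2
    have h1 : 1 / 2 ≤ (2 : ℝ) ^ m * Γ ‖t‖ := by
      by_contra hc; exact hz (hh.left _ (not_le.1 hc).le)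
    have h2 : (2 : ℝ) ^ m * Γ ‖t‖ ≤ 2 := by
      by_contra hc; exact hz (hh.right _ (not_le.1 hc).le)
    obtain ⟨h3, h4⟩ := hΓ.mem_annulus (norm_nonneg t) h1 h2
    obtain ⟨h5, h6⟩ := hΓ.scale_annulus m
    have ht : t ≠ 0 := norm_pos_iff.1 ((hΓ.scale_pos _).trans_le h3)
    have hnt : ‖σ⁻¹ • t‖ = σ⁻¹ * ‖t‖ := by
      rw [norm_smul, norm_inv, Real.norm_of_nonneg h0.le]
    rw [hP3 _ (by
      rw [hnt, ← div_eq_inv_mul, le_div_iff₀ h0, inv_mul_le_iff₀ hr]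
      exact h5.trans (mul_le_mul_of_nonneg_left h3 hr.le)) (by
      rw [hnt, inv_mul_le_iff₀ h0, mul_comm]
      exact h4.trans h6), hK.map_smul (inv_pos.2 h0) ht, inv_pow, inv_inv,
      inv_mul_cancel_left₀ (by positivity)]
  have hP0 : ∀ t, ‖(((σ ^ n)⁻¹ * P (σ⁻¹ • t) : ℝ) : ℂ)‖ ≤ (σ ^ n)⁻¹ * C := fun t => by
    rw [Complex.norm_real, Real.norm_eq_abs, abs_mul, abs_of_nonneg (by positivity)]
    exact mul_le_mul_of_nonneg_left (hP1 _) (by positivity)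
  refine ⟨fun t ht => ?_, fun t => ?_, fun s t => ?_⟩
  · unfold cutKer
    rw [hh.right, zero_mul]
    by_contra hc
    push Not at hc
    have hp : (0 : ℝ) < 2 ^ m := by positivity
    have h1 : phaseScale Γ (m - 1) ≤ ‖t‖ := (hΓ.scale_annulus m).2.trans ht.le
    have h2 := (hΓ.le_iff (hΓ.scale_pos _).le (norm_nonneg t)).2 h1
    have e : (2 : ℝ) ^ m * Γ (phaseScale Γ (m - 1)) = 2 := by
      rw [hΓ.map_scale, ← zpow_add₀ two_ne_zero]; norm_num
    nlinarith
  · rw [e, norm_mul]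
    calc _ ≤ a * ((σ ^ n)⁻¹ * C) := mul_le_mul (hh.bd _) (hP0 t) (norm_nonneg _) ha
      _ ≤ a * ((σ ^ n)⁻¹ * C') := by gcongr
      _ = _ := by ring
  · rw [e, e]
    have e2 : ∀ x y z w : ℂ, x * y - z * w = (x - z) * y + z * (y - w) := fun x y z w => by ring
    rw [e2]
    refine (norm_add_le _ _).trans ?_
    rw [norm_mul, norm_mul]
    have b1 := hΓ.profile_lip hh m (norm_nonneg s) (norm_nonneg t)
    have b2 : |‖s‖ - ‖t‖| ≤ ‖s - t‖ := abs_norm_sub_norm_le s t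
    have b3 := hP2 (σ⁻¹ • s) (σ⁻¹ • t)
    rw [← smul_sub, norm_smul, norm_inv, Real.norm_of_nonneg h0.le] at b3
    have b4 : ‖(((σ ^ n)⁻¹ * P (σ⁻¹ • s) : ℝ) : ℂ) - (((σ ^ n)⁻¹ * P (σ⁻¹ • t) : ℝ) : ℂ)‖ ≤
        (σ ^ n)⁻¹ * (C * (σ⁻¹ * ‖s - t‖)) := by
      rw [← Complex.ofReal_sub, Complex.norm_real, ← mul_sub, Real.norm_eq_abs, abs_mul,
        abs_of_nonneg (by positivity : 0 ≤ (σ ^ n)⁻¹)]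
      exact mul_le_mul_of_nonneg_left b3 (by positivity)
    calc _ ≤ b * (2 * c₂ * annRatio c₁ * σ⁻¹ * ‖s - t‖) * ((σ ^ n)⁻¹ * C) +
          a * ((σ ^ n)⁻¹ * (C * (σ⁻¹ * ‖s - t‖))) := by
          refine add_le_add (mul_le_mul (b1.trans ?_) (hP0 s) (norm_nonneg _) (by positivity))
            (mul_le_mul (hh.bd _) b4 (norm_nonneg _) ha)
          exact mul_le_mul_of_nonneg_left (mul_le_mul_of_nonneg_left b2 (by positivity)) hb
      _ = (b * (C * (2 * c₂ * annRatio c₁)) + a * C) * ((σ ^ (n + 1))⁻¹ * ‖s - t‖) := by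
          rw [pow_succ]; field_simp
      _ ≤ (b * C' + a * C') * ((σ ^ (n + 1))⁻¹ * ‖s - t‖) := by
          have : C * (2 * c₂ * annRatio c₁) ≤ C' := by
            rw [hC']; exact mul_le_mul_of_nonneg_left (by linarith) hC.le
          gcongr
      _ = _ := by ring

lemma integral_cutKer (hΓ : PhaseCtl Γ c₁ c₂)
    (hn : 0 < n) (hK : IsHomCZKernel n K) (hh : Profile a b h) (m : ℤ) :
    ∫ t, cutKer Γ K h m t = 0 := by
  obtain ⟨C, -, hC⟩ := hΓ.exists_scaleKer_cutKer hK
  exact hK.integral_radial_mul hn (G := fun s => h ((2 : ℝ) ^ m * Γ s)) (hC a b h hh m).integrable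

end PhaseCtl

end CutKernel

section Profiles

/-- A smooth cutoff, one on `(-∞, 1]` and zero on `[2, ∞)`. -/
def cutoff (v : ℝ) : ℝ := Real.smoothTransition (2 - v)

/-- A smooth bump on `[1/2, 2]` whose dyadic dilates sum to one. -/
def annProf (v : ℝ) : ℝ := cutoff v - cutoff (2 * v)

lemma cutoff_eq_one {v : ℝ} (h : v ≤ 1) : cutoff v = 1 :=
  Real.smoothTransition.one_of_one_le (by linarith)

lemma cutoff_eq_zero {v : ℝ} (h : 2 ≤ v) : cutoff v = 0 :=
  Real.smoothTransition.zero_of_nonpos (by linarith)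

lemma cutoff_nonneg (v : ℝ) : 0 ≤ cutoff v := Real.smoothTransition.nonneg _

lemma cutoff_le_one (v : ℝ) : cutoff v ≤ 1 := Real.smoothTransition.le_one _

lemma contDiff_cutoff : ContDiff ℝ 1 cutoff :=
  Real.smoothTransition.contDiff.comp (contDiff_const.sub contDiff_id)

lemma annProf_eq_zero_left {v : ℝ} (h : v ≤ 1 / 2) : annProf v = 0 := by
  rw [annProf, cutoff_eq_one (by linarith), cutoff_eq_one (by linarith), sub_self]

lemma annProf_eq_zero_right {v : ℝ} (h : 2 ≤ v) : annProf v = 0 := by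
  rw [annProf, cutoff_eq_zero h, cutoff_eq_zero (by linarith), sub_self]

lemma abs_annProf_le (v : ℝ) : |annProf v| ≤ 1 := by
  rw [annProf, abs_le]
  constructor <;> linarith [cutoff_nonneg v, cutoff_nonneg (2 * v), cutoff_le_one v,
    cutoff_le_one (2 * v)]

lemma contDiff_annProf : ContDiff ℝ 1 annProf :=
  contDiff_cutoff.sub (contDiff_cutoff.comp (contDiff_const.mul contDiff_id))

lemma hasCompactSupport_annProf : HasCompactSupport annProf :=
  HasCompactSupport.intro (isCompact_Icc (a := (1 / 2 : ℝ)) (b := 2)) fun v hv => by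
    rcases le_total v (1 / 2) with h | h
    · exact annProf_eq_zero_left h
    · refine annProf_eq_zero_right ?_
      by_contra hc
      exact hv ⟨h, (not_le.1 hc).le⟩

lemma exists_deriv_annProf_le : ∃ B > 0, ∀ v, |deriv annProf v| ≤ B := by
  obtain ⟨B, hB⟩ := (contDiff_annProf.continuous_deriv le_rfl).bounded_above_of_compact_support
    hasCompactSupport_annProf.deriv
  exact ⟨max B 1, by positivity, fun v => (hB v).trans (le_max_left _ _)⟩

lemma annProf_lip {B : ℝ} (hB : ∀ v, |deriv annProf v| ≤ B) (u v : ℝ) :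
    |annProf u - annProf v| ≤ B * |u - v| :=
  convex_univ.norm_image_sub_le_of_norm_deriv_le
    (fun x _ => (contDiff_annProf.differentiable one_ne_zero) x) (fun x _ => hB x) (mem_univ v)
    (mem_univ u)

/-- The modulation `e^{iLv}`. -/
def phaseExp (L v : ℝ) : ℂ := Complex.exp (Complex.I * ((L * v : ℝ) : ℂ))

lemma norm_phaseExp (L v : ℝ) : ‖phaseExp L v‖ = 1 := by
  rw [phaseExp, mul_comm]; exact Complex.norm_exp_ofReal_mul_I _

lemma norm_phaseExp_sub_one_le (L v : ℝ) : ‖phaseExp L v - 1‖ ≤ |L * v| :=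
  Real.norm_exp_I_mul_ofReal_sub_one_le

lemma norm_phaseExp_sub_le {L : ℝ} (hL : 0 ≤ L) (u v : ℝ) :
    ‖phaseExp L u - phaseExp L v‖ ≤ L * |u - v| := by
  have : phaseExp L u - phaseExp L v = phaseExp L v * (phaseExp L (u - v) - 1) := by
    rw [mul_sub, mul_one]
    simp only [phaseExp]
    rw [← Complex.exp_add]
    congr 2
    push_cast
    ring
  rw [this, norm_mul, norm_phaseExp, one_mul]
  refine (norm_phaseExp_sub_one_le _ _).trans_eq ?_
  rw [abs_mul, abs_of_nonneg hL]

lemma continuous_phaseExp (L : ℝ) : Continuous (phaseExp L) := by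
  unfold phaseExp; fun_prop

/-- The basic profile. -/
def baseProf (v : ℝ) : ℂ := (annProf v : ℂ)

/-- The modulated profile. -/
def modProf (L v : ℝ) : ℂ := phaseExp L v * (annProf v : ℂ)

/-- The modulated profile with its leading term removed. -/
def errProf (L v : ℝ) : ℂ := (phaseExp L v - 1) * (annProf v : ℂ)

lemma norm_annProf_cast (v : ℝ) : ‖(annProf v : ℂ)‖ ≤ 1 := by
  rw [Complex.norm_real]; exact abs_annProf_le v

variable {B L : ℝ}

lemma profile_base (hB : ∀ v, |deriv annProf v| ≤ B) : Profile 1 B baseProf where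
  left v hv := by rw [baseProf, annProf_eq_zero_left hv, Complex.ofReal_zero]
  right v hv := by rw [baseProf, annProf_eq_zero_right hv, Complex.ofReal_zero]
  bd := norm_annProf_cast
  lip u v := by
    rw [baseProf, baseProf, ← Complex.ofReal_sub, Complex.norm_real]
    exact annProf_lip hB u v

lemma profile_mod (hB : ∀ v, |deriv annProf v| ≤ B) (hL : 0 ≤ L) :
    Profile 1 (L + B) (modProf L) where
  left v hv := by rw [modProf, annProf_eq_zero_left hv, Complex.ofReal_zero, mul_zero]
  right v hv := by rw [modProf, annProf_eq_zero_right hv, Complex.ofReal_zero, mul_zero]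
  bd v := by rw [modProf, norm_mul, norm_phaseExp, one_mul]; exact norm_annProf_cast v
  lip u v := by
    have e : modProf L u - modProf L v = (phaseExp L u - phaseExp L v) * (annProf u : ℂ) +
        phaseExp L v * (baseProf u - baseProf v) := by
      simp only [modProf, baseProf]; ring
    rw [e, add_mul]
    refine (norm_add_le _ _).trans (add_le_add ?_ ?_)
    · rw [norm_mul]
      exact (mul_le_of_le_one_right (norm_nonneg _) (norm_annProf_cast u)).trans
        (norm_phaseExp_sub_le hL u v)
    · rw [norm_mul, norm_phaseExp, one_mul]
      exact (profile_base hB).lip u v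

lemma profile_err (hB : ∀ v, |deriv annProf v| ≤ B) (hL : 0 ≤ L) :
    Profile (2 * L) (L * (1 + 2 * B)) (errProf L) where
  left v hv := by rw [errProf, annProf_eq_zero_left hv, Complex.ofReal_zero, mul_zero]
  right v hv := by rw [errProf, annProf_eq_zero_right hv, Complex.ofReal_zero, mul_zero]
  bd v := by
    rw [errProf, norm_mul]
    rcases le_total 2 |v| with h | h
    · have : annProf v = 0 := by
        rcases le_abs.1 h with h | h
        · exact annProf_eq_zero_right h
        · exact annProf_eq_zero_left (by linarith)
      rw [this, Complex.ofReal_zero, norm_zero, mul_zero]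
      positivity
    · refine (mul_le_of_le_one_right (norm_nonneg _) (norm_annProf_cast v)).trans
        ((norm_phaseExp_sub_one_le L v).trans ?_)
      rw [abs_mul, abs_of_nonneg hL, mul_comm]
      exact mul_le_mul_of_nonneg_right h hL
  lip := by
    have hB0 : 0 ≤ B := (abs_nonneg _).trans (hB 0)
    have hz : ∀ v, 2 ≤ |v| → annProf v = 0 := fun v h => by
      rcases le_abs.1 h with h | h
      · exact annProf_eq_zero_right h
      · exact annProf_eq_zero_left (by linarith)
    have hs : ∀ v, |v| ≤ 2 → ‖phaseExp L v - 1‖ ≤ 2 * L := fun v h => by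
      refine (norm_phaseExp_sub_one_le L v).trans ?_
      rw [abs_mul, abs_of_nonneg hL, mul_comm]
      exact mul_le_mul_of_nonneg_right h hL
    have key : ∀ u v, |v| ≤ 2 → ‖errProf L u - errProf L v‖ ≤ L * (1 + 2 * B) * |u - v| :=
      fun u v hv => by
      have e : errProf L u - errProf L v = (phaseExp L u - phaseExp L v) * (annProf u : ℂ) +
          (phaseExp L v - 1) * (baseProf u - baseProf v) := by
        simp only [errProf, baseProf]; ring
      rw [e, show L * (1 + 2 * B) * |u - v| = L * |u - v| + 2 * L * (B * |u - v|) by ring]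
      refine (norm_add_le _ _).trans (add_le_add ?_ ?_)
      · rw [norm_mul]
        exact (mul_le_of_le_one_right (norm_nonneg _) (norm_annProf_cast u)).trans
          (norm_phaseExp_sub_le hL u v)
      · rw [norm_mul]
        exact mul_le_mul (hs v hv) ((profile_base hB).lip u v) (norm_nonneg _) (by positivity)
    intro u v
    rcases le_total |v| 2 with hv | hv
    · exact key u v hv
    rcases le_total |u| 2 with hu | hu
    · rw [norm_sub_rev, abs_sub_comm]
      exact key v u hu
    · rw [errProf, errProf, hz u hu, hz v hv, Complex.ofReal_zero, mul_zero, mul_zero, sub_zero,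
        norm_zero]
      positivity

end Profiles

section FourierDecay

variable {n : ℕ} {Γ : ℝ → ℝ} {c₁ c₂ : ℝ} {K : Rn n → ℝ}

namespace PhaseCtl

/-- The one-dimensional oscillatory integral along a ray. -/
lemma norm_integral_ray_le (hΓ : PhaseCtl Γ c₁ c₂)
    {B : ℝ} (hB : ∀ v, |deriv annProf v| ≤ B) {L : ℝ} (hL : 0 < L) (m : ℤ)
    (τ : ℝ) :
    ‖∫ ρ in Ioi (0 : ℝ), Complex.exp (Complex.I * ((L * ((2 : ℝ) ^ m * Γ ρ) - τ * ρ : ℝ) : ℂ)) *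
        ((annProf ((2 : ℝ) ^ m * Γ ρ) / ρ : ℝ) : ℂ)‖ ≤
      (2 * Real.pi * annRatio c₁ ^ 2 + (2 * c₂ * B + 1) * annRatio c₁ ^ 4) / √(c₁ / 2) / √L := by
  have hB0 : 0 ≤ B := (abs_nonneg _).trans (hB 0)
  have hr := annRatio_pos c₁
  have hc₁ := hΓ.c₁_pos
  have hc₂ := hΓ.c₂_pos
  set σ := phaseScale Γ m with hσ
  have h0 : 0 < σ := hΓ.scale_pos m
  set α := phaseScale Γ (m + 1) with hα
  set β := phaseScale Γ (m - 1) with hβ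
  have hα0 : 0 < α := hΓ.scale_pos _
  have hβ0 : 0 < β := hΓ.scale_pos _
  obtain ⟨hσα, hβσ⟩ := hΓ.scale_annulus m
  have hp : (0 : ℝ) < 2 ^ m := by positivity
  have hαβ : α ≤ β := by
    refine (hΓ.scale_succ_le m).trans ?_
    have := hΓ.scale_succ_le (m - 1)
    rwa [sub_add_cancel] at this
  have hzl : ∀ ρ, 0 ≤ ρ → ρ ≤ α → annProf ((2 : ℝ) ^ m * Γ ρ) = 0 := fun ρ h1 h2 => by
    refine annProf_eq_zero_left ?_
    have e : (2 : ℝ) ^ m * Γ α = 1 / 2 := by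
      rw [hα, hΓ.map_scale, ← zpow_add₀ two_ne_zero]; norm_num
    exact (mul_le_mul_of_nonneg_left ((hΓ.le_iff h1 hα0.le).2 h2) hp.le).trans_eq e
  have hzr : ∀ ρ, β ≤ ρ → annProf ((2 : ℝ) ^ m * Γ ρ) = 0 := fun ρ h2 => by
    refine annProf_eq_zero_right ?_
    have e : (2 : ℝ) ^ m * Γ β = 2 := by
      rw [hβ, hΓ.map_scale, ← zpow_add₀ two_ne_zero]; norm_num
    exact e.ge.trans
      (mul_le_mul_of_nonneg_left ((hΓ.le_iff hβ0.le (hβ0.le.trans h2)).2 h2) hp.le)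
  have hpos : ∀ x ∈ Icc α β, 0 < x := fun x hx => hα0.trans_le hx.1
  have hσx : ∀ x ∈ Icc α β, x⁻¹ ≤ annRatio c₁ / σ := fun x hx => by
    rw [inv_eq_one_div, div_le_div_iff₀ (hpos x hx) h0, one_mul]
    exact hσα.trans (mul_le_mul_of_nonneg_left hx.1 hr.le)
  set μ : ℝ := c₁ / 2 * L / (annRatio c₁ * σ) ^ 2 with hμ
  have hμ0 : 0 < μ := by positivity
  have hsq : √μ = √(c₁ / 2) * √L / (annRatio c₁ * σ) := by
    rw [hμ, Real.sqrt_div (by positivity), Real.sqrt_sq (by positivity),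
      Real.sqrt_mul (by positivity)]
  have hdd : ∀ x ∈ Icc α β, μ ≤ |L * ((2 : ℝ) ^ m * deriv (deriv Γ) x)| := fun x hx => by
    have hx0 := hpos x hx
    have h1 := (hΓ.mul_map_le_of_mem hx0.le hx.1 hx.2).1
    have h2 := hΓ.lo2 x hx0
    have h3 : x ≤ annRatio c₁ * σ := hx.2.trans hβσ
    rw [abs_mul, abs_mul, abs_of_pos hL, abs_of_pos hp]
    have h4 : c₁ / 2 ≤ x ^ 2 * ((2 : ℝ) ^ m * |deriv (deriv Γ) x|) := by
      calc c₁ / 2 = c₁ * (1 / 2) := by ring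
        _ ≤ c₁ * ((2 : ℝ) ^ m * Γ x) := by gcongr
        _ = (2 : ℝ) ^ m * (c₁ * Γ x) := by ring
        _ ≤ (2 : ℝ) ^ m * (x ^ 2 * |deriv (deriv Γ) x|) := by gcongr
        _ = _ := by ring
    rw [hμ, div_le_iff₀ (by positivity)]
    calc c₁ / 2 * L ≤ x ^ 2 * ((2 : ℝ) ^ m * |deriv (deriv Γ) x|) * L := by gcongr
      _ = L * ((2 : ℝ) ^ m * |deriv (deriv Γ) x|) * x ^ 2 := by ring
      _ ≤ _ := by gcongr
  have hvdc := norm_integral_exp_le (α := α) (β := β) (μ := μ) (S := annRatio c₁ / σ)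
    (D := (2 * c₂ * B + 1) * (annRatio c₁ / σ) ^ 2) hαβ hμ0
    (Φ := fun ρ => L * ((2 : ℝ) ^ m * Γ ρ) - τ * ρ)
    (Φ' := fun ρ => L * ((2 : ℝ) ^ m * deriv Γ ρ) - τ)
    (Φ'' := fun ρ => L * ((2 : ℝ) ^ m * deriv (deriv Γ) ρ))
    (a := fun ρ => annProf ((2 : ℝ) ^ m * Γ ρ) / ρ)
    (a' := fun ρ => (deriv annProf ((2 : ℝ) ^ m * Γ ρ) * ((2 : ℝ) ^ m * deriv Γ ρ) * ρ -
      annProf ((2 : ℝ) ^ m * Γ ρ)) / ρ ^ 2)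
    (fun x hx => (((hΓ.d1 x (hpos x hx)).const_mul _).const_mul _).sub
      (by simpa using (hasDerivAt_id x).const_mul τ))
    (fun x hx => (((hΓ.d2 x (hpos x hx)).const_mul _).const_mul _).sub_const _)
    (continuousOn_const.mul (continuousOn_const.mul (hΓ.cont2.mono fun x hx => hpos x hx)))
    (by
      rcases hΓ.second_deriv_sign with hs | hs
      · refine .inl fun x hx => ?_
        have h1 := hdd x hx
        have h2 := hs x (hpos x hx)
        rwa [abs_of_pos (by positivity)] at h1
      · refine .inr fun x hx => ?_
        have h1 := hdd x hx
        have h2 := hs x (hpos x hx)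
        rw [abs_of_neg (mul_neg_of_pos_of_neg hL (mul_neg_of_pos_of_neg hp h2))] at h1
        linarith)
    (fun x hx => by
      have h1 : HasDerivAt annProf (deriv annProf ((2 : ℝ) ^ m * Γ x)) ((2 : ℝ) ^ m * Γ x) :=
        (contDiff_annProf.differentiable one_ne_zero _).hasDerivAt
      have h2 : HasDerivAt (fun ρ => annProf ((2 : ℝ) ^ m * Γ ρ))
          (deriv annProf ((2 : ℝ) ^ m * Γ x) * ((2 : ℝ) ^ m * deriv Γ x)) x :=
        HasDerivAt.comp (h := fun ρ => (2 : ℝ) ^ m * Γ ρ) x h1 ((hΓ.d1 x (hpos x hx)).const_mul _)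
      exact (h2.div (hasDerivAt_id x) (hpos x hx).ne').congr_deriv (by simp only [id, mul_one]))
    (by
      have hc : ContinuousOn Γ (Icc α β) := hΓ.cont.mono fun x hx => (hpos x hx).le
      have hc' : ContinuousOn (deriv Γ) (Icc α β) := fun x hx =>
        (hΓ.d2 x (hpos x hx)).continuousAt.continuousWithinAt
      have h1 : ContinuousOn (fun ρ => (2 : ℝ) ^ m * Γ ρ) (Icc α β) := continuousOn_const.mul hc
      exact (((((contDiff_annProf.continuous_deriv le_rfl).comp_continuousOn h1).mul
        (continuousOn_const.mul hc')).mul continuousOn_id).sub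
        (contDiff_annProf.continuous.comp_continuousOn h1)).div (continuousOn_id.pow 2)
        fun x hx => pow_ne_zero _ (hpos x hx).ne')
    (by simp only [hzl α hα0.le le_rfl, zero_div]) (by simp only [hzr β le_rfl, zero_div])
    (fun x hx => by
      rw [abs_div, abs_of_pos (hpos x hx), div_eq_mul_inv]
      exact (mul_le_of_le_one_left (inv_nonneg.2 (hpos x hx).le) (abs_annProf_le _)).trans
        (hσx x hx))
    (fun x hx => by
      have hx0 := hpos x hx
      have h1 := (hΓ.mul_map_le_of_mem hx0.le hx.1 hx.2).2
      have h2 := hΓ.hi x hx0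
      have h3 := (mul_pos hc₁ (hΓ.pos hx0)).le.trans (hΓ.lo x hx0)
      have h4 : |(2 : ℝ) ^ m * deriv Γ x * x| ≤ 2 * c₂ := by
        rw [abs_of_nonneg (by nlinarith)]
        calc (2 : ℝ) ^ m * deriv Γ x * x = (2 : ℝ) ^ m * (x * deriv Γ x) := by ring
          _ ≤ (2 : ℝ) ^ m * (c₂ * Γ x) := by gcongr
          _ = c₂ * ((2 : ℝ) ^ m * Γ x) := by ring
          _ ≤ c₂ * 2 := by gcongr
          _ = _ := by ring
      rw [abs_div, abs_of_pos (pow_pos hx0 2), div_eq_mul_inv, ← inv_pow]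
      refine mul_le_mul ?_ (pow_le_pow_left₀ (inv_nonneg.2 hx0.le) (hσx x hx) 2) (by positivity)
        (by positivity)
      refine (abs_sub _ _).trans (add_le_add ?_ (abs_annProf_le _))
      rw [mul_assoc, abs_mul, mul_comm (2 * c₂)]
      exact mul_le_mul (hB _) h4 (abs_nonneg _) hB0)
  rw [intervalIntegral.integral_of_le hαβ] at hvdc
  rw [setIntegral_eq_of_subset_of_forall_sdiff_eq_zero measurableSet_Ioi
    (fun x (hx : x ∈ Ioc α β) => hα0.trans hx.1) fun x hx => ?_]
  · refine hvdc.trans ?_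
    have hd : β - α ≤ annRatio c₁ * σ := by linarith
    have : (2 * c₂ * B + 1) * (annRatio c₁ / σ) ^ 2 * (β - α) / √μ ≤
        (2 * c₂ * B + 1) * (annRatio c₁ / σ) ^ 2 * (annRatio c₁ * σ) / √μ := by gcongr
    refine (add_le_add le_rfl this).trans (le_of_eq ?_)
    rw [hsq]
    have e1 : √(c₁ / 2) ≠ 0 := (Real.sqrt_pos.2 (by positivity)).ne'
    have e2 : √L ≠ 0 := (Real.sqrt_pos.2 hL).ne'
    field_simp
  · have hx0 : (0 : ℝ) < x := hx.1
    have : annProf ((2 : ℝ) ^ m * Γ x) = 0 := by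
      rcases le_total x α with h1 | h1
      · exact hzl x hx0.le h1
      · rcases h1.eq_or_lt with h1 | h1
        · exact hzl x hx0.le h1.ge
        · exact hzr x (not_lt.1 fun h2 => hx.2 ⟨h1, h2.le⟩)
    rw [this, zero_div, Complex.ofReal_zero, mul_zero]

/-- Decay of the Fourier transform of the modulated pieces. -/
lemma exists_fourier_cutKer_le (hΓ : PhaseCtl Γ c₁ c₂) (hn : 0 < n) (hK : IsHomCZKernel n K) :
    ∃ C > 0, ∀ L > 0, ∀ (m : ℤ) (ξ : Rn n),
      ‖𝓕 (cutKer Γ K (modProf L) m) ξ‖ ≤ C * L ^ (-(1 / 2) : ℝ) := by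
  obtain ⟨B, hB0, hB⟩ := exists_deriv_annProf_le
  obtain ⟨A, hA0, hA⟩ := hK.exists_norm_le
  obtain ⟨C₀, hC₀, hker⟩ := hΓ.exists_scaleKer_cutKer hK
  have hc₁ := hΓ.c₁_pos
  have hc₂ := hΓ.c₂_pos
  have hr := annRatio_pos c₁
  set M := (2 * Real.pi * annRatio c₁ ^ 2 + (2 * c₂ * B + 1) * annRatio c₁ ^ 4) / √(c₁ / 2) with hM
  have hM0 : 0 < M := by
    have := Real.pi_pos
    have := Real.sqrt_pos.2 (half_pos hc₁)
    positivity
  set S := ((volume : Measure (Rn n)).toSphere).real univ with hS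
  have hS0 : 0 ≤ S := measureReal_nonneg
  refine ⟨A * M * (S + 1), by positivity, fun L hL m ξ => ?_⟩
  have hint := (hker _ _ _ (profile_mod hB hL.le) m).integrable
  have hsq : L ^ (-(1 / 2) : ℝ) = (√L)⁻¹ := by rw [Real.rpow_neg hL.le, ← Real.sqrt_eq_rpow]
  rw [Real.fourier_eq, integral_polar hn ((Real.fourierIntegral_convergent_iff ξ).2 hint)]
  refine (norm_integral_le_of_norm_le_const (C := A * (M / √L))
    (Eventually.of_forall fun θ => ?_)).trans ?_
  · have hθ : ‖(θ : Rn n)‖ = 1 := mem_sphere_zero_iff_norm.1 θ.2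
    have hθ0 : (θ : Rn n) ≠ 0 := norm_ne_zero_iff.1 (by rw [hθ]; simp)
    have e : (∫ ρ in Ioi (0 : ℝ), ((ρ ^ (n - 1) : ℝ) : ℂ) *
        (Real.fourierChar (-inner ℝ (ρ • (θ : Rn n)) ξ) • cutKer Γ K (modProf L) m (ρ • (θ : Rn n)))) =
        (K θ : ℂ) * ∫ ρ in Ioi (0 : ℝ), Complex.exp (Complex.I *
          ((L * ((2 : ℝ) ^ m * Γ ρ) - (2 * Real.pi * inner ℝ (θ : Rn n) ξ) * ρ : ℝ) : ℂ)) *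
        ((annProf ((2 : ℝ) ^ m * Γ ρ) / ρ : ℝ) : ℂ) := by
      rw [← integral_const_mul]
      refine setIntegral_congr_fun measurableSet_Ioi fun ρ hρ => ?_
      have hρ0 : (0 : ℝ) < ρ := hρ
      have hnorm : ‖ρ • (θ : Rn n)‖ = ρ := by
        rw [norm_smul, hθ, mul_one, Real.norm_of_nonneg hρ0.le]
      have hpow : ρ ^ n = ρ ^ (n - 1) * ρ := by rw [← pow_succ, Nat.sub_add_cancel hn]
      simp only [cutKer, modProf, phaseExp, hnorm]
      rw [hK.map_smul hρ0 hθ0, Circle.smul_def, Real.fourierChar_apply, smul_eq_mul,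
        real_inner_smul_left, hpow, Complex.ofReal_sub, mul_sub, sub_eq_add_neg, Complex.exp_add]
      have hρc : (ρ : ℂ) ≠ 0 := Complex.ofReal_ne_zero.2 hρ0.ne'
      have e3 : Complex.exp (((2 * Real.pi * -(ρ * inner ℝ (θ : Rn n) ξ) : ℝ) : ℂ) * Complex.I) =
          Complex.exp (-(Complex.I * ((2 * Real.pi * inner ℝ (θ : Rn n) ξ * ρ : ℝ) : ℂ))) := by
        congr 1
        push_cast
        ring
      rw [e3]
      push_cast
      field_simp
    rw [e, norm_mul]
    refine mul_le_mul ?_ (hΓ.norm_integral_ray_le hB hL m _) (norm_nonneg _) hA0.le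
    rw [Complex.norm_real]
    simpa [hθ] using hA θ hθ0
  · rw [hsq, ← div_eq_mul_inv, ← hS]
    have := Real.sqrt_pos.2 hL
    calc A * (M / √L) * S ≤ A * (M / √L) * (S + 1) := by gcongr; linarith
      _ = _ := by ring

end PhaseCtl

end FourierDecay

section Pieces

variable {n : ℕ}

lemma ScaleKer.mono {R R' σ A A' B B' : ℝ} {κ : Rn n → ℂ} (h : ScaleKer R σ A B κ) (hσ : 0 < σ)
    (hR : R ≤ R') (hA : A ≤ A') (hB : B ≤ B') : ScaleKer R' σ A' B' κ where
  supp t ht := h.supp t ((mul_le_mul_of_nonneg_right hR hσ.le).trans_lt ht)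
  bd t := (h.bd t).trans (mul_le_mul_of_nonneg_right hA (by positivity))
  lip s t := (h.lip s t).trans (by gcongr)

/-- Normalized bumps at every scale. -/
lemma exists_scaleKer_bump (n : ℕ) : ∃ A > 0, ∀ σ > 0, ∃ φ : Rn n → ℂ,
    ScaleKer 2 σ A A φ ∧ ∫ t, φ t = 1 := by
  set b : ContDiffBump (0 : Rn n) := ⟨1, 2, one_pos, one_lt_two⟩ with hb
  have hd : ContDiff ℝ 1 (b.normed volume) := b.contDiff_normed
  have hs : HasCompactSupport (b.normed volume) := b.hasCompactSupport_normed
  obtain ⟨C₁, hC₁⟩ := hd.continuous.bounded_above_of_compact_support hs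
  obtain ⟨C₂, hC₂⟩ := hd.lipschitzWith_of_hasCompactSupport hs one_ne_zero
  set C : ℝ := max (max C₁ C₂) 1
  have h1 : C₁ ≤ C := (le_max_left _ _).trans (le_max_left _ _)
  have h2 : (C₂ : ℝ) ≤ C := (le_max_right _ _).trans (le_max_left _ _)
  refine ⟨C, by positivity, fun σ hσ =>
    ⟨fun t => (((σ ^ n)⁻¹ * b.normed volume (σ⁻¹ • t) : ℝ) : ℂ), ⟨fun t ht => ?_, fun t => ?_,
      fun s t => ?_⟩, ?_⟩⟩
  · have : b.normed volume (σ⁻¹ • t) = 0 := by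
      rw [← Function.notMem_support, b.support_normed_eq, mem_ball_zero_iff, not_lt, norm_smul,
        norm_inv, Real.norm_of_nonneg hσ.le, ← div_eq_inv_mul, le_div_iff₀ hσ]
      exact ht.le
    rw [this, mul_zero, Complex.ofReal_zero]
  · rw [Complex.norm_real, norm_mul, Real.norm_of_nonneg (by positivity), mul_comm]
    exact mul_le_mul_of_nonneg_right ((hC₁ _).trans h1) (by positivity)
  · have h3 := hC₂.dist_le_mul (σ⁻¹ • s) (σ⁻¹ • t)
    rw [dist_eq_norm, dist_eq_norm, ← smul_sub, norm_smul, norm_inv, Real.norm_of_nonneg hσ.le] at h3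
    rw [← Complex.ofReal_sub, Complex.norm_real, ← mul_sub, norm_mul,
      Real.norm_of_nonneg (by positivity)]
    calc _ ≤ (σ ^ n)⁻¹ * (C * (σ⁻¹ * ‖s - t‖)) := by
          refine mul_le_mul_of_nonneg_left (h3.trans ?_) (by positivity)
          gcongr
      _ = _ := by rw [pow_succ]; field_simp
  · rw [integral_complex_ofReal, integral_const_mul,
      Measure.integral_comp_inv_smul volume (fun t => b.normed volume t) σ, b.integral_normed,
      finrank_euclideanSpace_fin, smul_eq_mul, mul_one, abs_of_pos (pow_pos hσ n),
      inv_mul_cancel₀ (pow_pos hσ n).ne', Complex.ofReal_one]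

variable {Γ : ℝ → ℝ} {c₁ c₂ : ℝ} {K : Rn n → ℝ}

/-- The ratio of consecutive scales is at most this. -/
def lacRatio (c₂ : ℝ) : ℝ := (2 : ℝ) ^ (-c₂⁻¹)

lemma lacRatio_pos (c₂ : ℝ) : 0 < lacRatio c₂ := Real.rpow_pos_of_pos two_pos _

lemma lacRatio_lt_one (hc : 0 < c₂) : lacRatio c₂ < 1 :=
  Real.rpow_lt_one_of_one_lt_of_neg one_lt_two (neg_lt_zero.2 (inv_pos.2 hc))

/-- The profile of the `l`-th piece of the modulated kernel. -/
def pieceProf (l : ℤ) : ℝ → ℂ :=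
  if 0 ≤ l then modProf ((2 : ℝ) ^ l) else errProf ((2 : ℝ) ^ l)

/-- The pieces of the modulated kernel, truncated to the annuli with `|k - l| ≤ M`. -/
def pieceKer (Γ : ℝ → ℝ) (K : Rn n → ℝ) (M : ℕ) (l k : ℤ) (t : Rn n) : ℂ :=
  if |k - l| ≤ M then cutKer Γ K (pieceProf l) (k - l) t else 0

lemma scaleKer_zero {R σ A B : ℝ} (hσ : 0 < σ) (hA : 0 ≤ A) (hB : 0 ≤ B) :
    ScaleKer R σ A B (fun _ : Rn n => (0 : ℂ)) where
  supp _ _ := rfl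
  bd _ := by rw [norm_zero]; positivity
  lip _ _ := by rw [sub_zero, norm_zero]; positivity

namespace PhaseCtl

lemma scale_add_succ_le (hΓ : PhaseCtl Γ c₁ c₂)
    (a : ℤ) (k : ℕ) : phaseScale Γ (a + ((k + 1 : ℕ) : ℤ)) ≤
    lacRatio c₂ * phaseScale Γ (a + k) := by
  have := hΓ.scale_succ_le_mul (a + k)
  rwa [add_assoc] at this

lemma exists_lowData (hΓ : PhaseCtl Γ c₁ c₂) (hn : 0 < n) (hK : IsHomCZKernel n K) :
    ∃ R > 0, ∃ A > 0, ∀ a : ℤ, ∃ (j : ℕ → ℤ) (φ : ℕ → Rn n → ℂ),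
      LowData R A (lacRatio c₂) j (fun k => phaseScale Γ (a + k)) φ
        (fun k => cutKer Γ K baseProf (a + k)) := by
  obtain ⟨B, hB0, hB⟩ := exists_deriv_annProf_le
  obtain ⟨C, hC0, hC⟩ := hΓ.exists_scaleKer_cutKer hK
  obtain ⟨A, hA0, hA⟩ := exists_scaleKer_bump n
  refine ⟨max 2 (annRatio c₁), by positivity, max A (C * (1 + B)), by positivity, fun a => ?_⟩
  choose! φ hφ hφ1 using hA
  have hpos := fun k : ℕ => hΓ.scale_pos (a + k)
  refine ⟨fun k => -Int.log 2 (phaseScale Γ (a + k)), fun k => φ (phaseScale Γ (a + k)),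
    ⟨monotone_nat_of_le_succ fun k => ?_, hpos, fun k => ?_, fun k => ?_, hΓ.scale_add_succ_le a,
      fun k => ?_, fun k => hφ1 _ (hpos k), fun k => ?_, fun k => ?_⟩⟩
  · refine neg_le_neg (Int.log_mono_right (hpos (k + 1)) ?_)
    have := hΓ.scale_succ_le (a + k)
    rwa [add_assoc] at this
  · rw [zpow_neg, inv_inv]
    exact_mod_cast Int.zpow_log_le_self (b := 2) one_lt_two (hpos k)
  · rw [zpow_neg, inv_inv]
    have := (Int.lt_zpow_succ_log_self (b := 2) one_lt_two (phaseScale Γ (a + k))).le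
    rw [Nat.cast_ofNat, zpow_add_one₀ two_ne_zero, mul_comm] at this
    exact this
  · exact (hφ _ (hpos k)).mono (hpos k) (le_max_left _ _) (le_max_left _ _) (le_max_left _ _)
  · refine (hC _ _ _ (profile_base hB) (a + k)).mono (hpos k) (le_max_right _ _)
      (le_max_of_le_right ?_) (le_max_right _ _)
    exact mul_le_mul_of_nonneg_left (by linarith) hC0.le
  · exact hΓ.integral_cutKer hn hK (profile_base hB) _

variable {p r : ℝ} [hq : Fact (1 ≤ ENNReal.ofReal r)]

/-- Bounds for the jumps of a single piece, decaying geometrically. -/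
lemma exists_piece_bound (hΓ : PhaseCtl Γ c₁ c₂)
    (hn : 0 < n) (hK : IsHomCZKernel n K) (hp : 1 < p) (hr : 2 ≤ r) :
    ∃ C > 0, ∃ δ > 0, ∀ (s : Finset Chain) (N : ℕ), ChainsLe s N → ∀ (a : ℤ) (M : ℕ) (l : ℤ),
      ∀ f : Rn n → ℂ, Nice f →
      ∫⁻ x, ‖jumpVec r s fun k => opConv (mulK (pieceKer Γ K M l (a + k))) f x‖ₑ ^ p ≤
        ENNReal.ofReal (C * ((2 : ℝ) ^ (-(δ * |(l : ℝ)|))) ^ p) * ∫⁻ x, ‖f x‖ₑ ^ p := by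
  obtain ⟨B, hB0, hB⟩ := exists_deriv_annProf_le
  obtain ⟨C, hC0, hC⟩ := hΓ.exists_scaleKer_cutKer hK
  obtain ⟨D, hD0, hD⟩ := hΓ.exists_fourier_cutKer_le hn hK
  have hR := annRatio_pos c₁
  have hρ := lacRatio_pos c₂
  have hρ1 := lacRatio_lt_one hΓ.c₂_pos
  obtain ⟨C₁, hC₁, hsmall⟩ := lp_small_bound hn hp hr hR (M := C * (3 + 2 * B)) (by positivity) hρ hρ1
  obtain ⟨C₂, hC₂, δ, hδ, hhigh⟩ := lp_high_bound hn hp hr hR (M := max (C * (2 + B)) D)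
    (by positivity) hρ hρ1
  refine ⟨max C₁ C₂, by positivity, min δ 1, by positivity, fun s N hs a M l f hf => ?_⟩
  set L : ℝ := (2 : ℝ) ^ l with hL
  have hL0 : 0 < L := by positivity
  have hσ := fun k : ℕ => hΓ.scale_pos (a - l + k)
  have hidx : ∀ k : ℕ, a + (k : ℤ) - l = a - l + k := fun k => by ring
  have hker : ∀ (A B' : ℝ), 0 ≤ A → 0 ≤ B' → (∀ m, ScaleKer (annRatio c₁) (phaseScale Γ m) A B'
      (cutKer Γ K (pieceProf l) m)) → ∀ k : ℕ, ScaleKer (annRatio c₁) (phaseScale Γ (a - l + k)) A B'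
        (pieceKer Γ K M l (a + k)) := fun A B' hA hB' h k => by
    unfold pieceKer
    split_ifs
    · rw [hidx]; exact h _
    · exact scaleKer_zero (hσ k) hA hB'
  have hLr : L = (2 : ℝ) ^ (l : ℝ) := by rw [hL, Real.rpow_intCast]
  rcases le_or_gt 0 l with hl | hl
  · have hl0 : (0 : ℝ) ≤ l := by exact_mod_cast hl
    have hL1 : 1 ≤ L := one_le_zpow₀ one_le_two hl
    have hprof : pieceProf l = modProf L := by rw [pieceProf, if_pos hl]
    refine (hhigh s N hs L (fun k => phaseScale Γ (a - l + k)) _ hL1 hσ (hΓ.scale_add_succ_le _)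
      (hker _ _ (by positivity) (by positivity) fun m => ?_) (fun k => ?_) (fun k ξ => ?_) f hf).trans
      (mul_le_mul_left (ENNReal.ofReal_le_ofReal ?_) _)
    · rw [hprof]
      refine (hC _ _ _ (profile_mod hB hL0.le) m).mono (hΓ.scale_pos m) le_rfl
        (le_max_of_le_left ?_) ?_
      · exact mul_le_mul_of_nonneg_left (by linarith) hC0.le
      · calc C * (1 + (L + B)) ≤ C * (2 + B) * L := by
              rw [mul_assoc]
              exact mul_le_mul_of_nonneg_left (by nlinarith) hC0.le
          _ ≤ _ := mul_le_mul_of_nonneg_right (le_max_left _ _) hL0.le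
    · unfold pieceKer
      split_ifs
      · rw [hprof]; exact hΓ.integral_cutKer hn hK (profile_mod hB hL0.le) _
      · simp
    · by_cases hc : |a + k - l| ≤ (M : ℤ)
      · have : pieceKer Γ K M l (a + k) = cutKer Γ K (modProf L) (a + k - l) := by
          funext t; rw [pieceKer, if_pos hc, hprof]
        rw [this]
        exact (hD L hL0 _ ξ).trans (mul_le_mul_of_nonneg_right (le_max_right _ _) (by positivity))
      · have : pieceKer Γ K M l (a + k) = 0 := by
          funext t; rw [pieceKer, if_neg hc]; rfl
        rw [this, Real.fourier_eq]
        simp only [Pi.zero_apply, smul_zero, integral_zero, norm_zero]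
        positivity
    · have : L ^ (-δ) ≤ (2 : ℝ) ^ (-(min δ 1 * |(l : ℝ)|)) := by
        rw [hLr, ← Real.rpow_mul zero_le_two, abs_of_nonneg hl0]
        refine Real.rpow_le_rpow_of_exponent_le one_le_two ?_
        have := mul_le_mul_of_nonneg_right (min_le_left δ 1) hl0
        linarith
      exact mul_le_mul (le_max_right _ _) (Real.rpow_le_rpow (by positivity) this (by linarith))
        (by positivity) (by positivity)
  · have hl0 : (l : ℝ) < 0 := by exact_mod_cast hl
    have hprof : pieceProf l = errProf L := by rw [pieceProf, if_neg (not_le.2 hl)]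
    refine (hsmall s N hs L (fun k => phaseScale Γ (a - l + k)) _ hL0 hσ (hΓ.scale_add_succ_le _)
      (hker _ _ (by positivity) (by positivity) fun m => ?_) (fun k => ?_) f hf).trans
      (mul_le_mul_left (ENNReal.ofReal_le_ofReal ?_) _)
    · rw [hprof]
      refine (hC _ _ _ (profile_err hB hL0.le) m).mono (hΓ.scale_pos m) le_rfl ?_ ?_
      · rw [mul_assoc]
        exact mul_le_mul_of_nonneg_left (by nlinarith) hC0.le
      · rw [mul_assoc]
        exact mul_le_mul_of_nonneg_left (by nlinarith) hC0.le
    · unfold pieceKer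
      split_ifs
      · rw [hprof]; exact hΓ.integral_cutKer hn hK (profile_err hB hL0.le) _
      · simp
    · have : L ≤ (2 : ℝ) ^ (-(min δ 1 * |(l : ℝ)|)) := by
        rw [hLr, abs_of_neg hl0]
        refine Real.rpow_le_rpow_of_exponent_le one_le_two ?_
        have := mul_le_mul_of_nonpos_right (min_le_right δ 1) hl0.le
        linarith
      exact mul_le_mul (le_max_left _ _) (Real.rpow_le_rpow hL0.le this (by linarith))
        (by positivity) (by positivity)

end PhaseCtl

end Pieces

section Uniform

variable {n : ℕ}

lemma opConv_mulK_sum {ι : Type*} {s : Finset ι} {κ : ι → Rn n → ℂ}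
    (hκ : ∀ i ∈ s, Continuous (κ i)) (hc : ∀ i ∈ s, HasCompactSupport (κ i)) {f : Rn n → ℂ}
    (hf : Integrable f) (x : Rn n) :
    opConv (mulK fun t => ∑ i ∈ s, κ i t) f x = ∑ i ∈ s, opConv (mulK (κ i)) f x := by
  simp only [opConv_mulK, Finset.sum_mul]
  exact integral_finsetSum _ fun i hi => integrable_opConv_integrand (continuous_mulK (hκ i hi))
    (hasCompactSupport_mulK (hc i hi)) hf x

lemma opConv_mulK_add {κ μ : Rn n → ℂ} (hκ : Continuous κ) (hc : HasCompactSupport κ)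
    (hμ : Continuous μ) (hd : HasCompactSupport μ) {f : Rn n → ℂ} (hf : Integrable f) (x : Rn n) :
    opConv (mulK fun t => κ t + μ t) f x = opConv (mulK κ) f x + opConv (mulK μ) f x := by
  simp only [opConv_mulK, add_mul]
  exact integral_add (integrable_opConv_integrand (continuous_mulK hκ)
    (hasCompactSupport_mulK hc) hf x) (integrable_opConv_integrand (continuous_mulK hμ)
    (hasCompactSupport_mulK hd) hf x)

variable {r : ℝ} {s : Finset Chain} {N : ℕ}

lemma jumpVec_congr {α β : ℕ → ℂ} (hs : ChainsLe s N) (h : ∀ i ≤ N, α i = β i) :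
    jumpVec r s α = jumpVec r s β := by
  funext c
  ext i
  simp only [jumpVec]
  rw [h _ ((hs c.1 c.2).2 _), h _ ((hs c.1 c.2).2 _)]

lemma jumpVec_const (z : ℂ) : jumpVec r s (fun _ => z) = 0 := by
  funext c
  ext i
  simp [jumpVec]

lemma jumpVec_sum {ι : Type*} (S : Finset ι) (α : ι → ℕ → ℂ) :
    jumpVec r s (fun k => ∑ l ∈ S, α l k) = ∑ l ∈ S, jumpVec r s (α l) := by
  classical
  induction S using Finset.induction_on with
  | empty => simpa using jumpVec_const 0
  | insert l S hl ih => simp only [Finset.sum_insert hl, jumpVec_add, ih]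

lemma continuous_jumpVec {X : Type*} [TopologicalSpace X] {α : ℕ → X → ℂ}
    (h : ∀ k, Continuous (α k)) : Continuous fun x => jumpVec r s fun k => α k x :=
  continuous_pi fun _ => (PiLp.continuous_toLp _ _).comp
    (continuous_pi fun _ => (h _).sub (h _))

lemma eLpNorm_le_of_lintegral {E F : Type*} [NormedAddCommGroup E] [NormedAddCommGroup F] {p c : ℝ}
    (hp : 1 < p) (hc : 0 ≤ c) {g : Rn n → E} {f : Rn n → F}
    (h : ∫⁻ x, ‖g x‖ₑ ^ p ≤ ENNReal.ofReal c * ∫⁻ x, ‖f x‖ₑ ^ p) :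
    eLpNorm g (ENNReal.ofReal p) volume ≤
      ENNReal.ofReal (c ^ (1 / p)) * eLpNorm f (ENNReal.ofReal p) volume := by
  have hp0 : 0 < p := by linarith
  have h1 : ENNReal.ofReal p ≠ 0 := by simpa using hp0
  rw [eLpNorm_eq_lintegral_rpow_enorm_toReal h1 ENNReal.ofReal_ne_top,
    eLpNorm_eq_lintegral_rpow_enorm_toReal h1 ENNReal.ofReal_ne_top,
    ENNReal.toReal_ofReal hp0.le, ← ENNReal.ofReal_rpow_of_nonneg hc (by positivity),
    ← ENNReal.mul_rpow_of_nonneg _ _ (by positivity)]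
  exact ENNReal.rpow_le_rpow h (by positivity)

lemma sum_two_rpow_neg_le {δ : ℝ} (hδ : 0 < δ) :
    ∃ C > 0, ∀ S : Finset ℤ, ∑ l ∈ S, (2 : ℝ) ^ (-(δ * |(l : ℝ)|)) ≤ C := by
  have hg : Summable fun k : ℕ => (2 : ℝ) ^ (-(δ * |((k : ℤ) : ℝ)|)) := by
    have h1 : (2 : ℝ) ^ (-δ) < 1 := Real.rpow_lt_one_of_one_lt_of_neg one_lt_two (by linarith)
    refine (summable_geometric_of_lt_one (by positivity) h1).congr fun k => ?_
    rw [← Real.rpow_natCast, ← Real.rpow_mul two_pos.le]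
    simp
  have hs : Summable fun l : ℤ => (2 : ℝ) ^ (-(δ * |(l : ℝ)|)) :=
    Summable.of_nat_of_neg hg (by simpa using hg)
  refine ⟨1 + ∑' l : ℤ, (2 : ℝ) ^ (-(δ * |(l : ℝ)|)), ?_, fun S => ?_⟩
  · have : 0 ≤ ∑' l : ℤ, (2 : ℝ) ^ (-(δ * |(l : ℝ)|)) := tsum_nonneg fun l => Real.rpow_nonneg two_pos.le (-(δ * |(l : ℝ)|))
    linarith
  · have := hs.sum_le_tsum S fun l _ => Real.rpow_nonneg two_pos.le _
    linarith

variable {Γ : ℝ → ℝ} {c₁ c₂ : ℝ} {K : Rn n → ℝ}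

/-- Smooth truncations of the modulated kernel. -/
def truncKer (Γ : ℝ → ℝ) (K : Rn n → ℝ) (M : ℕ) (u : ℝ) (t : Rn n) : ℂ :=
  phaseExp u (Γ ‖t‖) *
    ((cutoff ((2 : ℝ) ^ (-(M : ℤ)) * Γ ‖t‖) - cutoff ((2 : ℝ) ^ ((M : ℤ) + 1) * Γ ‖t‖) : ℝ) : ℂ) *
    (K t : ℂ)

lemma sum_annProf (M : ℕ) (v : ℝ) : ∑ m ∈ Finset.Icc (-(M : ℤ)) M, annProf ((2 : ℝ) ^ m * v) =
    cutoff ((2 : ℝ) ^ (-(M : ℤ)) * v) - cutoff ((2 : ℝ) ^ ((M : ℤ) + 1) * v) := by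
  have h : ∀ m : ℤ, annProf ((2 : ℝ) ^ m * v) =
      cutoff ((2 : ℝ) ^ m * v) - cutoff ((2 : ℝ) ^ (m + 1) * v) := fun m => by
    rw [annProf, zpow_add_one₀ two_ne_zero]; ring_nf
  simp only [h]
  have h2 := Finset.sum_range_sub' (fun i : ℕ => cutoff ((2 : ℝ) ^ (-(M : ℤ) + i) * v)) (2 * M + 1)
  have h3 : -(M : ℤ) + ((2 * M + 1 : ℕ) : ℤ) = M + 1 := by push_cast; ring
  rw [h3, Nat.cast_zero, add_zero] at h2
  rw [← h2]
  refine Finset.sum_nbij' (fun m => (m + M).toNat) (fun i => -(M : ℤ) + i) ?_ ?_ ?_ ?_ ?_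
  · intro m; simp only [Finset.mem_Icc, Finset.mem_range]; omega
  · intro m; simp only [Finset.mem_Icc, Finset.mem_range]; omega
  · intro m; simp only [Finset.mem_Icc]; omega
  · intro m; simp only [Finset.mem_range]; omega
  · intro m hm
    rw [Finset.mem_Icc] at hm
    have h4 : -(M : ℤ) + ((m + M).toNat : ℤ) = m := by omega
    rw [Nat.cast_add, Nat.cast_one, ← add_assoc, h4]

lemma truncKer_eq_sum (M : ℕ) (k : ℤ) (t : Rn n) : truncKer Γ K M ((2 : ℝ) ^ k) t =
    ∑ m ∈ Finset.Icc (-(M : ℤ)) M, cutKer Γ K (modProf ((2 : ℝ) ^ (k - m))) m t := by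
  have h : ∀ m : ℤ, cutKer Γ K (modProf ((2 : ℝ) ^ (k - m))) m t =
      phaseExp ((2 : ℝ) ^ k) (Γ ‖t‖) * (annProf ((2 : ℝ) ^ m * Γ ‖t‖) : ℂ) * (K t : ℂ) := fun m => by
    rw [cutKer, modProf, phaseExp, ← mul_assoc, ← zpow_add₀ two_ne_zero, sub_add_cancel]; rfl
  simp only [h]
  rw [← Finset.sum_mul, ← Finset.mul_sum, ← Complex.ofReal_sum, sum_annProf, truncKer]

lemma cutKer_mod_eq (k m : ℤ) (t : Rn n) : cutKer Γ K (modProf ((2 : ℝ) ^ (k - m))) m t =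
    cutKer Γ K (pieceProf (k - m)) m t + if k < m then cutKer Γ K baseProf m t else 0 := by
  by_cases h : k < m
  · rw [if_pos h, pieceProf, if_neg (by omega)]
    simp only [cutKer, modProf, errProf, baseProf]; ring
  · rw [if_neg h, pieceProf, if_pos (by omega), add_zero]

lemma sum_pieceKer {M : ℕ} {k : ℤ} (hk : |k| ≤ M) (t : Rn n) :
    ∑ l ∈ Finset.Icc (-(2 * M : ℤ)) (2 * M), pieceKer Γ K M l k t =
      ∑ m ∈ Finset.Icc (-(M : ℤ)) M, cutKer Γ K (pieceProf (k - m)) m t := by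
  unfold pieceKer
  rw [← Finset.sum_filter]
  rw [abs_le] at hk
  refine Finset.sum_nbij' (fun l => k - l) (fun m => k - m) ?_ ?_ ?_ ?_ ?_
  · intro l; simp only [Finset.mem_filter, Finset.mem_Icc, abs_le]; omega
  · intro l; simp only [Finset.mem_filter, Finset.mem_Icc, abs_le]; omega
  · intro l _; simp
  · intro l _; simp
  · intro l _; simp

/-- The part of the kernel with negligible oscillation. -/
def tailKer (Γ : ℝ → ℝ) (K : Rn n → ℝ) (M : ℕ) (k : ℤ) (t : Rn n) : ℂ :=
  ∑ m ∈ Finset.Icc (-(M : ℤ)) M, if k < m then cutKer Γ K baseProf m t else 0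

lemma tailKer_add_psum {M : ℕ} {a : ℤ} (ha : -(M : ℤ) ≤ a) {i : ℕ} (hi : a + i ≤ M) (t : Rn n) :
    tailKer Γ K M (a + i) t + psum (fun k => cutKer Γ K baseProf (a + 1 + k)) i t =
      tailKer Γ K M a t := by
  induction i with
  | zero => simp [psum]
  | succ i ih =>
    rw [← ih (by push_cast at hi; linarith), psum, Finset.sum_range_succ, psum]
    have h : tailKer Γ K M (a + i) t =
        tailKer Γ K M (a + (i + 1 : ℕ)) t + cutKer Γ K baseProf (a + 1 + i) t := by
      have h2 : cutKer Γ K baseProf (a + 1 + i) t = ∑ m ∈ Finset.Icc (-(M : ℤ)) M,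
          if m = a + 1 + i then cutKer Γ K baseProf m t else 0 := by
        rw [Finset.sum_ite_eq_of_mem']
        push_cast at hi
        simp only [Finset.mem_Icc]; omega
      rw [h2, tailKer, tailKer, ← Finset.sum_add_distrib]
      refine Finset.sum_congr rfl fun m _ => ?_
      push_cast
      rcases lt_trichotomy m (a + 1 + i) with h | h | h
      · rw [if_neg (by omega), if_neg (by omega), if_neg (by omega), add_zero]
      · rw [if_pos (by omega), if_neg (by omega), if_pos h, zero_add]
      · rw [if_pos (by omega), if_pos (by omega), if_neg (by omega), add_zero]
    rw [h]; ring

lemma truncKer_add_psum {M : ℕ} {a : ℤ} (ha : -(M : ℤ) ≤ a) {i : ℕ} (hi : a + i ≤ M) (t : Rn n) :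
    truncKer Γ K M ((2 : ℝ) ^ (a + i)) t + psum (fun k => cutKer Γ K baseProf (a + 1 + k)) i t =
      (∑ l ∈ Finset.Icc (-(2 * M : ℤ)) (2 * M), pieceKer Γ K M l (a + i) t) +
        tailKer Γ K M a t := by
  rw [sum_pieceKer (abs_le.2 ⟨by omega, hi⟩), ← tailKer_add_psum ha hi, truncKer_eq_sum]
  simp only [cutKer_mod_eq, Finset.sum_add_distrib]
  rw [tailKer]; ring

namespace PhaseCtl

lemma continuous_cutKer (hΓ : PhaseCtl Γ c₁ c₂)
    (hK : IsHomCZKernel n K) {a b : ℝ} {h : ℝ → ℂ} (hh : Profile a b h)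
    (m : ℤ) : Continuous (cutKer Γ K h m) ∧ HasCompactSupport (cutKer Γ K h m) := by
  obtain ⟨C, -, hC⟩ := hΓ.exists_scaleKer_cutKer hK
  exact ⟨(hC a b h hh m).continuous, (hC a b h hh m).hasCompactSupport⟩

lemma continuous_pieceKer (hΓ : PhaseCtl Γ c₁ c₂) (hK : IsHomCZKernel n K) (M : ℕ) (l k : ℤ) :
    Continuous (pieceKer Γ K M l k) ∧ HasCompactSupport (pieceKer Γ K M l k) := by
  obtain ⟨B, -, hB⟩ := exists_deriv_annProf_le
  unfold pieceKer
  split_ifs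
  · unfold pieceProf
    split_ifs
    · exact hΓ.continuous_cutKer hK (profile_mod hB (by positivity)) _
    · exact hΓ.continuous_cutKer hK (profile_err hB (by positivity)) _
  · exact ⟨continuous_const, HasCompactSupport.zero⟩

lemma continuous_tailKer (hΓ : PhaseCtl Γ c₁ c₂) (hK : IsHomCZKernel n K) (M : ℕ) (k : ℤ) :
    Continuous (tailKer Γ K M k) ∧ HasCompactSupport (tailKer Γ K M k) := by
  obtain ⟨B, -, hB⟩ := exists_deriv_annProf_le
  have h : ∀ m, Continuous (fun t => if k < m then cutKer Γ K baseProf m t else 0) ∧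
      HasCompactSupport (fun t => if k < m then cutKer Γ K baseProf m t else 0) := fun m => by
    by_cases h : k < m
    · simp only [if_pos h]; exact hΓ.continuous_cutKer hK (profile_base hB) _
    · simp only [if_neg h]; exact ⟨continuous_const, HasCompactSupport.zero⟩
  exact ⟨continuous_finsetSum _ fun m _ => (h m).1, hasCompactSupport_finsetSum _ fun m => (h m).2⟩

lemma continuous_truncKer (hΓ : PhaseCtl Γ c₁ c₂) (hK : IsHomCZKernel n K) (M : ℕ) (k : ℤ) :
    Continuous (truncKer Γ K M ((2 : ℝ) ^ k)) ∧
      HasCompactSupport (truncKer Γ K M ((2 : ℝ) ^ k)) := by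
  obtain ⟨B, -, hB⟩ := exists_deriv_annProf_le
  have h : ∀ m : ℤ, _ := fun m => hΓ.continuous_cutKer hK
    (profile_mod hB (L := (2 : ℝ) ^ (k - m)) (by positivity)) m
  rw [funext (truncKer_eq_sum M k)]
  exact ⟨continuous_finsetSum _ fun m _ => (h m).1, hasCompactSupport_finsetSum _ fun m => (h m).2⟩

variable {p : ℝ} [hq : Fact (1 ≤ ENNReal.ofReal r)]

/-- Bounds for the jumps of the truncated operators, uniform in the truncation. -/
lemma exists_truncKer_bound (hΓ : PhaseCtl Γ c₁ c₂)
    (hn : 0 < n) (hK : IsHomCZKernel n K) (hp : 1 < p) (hr : 2 < r) :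
    ∃ C > 0, ∀ (s : Finset Chain) (N : ℕ), ChainsLe s N → ∀ (a : ℤ) (M : ℕ), -(M : ℤ) ≤ a →
      a + N ≤ M → ∀ f : Rn n → ℂ, Nice f →
      eLpNorm (fun x => jumpVec r s fun i => opConv (mulK (truncKer Γ K M ((2 : ℝ) ^ (a + i)))) f x)
        (ENNReal.ofReal p) volume ≤ ENNReal.ofReal C * eLpNorm f (ENNReal.ofReal p) volume := by
  obtain ⟨R, hR, A, hA, hlow⟩ := hΓ.exists_lowData hn hK
  obtain ⟨C₁, hC₁, h1⟩ := lp_low_bound (r := r) hn hp hr hR hA (lacRatio_pos c₂)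
    (lacRatio_lt_one hΓ.c₂_pos)
  obtain ⟨C₂, hC₂, δ, hδ, h2⟩ := hΓ.exists_piece_bound (r := r) hn hK hp hr.le
  obtain ⟨C₃, hC₃, h3⟩ := sum_two_rpow_neg_le hδ
  have hp0 : 0 < p := by linarith
  have hp1 : (1 : ℝ≥0∞) ≤ ENNReal.ofReal p := by
    rw [← ENNReal.ofReal_one]; exact ENNReal.ofReal_le_ofReal hp.le
  refine ⟨C₂ ^ (1 / p) * C₃ + C₁ ^ (1 / p), by positivity, fun s N hs a M ha haN f hf => ?_⟩
  obtain ⟨j, φ, hq'⟩ := hlow (a + 1)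
  set q : ℕ → Rn n → ℂ := fun k => cutKer Γ K baseProf (a + 1 + k) with hqdef
  set S := Finset.Icc (-(2 * M : ℤ)) (2 * M) with hS
  set P : ℤ → Rn n → JumpSpace r s :=
    fun l x => jumpVec r s fun i => opConv (mulK (pieceKer Γ K M l (a + i))) f x with hP
  set L : Rn n → JumpSpace r s :=
    fun x => jumpVec r s fun k => opConv (mulK (psum q (min k N))) f x with hL
  have hPc : ∀ l, Continuous (P l) := fun l => continuous_jumpVec fun k =>
    continuous_opConv (continuous_mulK (hΓ.continuous_pieceKer hK _ _ _).1)
      (hasCompactSupport_mulK (hΓ.continuous_pieceKer hK _ _ _).2) hf.int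
  have hLc : Continuous L := continuous_jumpVec fun k =>
    continuous_opConv (continuous_mulK (hq'.continuous_psum _))
      (hasCompactSupport_mulK (hq'.hasCompactSupport_psum _)) hf.int
  have hkey : (fun x => jumpVec r s fun i =>
      opConv (mulK (truncKer Γ K M ((2 : ℝ) ^ (a + i)))) f x) = (∑ l ∈ S, P l) - L := by
    funext x
    rw [Pi.sub_apply, eq_sub_iff_add_eq, hL, ← jumpVec_add, Finset.sum_apply, ← jumpVec_sum,
      ← add_zero (jumpVec r s fun k => ∑ l ∈ S, opConv (mulK (pieceKer Γ K M l (a + k))) f x),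
      ← jumpVec_const (opConv (mulK (tailKer Γ K M a)) f x),
      ← jumpVec_add]
    refine jumpVec_congr hs fun i hi => ?_
    have hi' : a + (i : ℤ) ≤ M := by
      have : (i : ℤ) ≤ N := by exact_mod_cast hi
      linarith
    have hT := hΓ.continuous_truncKer hK M (a + i)
    have hpc := fun l => hΓ.continuous_pieceKer hK M l (a + i)
    have ht := hΓ.continuous_tailKer hK M a
    rw [min_eq_left hi, ← opConv_mulK_add hT.1 hT.2 (hq'.continuous_psum _)
      (hq'.hasCompactSupport_psum _) hf.int,
      ← opConv_mulK_sum (fun l _ => (hpc l).1) (fun l _ => (hpc l).2) hf.int,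
      ← opConv_mulK_add (continuous_finsetSum _ fun l _ => (hpc l).1)
        (hasCompactSupport_finsetSum _ fun l => (hpc l).2) ht.1 ht.2 hf.int]
    rw [funext (truncKer_add_psum ha hi')]
  have hPb : ∀ l, eLpNorm (P l) (ENNReal.ofReal p) volume ≤
      ENNReal.ofReal (C₂ ^ (1 / p) * (2 : ℝ) ^ (-(δ * |(l : ℝ)|))) *
        eLpNorm f (ENNReal.ofReal p) volume := fun l => by
    have := eLpNorm_le_of_lintegral hp (by positivity) (h2 s N hs a M l f hf)
    rwa [Real.mul_rpow hC₂.le (by positivity), ← Real.rpow_mul (by positivity),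
      mul_one_div_cancel hp0.ne', Real.rpow_one] at this
  have hLb := eLpNorm_le_of_lintegral hp hC₁.le (h1 s N hs j _ φ q hq' f hf)
  have hSc : Continuous (∑ l ∈ S, P l) := by
    rw [Finset.sum_fn]
    exact continuous_finsetSum _ fun l _ => hPc l
  rw [hkey]
  refine (eLpNorm_sub_le hSc.aestronglyMeasurable
    hLc.aestronglyMeasurable hp1).trans ?_
  rw [ENNReal.ofReal_add (by positivity) (by positivity), add_mul]
  refine add_le_add ?_ hLb
  have hsum : ∑ l ∈ S, ENNReal.ofReal (C₂ ^ (1 / p) * (2 : ℝ) ^ (-(δ * |(l : ℝ)|))) ≤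
      ENNReal.ofReal (C₂ ^ (1 / p) * C₃) := by
    rw [← ENNReal.ofReal_sum_of_nonneg fun l _ => by positivity, ← Finset.mul_sum]
    exact ENNReal.ofReal_le_ofReal (mul_le_mul_of_nonneg_left (h3 S) (by positivity))
  calc eLpNorm (∑ l ∈ S, P l) (ENNReal.ofReal p) volume
      ≤ ∑ l ∈ S, eLpNorm (P l) (ENNReal.ofReal p) volume :=
        eLpNorm_sum_le (fun l _ => (hPc l).aestronglyMeasurable) hp1
    _ ≤ ∑ l ∈ S, ENNReal.ofReal (C₂ ^ (1 / p) * (2 : ℝ) ^ (-(δ * |(l : ℝ)|))) *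
        eLpNorm f (ENNReal.ofReal p) volume := Finset.sum_le_sum fun l _ => hPb l
    _ ≤ _ := by
        rw [← Finset.sum_mul]
        exact mul_le_mul_left hsum _

end PhaseCtl

end Uniform

section PrincipalValue

variable {n : ℕ} {K : Rn n → ℝ}

lemma ae_ne_zero_of_pos (hn : 0 < n) : ∀ᵐ t : Rn n, t ≠ 0 := by
  have : Nonempty (Fin n) := ⟨⟨0, hn⟩⟩
  have : Nontrivial (Rn n) := Module.nontrivial_of_finrank_pos (R := ℝ) (by simpa using hn)
  exact Measure.ae_ne volume 0

lemma aestronglyMeasurable_of_continuousOn_compl (hn : 0 < n) {g : Rn n → ℂ}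
    (hg : ContinuousOn g {0}ᶜ) : AEStronglyMeasurable g volume := by
  have h := hg.aestronglyMeasurable (μ := volume) (measurableSet_singleton (0 : Rn n)).compl
  have h0 : ∀ᵐ t : Rn n, t ∈ ({0} : Set (Rn n))ᶜ := ae_ne_zero_of_pos hn
  rwa [Measure.restrict_eq_self_of_ae_mem h0] at h

lemma IsHomCZKernel.continuousOn_ofReal (hK : IsHomCZKernel n K) :
    ContinuousOn (fun t => (K t : ℂ)) {0}ᶜ :=
  Complex.continuous_ofReal.comp_continuousOn hK.continuousOn

/-- Truncations of the kernel inside the unit ball have integral zero. -/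
lemma IsHomCZKernel.integral_truncated (hn : 0 < n) (hK : IsHomCZKernel n K) {X : ℝ → ℝ} {δ : ℝ}
    (hδ : 0 < δ) (hX : AEStronglyMeasurable (fun t : Rn n => X ‖t‖) volume) (hX1 : ∀ v, |X v| ≤ 1)
    (hX0 : ∀ v, 0 ≤ v → v ≤ δ → X v = 0) :
    Integrable (fun t : Rn n => (X ‖t‖ : ℂ) * (Metric.ball 0 1).indicator (fun t => (K t : ℂ)) t) ∧
    ∫ t : Rn n, (X ‖t‖ : ℂ) * (Metric.ball 0 1).indicator (fun t => (K t : ℂ)) t = 0 := by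
  obtain ⟨C, hC0, hC⟩ := hK.exists_norm_le
  have hb : MeasurableSet (Metric.ball (0 : Rn n) 1) := Metric.isOpen_ball.measurableSet
  have hint : Integrable fun t : Rn n =>
      (X ‖t‖ : ℂ) * (Metric.ball 0 1).indicator (fun t => (K t : ℂ)) t := by
    have hi : Integrable ((Metric.ball (0 : Rn n) 1).indicator fun _ => C * (δ ^ n)⁻¹) :=
      (integrable_indicator_iff hb).2 (integrableOn_const (measure_ball_lt_top).ne)
    refine hi.mono' ((Complex.continuous_ofReal.comp_aestronglyMeasurable hX).mul
      ((aestronglyMeasurable_of_continuousOn_compl hn hK.continuousOn_ofReal).indicator hb))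
      (.of_forall fun t => ?_)
    by_cases ht : t ∈ Metric.ball (0 : Rn n) 1
    · rw [indicator_of_mem ht, indicator_of_mem ht]
      rcases le_or_gt ‖t‖ δ with h | h
      · rw [hX0 _ (norm_nonneg _) h, Complex.ofReal_zero, zero_mul, norm_zero]; positivity
      · rw [norm_mul, Complex.norm_real, Complex.norm_real]
        calc _ ≤ 1 * (C * (‖t‖ ^ n)⁻¹) := mul_le_mul (hX1 _)
              (hC t (norm_pos_iff.1 (hδ.trans h))) (abs_nonneg _) zero_le_one
          _ ≤ _ := by
              rw [one_mul]
              gcongr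
    · rw [indicator_of_notMem ht, indicator_of_notMem ht, mul_zero, norm_zero]
  refine ⟨hint, ?_⟩
  have he : (fun t : Rn n => (X ‖t‖ : ℂ) * (Metric.ball 0 1).indicator (fun t => (K t : ℂ)) t) =
      fun t => (fun v : ℝ => if v < 1 then (X v : ℂ) else 0) ‖t‖ * (K t : ℂ) := by
    funext t
    by_cases ht : ‖t‖ < 1
    · rw [indicator_of_mem (by simpa using ht)]; simp only [if_pos ht]
    · rw [indicator_of_notMem (by simpa using ht)]; simp only [if_neg ht, mul_zero, zero_mul]
  rw [he] at hint ⊢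
  exact hK.integral_radial_mul hn (G := fun v : ℝ => if v < 1 then (X v : ℂ) else 0) hint

variable {Γ : ℝ → ℝ} {c₁ c₂ : ℝ} {f : Rn n → ℂ} {L : ℝ}

/-- The integrand of the modulated operator with its singularity removed. -/
def regInt (Γ : ℝ → ℝ) (K : Rn n → ℝ) (u : ℝ) (f : Rn n → ℂ) (x t : Rn n) : ℂ :=
  phaseExp u (Γ ‖t‖) * (K t : ℂ) * f (x - t) -
    f x * (Metric.ball 0 1).indicator (fun t => (K t : ℂ)) t

namespace PhaseCtl

lemma continuous_comp_norm (hΓ : PhaseCtl Γ c₁ c₂) : Continuous fun t : Rn n => Γ ‖t‖ :=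
  hΓ.cont.comp_continuous continuous_norm fun t => norm_nonneg t

lemma integrable_regInt (hΓ : PhaseCtl Γ c₁ c₂)
    (hn : 0 < n) (hK : IsHomCZKernel n K) (u : ℝ) (hf : Nice f)
    (hL : ∀ x y, ‖f x - f y‖ ≤ L * ‖x - y‖) (x : Rn n) : Integrable (regInt Γ K u f x) := by
  have : Nonempty (Fin n) := ⟨⟨0, hn⟩⟩
  obtain ⟨C, hC0, hC⟩ := hK.exists_norm_le
  have hb : MeasurableSet (Metric.ball (0 : Rn n) 1) := Metric.isOpen_ball.measurableSet
  have hfc : Continuous f := (LipschitzWith.of_dist_le_mul (K := L.toNNReal) fun s t => by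
    rw [dist_eq_norm, dist_eq_norm]
    exact (hL s t).trans (mul_le_mul_of_nonneg_right (Real.le_coe_toNNReal _) (norm_nonneg _))).continuous
  have hK' := aestronglyMeasurable_of_continuousOn_compl hn hK.continuousOn_ofReal
  have hE : Continuous fun t : Rn n => phaseExp u (Γ ‖t‖) :=
    (continuous_phaseExp u).comp hΓ.continuous_comp_norm
  have hm : AEStronglyMeasurable (regInt Γ K u f x) volume :=
    ((hE.aestronglyMeasurable.mul hK').mul
      (hfc.comp (continuous_const.sub continuous_id)).aestronglyMeasurable).sub
      (aestronglyMeasurable_const.mul (hK'.indicator hb))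
  rw [← integrableOn_univ, ← union_compl_self (Metric.ball (0 : Rn n) 1)]
  refine IntegrableOn.union ?_ ?_
  · set β := min 1 c₁ with hβ
    have hβ0 : 0 < β := lt_min one_pos hΓ.c₁_pos
    have hΓ1 := hΓ.pos one_pos
    refine integrableOn_ball_of_norm_le_rpow (C := (L + ‖f x‖ * (|u| * Γ 1)) * C) (α := n - β)
      (by simpa using Nat.succ_le_of_lt hn) (by simpa using hβ0) ?_ hm
    filter_upwards [ae_restrict_of_ae (ae_ne_zero_of_pos hn), ae_restrict_mem hb] with t ht0 ht
    have htp := norm_pos_iff.2 ht0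
    have ht1 : ‖t‖ < 1 := by simpa using ht
    have hL0 : 0 ≤ L := by
      have := (norm_nonneg _).trans (hL t 0)
      rw [sub_zero] at this
      exact nonneg_of_mul_nonneg_left this htp
    have e1 : ‖t‖ ≤ ‖t‖ ^ β := by
      conv_lhs => rw [← Real.rpow_one ‖t‖]
      exact Real.rpow_le_rpow_of_exponent_ge htp ht1.le (min_le_left _ _)
    have e2 : Γ ‖t‖ ≤ Γ 1 * ‖t‖ ^ β := by
      have h1 := (hΓ.mul_rpow_le_mul_rpow htp ht1.le).1
      rw [one_div, Real.inv_rpow htp.le, ← div_eq_mul_inv, div_le_iff₀ (by positivity)] at h1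
      exact h1.trans (mul_le_mul_of_nonneg_left
        (Real.rpow_le_rpow_of_exponent_ge htp ht1.le (min_le_right _ _)) hΓ1.le)
    have e3 : ‖t‖ ^ (-(n - β)) = ‖t‖ ^ β * (‖t‖ ^ n)⁻¹ := by
      rw [neg_sub, Real.rpow_sub htp, Real.rpow_natCast, div_eq_mul_inv]
    have e4 : regInt Γ K u f x t = (phaseExp u (Γ ‖t‖) * (f (x - t) - f x) +
        (phaseExp u (Γ ‖t‖) - 1) * f x) * (K t : ℂ) := by
      rw [regInt, indicator_of_mem ht]; ring
    have e5 : ‖f (x - t) - f x‖ ≤ L * ‖t‖ ^ β := by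
      refine (hL _ _).trans ?_
      rw [sub_sub_cancel_left, norm_neg]
      gcongr
    have e6 : ‖phaseExp u (Γ ‖t‖) - 1‖ ≤ |u| * (Γ 1 * ‖t‖ ^ β) := by
      refine (norm_phaseExp_sub_one_le _ _).trans ?_
      rw [abs_mul, abs_of_nonneg (hΓ.nonneg htp.le)]
      gcongr
    rw [e4, e3, norm_mul, Complex.norm_real]
    calc _ ≤ (L * ‖t‖ ^ β + |u| * (Γ 1 * ‖t‖ ^ β) * ‖f x‖) * (C * (‖t‖ ^ n)⁻¹) := by
          refine mul_le_mul ((norm_add_le _ _).trans (add_le_add ?_ ?_)) (hC t ht0)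
            (norm_nonneg _) (by positivity)
          · rwa [norm_mul, norm_phaseExp, one_mul]
          · rw [norm_mul]; gcongr
      _ = _ := by ring
  · have hi : Integrable fun t => C * ‖f (x - t)‖ := (hf.int.comp_sub_left x).norm.const_mul C
    refine hi.integrableOn.mono' hm.restrict ?_
    filter_upwards [ae_restrict_mem hb.compl] with t ht
    have ht1 : 1 ≤ ‖t‖ := by simpa using ht
    rw [regInt, indicator_of_notMem ht, mul_zero, sub_zero, norm_mul, norm_mul, norm_phaseExp,
      one_mul, Complex.norm_real]
    refine mul_le_mul_of_nonneg_right ((hC t (norm_pos_iff.1 (by linarith))).trans ?_) (norm_nonneg _)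
    exact mul_le_of_le_one_right hC0.le (inv_le_one_of_one_le₀ (one_le_pow₀ ht1))

/-- Truncated integrals converge, and the limit does not depend on the truncation. -/
lemma tendsto_truncated (hΓ : PhaseCtl Γ c₁ c₂)
    (hn : 0 < n) (hK : IsHomCZKernel n K) (u : ℝ) (hf : Nice f)
    (hL : ∀ x y, ‖f x - f y‖ ≤ L * ‖x - y‖) (x : Rn n) {ι : Type*} {l : Filter ι}
    [l.IsCountablyGenerated] {X : ι → ℝ → ℝ} {δ : ι → ℝ} (hδ : ∀ᶠ i in l, 0 < δ i)
    (hX : ∀ i, AEStronglyMeasurable (fun t : Rn n => X i ‖t‖) volume) (hX1 : ∀ i v, |X i v| ≤ 1)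
    (hX0 : ∀ i v, 0 ≤ v → v ≤ δ i → X i v = 0)
    (hlim : ∀ v > 0, Tendsto (fun i => X i v) l (𝓝 1)) :
    Tendsto (fun i => ∫ t, (X i ‖t‖ : ℂ) * (phaseExp u (Γ ‖t‖) * (K t : ℂ) * f (x - t))) l
      (𝓝 (∫ t, regInt Γ K u f x t)) := by
  have hg := hΓ.integrable_regInt hn hK u hf hL x
  have hXc := fun i => Complex.continuous_ofReal.comp_aestronglyMeasurable (hX i)
  have hb : ∀ i t, ‖(X i ‖t‖ : ℂ) * regInt Γ K u f x t‖ ≤ ‖regInt Γ K u f x t‖ := fun i t => by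
    rw [norm_mul, Complex.norm_real]
    exact mul_le_of_le_one_left (norm_nonneg _) (hX1 _ _)
  have hint : ∀ i, Integrable fun t => (X i ‖t‖ : ℂ) * regInt Γ K u f x t := fun i =>
    hg.norm.mono' ((hXc i).mul hg.1) (.of_forall (hb i))
  have h1 : Tendsto (fun i => ∫ t, (X i ‖t‖ : ℂ) * regInt Γ K u f x t) l
      (𝓝 (∫ t, regInt Γ K u f x t)) := by
    refine tendsto_integral_filter_of_dominated_convergence (fun t => ‖regInt Γ K u f x t‖)
      (.of_forall fun i => (hint i).1) (.of_forall fun i => .of_forall (hb i)) hg.norm ?_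
    filter_upwards [ae_ne_zero_of_pos hn] with t ht
    have h2 := ((Complex.continuous_ofReal.tendsto 1).comp (hlim _ (norm_pos_iff.2 ht))).mul_const
      (regInt Γ K u f x t)
    rwa [Complex.ofReal_one, one_mul] at h2
  refine h1.congr' ?_
  filter_upwards [hδ] with i hi
  obtain ⟨h2, h3⟩ := hK.integral_truncated hn hi (hX i) (hX1 i) (hX0 i)
  have h4 : ∀ t, (X i ‖t‖ : ℂ) * (phaseExp u (Γ ‖t‖) * (K t : ℂ) * f (x - t)) =
      (X i ‖t‖ : ℂ) * regInt Γ K u f x t +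
        f x * ((X i ‖t‖ : ℂ) * (Metric.ball 0 1).indicator (fun t => (K t : ℂ)) t) := fun t => by
    rw [regInt]; ring
  simp only [h4]
  rw [integral_add (hint i) (h2.const_mul _), integral_const_mul, h3, mul_zero, add_zero]

lemma pvH_eq (hΓ : PhaseCtl Γ c₁ c₂) (hn : 0 < n) (hK : IsHomCZKernel n K) (u : ℝ) (hf : Nice f)
    (hL : ∀ x y, ‖f x - f y‖ ≤ L * ‖x - y‖) (x : Rn n) :
    pvH Γ K u f x = ∫ t, regInt Γ K u f x t := by
  refine Tendsto.limUnder_eq ?_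
  refine (hΓ.tendsto_truncated hn hK u hf hL x (l := 𝓝[>] (0 : ℝ)) (δ := fun ε => ε)
    (X := fun ε => (Ioo ε ε⁻¹).indicator 1) (eventually_mem_nhdsWithin) (fun ε => ?_)
    (fun ε v => ?_) (fun ε v _ hv => ?_) fun v hv => ?_).congr fun ε => ?_
  · exact (((measurable_one.indicator measurableSet_Ioo).comp measurable_norm)).aestronglyMeasurable
  · rw [← Real.norm_eq_abs]
    exact (norm_indicator_le_norm_self _ _).trans (by simp)
  · exact indicator_of_notMem (fun h => hv.not_gt h.1) _
  · refine tendsto_const_nhds.congr' ?_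
    have h1 : ∀ᶠ ε in 𝓝[>] (0 : ℝ), ε < min v v⁻¹ :=
      eventually_nhdsWithin_of_eventually_nhds (eventually_lt_nhds (by positivity))
    filter_upwards [h1, eventually_mem_nhdsWithin] with ε h1 h2
    rw [indicator_of_mem, Pi.one_apply]
    exact ⟨h1.trans_le (min_le_left _ _), (lt_inv_comm₀ h2 hv).1 (h1.trans_le (min_le_right _ _))⟩
  · have hms : MeasurableSet {t : Rn n | ε < ‖t‖ ∧ ‖t‖ < ε⁻¹} :=
      (measurableSet_lt measurable_const measurable_norm).inter
        (measurableSet_lt measurable_norm measurable_const)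
    rw [← integral_indicator hms]
    refine integral_congr_ae (.of_forall fun t => ?_)
    by_cases ht : ε < ‖t‖ ∧ ‖t‖ < ε⁻¹
    · have h1 : t ∈ {t : Rn n | ε < ‖t‖ ∧ ‖t‖ < ε⁻¹} := ht
      have h2 : ‖t‖ ∈ Ioo ε ε⁻¹ := ht
      simp only [indicator_of_mem h1, indicator_of_mem h2, Pi.one_apply, Complex.ofReal_one, phaseExp]
      ring
    · have h1 : t ∉ {t : Rn n | ε < ‖t‖ ∧ ‖t‖ < ε⁻¹} := ht
      have h2 : ‖t‖ ∉ Ioo ε ε⁻¹ := ht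
      simp only [indicator_of_notMem h1, indicator_of_notMem h2, Complex.ofReal_zero, zero_mul]

/-- The smooth truncations converge to the principal value. -/
lemma tendsto_truncKer (hΓ : PhaseCtl Γ c₁ c₂)
    (hn : 0 < n) (hK : IsHomCZKernel n K) (u : ℝ) (hf : Nice f)
    (hL : ∀ x y, ‖f x - f y‖ ≤ L * ‖x - y‖) (x : Rn n) :
    Tendsto (fun M => opConv (mulK (truncKer Γ K M u)) f x) atTop (𝓝 (pvH Γ K u f x)) := by
  rw [hΓ.pvH_eq hn hK u hf hL x]
  have hz : Tendsto (fun M : ℕ => (2 : ℝ) ^ (-(M : ℤ))) atTop (𝓝 0) := by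
    have := tendsto_pow_atTop_nhds_zero_of_lt_one (r := (2 : ℝ)⁻¹) (by norm_num) (by norm_num)
    simpa [inv_pow, zpow_neg] using this
  have hi : Tendsto (fun M : ℕ => (2 : ℝ) ^ ((M : ℤ) + 1)) atTop atTop := by
    have := (tendsto_pow_atTop_atTop_of_one_lt (r := (2 : ℝ)) one_lt_two).comp (tendsto_add_atTop_nat 1)
    refine this.congr fun M => ?_
    exact_mod_cast rfl
  refine (hΓ.tendsto_truncated hn hK u hf hL x (l := atTop)
    (δ := fun M : ℕ => phaseScale Γ ((M : ℤ) + 1))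
    (X := fun (M : ℕ) v => cutoff ((2 : ℝ) ^ (-(M : ℤ)) * Γ v) - cutoff ((2 : ℝ) ^ ((M : ℤ) + 1) * Γ v))
    (.of_forall fun M => hΓ.scale_pos _) (fun M => ?_) (fun M v => ?_) (fun M v hv0 hv => ?_)
    fun v hv => ?_).congr fun M => ?_
  · have hc := contDiff_cutoff.continuous
    have := hΓ.continuous_comp_norm (n := n)
    exact ((hc.comp (continuous_const.mul this)).sub
      (hc.comp (continuous_const.mul this))).aestronglyMeasurable
  · rw [abs_le]
    constructor <;> linarith [cutoff_nonneg ((2 : ℝ) ^ (-(M : ℤ)) * Γ v),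
      cutoff_le_one ((2 : ℝ) ^ (-(M : ℤ)) * Γ v), cutoff_nonneg ((2 : ℝ) ^ ((M : ℤ) + 1) * Γ v),
      cutoff_le_one ((2 : ℝ) ^ ((M : ℤ) + 1) * Γ v)]
  · rw [← hΓ.le_iff hv0 (hΓ.scale_pos _).le, hΓ.map_scale] at hv
    have h1 : (2 : ℝ) ^ ((M : ℤ) + 1) * Γ v ≤ 1 := by
      refine (mul_le_mul_of_nonneg_left hv (by positivity)).trans_eq ?_
      rw [← zpow_add₀ two_ne_zero, add_neg_cancel, zpow_zero]
    have h2 : (2 : ℝ) ^ (-(M : ℤ)) * Γ v ≤ 1 := by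
      refine le_trans (mul_le_mul_of_nonneg_right ?_ (hΓ.nonneg hv0)) h1
      exact zpow_le_zpow_right₀ one_le_two (by omega)
    rw [cutoff_eq_one h1, cutoff_eq_one h2, sub_self]
  · have hp := hΓ.pos hv
    refine tendsto_const_nhds.congr' ?_
    have h1 := hz.mul_const (Γ v)
    rw [zero_mul] at h1
    filter_upwards [h1.eventually_le_const one_pos,
      (hi.atTop_mul_const hp).eventually_ge_atTop 2] with M h1 h2
    rw [cutoff_eq_one h1, cutoff_eq_zero h2, sub_zero]
  · rw [opConv_mulK, ← integral_sub_left_eq_self _ volume x]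
    refine integral_congr_ae (.of_forall fun t => ?_)
    simp only [truncKer, sub_sub_cancel]
    ring

end PhaseCtl

end PrincipalValue

section Assembly

variable {n : ℕ} {Γ : ℝ → ℝ} {c₁ c₂ : ℝ} {K : Rn n → ℝ} {f : Rn n → ℂ} {L p r : ℝ}

lemma tendsto_jumpVec {s : Finset Chain} {ι : Type*} {l : Filter ι} {α : ι → ℕ → ℂ} {β : ℕ → ℂ}
    (h : ∀ k, Tendsto (fun M => α M k) l (𝓝 (β k))) :
    Tendsto (fun M => jumpVec r s (α M)) l (𝓝 (jumpVec r s β)) := by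
  have hc : Continuous (jumpVec r s) :=
    continuous_jumpVec (α := fun k (y : ℕ → ℂ) => y k) fun k => continuous_apply k
  exact (hc.tendsto β).comp (tendsto_pi_nhds.2 h)

namespace PhaseCtl

lemma measurable_pvH (hΓ : PhaseCtl Γ c₁ c₂)
    (hn : 0 < n) (hK : IsHomCZKernel n K) (k : ℤ) (hf : Nice f)
    (hL : ∀ x y, ‖f x - f y‖ ≤ L * ‖x - y‖) : Measurable (pvH Γ K ((2 : ℝ) ^ k) f) :=
  measurable_of_tendsto_metrizable (fun M => (continuous_opConv
    (continuous_mulK (hΓ.continuous_truncKer hK M k).1)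
    (hasCompactSupport_mulK (hΓ.continuous_truncKer hK M k).2) hf.int).measurable)
    (tendsto_pi_nhds.2 fun x => hΓ.tendsto_truncKer hn hK _ hf hL x)

variable [hq : Fact (1 ≤ ENNReal.ofReal r)]

/-- Bounds for the jumps of the modulated operators along finitely many chains. -/
lemma exists_jumpVec_pvH_bound (hΓ : PhaseCtl Γ c₁ c₂)
    (hn : 0 < n) (hK : IsHomCZKernel n K) (hp : 1 < p) (hr : 2 < r) :
    ∃ C > 0, ∀ (s : Finset Chain) (N : ℕ), ChainsLe s N → ∀ (a : ℤ) (f : Rn n → ℂ) (L : ℝ), Nice f →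
      (∀ x y, ‖f x - f y‖ ≤ L * ‖x - y‖) →
      eLpNorm (fun x => jumpVec r s fun i => pvH Γ K ((2 : ℝ) ^ (a + i)) f x)
        (ENNReal.ofReal p) volume ≤ ENNReal.ofReal C * eLpNorm f (ENNReal.ofReal p) volume := by
  obtain ⟨C, hC0, hC⟩ := hΓ.exists_truncKer_bound (r := r) hn hK hp hr
  refine ⟨C, hC0, fun s N hs a f L hf hL => ?_⟩
  have hc : ∀ M, Continuous fun x => jumpVec r s fun i =>
      opConv (mulK (truncKer Γ K M ((2 : ℝ) ^ (a + i)))) f x := fun M => continuous_jumpVec fun k =>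
    continuous_opConv (continuous_mulK (hΓ.continuous_truncKer hK M _).1)
      (hasCompactSupport_mulK (hΓ.continuous_truncKer hK M _).2) hf.int
  have hlim : ∀ x, Tendsto (fun M => jumpVec r s fun i =>
      opConv (mulK (truncKer Γ K M ((2 : ℝ) ^ (a + i)))) f x) atTop
      (𝓝 (jumpVec r s fun i => pvH Γ K ((2 : ℝ) ^ (a + i)) f x)) := fun x =>
    tendsto_jumpVec fun i => hΓ.tendsto_truncKer hn hK _ hf hL x
  have hfat := Lp.eLpNorm_lim_le_liminf_eLpNorm (μ := (volume : Measure (Rn n))) (p := ENNReal.ofReal p)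
    (fun M => (hc M).aestronglyMeasurable) _ (Eventually.of_forall hlim)
  refine hfat.trans (liminf_le_of_frequently_le' (Eventually.frequently ?_))
  filter_upwards [eventually_ge_atTop (a.natAbs + N)] with M hM
  exact hC s N hs a M (by omega) (by omega) f hf

end PhaseCtl

/-- The jumps of a family indexed by the integers along a finite increasing sequence. -/
def jumpNorm (r : ℝ) (β : ℤ → ℂ) (c : Σ J : ℕ, (Fin (J + 1) → ℤ)) : ℝ≥0∞ :=
  (∑ i : Fin c.1, (‖β (c.2 i.succ) - β (c.2 i.castSucc)‖₊ : ℝ≥0∞) ^ r) ^ (1 / r)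

lemma variation_dyadic_le (r : ℝ) (a : ℝ → ℂ) :
    variation r (Set.range fun k : ℤ => (2 : ℝ) ^ k) a ≤
      ⨆ c : {c : Σ J : ℕ, (Fin (J + 1) → ℤ) // StrictMono c.2},
        jumpNorm r (fun k => a ((2 : ℝ) ^ k)) c := by
  refine iSup_le fun J => iSup_le fun u => iSup_le fun hu => iSup_le fun h => ?_
  choose k hk using h
  have hkm : StrictMono k := fun i j hij => by
    have := hu hij
    rw [← hk, ← hk] at this
    exact (zpow_lt_zpow_iff_right₀ one_lt_two).1 this
  refine le_iSup_of_le ⟨⟨J, k⟩, hkm⟩ (le_of_eq ?_)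
  simp only [jumpNorm]
  congr 2
  ext i
  have hku : ∀ i, (2 : ℝ) ^ k i = u i := hk
  rw [hku, hku]

/-- Finitely many increasing sequences of integers can be shifted to sequences of naturals. -/
lemma exists_chains_jumpNorm_le [hq : Fact (1 ≤ ENNReal.ofReal r)]
    (S : Finset {c : Σ J : ℕ, (Fin (J + 1) → ℤ) // StrictMono c.2}) :
    ∃ (s : Finset Chain) (N : ℕ) (a : ℤ), ChainsLe s N ∧ ∀ β : ℤ → ℂ,
      (S.sup fun c => jumpNorm r β c) ≤ ‖jumpVec r s fun i => β (a + i)‖ₑ := by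
  classical
  set B : ℕ := S.sup fun c => Finset.univ.sup fun i => (c.1.2 i).natAbs with hB
  have hb : ∀ c ∈ S, ∀ i, (c.1.2 i).natAbs ≤ B := fun c hc i =>
    (Finset.le_sup (f := fun i => (c.1.2 i).natAbs) (Finset.mem_univ i)).trans
      (Finset.le_sup (f := fun c : {c : Σ J : ℕ, (Fin (J + 1) → ℤ) // StrictMono c.2} =>
        Finset.univ.sup fun i => (c.1.2 i).natAbs) hc)
  set T : {c : Σ J : ℕ, (Fin (J + 1) → ℤ) // StrictMono c.2} → Chain :=
    fun c => ⟨c.1.1, fun i => (c.1.2 i + B).toNat⟩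
  have hr1 := one_le_of_fact r
  refine ⟨S.image T, 2 * B, -(B : ℤ), fun c hc => ?_, fun β => Finset.sup_le fun c hc => ?_⟩
  · obtain ⟨d, hd, rfl⟩ := Finset.mem_image.1 hc
    refine ⟨fun i j hij => ?_, fun i => ?_⟩
    · have h1 := d.2 hij
      have h2 := hb d hd i
      change (_ : ℤ).toNat < (_ : ℤ).toNat
      omega
    · have h2 := hb d hd i
      change (_ : ℤ).toNat ≤ 2 * B
      omega
  · have h1 := le_norm_jumpVec (r := r) (α := fun i => β (-(B : ℤ) + i))
      (Finset.mem_image_of_mem T hc)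
    have h2 : ∀ i, -(B : ℤ) + (((c.1.2 i + B).toNat : ℕ) : ℤ) = c.1.2 i := fun i => by
      have := hb c hc i
      omega
    change (∑ i, ‖β (-(B : ℤ) + (((c.1.2 (Fin.succ i) + B).toNat : ℕ) : ℤ)) -
      β (-(B : ℤ) + (((c.1.2 i.castSucc + B).toNat : ℕ) : ℤ))‖ ^ r) ^ (1 / r) ≤ _ at h1
    simp only [h2] at h1
    rw [← ofReal_norm]
    refine le_trans (le_of_eq ?_) (ENNReal.ofReal_le_ofReal h1)
    rw [jumpNorm, ← ENNReal.ofReal_rpow_of_nonneg (by positivity) (by positivity),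
      ENNReal.ofReal_sum_of_nonneg fun i _ => by positivity]
    congr 2
    ext i
    rw [← ENNReal.ofReal_rpow_of_nonneg (norm_nonneg _) (by positivity), ofReal_norm]
    rfl

lemma lintegral_iSup_rpow_le {ι : Type*} [Countable ι] (hp : 0 < p) {W : ι → Rn n → ℝ≥0∞}
    (hW : ∀ i, Measurable (W i)) {A : ℝ≥0∞}
    (h : ∀ S : Finset ι, ∫⁻ x, (S.sup fun i => W i x) ^ p ≤ A) :
    ∫⁻ x, (⨆ i, W i x) ^ p ≤ A := by
  classical
  have h1 : ∀ x, (⨆ i, W i x) ^ p = ⨆ S : Finset ι, (S.sup fun i => W i x) ^ p := fun x => by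
    have h2 : ⨆ i, W i x = ⨆ S : Finset ι, S.sup fun i => W i x := by
      rw [iSup_eq_iSup_finset]
      simp only [Finset.sup_eq_iSup]
    rw [h2]
    exact (ENNReal.orderIsoRpow p hp).map_iSup _
  simp only [h1]
  rw [lintegral_iSup_directed]
  · exact iSup_le h
  · intro S
    refine Measurable.aemeasurable (Measurable.pow_const ?_ p)
    simp only [Finset.sup_eq_iSup]
    exact Measurable.iSup fun i => Measurable.iSup fun _ => hW i
  · refine Monotone.directed_le fun S T hST x => ?_
    exact ENNReal.rpow_le_rpow (Finset.sup_mono hST) hp.le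

lemma SchwartzMap.nice (f : SchwartzMap (Rn n) ℂ) : Nice f :=
  ⟨f.continuous.stronglyMeasurable, f.integrable, _, f.norm_le_seminorm ℝ⟩

lemma SchwartzMap.exists_norm_sub_le (f : SchwartzMap (Rn n) ℂ) :
    ∃ L : ℝ, ∀ x y, ‖f x - f y‖ ≤ L * ‖x - y‖ := by
  obtain ⟨C, hC⟩ := f.decay 0 1
  refine ⟨C, fun x y => convex_univ.norm_image_sub_le_of_norm_fderiv_le (𝕜 := ℝ)
    (fun z _ => f.differentiableAt) (fun z _ => ?_) (mem_univ y) (mem_univ x)⟩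
  have := hC.2 z
  rwa [pow_zero, one_mul, norm_iteratedFDeriv_one] at this

end Assembly

/-- Proposition 3.1: the long (dyadic) variation estimate. -/
theorem long_variation_estimate (n : ℕ) (hn : 2 ≤ n) (Γ : ℝ → ℝ) (hΓ : IsGammaU Γ)
    (K : Rn n → ℝ) (hK : IsHomCZKernel n K)
    (p r : ℝ) (hp : 1 < p) (hr : 2 < r) :
    ∃ C > (0 : ℝ), ∀ f : SchwartzMap (Rn n) ℂ,
      lpNormENN p
          (fun x => variation r (Set.range fun k : ℤ => (2 : ℝ) ^ k)
            fun u => pvH Γ K u (⇑f) x) volume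
        ≤ ENNReal.ofReal C * eLpNorm (⇑f) (ENNReal.ofReal p) volume := by
  obtain ⟨c₁, c₂, hΓ'⟩ := hΓ.exists_phaseCtl
  have hn0 : 0 < n := by omega
  have hp0 : 0 < p := by linarith
  have hq : Fact (1 ≤ ENNReal.ofReal r) := ⟨by
    rw [← ENNReal.ofReal_one]; exact ENNReal.ofReal_le_ofReal (by linarith)⟩
  obtain ⟨C, hC0, hC⟩ := hΓ'.exists_jumpVec_pvH_bound (r := r) hn0 hK hp hr
  refine ⟨C, hC0, fun f => ?_⟩
  obtain ⟨L, hL⟩ := f.exists_norm_sub_le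
  set A := ENNReal.ofReal C * eLpNorm (⇑f) (ENNReal.ofReal p) volume with hA
  have hβ := fun k : ℤ => hΓ'.measurable_pvH hn0 hK k f.nice hL
  have hbound : ∫⁻ x, (variation r (Set.range fun k : ℤ => (2 : ℝ) ^ k)
      fun u => pvH Γ K u (⇑f) x) ^ p ≤ A ^ p := by
    refine (lintegral_mono fun x => ENNReal.rpow_le_rpow (variation_dyadic_le r _) hp0.le).trans
      (lintegral_iSup_rpow_le hp0 (fun c => ?_) fun S => ?_)
    · unfold jumpNorm
      refine Measurable.pow_const (Finset.measurable_fun_sum _ fun i _ => Measurable.pow_const ?_ r) _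
      exact ((hβ _).sub (hβ _)).nnnorm.coe_nnreal_ennreal
    · obtain ⟨s, N, a, hs, hS⟩ := exists_chains_jumpNorm_le (r := r) S
      have h1 := hC s N hs a f L f.nice hL
      rw [eLpNorm_eq_lintegral_rpow_enorm_toReal (by simpa using hp0) ENNReal.ofReal_ne_top,
        ENNReal.toReal_ofReal hp0.le, one_div, ENNReal.rpow_inv_le_iff hp0] at h1
      exact (lintegral_mono fun x => ENNReal.rpow_le_rpow (hS _) hp0.le).trans h1
  rw [lpNormENN, one_div, ENNReal.rpow_inv_le_iff hp0]
  exact hbound
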